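/- (Thick Ladder Theorem) Let Y be a two-sided 2-connected ladder over a field k, with lower inside corners (a_1,b_1),…,(a_h,b_h) (h ≥ 1) and upper inside corners (c_1,d_1),…,(c_k,d_k) (k ≥ 1), such that for all 1 ≤ i ≤ h and 1 ≤ j ≤ k one has a_i ≤ c_j, b_i ≤ d_j, and (a_i,b_i) ≠ (c_j,d_j). Then R_2(Y) has at most two semidualizing modules up to isomorphism: among any three semidualizing R_2(Y)-modules, two are isomorphic. -/

import Mathlib

set_option maxHeartbeats 1000000
set_option synthInstance.maxHeartbeats 1000000

open CategoryTheory

namespace LadderDet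

/-- The position `p` lies in the `m × n` grid `{1,…,m} × {1,…,n}`. -/
def InGrid (m n : ℕ) (p : ℕ × ℕ) : Prop :=
  1 ≤ p.1 ∧ p.1 ≤ m ∧ 1 ≤ p.2 ∧ p.2 ≤ n

/-- `Y` is a ladder in the `m × n` grid. -/
def IsLadder (m n : ℕ) (Y : Set (ℕ × ℕ)) : Prop :=
  (∀ p ∈ Y, InGrid m n p) ∧
  ∀ i j p q : ℕ, (i, j) ∈ Y → (p, q) ∈ Y → i ≤ p → j ≤ q → (i, q) ∈ Y ∧ (p, j) ∈ Y

/-- A ladder together with the standard nontriviality assumptions: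
`(1,n), (m,1) ∈ Y` and every row and every column of the grid meets `Y`. -/
def StdLadder (m n : ℕ) (Y : Set (ℕ × ℕ)) : Prop :=
  IsLadder m n Y ∧ (1, n) ∈ Y ∧ (m, 1) ∈ Y ∧
  (∀ i, 1 ≤ i → i ≤ m → ∃ j, (i, j) ∈ Y) ∧
  (∀ j, 1 ≤ j → j ≤ n → ∃ i, (i, j) ∈ Y)

/-- Two positions differ by exactly `1` in exactly one coordinate. -/
def AdjStep (p q : ℕ × ℕ) : Prop :=
  (p.1 = q.1 ∧ (p.2 + 1 = q.2 ∨ q.2 + 1 = p.2)) ∨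
  (p.2 = q.2 ∧ (p.1 + 1 = q.1 ∨ q.1 + 1 = p.1))

/-- There is a path in `Y` from `p` to `q`. -/
def HasPath (Y : Set (ℕ × ℕ)) (p q : ℕ × ℕ) : Prop :=
  p ∈ Y ∧ q ∈ Y ∧
    Relation.ReflTransGen (fun a b => a ∈ Y ∧ b ∈ Y ∧ AdjStep a b) p q

/-- `Y` is path-connected. -/
def PathConnected (Y : Set (ℕ × ℕ)) : Prop :=
  ∀ p ∈ Y, ∀ q ∈ Y, HasPath Y p q

/-- `M` is (the set of entries of) a `t × t` minor of `Y`. -/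
def IsMinor (t : ℕ) (Y : Set (ℕ × ℕ)) (M : Set (ℕ × ℕ)) : Prop :=
  ∃ r c : Fin t → ℕ, StrictMono r ∧ StrictMono c ∧
    (∀ u v, (r u, c v) ∈ Y) ∧ M = {p | ∃ u v, p = (r u, c v)}

/-- `Y` is `t`-disconnected. -/
def TDisconnected (m n t : ℕ) (Y : Set (ℕ × ℕ)) : Prop :=
  ∃ Z₁ Z₂ : Set (ℕ × ℕ), Z₁.Nonempty ∧ Z₂.Nonempty ∧
    IsLadder m n Z₁ ∧ IsLadder m n Z₂ ∧ Z₁ ∩ Z₂ = ∅ ∧ Z₁ ∪ Z₂ = Y ∧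
    ∀ M, IsMinor t Y M → M ⊆ Z₁ ∨ M ⊆ Z₂

/-- `Y` is `t`-connected. -/
def TConnected (m n t : ℕ) (Y : Set (ℕ × ℕ)) : Prop := ¬ TDisconnected m n t Y

/-- `p` is a lower inside corner of `Y`. -/
def IsLowerCorner (Y : Set (ℕ × ℕ)) (p : ℕ × ℕ) : Prop :=
  p ∈ Y ∧ (p.1 - 1, p.2) ∈ Y ∧ (p.1, p.2 - 1) ∈ Y ∧ (p.1 - 1, p.2 - 1) ∉ Y

/-- `p` is an upper inside corner of `Y`. -/
def IsUpperCorner (Y : Set (ℕ × ℕ)) (p : ℕ × ℕ) : Prop :=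
  p ∈ Y ∧ (p.1 + 1, p.2) ∈ Y ∧ (p.1, p.2 + 1) ∈ Y ∧ (p.1 + 1, p.2 + 1) ∉ Y

/-- `Y` is one-sided: path-connected and with no lower or no upper inside corners. -/
def OneSided (Y : Set (ℕ × ℕ)) : Prop :=
  PathConnected Y ∧
  ((∀ p, ¬ IsLowerCorner Y p) ∨ (∀ p, ¬ IsUpperCorner Y p))

/-- `Y` is two-sided: path-connected with at least one lower and one upper inside corner. -/
def TwoSided (Y : Set (ℕ × ℕ)) : Prop :=
  PathConnected Y ∧ (∃ p, IsLowerCorner Y p) ∧ (∃ p, IsUpperCorner Y p)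

section Algebra

variable (k : Type) [Field k]

/-- The `t × t` minor of the generic matrix determined by rows `r` and columns `c`,
as an element of the polynomial ring `k[Y]`. -/
noncomputable def minorPoly {t : ℕ} {Y : Set (ℕ × ℕ)} (r c : Fin t → ℕ)
    (h : ∀ u v, (r u, c v) ∈ Y) : MvPolynomial Y k :=
  (Matrix.of fun u v : Fin t =>
    (MvPolynomial.X ⟨(r u, c v), h u v⟩ : MvPolynomial Y k)).det

/-- The ideal `I_t(Y) ⊆ k[Y]` generated by all `t × t` minors of `X` lying in `Y`. -/
noncomputable def minorIdeal (t : ℕ) (Y : Set (ℕ × ℕ)) : Ideal (MvPolynomial Y k) :=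
  Ideal.span {f | ∃ (r c : Fin t → ℕ) (_ : StrictMono r) (_ : StrictMono c)
    (h : ∀ u v, (r u, c v) ∈ Y), f = minorPoly k r c h}

/-- The ladder determinantal ring `R_t(Y) = k[Y]/I_t(Y)`. -/
abbrev LadderRing (t : ℕ) (Y : Set (ℕ × ℕ)) : Type :=
  MvPolynomial Y k ⧸ minorIdeal k t Y

/-- The residue `x_{ij}` of the variable `X_{ij}` in `R_t(Y)`. -/
noncomputable def xres (t : ℕ) {Y : Set (ℕ × ℕ)} (p : ℕ × ℕ) (hp : p ∈ Y) :
    LadderRing k t Y :=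
  Ideal.Quotient.mk (minorIdeal k t Y) (MvPolynomial.X ⟨p, hp⟩)

/-- The ideal of `R_2(Y)` generated by the residues of the variables in row `r`
(an ideal of type `𝔮`). -/
noncomputable def rowIdeal (Y : Set (ℕ × ℕ)) (r : ℕ) : Ideal (LadderRing k 2 Y) :=
  Ideal.span {z | ∃ q, ∃ h : (r, q) ∈ Y, z = xres k 2 (r, q) h}

/-- The ideal of `R_2(Y)` generated by the residues of the variables in column `b`
(an ideal of type `𝔮'`). -/
noncomputable def colIdeal (Y : Set (ℕ × ℕ)) (b : ℕ) : Ideal (LadderRing k 2 Y) :=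
  Ideal.span {z | ∃ p, ∃ h : (p, b) ∈ Y, z = xres k 2 (p, b) h}

/-- The ideal `𝔭` of `R_2(Y)` generated by the residues of the variables weakly
northwest of the position `(c, d)`. -/
noncomputable def cornerIdeal (Y : Set (ℕ × ℕ)) (c d : ℕ) : Ideal (LadderRing k 2 Y) :=
  Ideal.span {z | ∃ p q, ∃ h : (p, q) ∈ Y, p ≤ c ∧ q ≤ d ∧ z = xres k 2 (p, q) h}

end Algebra

/-- An ideal of `k[Y]` is a monomial ideal if it is generated by monomials. -/
def IsMonomialIdeal {k : Type} [Field k] {Y : Set (ℕ × ℕ)}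
    (M : Ideal (MvPolynomial Y k)) : Prop :=
  ∃ S : Set (Y →₀ ℕ), M = Ideal.span ((fun d => MvPolynomial.monomial d (1 : k)) '' S)

/-- A finitely generated module `C` over a commutative ring `R` is semidualizing if
the natural homothety map `R → Hom_R(C, C)` is bijective and `Ext^i_R(C, C) = 0` for
all `i ≥ 1`. -/
def IsSemidualizing {R : Type} [CommRing R] (C : ModuleCat.{0} R) : Prop :=
  Module.Finite R C ∧
  Function.Bijective (LinearMap.lsmul R C) ∧
  ∀ i : ℕ, 1 ≤ i →
    Subsingleton (((Ext R (ModuleCat.{0} R) i).obj (Opposite.op C)).obj C)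

/-- `C` has finite injective dimension: for some `n`, `Ext^i_R(M, C) = 0` for all
modules `M` and all `i > n`. -/
def HasFiniteInjDim {R : Type} [CommRing R] (C : ModuleCat.{0} R) : Prop :=
  ∃ n : ℕ, ∀ i : ℕ, n < i → ∀ M : ModuleCat.{0} R,
    Subsingleton (((Ext R (ModuleCat.{0} R) i).obj (Opposite.op M)).obj C)



end LadderDet


set_option linter.unusedVariables false
set_option linter.style.haveILetI false

open TensorProduct

namespace SDP

section Mx
variable {R : Type} [CommRing R]

/-- Matrix acting on vectors with entries in a module. -/
def Mx {p q : ℕ} (D : Matrix (Fin p) (Fin q) R) (X : Type) [AddCommGroup X] [Module R X] :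
    (Fin q → X) →ₗ[R] (Fin p → X) where
  toFun v := fun b => ∑ a, D b a • v a
  map_add' v w := by
    funext b; simp [smul_add, Finset.sum_add_distrib]
  map_smul' r v := by
    funext b
    simp only [Pi.smul_apply, RingHom.id_apply, Finset.smul_sum]
    exact Finset.sum_congr rfl fun a _ => smul_comm _ _ _

variable {X : Type} [AddCommGroup X] [Module R X] {X' : Type} [AddCommGroup X'] [Module R X']

theorem Mx_apply {p q : ℕ} (D : Matrix (Fin p) (Fin q) R) (v : Fin q → X) (b : Fin p) :
    Mx D X v b = ∑ a, D b a • v a := rfl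

theorem Mx_nat {p q : ℕ} (D : Matrix (Fin p) (Fin q) R) (f : X →ₗ[R] X') (v : Fin q → X) :
    Mx D X' (fun a => f (v a)) = fun b => f (Mx D X v b) := by
  funext b; simp [Mx_apply, map_sum]

theorem Mx_comp {p q r : ℕ} (D : Matrix (Fin p) (Fin q) R) (D' : Matrix (Fin r) (Fin p) R)
    (v : Fin q → X) : Mx D' X (Mx D X v) = Mx (D' * D) X v := by
  funext b
  simp only [Mx_apply, Matrix.mul_apply, Finset.smul_sum, Finset.sum_smul, smul_smul]
  rw [Finset.sum_comm]

theorem Mx_zero {p q : ℕ} (v : Fin q → X) : Mx (0 : Matrix (Fin p) (Fin q) R) X v = 0 := by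
  funext b; simp [Mx_apply]

/-- exactness of a pair of matrices with coefficients in a module -/
def Ex {p q r : ℕ} (D : Matrix (Fin p) (Fin q) R) (D' : Matrix (Fin r) (Fin p) R)
    (X : Type) [AddCommGroup X] [Module R X] : Prop :=
  ∀ v : Fin p → X, Mx D' X v = 0 → ∃ w, Mx D X w = v

theorem Ex_equiv {p q r : ℕ} {D : Matrix (Fin p) (Fin q) R} {D' : Matrix (Fin r) (Fin p) R}
    (e : X ≃ₗ[R] X') (h : Ex D D' X) : Ex D D' X' := by
  intro v hv
  obtain ⟨w, hw⟩ := h (fun a => e.symm (v a)) (by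
    rw [show (fun a => e.symm (v a)) = fun a => e.symm.toLinearMap (v a) from rfl, Mx_nat, hv]
    funext b; simp)
  refine ⟨fun a => e (w a), ?_⟩
  rw [show (fun a => e (w a)) = fun a => e.toLinearMap (w a) from rfl, Mx_nat, hw]
  funext b; simp

theorem common_denom {S : Submonoid R} (f : X →ₗ[R] X') [IsLocalizedModule S f] {p : ℕ}
    (v : Fin p → X') : ∃ s : S, ∃ w : Fin p → X, ∀ a, (s : R) • v a = f (w a) := by
  obtain ⟨b, hb⟩ := IsLocalizedModule.exist_integer_multiples S f Finset.univ v
  have : ∀ a, ∃ w, f w = (b : R) • v a := fun a => hb a (Finset.mem_univ a)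
  choose w hw using this
  exact ⟨b, w, fun a => (hw a).symm⟩

theorem common_zero {S : Submonoid R} (f : X →ₗ[R] X') [IsLocalizedModule S f] {p : ℕ}
    (v : Fin p → X) (h : ∀ a, f (v a) = 0) : ∃ s : S, ∀ a, (s : R) • v a = 0 := by
  have : ∀ a, ∃ s : S, s • v a = 0 := fun a => (IsLocalizedModule.eq_zero_iff S f).1 (h a)
  choose s hs using this
  refine ⟨∏ a, s a, fun a => ?_⟩
  rw [← Finset.prod_erase_mul _ _ (Finset.mem_univ a)]
  have := hs a
  rw [Submonoid.smul_def] at this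
  simp only [Submonoid.coe_mul, mul_smul, this, smul_zero]

theorem loc_cancel {S : Submonoid R} (f : X →ₗ[R] X') [IsLocalizedModule S f] (s : S)
    {x y : X'} (h : (s : R) • x = (s : R) • y) : x = y := by
  have := IsLocalizedModule.map_units f s
  rw [Module.End.isUnit_iff] at this
  exact this.1 h

theorem loc_div {S : Submonoid R} (f : X →ₗ[R] X') [IsLocalizedModule S f] (s : S)
    (x : X') : ∃ y, (s : R) • y = x := by
  have := IsLocalizedModule.map_units f s
  rw [Module.End.isUnit_iff] at this
  exact this.2 x

theorem Ex_loc {p q r : ℕ} {D : Matrix (Fin p) (Fin q) R} {D' : Matrix (Fin r) (Fin p) R}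
    {S : Submonoid R} (f : X →ₗ[R] X') [IsLocalizedModule S f] (h : Ex D D' X) : Ex D D' X' := by
  intro v hv
  obtain ⟨s, w, hw⟩ := common_denom (S := S) f v
  have h1 : ∀ b, f (Mx D' X w b) = 0 := by
    intro b
    have := congrFun (Mx_nat D' f w) b
    rw [← this, show (fun a => f (w a)) = (s : R) • v from funext fun a => (hw a).symm,
      map_smul, hv]; simp
  obtain ⟨s', hs'⟩ := common_zero (S := S) f _ h1
  obtain ⟨u, hu⟩ := h ((s' : R) • w) (by rw [map_smul]; funext b; exact hs' b)
  obtain ⟨u', hu'⟩ : ∃ u' : Fin q → X', ∀ a, ((s' * s : S) : R) • u' a = f (u a) := by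
    have : ∀ a, ∃ y, ((s' * s : S) : R) • y = f (u a) := fun a => loc_div (S := S) f _ _
    exact ⟨fun a => (this a).choose, fun a => (this a).choose_spec⟩
  refine ⟨u', ?_⟩
  funext b
  apply loc_cancel (S := S) f (s' * s)
  have h2 := congrFun (map_smul (Mx D X') ((s' * s : S) : R) u') b
  simp only [Pi.smul_apply] at h2
  rw [← h2, show ((s' * s : S) : R) • u' = fun a => f (u a) from funext hu', Mx_nat, hu]
  simp only [Pi.smul_apply, map_smul, Submonoid.coe_mul, mul_smul, hw]

end Mx

/-- Semidualizing data in terms of matrices. -/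
structure SD (R : Type) [CommRing R] (C : Type) [AddCommGroup C] [Module R C] where
  n : ℕ → ℕ
  D : ∀ i, Matrix (Fin (n (i+1))) (Fin (n i)) R
  c : Fin (n 0) → C
  dd : ∀ i, D (i+1) * D i = 0
  dc : Mx (D 0) C c = 0
  ex : ∀ i, Ex (D (i+1)).transpose (D i).transpose R
  ex0 : ∀ v : Fin (n 0) → R, ∑ a, v a • c a = 0 → ∃ w, Mx (D 0).transpose R w = v
  gen : ∀ x : C, ∃ v : Fin (n 0) → R, x = ∑ a, v a • c a
  hex : ∀ i, Ex (D i) (D (i+1)) C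
  hinj : ∀ r : R, (∀ a, r • c a = 0) → r = 0
  h0 : ∀ v : Fin (n 0) → C, Mx (D 0) C v = 0 → ∃ r : R, ∀ a, v a = r • c a

variable {R : Type} [CommRing R] {C : Type} [AddCommGroup C] [Module R C]

namespace SD
variable (d : SD R C)

/-- transport along linear equivalences -/
def congr {C' : Type} [AddCommGroup C'] [Module R C'] (e : C ≃ₗ[R] C') : SD R C' where
  n := d.n
  D := d.D
  c := fun a => e (d.c a)
  dd := d.dd
  dc := by
    have := Mx_nat (d.D 0) e.toLinearMap d.c
    simp only [LinearEquiv.coe_coe] at this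
    rw [this, d.dc]; funext b; simp
  ex := d.ex
  ex0 := by
    intro v hv
    apply d.ex0
    apply e.injective
    simpa [map_sum] using hv
  gen := by
    intro x
    obtain ⟨v, hv⟩ := d.gen (e.symm x)
    refine ⟨v, ?_⟩
    apply e.symm.injective
    rw [hv]; simp [map_sum]
  hex := fun i => Ex_equiv e (d.hex i)
  hinj := by
    intro r hr
    apply d.hinj
    intro a
    apply e.injective
    simpa using hr a
  h0 := by
    intro v hv
    obtain ⟨r, hr⟩ := d.h0 (fun a => e.symm.toLinearMap (v a)) (by
      rw [Mx_nat, hv]; funext b; simp)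
    refine ⟨r, fun a => ?_⟩
    apply e.symm.injective
    simpa using hr a

/-- linear map from C determined by a tuple killed by D 0 -/
theorem exists_map (d : SD R C) {X : Type} [AddCommGroup X] [Module R X] (v : Fin (d.n 0) → X)
    (hv : Mx (d.D 0) X v = 0) : ∃ φ : C →ₗ[R] X, ∀ a, φ (d.c a) = v a := by
  let π : (Fin (d.n 0) → R) →ₗ[R] C := Fintype.linearCombination R d.c
  have hπ : Function.Surjective π := by
    intro x; obtain ⟨w, hw⟩ := d.gen x
    exact ⟨w, by rw [hw]; simp [π, Fintype.linearCombination_apply]⟩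
  let ψ : (Fin (d.n 0) → R) →ₗ[R] X := Fintype.linearCombination R v
  have hk : LinearMap.ker π ≤ LinearMap.ker ψ := by
    intro w hw
    rw [LinearMap.mem_ker] at hw ⊢
    obtain ⟨u, rfl⟩ := d.ex0 w (by simpa [π, Fintype.linearCombination_apply] using hw)
    simp only [ψ, Fintype.linearCombination_apply, Mx_apply, Finset.sum_smul]
    rw [Finset.sum_comm]
    apply Finset.sum_eq_zero
    intro b _
    have h1 := congrFun hv b
    simp only [Mx_apply, Pi.zero_apply] at h1
    have h2 : ∑ a, ((d.D 0).transpose a b • u b) • v a = u b • ∑ a, d.D 0 b a • v a := by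
      rw [Finset.smul_sum]
      apply Finset.sum_congr rfl
      intro a _
      rw [smul_smul, Matrix.transpose_apply, smul_eq_mul, mul_comm]
    rw [h2, h1, smul_zero]
  refine ⟨((LinearMap.ker π).liftQ ψ hk).comp (π.quotKerEquivOfSurjective hπ).symm.toLinearMap,
    fun a => ?_⟩
  have : d.c a = π (Pi.single a 1) := by simp [π]
  rw [this]
  simp only [LinearMap.comp_apply, LinearEquiv.coe_coe]
  have h3 : (π.quotKerEquivOfSurjective hπ).symm (π (Pi.single a 1))
      = Submodule.Quotient.mk (Pi.single a 1) := by
    rw [LinearEquiv.symm_apply_eq]; rfl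
  rw [h3]
  simp [ψ]

theorem map_rel {X : Type} [AddCommGroup X] [Module R X] (φ : C →ₗ[R] X) :
    Mx (d.D 0) X (fun a => φ (d.c a)) = 0 := by
  rw [Mx_nat, d.dc]; funext b; simp

theorem map_ext {X : Type} [AddCommGroup X] [Module R X] {φ ψ : C →ₗ[R] X}
    (h : ∀ a, φ (d.c a) = ψ (d.c a)) : φ = ψ := by
  ext x
  obtain ⟨v, rfl⟩ := d.gen x
  simp [map_sum, h]

theorem fin (d : SD R C) : Module.Finite R C := by
  classical
  refine ⟨⟨Finset.univ.image d.c, ?_⟩⟩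
  rw [eq_top_iff]
  intro x _
  obtain ⟨v, rfl⟩ := d.gen x
  apply Submodule.sum_mem
  intro a _
  apply Submodule.smul_mem
  apply Submodule.subset_span
  simp

theorem smul_eq_zero (d : SD R C) (r : R) (h : ∀ x : C, r • x = 0) : r = 0 := d.hinj r fun a => h _

end SD

/-! ### tensor presentation -/
/-- canonical map `N^{n 0} → N ⊗ C` -/
noncomputable def tpi (d : SD R C) (N : Type) [AddCommGroup N] [Module R N] :
    (Fin (d.n 0) → N) →ₗ[R] N ⊗[R] C where
  toFun v := ∑ a, v a ⊗ₜ d.c a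
  map_add' v w := by simp [TensorProduct.add_tmul, Finset.sum_add_distrib]
  map_smul' r v := by simp [Finset.smul_sum, TensorProduct.smul_tmul']

theorem tpi_apply (d : SD R C) {N : Type} [AddCommGroup N] [Module R N] (v : Fin (d.n 0) → N) :
    tpi d N v = ∑ a, v a ⊗ₜ d.c a := rfl

theorem tpi_surj (d : SD R C) (N : Type) [AddCommGroup N] [Module R N] :
    Function.Surjective (tpi d N) := by
  intro x
  induction x with
  | zero => exact ⟨0, map_zero _⟩
  | add x y hx hy =>
    obtain ⟨v, rfl⟩ := hx
    obtain ⟨w, rfl⟩ := hy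
    exact ⟨v + w, map_add _ _ _⟩
  | tmul m y =>
    obtain ⟨v, rfl⟩ := d.gen y
    refine ⟨fun a => v a • m, ?_⟩
    simp [tpi_apply, TensorProduct.tmul_sum, TensorProduct.smul_tmul]

theorem tpi_rel (d : SD R C) {N : Type} [AddCommGroup N] [Module R N] (w : Fin (d.n 1) → N) :
    tpi d N (Mx (d.D 0).transpose N w) = 0 := by
  simp only [tpi_apply, Mx_apply, TensorProduct.sum_tmul]
  rw [Finset.sum_comm]
  apply Finset.sum_eq_zero
  intro b _
  have h1 := congrFun d.dc b
  simp only [Mx_apply, Pi.zero_apply] at h1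
  simp only [TensorProduct.smul_tmul, ← TensorProduct.tmul_sum, Matrix.transpose_apply, h1,
    TensorProduct.tmul_zero]

theorem tpi_ker (d : SD R C) {N : Type} [AddCommGroup N] [Module R N] (v : Fin (d.n 0) → N)
    (hv : tpi d N v = 0) : ∃ w, Mx (d.D 0).transpose N w = v := by
  -- map N ⊗ C → coker
  let Q := (Fin (d.n 0) → N) ⧸ LinearMap.range (Mx (d.D 0).transpose N)
  let q : (Fin (d.n 0) → N) →ₗ[R] Q := Submodule.mkQ _
  -- for each tuple, C →ₗ (N →ₗ Q)
  obtain ⟨φ, hφ⟩ := d.exists_map (X := N →ₗ[R] Q)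
    (fun a => q.comp (LinearMap.single R (fun _ => N) a)) (by
    funext b
    ext x
    simp only [Mx_apply, LinearMap.sum_apply, LinearMap.smul_apply, LinearMap.comp_apply,
      Pi.zero_apply, LinearMap.zero_apply]
    have : ∑ a, d.D 0 b a • q (LinearMap.single R (fun _ => N) a x)
        = q (Mx (d.D 0).transpose N (Pi.single b x)) := by
      have h1 : Mx (d.D 0).transpose N (Pi.single b x)
          = ∑ a, d.D 0 b a • LinearMap.single R (fun _ => N) a x := by
        funext a
        simp [Mx_apply, Finset.sum_apply, Pi.single_apply]
      rw [h1, map_sum]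
      simp only [map_smul]
    rw [this]
    rw [← LinearMap.mem_ker, Submodule.ker_mkQ]
    exact ⟨_, rfl⟩)
  let Φ : N ⊗[R] C →ₗ[R] Q := TensorProduct.lift φ.flip
  have h2 : Φ (tpi d N v) = q v := by
    simp only [tpi_apply, map_sum, Φ, TensorProduct.lift.tmul, LinearMap.flip_apply, hφ,
      LinearMap.comp_apply]
    rw [← map_sum]
    congr 1
    funext a
    simp [Finset.sum_apply, Pi.single_apply]
  rw [hv, map_zero] at h2
  have h3 : v ∈ LinearMap.ker q := h2.symm
  rw [Submodule.ker_mkQ] at h3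
  exact h3

theorem tpi_nat (d : SD R C) {N N' : Type} [AddCommGroup N] [Module R N] [AddCommGroup N']
    [Module R N'] (f : N →ₗ[R] N') (v : Fin (d.n 0) → N) :
    f.rTensor C (tpi d N v) = tpi d N' (fun a => f (v a)) := by
  simp [tpi_apply, map_sum]

/-! ### Auslander class -/
/-- The Auslander class of C. -/
structure AC (d : SD R C) (N : Type) [AddCommGroup N] [Module R N] : Prop where
  t : ∀ i, Ex (d.D (i+1)).transpose (d.D i).transpose N
  h : ∀ i, Ex (d.D i) (d.D (i+1)) (N ⊗[R] C)
  inj : ∀ x : N, (∀ a, x ⊗ₜ[R] d.c a = 0) → x = 0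
  surj : ∀ v : Fin (d.n 0) → N ⊗[R] C, Mx (d.D 0) _ v = 0 → ∃ x : N, ∀ a, v a = x ⊗ₜ d.c a

theorem AC_self (d : SD R C) : AC d R where
  t := d.ex
  h := fun i => Ex_equiv (TensorProduct.lid R C).symm (d.hex i)
  inj := by
    intro x hx
    apply d.hinj
    intro a
    have := congrArg (TensorProduct.lid R C) (hx a)
    simpa using this
  surj := by
    intro v hv
    obtain ⟨r, hr⟩ := d.h0 (fun a => (TensorProduct.lid R C).toLinearMap (v a)) (by
      rw [Mx_nat, hv]; funext b; simp)
    refine ⟨r, fun a => ?_⟩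
    apply (TensorProduct.lid R C).injective
    simpa using hr a

/-- for N in the class, every map C → N ⊗ C comes from an element -/
theorem AC.hom {d : SD R C} {N : Type} [AddCommGroup N] [Module R N] (h : AC d N)
    (φ : C →ₗ[R] N ⊗[R] C) : ∃ x : N, ∀ c : C, φ c = x ⊗ₜ c := by
  obtain ⟨x, hx⟩ := h.surj (fun a => φ (d.c a)) (d.map_rel φ)
  refine ⟨x, fun c => ?_⟩
  obtain ⟨v, rfl⟩ := d.gen c
  simp [map_sum, hx, TensorProduct.tmul_sum]

theorem AC.inj' {d : SD R C} {N : Type} [AddCommGroup N] [Module R N] (h : AC d N)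
    (x : N) (hx : ∀ c : C, x ⊗ₜ[R] c = 0) : x = 0 := h.inj x fun a => hx _

theorem AC.loc {d : SD R C} {N N' : Type} [AddCommGroup N] [Module R N] [AddCommGroup N']
    [Module R N'] (h : AC d N) (S : Submonoid R) (f : N →ₗ[R] N') [IsLocalizedModule S f] :
    AC d N' := by
  haveI hl : IsLocalizedModule S (f.rTensor C) := IsLocalizedModule.rTensor (R := R) R S f
  refine ⟨fun i => Ex_loc (S := S) f (h.t i), fun i => Ex_loc (S := S) (f.rTensor C) (h.h i),
    ?_, ?_⟩
  · intro x hx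
    obtain ⟨⟨y, s⟩, hy⟩ := IsLocalizedModule.surj S f x
    simp only at hy
    obtain ⟨s', hs'⟩ := common_zero (S := S) (f.rTensor C) (fun a => y ⊗ₜ[R] d.c a) (by
      intro a
      rw [LinearMap.rTensor_tmul, ← hy, Submonoid.smul_def, ← TensorProduct.smul_tmul', hx,
        smul_zero])
    have : (s' : R) • y = 0 := h.inj _ (by
      intro a; rw [← TensorProduct.smul_tmul']; exact hs' a)
    apply loc_cancel (S := S) f (s' * s)
    rw [smul_zero, Submonoid.coe_mul, mul_smul, ← Submonoid.smul_def s, hy, ← map_smul, this, map_zero]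
  · intro v hv
    obtain ⟨s, w, hw⟩ := common_denom (S := S) (f.rTensor C) v
    have h1 : ∀ b, f.rTensor C (Mx (d.D 0) _ w b) = 0 := by
      intro b
      have := congrFun (Mx_nat (d.D 0) (f.rTensor C) w) b
      rw [← this, show (fun a => f.rTensor C (w a)) = (s : R) • v from funext fun a => (hw a).symm,
        map_smul, hv]; simp
    obtain ⟨s', hs'⟩ := common_zero (S := S) (f.rTensor C) _ h1
    obtain ⟨x, hx⟩ := h.surj ((s' : R) • w) (by rw [map_smul]; funext b; exact hs' b)
    obtain ⟨y, hy⟩ := loc_div (S := S) f (s' * s) (f x)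
    refine ⟨y, fun a => ?_⟩
    apply loc_cancel (S := S) (f.rTensor C) (s' * s)
    rw [TensorProduct.smul_tmul', hy, ← LinearMap.rTensor_tmul, ← hx a]
    simp only [Pi.smul_apply, map_smul, Submonoid.coe_mul, mul_smul, hw]

end SDP

set_option linter.unusedVariables false
set_option maxHeartbeats 1000000
set_option synthInstance.maxHeartbeats 1000000

open CategoryTheory

namespace SDP

section bridge
variable {R : Type} [CommRing R] 

/-- a free chain complex -/
noncomputable def frC (n : ℕ → ℕ) (f : ∀ i, (Fin (n (i+1)) → R) →ₗ[R] (Fin (n i) → R))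
    (hff : ∀ i x, f i (f (i+1) x) = 0) : ChainComplex (ModuleCat.{0} R) ℕ :=
  ChainComplex.of (fun i => ModuleCat.of R (Fin (n i) → R)) (fun i => ModuleCat.ofHom (f i))
    (fun i => ModuleCat.hom_ext (LinearMap.ext fun x => hff i x))

theorem frC_d (n : ℕ → ℕ) (f : ∀ i, (Fin (n (i+1)) → R) →ₗ[R] (Fin (n i) → R))
    (hff : ∀ i x, f i (f (i+1) x) = 0) (i : ℕ) :
    (frC n f hff).d (i+1) i = ModuleCat.ofHom (f i) :=
  ChainComplex.of_d (fun i => ModuleCat.of R (Fin (n i) → R)) (fun i => ModuleCat.ofHom (f i)) i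

theorem frC_exact (n : ℕ → ℕ) (f : ∀ i, (Fin (n (i+1)) → R) →ₗ[R] (Fin (n i) → R))
    (hff : ∀ i x, f i (f (i+1) x) = 0) 
    (hex : ∀ i x, f i x = 0 → ∃ y, f (i+1) y = x) (i : ℕ) :
    (frC n f hff).ExactAt (i+1) := by
  rw [HomologicalComplex.exactAt_iff' _ (i + 1 + 1) (i + 1) i (by simp) (by simp)]
  rw [ShortComplex.moduleCat_exact_iff]
  intro x hx
  have hx' : ((frC n f hff).d (i+1) i).hom x = 0 := hx
  rw [frC_d] at hx'
  obtain ⟨y, hy⟩ := hex i x hx'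
  refine ⟨y, ?_⟩
  change ((frC n f hff).d (i+1+1) (i+1)).hom y = x
  rw [frC_d]
  exact hy

theorem frC_res {C : ModuleCat.{0} R} (n : ℕ → ℕ)
    (f : ∀ i, (Fin (n (i+1)) → R) →ₗ[R] (Fin (n i) → R))
    (hff : ∀ i x, f i (f (i+1) x) = 0) 
    (hex : ∀ i x, f i x = 0 → ∃ y, f (i+1) y = x) 
    (p : (Fin (n 0) → R) →ₗ[R] C) (hpf : ∀ x, p (f 0 x) = 0) (hp : Function.Surjective p)
    (hp0 : ∀ x, p x = 0 → ∃ y, f 0 y = x) :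
    ∃ P : ProjectiveResolution C, P.complex = frC n f hff := by
  refine ⟨{
    complex := frC n f hff
    projective := fun i => by
      have : Module.Projective R (Fin (n i) → R) := inferInstance
      exact (IsProjective.iff_projective (R := R) (Fin (n i) → R)).1 this
    hasHomology := fun i => inferInstance
    π := (ChainComplex.toSingle₀Equiv _ _).symm ⟨(ModuleCat.ofHom p :
      ModuleCat.of R (Fin (n 0) → R) ⟶ C), by
          rw [frC_d]; exact ModuleCat.hom_ext (LinearMap.ext fun x => hpf x)⟩
    quasiIso := ⟨fun i => ?_⟩ }, rfl⟩
  cases i with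
  | zero =>
    rw [ChainComplex.quasiIsoAt₀_iff, ShortComplex.quasiIso_iff_of_zeros']
    · let S : ShortComplex (ModuleCat R) := ShortComplex.mk (ModuleCat.ofHom (f 0))
        (ModuleCat.ofHom p : ModuleCat.of R (Fin (n 0) → R) ⟶ C) (ModuleCat.hom_ext (LinearMap.ext fun x => hpf x))
      have h1 : S.Exact ∧ Epi S.g := by
        constructor
        · rw [ShortComplex.moduleCat_exact_iff]
          intro x hx
          exact hp0 x hx
        · rw [ModuleCat.epi_iff_surjective]
          exact hp
      refine (ShortComplex.exact_and_epi_g_iff_of_iso ?_).2 h1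
      refine ShortComplex.isoMk (Iso.refl _) (Iso.refl _) (Iso.refl _) ?_ ?_
      · have := frC_d n f hff 0
        rw [Iso.refl_hom, Iso.refl_hom]
        erw [Category.id_comp]
      · rw [Iso.refl_hom, Iso.refl_hom]
        erw [Category.id_comp]
    all_goals rfl
  | succ i =>
    rw [quasiIsoAt_iff_exactAt']
    · exact frC_exact n f hff hex i
    · apply ChainComplex.exactAt_succ_single_obj

theorem ext_vanish {C : ModuleCat.{0} R} (n : ℕ → ℕ)
    (f : ∀ i, (Fin (n (i+1)) → R) →ₗ[R] (Fin (n i) → R))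
    (hff : ∀ i x, f i (f (i+1) x) = 0) 
    (hex : ∀ i x, f i x = 0 → ∃ y, f (i+1) y = x) 
    (p : (Fin (n 0) → R) →ₗ[R] C) (hpf : ∀ x, p (f 0 x) = 0) (hp : Function.Surjective p)
    (hp0 : ∀ x, p x = 0 → ∃ y, f 0 y = x) (X : ModuleCat.{0} R) (i : ℕ)
    (hE : Subsingleton (((Ext R (ModuleCat.{0} R) (i+1)).obj (Opposite.op C)).obj X))
    (φ : (Fin (n (i+1)) → R) →ₗ[R] X) (hφ : φ.comp (f (i+1)) = 0) :
    ∃ ψ : (Fin (n i) → R) →ₗ[R] X, ψ.comp (f i) = φ := by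
  obtain ⟨P, hP⟩ := frC_res n f hff hex p hpf hp hp0
  have e := P.isoExt (R := R) (i+1) X
  rw [hP] at e
  have h1 : Limits.IsZero (((frC n f hff).linearYonedaObj R X).homology (i+1)) := by
    refine Limits.IsZero.of_iso ?_ e.symm
    exact ModuleCat.isZero_of_subsingleton _
  rw [← HomologicalComplex.exactAt_iff_isZero_homology,
    HomologicalComplex.exactAt_iff' _ i (i + 1) (i+1+1) (by simp) (by simp),
    ShortComplex.moduleCat_exact_iff] at h1
  obtain ⟨y, hy⟩ := h1 (ModuleCat.ofHom φ : ModuleCat.of R (Fin (n (i+1)) → R) ⟶ X) (by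
    change (frC n f hff).d (i+1+1) (i+1) ≫ _ = 0
    rw [frC_d]
    exact ModuleCat.hom_ext hφ)
  let y' : ModuleCat.of R (Fin (n i) → R) ⟶ X := y
  refine ⟨y'.hom, ?_⟩
  have h2 : (frC n f hff).d (i+1) i ≫ y' = ModuleCat.ofHom φ := hy
  rw [frC_d] at h2
  ext x
  exact LinearMap.congr_fun (congrArg ModuleCat.Hom.hom h2) _


/-- a two-term piece of a free resolution -/
structure Stp (R : Type) [CommRing R] where
  p : ℕ
  q : ℕ
  f : (Fin q → R) →ₗ[R] (Fin p → R)

theorem exists_cover {M : Type} [AddCommGroup M] [Module R M] (K : Submodule R M) (hK : K.FG) :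
    ∃ (q : ℕ) (g : (Fin q → R) →ₗ[R] M), LinearMap.range g = K := by
  obtain ⟨q, s, hs⟩ := Submodule.fg_iff_exists_fin_generating_family.1 hK
  refine ⟨q, Fintype.linearCombination R s, ?_⟩
  rw [Fintype.range_linearCombination, hs]

theorem Stp.exists_next [IsNoetherianRing R] (s : Stp R) :
    ∃ (q : ℕ) (g : (Fin q → R) →ₗ[R] (Fin s.q → R)), LinearMap.range g = LinearMap.ker s.f :=
  exists_cover _ (IsNoetherian.noetherian _)

/-- next piece -/
noncomputable def Stp.next [IsNoetherianRing R] (s : Stp R) : Stp R :=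
  ⟨s.q, s.exists_next.choose, s.exists_next.choose_spec.choose⟩

theorem Stp.next_spec [IsNoetherianRing R] (s : Stp R) :
    LinearMap.range s.next.f = LinearMap.ker s.f := s.exists_next.choose_spec.choose_spec

/-- the sequence -/
noncomputable def Stp.seq [IsNoetherianRing R] (s : Stp R) : ℕ → Stp R
  | 0 => s
  | i+1 => (Stp.seq s i).next

/-- ranks -/
noncomputable def Stp.nn [IsNoetherianRing R] (s : Stp R) (i : ℕ) : ℕ := (s.seq i).p
/-- differentials -/
noncomputable def Stp.ff [IsNoetherianRing R] (s : Stp R) (i : ℕ) :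
    (Fin (s.nn (i+1)) → R) →ₗ[R] (Fin (s.nn i) → R) := (s.seq i).f
/-- augmentation -/
noncomputable def Stp.pp [IsNoetherianRing R] (s : Stp R) {C : Type} [AddCommGroup C] [Module R C]
    (p : (Fin s.p → R) →ₗ[R] C) : (Fin (s.nn 0) → R) →ₗ[R] C := p

theorem exists_resolution [IsNoetherianRing R] (C : Type) [AddCommGroup C] [Module R C]
    [Module.Finite R C] : ∃ (n : ℕ → ℕ) (f : ∀ i, (Fin (n (i+1)) → R) →ₗ[R] (Fin (n i) → R))
    (p : (Fin (n 0) → R) →ₗ[R] C), (∀ i, LinearMap.range (f (i+1)) = LinearMap.ker (f i)) ∧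
      LinearMap.range (f 0) = LinearMap.ker p ∧ Function.Surjective p := by
  obtain ⟨n0, p, hp⟩ := exists_cover (⊤ : Submodule R C) Module.Finite.fg_top
  obtain ⟨n1, f0, hf0⟩ := exists_cover (LinearMap.ker p) (IsNoetherian.noetherian _)
  let s : Stp R := ⟨n0, n1, f0⟩
  exact ⟨s.nn, s.ff, s.pp p, fun i => (s.seq i).next_spec, hf0, LinearMap.range_eq_top.1 hp⟩

/-- matrix of a map of free modules, in our convention -/
def mxOf {p q : ℕ} (f : (Fin p → R) →ₗ[R] (Fin q → R)) : Matrix (Fin p) (Fin q) R :=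
  fun b a => f (Pi.single b 1) a

theorem mxOf_spec {p q : ℕ} (f : (Fin p → R) →ₗ[R] (Fin q → R)) (v : Fin p → R) :
    Mx (mxOf f).transpose R v = f v := by
  conv_rhs => rw [← LinearMap.sum_single_apply (fun _ : Fin p => R) v, map_sum]
  funext a
  rw [Mx_apply, Finset.sum_apply]
  apply Finset.sum_congr rfl
  intro b _
  have : (Pi.single b (v b) : Fin p → R) = v b • Pi.single b 1 := by
    rw [← Pi.single_smul, smul_eq_mul, mul_one]
  rw [this, map_smul, Pi.smul_apply, Matrix.transpose_apply, smul_eq_mul, smul_eq_mul, mul_comm]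
  rfl

theorem mxOf_hom {p q : ℕ} (f : (Fin p → R) →ₗ[R] (Fin q → R)) {X : Type} [AddCommGroup X]
    [Module R X] (φ : (Fin q → R) →ₗ[R] X) (b : Fin p) :
    Mx (mxOf f) X (fun a => φ (Pi.single a 1)) b = φ (f (Pi.single b 1)) := by
  conv_rhs => rw [← LinearMap.sum_single_apply (fun _ : Fin q => R) (f (Pi.single b 1)), map_sum]
  rw [Mx_apply]
  apply Finset.sum_congr rfl
  intro a _
  have : (Pi.single a (f (Pi.single b 1) a) : Fin q → R) = f (Pi.single b 1) a • Pi.single a 1 := by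
    rw [← Pi.single_smul, smul_eq_mul, mul_one]
  rw [this, map_smul]
  rfl

theorem exists_SD [IsNoetherianRing R] (C : ModuleCat.{0} R) (hfin : Module.Finite R C)
    (hb : Function.Bijective (LinearMap.lsmul R C))
    (hE : ∀ i : ℕ, 1 ≤ i →
      Subsingleton (((Ext R (ModuleCat.{0} R) i).obj (Opposite.op C)).obj C)) :
    Nonempty (SD R C) := by
  obtain ⟨n, f, p, hf, hf0, hp⟩ := exists_resolution (R := R) C
  have hff : ∀ i x, f i (f (i+1) x) = 0 := by
    intro i x
    rw [← LinearMap.mem_ker, ← hf]; exact ⟨x, rfl⟩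
  have hex : ∀ i x, f i x = 0 → ∃ y, f (i+1) y = x := by
    intro i x hx
    rw [← LinearMap.mem_ker, ← hf] at hx; exact hx
  have hpf : ∀ x, p (f 0 x) = 0 := by
    intro x
    rw [← LinearMap.mem_ker, ← hf0]; exact ⟨x, rfl⟩
  have hp0 : ∀ x, p x = 0 → ∃ y, f 0 y = x := by
    intro x hx
    rw [← LinearMap.mem_ker, ← hf0] at hx; exact hx
  have hpv : ∀ v : Fin (n 0) → R, ∑ a, v a • p (Pi.single a 1) = p v := by
    intro v
    conv_rhs => rw [← LinearMap.sum_single_apply (fun _ : Fin (n 0) => R) v, map_sum]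
    apply Finset.sum_congr rfl
    intro a _
    rw [← map_smul, ← Pi.single_smul, smul_eq_mul, mul_one]
  have hlin : ∀ {q : ℕ} {X : Type} [AddCommGroup X] [Module R X] (v : Fin q → X),
      ∃ φ : (Fin q → R) →ₗ[R] X, ∀ a, φ (Pi.single a 1) = v a := by
    intro q X _ _ v
    exact ⟨Fintype.linearCombination R v, fun a => by simp⟩
  refine ⟨⟨n, fun i => mxOf (f i), fun a => p (Pi.single a 1), ?_, ?_, ?_, ?_, ?_, ?_, ?_, ?_⟩⟩
  · intro i
    have : ∀ v, Mx (mxOf (f (i+1)) * mxOf (f i)).transpose R v = 0 := by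
      intro v
      rw [Matrix.transpose_mul, ← Mx_comp, mxOf_spec, mxOf_spec, hff]
    ext b a
    have h1 := congrFun (this (Pi.single b 1)) a
    simp only [Mx_apply, Matrix.transpose_apply] at h1
    rw [Finset.sum_eq_single b (fun b' _ hb' => by simp [Pi.single_eq_of_ne hb'])
      (by simp)] at h1
    simpa using h1
  · funext b
    rw [mxOf_hom, hpf]; rfl
  · intro i v hv
    rw [mxOf_spec] at hv
    obtain ⟨w, hw⟩ := hex i v hv
    exact ⟨w, by rw [mxOf_spec, hw]⟩
  · intro v hv
    rw [hpv] at hv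
    obtain ⟨w, hw⟩ := hp0 v hv
    exact ⟨w, by rw [mxOf_spec, hw]⟩
  · intro x
    obtain ⟨v, rfl⟩ := hp x
    exact ⟨v, (hpv v).symm⟩
  · intro i v hv
    obtain ⟨φ, hφ⟩ := hlin v
    have hv2 : v = fun a => φ (Pi.single a 1) := funext fun a => (hφ a).symm
    obtain ⟨ψ, hψ⟩ := ext_vanish n f hff hex p hpf hp hp0 C i (hE (i+1) (by omega)) φ (by
      apply LinearMap.pi_ext'
      intro b
      ext
      have := congrFun hv b
      rw [hv2, mxOf_hom] at this
      simpa using this)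
    refine ⟨fun a => ψ (Pi.single a 1), ?_⟩
    funext b
    rw [mxOf_hom, ← hφ, ← hψ]; rfl
  · intro r hr
    apply hb.1
    ext x
    obtain ⟨v, rfl⟩ := hp x
    rw [← hpv]
    simp only [map_sum, map_smul, LinearMap.lsmul_apply, hr]
    simp
  · intro v hv
    obtain ⟨φ, hφ⟩ := hlin v
    have hv2 : v = fun a => φ (Pi.single a 1) := funext fun a => (hφ a).symm
    have h1 : φ.comp (f 0) = 0 := by
      apply LinearMap.pi_ext'
      intro b
      ext
      have := congrFun hv b
      rw [hv2, mxOf_hom] at this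
      simpa using this
    have h2 : LinearMap.ker p ≤ LinearMap.ker φ := by
      rw [← hf0]
      rintro _ ⟨x, rfl⟩
      exact LinearMap.congr_fun h1 x
    let g : C →ₗ[R] C := ((LinearMap.ker p).liftQ φ h2).comp
      (p.quotKerEquivOfSurjective hp).symm.toLinearMap
    obtain ⟨r, hr⟩ := hb.2 g
    refine ⟨r, fun a => ?_⟩
    have h3 : g (p (Pi.single a 1)) = v a := by
      have h4 : (p.quotKerEquivOfSurjective hp).symm (p (Pi.single a 1))
          = Submodule.Quotient.mk (Pi.single a 1) := by
        rw [LinearEquiv.symm_apply_eq]; rfl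
      simp only [g, LinearMap.comp_apply, LinearEquiv.coe_coe]
      rw [h4]
      simp [hφ]
    rw [← h3, ← hr]; simp

end bridge
end SDP

set_option linter.unusedVariables false
set_option maxHeartbeats 1000000
set_option synthInstance.maxHeartbeats 1000000
set_option linter.unusedSimpArgs false
set_option linter.style.haveILetI false

open TensorProduct

namespace SDP
variable {R : Type} [CommRing R] {C : Type} [AddCommGroup C] [Module R C]

/-- nonzero map from a f.g. module to a field of fractions, denominators cleared -/
theorem exists_map_domain {A : Type} [CommRing A] [IsDomain A] {W : Type} [AddCommGroup W]
    [Module A W] [Module.Finite A W] (hW : ∀ a : A, a ≠ 0 → ∃ w : W, a • w ≠ 0) :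
    ∃ φ : W →ₗ[A] A, φ ≠ 0 := by
  let F := FractionRing A
  let S := nonZeroDivisors A
  let WS := LocalizedModule S W
  let l : W →ₗ[A] WS := LocalizedModule.mkLinearMap S W
  -- some element of W is nontorsion
  have h1 : ∃ w : W, l w ≠ 0 := by
    by_contra hcon
    push Not at hcon
    obtain ⟨s, hs⟩ := (Module.Finite.fg_top : (⊤ : Submodule A W).FG)
    have h2 : ∀ w : W, ∃ a : S, a • w = 0 := fun w =>
      (IsLocalizedModule.eq_zero_iff S l).1 (hcon w)
    choose f hf using h2
    have h3 : ∀ w : W, (∏ x ∈ s, (f x : A)) • w = 0 := by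
      intro w
      have : w ∈ Submodule.span A (s : Set W) := by rw [hs]; trivial
      induction this using Submodule.span_induction with
      | mem x hx =>
        classical
        rw [← Finset.prod_erase_mul _ _ hx, mul_smul]
        have := hf x
        rw [Submonoid.smul_def] at this
        rw [this, smul_zero]
      | zero => simp
      | add x y _ _ hx hy => rw [smul_add, hx, hy, add_zero]
      | smul a x _ hx => rw [smul_comm, hx, smul_zero]
    obtain ⟨w, hw⟩ := hW (∏ x ∈ s, (f x : A)) (by
      rw [Finset.prod_ne_zero_iff]; intro x _; exact nonZeroDivisors.ne_zero (f x).2)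
    exact hw (h3 w)
  obtain ⟨w0, hw0⟩ := h1
  letI : Module F WS := inferInstanceAs (Module (Localization S) (LocalizedModule S W))
  haveI : IsScalarTower A F WS :=
    inferInstanceAs (IsScalarTower A (Localization S) (LocalizedModule S W))
  obtain ⟨lam, hlam⟩ : ∃ lam : Module.Dual F WS, lam (l w0) ≠ 0 := by
    by_contra hcon
    push Not at hcon
    exact hw0 ((Module.forall_dual_apply_eq_zero_iff F _).1 hcon)
  let ψ : W →ₗ[A] F := (lam.restrictScalars A).comp l
  obtain ⟨s, hs⟩ := (Module.Finite.fg_top : (⊤ : Submodule A W).FG)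
  obtain ⟨b, hb⟩ := IsLocalization.exist_integer_multiples S s ψ
  have hr : ∀ w : W, (b : A) • ψ w ∈ LinearMap.range (Algebra.linearMap A F) := by
    intro w
    have : w ∈ Submodule.span A (s : Set W) := by rw [hs]; trivial
    induction this using Submodule.span_induction with
    | mem x hx =>
      obtain ⟨y, hy⟩ := hb x hx
      exact ⟨y, hy⟩
    | zero => simp
    | add x y _ _ hx hy => rw [map_add, smul_add]; exact Submodule.add_mem _ hx hy
    | smul a x _ hx => rw [map_smul, smul_comm]; exact Submodule.smul_mem _ _ hx
  have hinj : Function.Injective (Algebra.linearMap A F) := IsFractionRing.injective A F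
  let e := LinearEquiv.ofInjective (Algebra.linearMap A F) hinj
  let φ : W →ₗ[A] A := e.symm.toLinearMap.comp (LinearMap.codRestrict _ ((b : A) • ψ) hr)
  refine ⟨φ, fun h => ?_⟩
  have h5 : φ w0 = 0 := by rw [h]; rfl
  have h6 : (LinearMap.codRestrict _ ((b : A) • ψ) hr) w0 = 0 := by
    apply e.symm.injective
    rw [map_zero]; exact h5
  have h7 : (b : A) • ψ w0 = 0 := congrArg Subtype.val h6
  rw [Algebra.smul_def, mul_eq_zero] at h7
  rcases h7 with h7 | h7
  · have : (b : A) = 0 := hinj (by simpa using h7)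
    exact nonZeroDivisors.ne_zero b.2 this
  · exact hlam h7

theorem faithful [IsNoetherianRing R] (hfin : Module.Finite R C)
    (hf : ∀ r : R, (∀ x : C, r • x = 0) → r = 0) {X : Type} [AddCommGroup X] [Module R X]
    (h : ∀ φ : C →ₗ[R] X, φ = 0) (x : X) : x = 0 := by
  by_contra hx
  haveI : Nontrivial X := ⟨x, 0, hx⟩
  obtain ⟨p, hp⟩ := associatedPrimes.nonempty R X
  have hp' : IsAssociatedPrime p X := hp
  haveI hpp : p.IsPrime := hp'.isPrime
  obtain ⟨ι, hι⟩ : ∃ ι : (R ⧸ p) →ₗ[R] X, Function.Injective ι := by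
    exact (isAssociatedPrime_iff_exists_injective_linearMap p X).1 hp' |>.2
  let W := C ⧸ (p • ⊤ : Submodule R C)
  haveI : Module.Finite R W := inferInstance
  haveI : Module.Finite (R ⧸ p) W := Module.Finite.of_restrictScalars_finite R (R ⧸ p) W
  obtain ⟨φ, hφ⟩ := exists_map_domain (A := R ⧸ p) (W := W) (by
    intro a ha
    by_contra hcon
    push Not at hcon
    obtain ⟨r, rfl⟩ := Ideal.Quotient.mk_surjective a
    have h1 : LinearMap.range (LinearMap.lsmul R C r : Module.End R C) ≤ p • ⊤ := by
      rintro _ ⟨y, rfl⟩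
      have := hcon (Submodule.Quotient.mk y)
      rw [← Submodule.Quotient.mk_eq_zero]
      simpa using this
    obtain ⟨P, hm, _, hc, ha0⟩ :=
      LinearMap.exists_monic_and_natDegree_eq_and_coeff_mem_pow_and_aeval_eq_zero R
        (LinearMap.lsmul R C r : Module.End R C) p h1
    have h2 : P.eval r = 0 := by
      apply hf
      intro y
      have h3 : Polynomial.aeval (LinearMap.lsmul R C r : Module.End R C) P
          = algebraMap R (Module.End R C) (P.eval r) := by
        have : (LinearMap.lsmul R C r : Module.End R C) = algebraMap R (Module.End R C) r := by
          ext; simp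
        rw [this, Polynomial.aeval_algebraMap_apply]
        simp
      rw [h3] at ha0
      have := LinearMap.congr_fun ha0 y
      simpa using this
    have h4 : r ^ P.natDegree ∈ p := by
      rw [Polynomial.eval_eq_sum_range, Finset.sum_range_succ, hm.coeff_natDegree, one_mul] at h2
      have h5 : ∑ i ∈ Finset.range P.natDegree, P.coeff i * r ^ i ∈ p := by
        apply Ideal.sum_mem
        intro i hi
        apply Ideal.mul_mem_right
        rw [Finset.mem_range] at hi
        exact Ideal.pow_le_self (by omega) (hc i)
      have h6 : r ^ P.natDegree = - ∑ i ∈ Finset.range P.natDegree, P.coeff i * r ^ i := by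
        linear_combination h2
      rw [h6]; exact p.neg_mem h5
    have h7 := hpp.mem_of_pow_mem _ h4
    exact ha (Ideal.Quotient.eq_zero_iff_mem.2 h7))
  apply hφ
  have h8 := h (ι.comp ((φ.restrictScalars R).comp (Submodule.mkQ _)))
  ext w
  obtain ⟨y, rfl⟩ := Submodule.Quotient.mk_surjective _ w
  apply hι
  have := LinearMap.congr_fun h8 y
  simp only [LinearMap.zero_apply, map_zero] at this ⊢
  exact this

theorem SD.faithful [IsNoetherianRing R] (d : SD R C) {X : Type} [AddCommGroup X] [Module R X]
    (h : ∀ φ : C →ₗ[R] X, φ = 0) (x : X) : x = 0 :=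
  SDP.faithful d.fin d.smul_eq_zero h x

/-- variant for submodules: if every map `C → Y` with image in `X` is zero then `X = 0` -/
theorem SD.faithful_sub [IsNoetherianRing R] (d : SD R C) {Y : Type} [AddCommGroup Y] [Module R Y]
    (X : Submodule R Y) (h : ∀ φ : C →ₗ[R] Y, (∀ c, φ c ∈ X) → φ = 0) (x : Y) (hx : x ∈ X) :
    x = 0 := by
  have := d.faithful (X := X) (fun φ => by
    have := h (X.subtype.comp φ) (fun c => (φ c).2)
    ext c
    simpa using LinearMap.congr_fun this c) ⟨x, hx⟩
  simpa using this

theorem AC.tensor_inj [IsNoetherianRing R] {d : SD R C} {N N' : Type} [AddCommGroup N] [Module R N]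
    [AddCommGroup N'] [Module R N'] (h : AC d N) (h' : AC d N') (f : N →ₗ[R] N')
    (hf : Function.Injective f) : Function.Injective (f.rTensor C) := by
  rw [injective_iff_map_eq_zero]
  intro x hx
  refine d.faithful_sub (LinearMap.ker (f.rTensor C)) ?_ x hx
  intro φ hφ
  obtain ⟨y, hy⟩ := h.hom φ
  have h1 : f y = 0 := h'.inj' _ (fun c => by
    have := hφ c
    rw [LinearMap.mem_ker, hy, LinearMap.rTensor_tmul] at this
    exact this)
  have h2 : y = 0 := hf (by rw [h1, map_zero])
  ext c
  rw [hy, h2]; simp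

/-- torsion lemma -/
theorem AC.torsion [IsNoetherianRing R] {d : SD R C} {N : Type} [AddCommGroup N] [Module R N]
    (h : AC d N) (J : Set R) (hJ : ∀ x : N, (∀ j ∈ J, j • x = 0) → x = 0) (y : N ⊗[R] C)
    (hy : ∀ j ∈ J, j • y = 0) : y = 0 := by
  let X : Submodule R (N ⊗[R] C) :=
    { carrier := {y | ∀ j ∈ J, j • y = 0}
      add_mem' := fun {a b} ha hb j hj => by rw [smul_add, ha j hj, hb j hj, add_zero]
      zero_mem' := fun j _ => smul_zero j
      smul_mem' := fun r a ha j hj => by rw [smul_comm, ha j hj, smul_zero] }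
  refine d.faithful_sub X ?_ y hy
  intro φ hφ
  obtain ⟨z, hz⟩ := h.hom φ
  have h2 : z = 0 := by
    apply hJ
    intro j hj
    apply h.inj'
    intro c
    have := hφ c j hj
    rwa [hz, TensorProduct.smul_tmul'] at this
  ext c
  rw [hz, h2]; simp

theorem lift_tuple {X X' : Type} (f : X → X') (hf : Function.Surjective f) {p : ℕ}
    (v : Fin p → X') : ∃ w : Fin p → X, ∀ a, f (w a) = v a :=
  ⟨fun a => (hf (v a)).choose, fun a => (hf (v a)).choose_spec⟩

/-- one diagram chase: `E` exact at `X'` one step further, `E` exact at `X` -/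
theorem Ex_quot {p q r s : ℕ} {D : Matrix (Fin p) (Fin q) R} {D' : Matrix (Fin r) (Fin p) R}
    {X' X X'' : Type} [AddCommGroup X'] [Module R X'] [AddCommGroup X] [Module R X]
    [AddCommGroup X''] [Module R X''] (f : X' →ₗ[R] X) (g : X →ₗ[R] X'')
    (hfg : Function.Exact f g) (hg : Function.Surjective g)
    (h1 : ∀ v' : Fin r → X', ∀ v, (fun a => f (v' a)) = Mx D' X v → ∃ w, Mx D' X' w = v')
    (h2 : ∀ v : Fin p → X, Mx D' X v = 0 → ∃ w, Mx D X w = v) : Ex D D' X'' := by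
  intro v'' hv''
  obtain ⟨v, hv⟩ := lift_tuple g hg v''
  have hv2 : (fun a => g (v a)) = v'' := funext hv
  have h3 : ∀ b, g (Mx D' X v b) = 0 := by
    intro b
    have := congrFun (Mx_nat D' g v) b
    rw [← this, hv2, hv'']; rfl
  have h4 : ∀ b, ∃ y, f y = Mx D' X v b := fun b => (hfg _).1 (h3 b)
  choose v' hv' using h4
  obtain ⟨w, hw⟩ := h1 v' v (funext hv')
  obtain ⟨u, hu⟩ := h2 (v - fun a => f (w a)) (by
    rw [map_sub, Mx_nat, hw, sub_eq_zero]; funext b; exact (hv' b).symm)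
  refine ⟨fun a => g (u a), ?_⟩
  rw [Mx_nat, hu]
  funext b
  simp [hv, hfg.apply_apply_eq_zero]

theorem AC.quot [IsNoetherianRing R] {d : SD R C} {N' N N'' : Type} [AddCommGroup N'] [Module R N']
    [AddCommGroup N] [Module R N] [AddCommGroup N''] [Module R N'']
    (h' : AC d N') (h : AC d N) (f : N' →ₗ[R] N) (g : N →ₗ[R] N'') (hf : Function.Injective f)
    (hfg : Function.Exact f g) (hg : Function.Surjective g) : AC d N'' := by
  have hF := h'.tensor_inj h f hf
  have hFG : Function.Exact (f.rTensor C) (g.rTensor C) := rTensor_exact C hfg hg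
  have hG : Function.Surjective (g.rTensor C) := LinearMap.rTensor_surjective C hg
  refine ⟨?_, ?_, ?_, ?_⟩
  · intro i
    refine Ex_quot (s := 0) f g hfg hg ?_ (h.t i)
    intro v' v hv
    cases i with
    | zero =>
      apply tpi_ker
      apply hF
      rw [map_zero, tpi_nat, hv, tpi_rel]
    | succ i =>
      apply h'.t i
      have h1 : Mx (d.D i).transpose N (fun a => f (v' a)) = 0 := by
        rw [hv, Mx_comp, ← Matrix.transpose_mul, d.dd]
        simp [Mx_zero]
      rw [Mx_nat] at h1
      funext b
      apply hf
      rw [congrFun h1 b]; simp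
  · intro i
    refine Ex_quot (s := 0) _ _ hFG hG ?_ (h.h i)
    intro v' v hv
    apply h'.h
    have h1 : Mx (d.D (i+1+1)) _ (fun a => f.rTensor C (v' a)) = 0 := by
      rw [hv, Mx_comp, d.dd, Mx_zero]
    rw [Mx_nat] at h1
    funext b
    apply hF
    rw [congrFun h1 b]; simp
  · intro x'' hx
    obtain ⟨x, rfl⟩ := hg x''
    have h1 : ∀ a, ∃ y, f.rTensor C y = x ⊗ₜ[R] d.c a := fun a => (hFG _).1 (by
      rw [LinearMap.rTensor_tmul]; exact hx a)
    choose y hy using h1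
    obtain ⟨x', hx'⟩ := h'.surj y (by
      have h2 : Mx (d.D 0) _ (fun a => f.rTensor C (y a)) = 0 := by
        rw [show (fun a => f.rTensor C (y a)) = fun a => TensorProduct.mk R N C x (d.c a) from
          funext hy]
        exact d.map_rel (TensorProduct.mk R N C x)
      rw [Mx_nat] at h2
      funext b
      apply hF
      rw [congrFun h2 b]; simp)
    have h3 : x - f x' = 0 := h.inj _ (by
      intro a
      rw [TensorProduct.sub_tmul, ← hy a, hx' a, LinearMap.rTensor_tmul, sub_self])
    rw [sub_eq_zero.1 h3, hfg.apply_apply_eq_zero]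
  · intro v'' hv''
    obtain ⟨v, hv⟩ := lift_tuple _ hG v''
    have hv2 : (fun a => g.rTensor C (v a)) = v'' := funext hv
    have h3 : ∀ b, g.rTensor C (Mx (d.D 0) _ v b) = 0 := by
      intro b
      have := congrFun (Mx_nat (d.D 0) (g.rTensor C) v) b
      rw [← this, hv2, hv'']; rfl
    have h4 : ∀ b, ∃ y, f.rTensor C y = Mx (d.D 0) _ v b := fun b => (hFG _).1 (h3 b)
    choose v' hv' using h4
    obtain ⟨w, hw⟩ := h'.h 0 v' (by
      have h1 : Mx (d.D (0+1)) _ (fun a => f.rTensor C (v' a)) = 0 := by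
        rw [show (fun a => f.rTensor C (v' a)) = Mx (d.D 0) _ v from funext hv', Mx_comp, d.dd,
          Mx_zero]
      rw [Mx_nat] at h1
      funext b
      apply hF
      rw [congrFun h1 b]; simp)
    obtain ⟨x, hx⟩ := h.surj (v - fun a => f.rTensor C (w a)) (by
      rw [map_sub, Mx_nat, hw, sub_eq_zero]; funext b; exact (hv' b).symm)
    refine ⟨g x, fun a => ?_⟩
    have := hx a
    rw [← LinearMap.rTensor_tmul, ← this]
    simp [hv, hFG.apply_apply_eq_zero]

theorem AC_subsingleton (d : SD R C) (N : Type) [AddCommGroup N] [Module R N] [Subsingleton N] :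
    AC d N := by
  have hs : Subsingleton (N ⊗[R] C) := inferInstance
  exact ⟨fun i v _ => ⟨0, Subsingleton.elim _ _⟩, fun i v _ => ⟨0, Subsingleton.elim _ _⟩,
    fun x _ => Subsingleton.elim _ _, fun v _ => ⟨0, fun a => Subsingleton.elim _ _⟩⟩

theorem AC.congr [IsNoetherianRing R] {d : SD R C} {N N'' : Type}
    [AddCommGroup N] [Module R N] [AddCommGroup N''] [Module R N'']
    (h : AC d N) (e : N ≃ₗ[R] N'') : AC d N'' := by
  refine AC.quot (AC_subsingleton d PUnit) h (0 : PUnit →ₗ[R] N) e.toLinearMap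
    (fun x y _ => rfl) ?_ e.surjective
  intro y
  constructor
  · intro hy
    exact ⟨0, by
      rw [LinearMap.zero_apply]; apply e.injective; rw [map_zero]; exact hy.symm⟩
  · rintro ⟨x, rfl⟩; simp

theorem AC.pi {d : SD R C} {ι : Type} [Fintype ι] {N : ι → Type} [∀ i, AddCommGroup (N i)]
    [∀ i, Module R (N i)] (h : ∀ i, AC d (N i)) : AC d (∀ i, N i) := by
  classical
  let e : (∀ i, N i) ⊗[R] C ≃ₗ[R] ∀ i, (N i ⊗[R] C) :=
    TensorProduct.comm _ _ _ ≪≫ₗ TensorProduct.piRight R R C N ≪≫ₗ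
      LinearEquiv.piCongrRight fun i => TensorProduct.comm _ _ _
  have he : ∀ x c i, e (x ⊗ₜ c) i = x i ⊗ₜ c := by
    intro x c i; simp [e]
  have key : ∀ {p q r : ℕ} (D : Matrix (Fin p) (Fin q) R) (D' : Matrix (Fin r) (Fin p) R)
      (P : ι → Type) [∀ i, AddCommGroup (P i)] [∀ i, Module R (P i)],
      (∀ i, Ex D D' (P i)) → Ex D D' (∀ i, P i) := by
    intro p q r D D' P _ _ hP v hv
    have h1 : ∀ i, ∃ w, Mx D (P i) w = fun a => v a i := by
      intro i
      apply hP i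
      have := Mx_nat D' (LinearMap.proj i : (∀ i, P i) →ₗ[R] P i) v
      simp only [LinearMap.proj_apply] at this
      rw [this, hv]; rfl
    choose w hw using h1
    refine ⟨fun a i => w i a, ?_⟩
    funext b i
    have := congrFun (hw i) b
    rw [← this]
    simp [Mx_apply, Finset.sum_apply]
  refine ⟨fun i => key _ _ N fun j => (h j).t i, fun i => ?_, ?_, ?_⟩
  · exact Ex_equiv e.symm (key _ _ (fun j => N j ⊗[R] C) fun j => (h j).h i)
  · intro x hx
    funext i
    apply (h i).inj
    intro a
    rw [← he, hx, map_zero]; rfl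
  · intro v hv
    have h1 : ∀ i, ∃ x : N i, ∀ a, e (v a) i = x ⊗ₜ d.c a := by
      intro i
      apply (h i).surj
      have := Mx_nat (d.D 0) ((LinearMap.proj i : (∀ i, N i ⊗[R] C) →ₗ[R] _).comp e.toLinearMap) v
      simp only [LinearMap.comp_apply, LinearMap.proj_apply, LinearEquiv.coe_coe] at this
      rw [this, hv]
      funext b; simp
    choose x hx using h1
    refine ⟨x, fun a => ?_⟩
    apply e.injective
    funext i
    rw [hx, he]

/-- LocTor -/
theorem locTor [IsNoetherianRing R] (d : SD R C) (S : Submonoid R) (x : R)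
    (hx : ∀ r : R, x * r = 0 → r = 0) (J : Set R) (c : C)
    (hc : ∀ j ∈ J, ∃ c', j • c = x • c')
    (hJ : ∀ r : R, (∀ j ∈ J, ∃ s ∈ S, x ∣ s * j * r) → ∃ s ∈ S, x ∣ s * r) :
    ∃ s ∈ S, ∃ c', s • c = x • c' := by
  have hA1 : AC d (R ⧸ Ideal.span {x}) := by
    refine AC.quot (AC_self d) (AC_self d) (LinearMap.lsmul R R x) (Submodule.mkQ _) ?_ ?_
      (Submodule.mkQ_surjective _)
    · rw [injective_iff_map_eq_zero]
      intro r hr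
      exact hx r hr
    · intro r
      rw [← LinearMap.mem_ker, Submodule.ker_mkQ, Ideal.mem_span_singleton]
      constructor
      · rintro ⟨y, rfl⟩; exact ⟨y, rfl⟩
      · rintro ⟨y, rfl⟩; exact ⟨y, rfl⟩
  let Q := R ⧸ Ideal.span {x}
  let NS := LocalizedModule S Q
  let l : Q →ₗ[R] NS := LocalizedModule.mkLinearMap S Q
  have hA2 : AC d NS := hA1.loc S l
  haveI hl : IsLocalizedModule S (l.rTensor C) := IsLocalizedModule.rTensor (R := R) R S l
  have hdvd : ∀ r : R, l (Submodule.Quotient.mk r) = 0 ↔ ∃ s ∈ S, x ∣ s * r := by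
    intro r
    rw [IsLocalizedModule.eq_zero_iff S l]
    constructor
    · rintro ⟨s, hs⟩
      refine ⟨s, s.2, ?_⟩
      rw [Submonoid.smul_def, ← Submodule.Quotient.mk_smul, Submodule.Quotient.mk_eq_zero,
        Ideal.mem_span_singleton] at hs
      exact hs
    · rintro ⟨s, hs, h⟩
      refine ⟨⟨s, hs⟩, ?_⟩
      rw [Submonoid.smul_def, ← Submodule.Quotient.mk_smul, Submodule.Quotient.mk_eq_zero,
        Ideal.mem_span_singleton]
      exact h
  have h0 : l (Submodule.Quotient.mk 1) ⊗ₜ[R] c = 0 := by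
    apply hA2.torsion J
    · intro y hy
      obtain ⟨⟨q, s⟩, hq⟩ := IsLocalizedModule.surj S l y
      obtain ⟨r, rfl⟩ := Submodule.Quotient.mk_surjective _ q
      simp only at hq
      have h1 : l (Submodule.Quotient.mk r) = 0 := by
        rw [hdvd]
        apply hJ
        intro j hj
        have h2 : l (Submodule.Quotient.mk (j * r)) = 0 := by
          rw [show (Submodule.Quotient.mk (j * r) : Q) = j • Submodule.Quotient.mk r from rfl,
            map_smul, ← hq, smul_comm, hy j hj, smul_zero]
        obtain ⟨s, hs, h3⟩ := (hdvd _).1 h2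
        exact ⟨s, hs, by rwa [mul_assoc]⟩
      apply loc_cancel (S := S) l s
      rw [smul_zero, ← Submonoid.smul_def, hq, h1]
    · intro j hj
      obtain ⟨c', hc'⟩ := hc j hj
      rw [← TensorProduct.tmul_smul, hc', TensorProduct.tmul_smul, TensorProduct.smul_tmul',
        ← map_smul]
      have : x • (Submodule.Quotient.mk 1 : Q) = 0 := by
        rw [← Submodule.Quotient.mk_smul, Submodule.Quotient.mk_eq_zero]
        simp [Ideal.mem_span_singleton]
      rw [this, map_zero, TensorProduct.zero_tmul]
  rw [← LinearMap.rTensor_tmul, IsLocalizedModule.eq_zero_iff S] at h0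
  obtain ⟨s, hs⟩ := h0
  refine ⟨s, s.2, ?_⟩
  -- Q ⊗ C → C / xC
  let P := C ⧸ LinearMap.range (LinearMap.lsmul R C x)
  let Φ : Q ⊗[R] C →ₗ[R] P := TensorProduct.lift
    (Submodule.liftQ _ ((LinearMap.lsmul R (C →ₗ[R] P)).flip (Submodule.mkQ _)) (by
      intro y hy
      rw [Ideal.mem_span_singleton] at hy
      obtain ⟨z, rfl⟩ := hy
      rw [LinearMap.mem_ker]
      ext c
      simp only [LinearMap.flip_apply, LinearMap.lsmul_apply, LinearMap.smul_apply,
        LinearMap.zero_apply, Submodule.mkQ_apply]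
      rw [← Submodule.Quotient.mk_smul, Submodule.Quotient.mk_eq_zero]
      exact ⟨z • c, by simp [mul_smul, smul_comm x z]⟩))
  have h1 : Φ ((s : R) • ((Submodule.Quotient.mk 1 : Q) ⊗ₜ[R] c)) = 0 := by
    rw [← Submonoid.smul_def, hs, map_zero]
  rw [map_smul] at h1
  have h2 : Φ ((Submodule.Quotient.mk 1 : Q) ⊗ₜ[R] c) = Submodule.Quotient.mk c := by
    simp only [Φ, TensorProduct.lift.tmul]
    change ((1 : R) • (Submodule.mkQ _ : C →ₗ[R] P)) c = _
    simp
  rw [h2, ← Submodule.Quotient.mk_smul, Submodule.Quotient.mk_eq_zero] at h1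
  obtain ⟨c', hc'⟩ := h1
  exact ⟨c', by simpa using hc'.symm⟩

end SDP

set_option linter.unusedVariables false
set_option maxHeartbeats 1000000
set_option synthInstance.maxHeartbeats 1000000

namespace SDP
open scoped TensorProduct

/-! ### region modules -/
/-- convex regions -/
structure Reg {M : Type} [AddCommGroup M] (σ : AddSubmonoid M) where
  carrier : Set M
  conv : ∀ g s s', g ∈ carrier → s ∈ σ → s' ∈ σ → g + s + s' ∈ carrier → g + s ∈ carrier

section Region
variable {M : Type} [AddCommGroup M] {σ : AddSubmonoid M} (k : Type) [Field k]

/-- the module with basis a region -/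
def RM (B : Reg σ) : Type := Finsupp.supported k k B.carrier

noncomputable instance (B : Reg σ) : AddCommGroup (RM k B) :=
  inferInstanceAs (AddCommGroup (Finsupp.supported k k B.carrier))

noncomputable instance (B : Reg σ) : Module k (RM k B) :=
  inferInstanceAs (Module k (Finsupp.supported k k B.carrier))

variable {k}
/-- coefficients -/
noncomputable def co {B : Reg σ} : RM k B →ₗ[k] (M →₀ k) := (Finsupp.supported k k B.carrier).subtype

theorem co_ext {B : Reg σ} {f f' : RM k B} (h : ∀ g ∈ B.carrier, co f g = co f' g) : f = f' := by
  apply Subtype.ext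
  ext g
  by_cases hg : g ∈ B.carrier
  · exact h g hg
  · have h1 : ∀ f : RM k B, co f g = 0 := fun f => by
      have := (Finsupp.mem_supported' k (co f)).1 f.2 g hg
      exact this
    exact (h1 f).trans (h1 f').symm

theorem co_out {B : Reg σ} (f : RM k B) {g : M} (hg : g ∉ B.carrier) : co f g = 0 :=
  (Finsupp.mem_supported' k (co f)).1 f.2 g hg

theorem co_mem {B : Reg σ} {f : RM k B} {g : M} (hg : co f g ≠ 0) : g ∈ B.carrier := by
  by_contra h; exact hg (co_out f h)

open Classical in
/-- truncate -/
noncomputable def tr (B : Reg σ) : (M →₀ k) →ₗ[k] RM k B := Finsupp.restrictDom k k B.carrier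

open Classical in
theorem co_tr (B : Reg σ) (f : M →₀ k) (g : M) : co (tr B f) g = if g ∈ B.carrier then f g else 0 := by
  change ((Finsupp.restrictDom k k B.carrier f : Finsupp.supported k k B.carrier) : M →₀ k) g = _
  rw [Finsupp.restrictDom_apply, Finsupp.filter_apply]

theorem tr_co {B : Reg σ} (f : RM k B) : tr B (co f) = f := by
  apply co_ext; intro g hg; rw [co_tr, if_pos hg]

/-- action of a monomial -/
noncomputable def actm (B : Reg σ) (s : M) : RM k B →ₗ[k] RM k B :=
  (tr B).comp ((Finsupp.lmapDomain k k (fun g => g + s)).comp co)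

open Classical in
theorem co_actm (B : Reg σ) (s : M) (f : RM k B) (g : M) :
    co (actm B s f) g = if g ∈ B.carrier then co f (g - s) else 0 := by
  rw [actm, LinearMap.comp_apply, co_tr]
  congr 1
  rw [LinearMap.comp_apply, Finsupp.lmapDomain_apply]
  have := Finsupp.mapDomain_apply (add_left_injective s) (co f) (g - s)
  simpa using this

noncomputable def actHom (B : Reg σ) : Multiplicative σ →* Module.End k (RM k B) where
  toFun s := actm B (s.toAdd : M)
  map_one' := by
    ext f
    apply co_ext
    intro g hg
    rw [co_actm, if_pos hg]
    simp
  map_mul' s s' := by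
    refine LinearMap.ext fun f => ?_
    apply co_ext
    intro g hg
    rw [Module.End.mul_apply, co_actm, if_pos hg, co_actm, if_pos hg, co_actm]
    have e : g - ((s * s').toAdd : σ) = g - (s.toAdd : M) - (s'.toAdd : M) := by
      rw [toAdd_mul]; push_cast; abel
    rw [e]
    split_ifs with h
    · rfl
    · by_contra h0
      have h1 := co_mem h0
      apply h
      have := B.conv _ (s'.toAdd : M) (s.toAdd : M) h1 s'.toAdd.2 s.toAdd.2 (by simpa using hg)
      simpa using this

noncomputable def actAlg (B : Reg σ) : AddMonoidAlgebra k σ →ₐ[k] Module.End k (RM k B) :=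
  AddMonoidAlgebra.lift k (Module.End k (RM k B)) σ (actHom B)

noncomputable instance (B : Reg σ) : Module (AddMonoidAlgebra k σ) (RM k B) :=
  Module.compHom (RM k B) (actAlg (k := k) B).toRingHom

theorem smul_def' {B : Reg σ} (r : AddMonoidAlgebra k σ) (f : RM k B) : r • f = actAlg B r f := rfl

open Classical in
theorem co_single_smul {B : Reg σ} (s : σ) (a : k) (f : RM k B) (g : M) :
    co ((AddMonoidAlgebra.single s a : AddMonoidAlgebra k σ) • f) g
      = if g ∈ B.carrier then a * co f (g - s) else 0 := by
  rw [smul_def', actAlg, AddMonoidAlgebra.lift_single]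
  simp only [LinearMap.smul_apply, map_smul, Finsupp.smul_apply]
  change a • co (actm B s f) g = _
  rw [co_actm]
  split_ifs <;> simp

/-- monomials -/
noncomputable abbrev mon (k : Type) [Field k] (s : σ) : AddMonoidAlgebra k σ := AddMonoidAlgebra.single s 1

open Classical in
theorem co_mon_smul {B : Reg σ} (s : σ) (f : RM k B) (g : M) :
    co (mon k s • f) g = if g ∈ B.carrier then co f (g - s) else 0 := by
  rw [co_single_smul]; simp

instance (B : Reg σ) : IsScalarTower k (AddMonoidAlgebra k σ) (RM k B) where
  smul_assoc a r f := by
    rw [smul_def', map_smul, smul_def']; rfl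

/-- basis vectors -/
noncomputable def bas (B : Reg σ) (g : M) : RM k B := tr B (Finsupp.single g 1)

open Classical in
theorem co_bas {B : Reg σ} {g : M} (hg : g ∈ B.carrier) : co (bas (k := k) B g) = Finsupp.single g 1 := by
  ext g'
  rw [bas, co_tr]
  split_ifs with h
  · rfl
  · rw [Finsupp.single_apply, if_neg]; rintro rfl; exact h hg

theorem bas_out {B : Reg σ} {g : M} (hg : g ∉ B.carrier) : bas (k := k) B g = 0 := by
  classical
  apply co_ext
  intro g' hg'
  rw [bas, co_tr, if_pos hg', Finsupp.single_apply, if_neg]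
  · simp
  · rintro rfl; exact hg hg'

theorem mon_bas {B : Reg σ} (s : σ) {g : M} (hg : g ∈ B.carrier) :
    mon k s • bas (k := k) B g = bas B (g + s) := by
  classical
  apply co_ext
  intro g' hg'
  rw [co_mon_smul, if_pos hg', co_bas hg, bas, co_tr, if_pos hg']
  simp only [Finsupp.single_apply, eq_sub_iff_add_eq]

theorem sum_bas {B : Reg σ} (f : RM k B) : f = ∑ g ∈ (co f).support, co f g • bas B g := by
  classical
  apply co_ext
  intro g hg
  rw [map_sum, Finsupp.finsetSum_apply]
  simp only [map_smul, Finsupp.smul_apply, smul_eq_mul]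
  have : ∀ x ∈ (co f).support, co f x * (co (bas (k := k) B x) g) = if x = g then co f x else 0 := by
    intro x hx
    rw [co_bas (co_mem (Finsupp.mem_support_iff.1 hx)), Finsupp.single_apply]
    split_ifs <;> simp
  rw [Finset.sum_congr rfl this, Finset.sum_ite_eq']
  split_ifs with h
  · rfl
  · simpa using h

/-- induction principle for linear maps out of the monoid algebra -/
theorem alg_lin {X X' : Type} [AddCommGroup X] [Module (AddMonoidAlgebra k σ) X] [AddCommGroup X']
    [Module (AddMonoidAlgebra k σ) X'] (φ : X →+ X')
    (h : ∀ s a x, φ ((AddMonoidAlgebra.single s a : AddMonoidAlgebra k σ) • x)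
      = (AddMonoidAlgebra.single s a : AddMonoidAlgebra k σ) • φ x) (r : AddMonoidAlgebra k σ) (x : X) :
    φ (r • x) = r • φ x := by
  induction r using AddMonoidAlgebra.induction_linear with
  | zero => simp
  | add f g hf hg => rw [add_smul, map_add, hf, hg, add_smul]
  | single s a => exact h s a x

/-- restriction map between regions -/
noncomputable def res (B B' : Reg σ)
    (h : ∀ g s, g ∈ B.carrier → s ∈ σ → g + s ∈ B'.carrier → (g + s ∈ B.carrier ↔ g ∈ B'.carrier)) :
    RM k B →ₗ[AddMonoidAlgebra k σ] RM k B' where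
  toFun f := tr B' (co f)
  map_add' f f' := by rw [map_add, map_add]
  map_smul' r f := by
    refine alg_lin (((tr B').comp co : RM k B →ₗ[k] RM k B').toAddMonoidHom) ?_ r f
    intro s a f
    apply co_ext
    intro g hg
    change co (tr B' (co _)) g = co (_ • tr B' (co f)) g
    rw [co_tr, if_pos hg, co_single_smul, co_single_smul, if_pos hg, co_tr]
    by_cases h0 : co f (g - s) = 0
    · simp [h0]
    · have h1 := co_mem h0
      have := h (g - s) s h1 s.2 (by simpa using hg)
      rw [sub_add_cancel] at this
      by_cases h2 : g ∈ B.carrier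
      · rw [if_pos h2, if_pos (this.1 h2)]
      · rw [if_neg h2, if_neg (fun h => h2 (this.2 h)), mul_zero]

open Classical in
theorem co_res {B B' : Reg σ} (h) (f : RM k B) (g : M) :
    co (res B B' h f) g = if g ∈ B'.carrier then co f g else 0 := by
  change co (tr B' (co f)) g = _
  rw [co_tr]

theorem reg_loc_linear {B B' : Reg σ} (hsub : B.carrier ⊆ B'.carrier)
    (h : ∀ g s, g ∈ B.carrier → s ∈ σ → g + s ∈ B'.carrier → g + s ∈ B.carrier) :
    ∀ g s, g ∈ B.carrier → s ∈ σ → g + s ∈ B'.carrier → (g + s ∈ B.carrier ↔ g ∈ B'.carrier) :=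
  fun g s hg hs hgs => ⟨fun _ => hsub hg, fun _ => h g s hg hs hgs⟩

theorem reg_loc {B B' : Reg σ} (hsub : B.carrier ⊆ B'.carrier)
    (h : ∀ g s, g ∈ B.carrier → s ∈ σ → g + s ∈ B'.carrier → g + s ∈ B.carrier)
    (x : σ) (hx : ∀ g, g ∈ B'.carrier ↔ g + x ∈ B'.carrier)
    (hN : ∀ g ∈ B'.carrier, ∃ N : ℕ, g + N • (x : M) ∈ B.carrier) :
    IsLocalizedModule (Submonoid.powers (mon k x)) (res (k := k) B B' (reg_loc_linear hsub h)) := by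
  classical
  have hxm : ∀ g, g ∈ B.carrier → g + x ∈ B.carrier := fun g hg =>
    h g x hg x.2 ((hx g).1 (hsub hg))
  have hpow : ∀ (N : ℕ), (mon k x) ^ N = mon k (N • x) := by
    intro N; rw [mon, AddMonoidAlgebra.single_pow, one_pow]
  have hxN' : ∀ (N : ℕ) g, g ∈ B'.carrier ↔ g + N • (x : M) ∈ B'.carrier := by
    intro N
    induction N with
    | zero => simp
    | succ N ih => intro g; rw [ih g, hx, succ_nsmul, add_assoc]
  have hxN : ∀ (N : ℕ) g, g ∈ B.carrier → g + N • (x : M) ∈ B.carrier := by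
    intro N
    induction N with
    | zero => simp
    | succ N ih => intro g hg; rw [succ_nsmul, ← add_assoc]; exact hxm _ (ih g hg)
  refine ⟨?_, ?_, ?_⟩
  · rintro ⟨_, N, rfl⟩
    rw [Module.End.isUnit_iff]
    simp only [hpow]
    constructor
    · intro f f' hff
      apply co_ext
      intro g hg
      have h1 : co (mon k (N • x) • f) (g + N • (x : M)) = co (mon k (N • x) • f') (g + N • (x : M)) :=
        congrArg (fun f => co f (g + N • (x : M))) hff
      rw [co_mon_smul, co_mon_smul, if_pos ((hxN' N g).1 hg), if_pos ((hxN' N g).1 hg)] at h1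
      simpa using h1
    · intro f
      refine ⟨tr B' (Finsupp.mapDomain (fun g => g - N • (x : M)) (co f)), ?_⟩
      rw [Module.algebraMap_end_apply]
      apply co_ext
      intro g hg
      rw [co_mon_smul, if_pos hg, co_tr, if_pos]
      · exact Finsupp.mapDomain_apply (sub_left_injective) (co f) g
      · rw [hxN' N]; simpa using hg
  · intro f
    choose! N hN using hN
    let n := (co f).support.sup N
    have hn : ∀ g, co f g ≠ 0 → g + n • (x : M) ∈ B.carrier := by
      intro g hg
      have h1 : N g ≤ n := Finset.le_sup (f := N) (Finsupp.mem_support_iff.2 hg)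
      obtain ⟨j, hj⟩ := Nat.exists_eq_add_of_le h1
      rw [hj, add_nsmul, ← add_assoc]
      exact hxN j _ (hN g (co_mem hg))
    refine ⟨⟨tr B (co (mon k (n • x) • f)), ⟨(mon k x)^n, n, rfl⟩⟩, ?_⟩
    change (mon k x)^n • f = res B B' _ (tr B (co (mon k (n • x) • f)))
    rw [hpow]
    apply co_ext
    intro g hg
    rw [co_res, if_pos hg, co_tr]
    split_ifs with h1
    · rfl
    · by_contra h0
      rw [co_mon_smul, if_pos hg] at h0
      apply h1
      simpa using hn _ h0
  · intro f f' hff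
    refine ⟨1, ?_⟩
    congr 1
    apply co_ext
    intro g hg
    have h1 := congrArg (fun f => co f g) hff
    simp only [co_res, if_pos (hsub hg)] at h1
    exact h1

end Region

/-! ### long exact sequences -/
theorem AC.long {R C : Type} [CommRing R] [AddCommGroup C] [Module R C] [IsNoetherianRing R] {d : SD R C}
    (W : ℕ → Type) [∀ i, AddCommGroup (W i)]
    [∀ i, Module R (W i)] (f : ∀ i, W i →ₗ[R] W (i+1)) (h0 : Function.Injective (f 0))
    (hex : ∀ i, Function.Exact (f i) (f (i+1))) (p : ℕ) (hp : ∀ q ≤ p, AC d (W q)) :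
    AC d (LinearMap.range (f p)) := by
  induction p with
  | zero => exact (hp 0 le_rfl).congr (LinearEquiv.ofInjective (f 0) h0)
  | succ p ih =>
    refine AC.quot (ih fun q hq => hp q (by omega)) (hp (p+1) le_rfl) (LinearMap.range (f p)).subtype
      (f (p+1)).rangeRestrict (Submodule.subtype_injective _) ?_ (LinearMap.surjective_rangeRestrict _)
    intro y
    have := hex p y
    constructor
    · intro h
      have h1 : f (p+1) y = 0 := congrArg Subtype.val h
      obtain ⟨x, rfl⟩ := this.1 h1
      exact ⟨⟨f p x, x, rfl⟩, rfl⟩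
    · rintro ⟨⟨_, x, rfl⟩, rfl⟩
      apply Subtype.ext
      exact this.2 ⟨x, rfl⟩

end SDP

set_option linter.unusedVariables false
set_option linter.unusedSectionVars false
set_option maxHeartbeats 1000000
set_option synthInstance.maxHeartbeats 1000000

namespace SDP
open scoped TensorProduct

/-- rooted directed graphs (the root is `none`) -/
structure Gr (W E : Type) where
  src : E → Option W
  tgt : E → Option W
  ht : Option W → ℕ
  hht : ∀ e, ht (src e) < ht (tgt e)
  hin : ∀ w, ∃ e, tgt e = some w

namespace Gr
variable {W E : Type} (Γ : Gr W E)

/-- value at a node -/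
def gv (v : Option W) : (W → ℤ) →+ ℤ where
  toFun g := v.elim 0 g
  map_zero' := by cases v <;> rfl
  map_add' g g' := by cases v <;> simp

/-- edge functional -/
def ev (e : E) : (W → ℤ) →+ ℤ := gv (Γ.tgt e) - gv (Γ.src e)

theorem ev_apply (e : E) (g : W → ℤ) : Γ.ev e g = gv (Γ.tgt e) g - gv (Γ.src e) g := rfl

def sig : AddSubmonoid (W → ℤ) where
  carrier := {g | ∀ e, 0 ≤ Γ.ev e g}
  zero_mem' := by intro e; simp
  add_mem' := by intro a b ha hb e; rw [map_add]; exact add_nonneg (ha e) (hb e)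

theorem mem_sig {g : W → ℤ} : g ∈ Γ.sig ↔ ∀ e, 0 ≤ Γ.ev e g := Iff.rfl

def Low (y : Finset (Option W)) : Prop := ∀ e, Γ.tgt e ∈ y → Γ.src e ∈ y

structure InG (y z : Finset (Option W)) (g : W → ℤ) : Prop where
  low : Γ.Low y
  sub : y ⊆ z
  neg : ∀ e, Γ.src e ∈ y → Γ.tgt e ∈ y → Γ.ev e g < 0
  pos : ∀ e, Γ.src e ∈ z → Γ.tgt e ∈ z → Γ.src e ∉ y → Γ.tgt e ∉ y → 0 ≤ Γ.ev e g
  off : ∀ e, Γ.src e ∉ z → Γ.tgt e ∉ z → 0 ≤ Γ.ev e g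

/-- Cousin regions -/
def G (y z : Finset (Option W)) : Reg Γ.sig where
  carrier := {g | Γ.InG y z g}
  conv := by
    intro g s s' hg hs hs' h
    refine ⟨hg.low, hg.sub, fun e h1 h2 => ?_, fun e h1 h2 h3 h4 => ?_, fun e h1 h2 => ?_⟩
    · have := h.neg e h1 h2
      rw [map_add] at this
      have := hs' e; linarith
    · rw [map_add]; exact add_nonneg (hg.pos e h1 h2 h3 h4) (hs e)
    · rw [map_add]; exact add_nonneg (hg.off e h1 h2) (hs e)

theorem mem_G {y z : Finset (Option W)} {g : W → ℤ} : g ∈ (Γ.G y z).carrier ↔ Γ.InG y z g := Iff.rfl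

section Cousin
variable [Fintype W] [DecidableEq W]

theorem low_none {z : Finset (Option W)} (hz : Γ.Low z) (hne : z.Nonempty) : none ∈ z := by
  obtain ⟨v, hv, hmin⟩ := z.exists_min_image Γ.ht hne
  cases v with
  | none => exact hv
  | some w =>
    obtain ⟨e, he⟩ := Γ.hin w
    have h1 := hz e (he ▸ hv)
    have := hmin _ h1
    have := Γ.hht e
    rw [he] at this; omega

/-- toggle vertex -/
theorem exists_toggle {z : Finset (Option W)} (hz : z.Nonempty) (g : W → ℤ) :
    ∃ x ∈ z, ∀ v ∈ z, gv x g < gv v g ∨ (gv x g = gv v g ∧ Γ.ht x ≤ Γ.ht v) := by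
  obtain ⟨x, hx, hmin⟩ := z.exists_min_image (fun v => toLex (gv v g, Γ.ht v)) hz
  exact ⟨x, hx, fun v hv => by simpa [Prod.Lex.le_iff] using hmin v hv⟩

theorem toggle_up {y z : Finset (Option W)} (hz : Γ.Low z) {g : W → ℤ} {x : Option W} (hx : x ∈ z)
    (hmin : ∀ v ∈ z, gv x g < gv v g ∨ (gv x g = gv v g ∧ Γ.ht x ≤ Γ.ht v)) (hxy : x ∉ y)
    (h : Γ.InG y z g) : Γ.InG (insert x y) z g := by
  have key : ∀ e, Γ.tgt e = x → Γ.ev e g < 0 ∧ Γ.src e ∈ y := by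
    intro e he
    have h1 : Γ.src e ∈ z := hz e (he ▸ hx)
    have h2 : Γ.ev e g < 0 := by
      rw [ev_apply, he]
      have h3 := Γ.hht e
      rw [he] at h3
      rcases hmin _ h1 with h4 | ⟨h4, h5⟩
      · linarith
      · omega
    refine ⟨h2, ?_⟩
    by_contra h3
    have := h.pos e h1 (he ▸ hx) h3 (he ▸ hxy)
    linarith
  refine ⟨?_, ?_, ?_, ?_, h.off⟩
  · intro e he
    rcases Finset.mem_insert.1 he with he | he
    · exact Finset.mem_insert_of_mem (key e he).2
    · exact Finset.mem_insert_of_mem (h.low e he)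
  · exact Finset.insert_subset hx h.sub
  · intro e h1 h2
    rcases Finset.mem_insert.1 h2 with h2 | h2
    · exact (key e h2).1
    · exact h.neg e (h.low e h2) h2
  · intro e h1 h2 h3 h4
    exact h.pos e h1 h2 (fun h => h3 (Finset.mem_insert_of_mem h)) (fun h => h4 (Finset.mem_insert_of_mem h))

theorem toggle_down {y z : Finset (Option W)} (hz : Γ.Low z) {g : W → ℤ} {x : Option W} (hx : x ∈ z)
    (hmin : ∀ v ∈ z, gv x g < gv v g ∨ (gv x g = gv v g ∧ Γ.ht x ≤ Γ.ht v)) (hxy : x ∉ y)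
    (h : Γ.InG (insert x y) z g) : Γ.InG y z g := by
  have hle : ∀ v ∈ z, gv x g ≤ gv v g := fun v hv => by
    rcases hmin v hv with h | ⟨h, _⟩
    · exact h.le
    · exact h.le
  have key : ∀ e, Γ.tgt e ∈ y → Γ.src e ∈ y := by
    intro e he
    rcases Finset.mem_insert.1 (h.low e (Finset.mem_insert_of_mem he)) with h1 | h1
    · have h2 := h.neg e (h1 ▸ Finset.mem_insert_self _ _) (Finset.mem_insert_of_mem he)
      rw [ev_apply, h1] at h2
      have := hle _ (h.sub (Finset.mem_insert_of_mem he))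
      linarith
    · exact h1
  refine ⟨key, fun v hv => h.sub (Finset.mem_insert_of_mem hv), ?_, ?_, h.off⟩
  · intro e h1 h2
    exact h.neg e (Finset.mem_insert_of_mem h1) (Finset.mem_insert_of_mem h2)
  · intro e h1 h2 h3 h4
    by_cases h5 : Γ.src e = x
    · rw [ev_apply, h5]
      have := hle _ h2
      linarith
    · by_cases h6 : Γ.tgt e = x
      · exfalso
        have := h.low e (h6 ▸ Finset.mem_insert_self _ _)
        rcases Finset.mem_insert.1 this with h7 | h7
        · exact h5 h7
        · exact h3 h7
      · refine h.pos e h1 h2 ?_ ?_ <;> simp [*]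

theorem mid {y z : Finset (Option W)} {g : W → ℤ} {x x' : Option W} (hxx : x ≠ x') (hx : x ∉ y)
    (hx' : x' ∉ y) (h : Γ.InG y z g) (h' : Γ.InG (insert x (insert x' y)) z g) :
    Γ.InG (insert x y) z g := by
  have hxz : x ∈ z := h'.sub (by simp)
  have hxz' : x' ∈ z := h'.sub (by simp)
  refine ⟨?_, Finset.insert_subset hxz h.sub, ?_, ?_, h.off⟩
  · intro e he
    rcases Finset.mem_insert.1 he with he | he
    · have h1 := h'.low e (by simp [he])
      have h2 := Γ.hht e
      simp only [Finset.mem_insert] at h1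
      rcases h1 with h1 | h1 | h1
      · rw [he, h1] at h2; omega
      · exfalso
        have h3 := h'.neg e (by simp [h1]) (by simp [he])
        have h4 := h.pos e (h1 ▸ hxz') (he ▸ hxz) (h1 ▸ hx') (he ▸ hx)
        linarith
      · exact Finset.mem_insert_of_mem h1
    · exact Finset.mem_insert_of_mem (h.low e he)
  · intro e h1 h2
    refine h'.neg e ?_ ?_
    · rcases Finset.mem_insert.1 h1 with h | h <;> simp [h]
    · rcases Finset.mem_insert.1 h2 with h | h <;> simp [h]
  · intro e h1 h2 h3 h4
    exact h.pos e h1 h2 (fun h => h3 (Finset.mem_insert_of_mem h)) (fun h => h4 (Finset.mem_insert_of_mem h))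

theorem G_res {y z : Finset (Option W)} {x : Option W} (g s : W → ℤ)
    (hg : g ∈ (Γ.G y z).carrier) (hs : s ∈ Γ.sig) (h : g + s ∈ (Γ.G (insert x y) z).carrier) :
    g + s ∈ (Γ.G y z).carrier ↔ g ∈ (Γ.G (insert x y) z).carrier := by
  rw [mem_G] at *
  refine iff_of_true ⟨hg.low, hg.sub, fun e h1 h2 => ?_, fun e h1 h2 h3 h4 => ?_, fun e h1 h2 => ?_⟩
    ⟨h.low, h.sub, fun e h1 h2 => ?_, fun e h1 h2 h3 h4 => ?_, hg.off⟩
  · exact h.neg e (Finset.mem_insert_of_mem h1) (Finset.mem_insert_of_mem h2)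
  · rw [map_add]; exact add_nonneg (hg.pos e h1 h2 h3 h4) (hs e)
  · rw [map_add]; exact add_nonneg (hg.off e h1 h2) (hs e)
  · have := h.neg e h1 h2
    rw [map_add] at this
    have := hs e; linarith
  · exact hg.pos e h1 h2 (fun h => h3 (Finset.mem_insert_of_mem h)) (fun h => h4 (Finset.mem_insert_of_mem h))

/-! signs -/
noncomputable def pos' (v : Option W) : ℕ := (Fintype.equivFin (Option W) v : ℕ)

noncomputable def eps (k : Type) [Field k] (x : Option W) (y : Finset (Option W)) : k :=
  (-1) ^ (y.filter (fun v => pos' v < pos' x)).card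

theorem eps_sq (k : Type) [Field k] (x : Option W) (y : Finset (Option W)) : eps k x y * eps k x y = 1 := by
  rw [eps, ← mul_pow]; simp

theorem eps_insert (k : Type) [Field k] {x x' : Option W} {y : Finset (Option W)} (hx : x' ∉ y) :
    eps k x (insert x' y) = (if pos' x' < pos' x then -1 else 1) * eps k x y := by
  rw [eps, eps, Finset.filter_insert]
  split_ifs with h
  · rw [Finset.card_insert_of_notMem (by simp [hx]), pow_succ']
  · simp

theorem eps_swap (k : Type) [Field k] {x x' : Option W} {y : Finset (Option W)} (hxx : x ≠ x')
    (hx : x ∉ y) (hx' : x' ∉ y) :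
    eps k x (insert x' y) * eps k x' y = -(eps k x' (insert x y) * eps k x y) := by
  rw [eps_insert k hx', eps_insert k hx]
  have : pos' x ≠ pos' x' := by
    intro h; apply hxx; exact (Fintype.equivFin (Option W)).injective (Fin.ext h)
  rcases lt_or_gt_of_ne this with h | h
  · rw [if_neg (by omega), if_pos h]; ring
  · rw [if_pos h, if_neg (by omega)]; ring

/-! the complex -/
variable (k : Type) [Field k]

abbrev CW (z : Finset (Option W)) (p : ℕ) : Type :=
  ∀ y : {y : Finset (Option W) // y.card = p}, RM k (Γ.G y.1 z)

theorem insert_erase_G {y : Finset (Option W)} {x : Option W} (hx : x ∈ y) (z : Finset (Option W)) :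
   ∀ g s, g ∈ (Γ.G (y.erase x) z).carrier → s ∈ Γ.sig → g + s ∈ (Γ.G y z).carrier →
    (g + s ∈ (Γ.G (y.erase x) z).carrier ↔ g ∈ (Γ.G y z).carrier) := by
  intro g s hg hs h
  have := Γ.G_res (y := y.erase x) (x := x) (z := z) g s hg hs
  rw [Finset.insert_erase hx] at this
  exact this h

/-- differential -/
noncomputable def dif (z : Finset (Option W)) (p : ℕ) :
    Γ.CW k z p →ₗ[AddMonoidAlgebra k Γ.sig] Γ.CW k z (p+1) :=
  LinearMap.pi fun y => ∑ x : {x // x ∈ y.1}, (algebraMap k (AddMonoidAlgebra k Γ.sig) (eps k x.1 (y.1.erase x.1))) •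
    (res (Γ.G (y.1.erase x.1) z) (Γ.G y.1 z) (Γ.insert_erase_G x.2 z)).comp
      (LinearMap.proj (R := AddMonoidAlgebra k Γ.sig)
        (φ := fun y : {y : Finset (Option W) // y.card = p} => RM k (Γ.G y.1 z))
       (⟨y.1.erase x.1, by rw [Finset.card_erase_of_mem x.2, y.2]; rfl⟩ : {y : Finset (Option W) // y.card = p}))

/-- total coefficient function -/
noncomputable def cf {z : Finset (Option W)} {p : ℕ} (f : Γ.CW k z p) (y : Finset (Option W)) (g : W → ℤ) : k :=
  if h : y.card = p then co (f ⟨y, h⟩) g else 0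

open Classical in
theorem cf_dif (z : Finset (Option W)) (p : ℕ) (f : Γ.CW k z p) (y : Finset (Option W)) (hy : y.card = p + 1)
    (g : W → ℤ) : Γ.cf k (Γ.dif k z p f) y g = if Γ.InG y z g then
      ∑ x ∈ y, eps k x (y.erase x) * Γ.cf k f (y.erase x) g else 0 := by
  rw [cf, dif_pos hy, dif, LinearMap.pi_apply, LinearMap.sum_apply, map_sum, Finsupp.finsetSum_apply]
  simp only [LinearMap.smul_apply, algebraMap_smul, map_smul, Finsupp.smul_apply, LinearMap.comp_apply,
    LinearMap.proj_apply, co_res, mem_G]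
  rw [← Finset.sum_coe_sort y]
  split_ifs with h
  · refine Finset.sum_congr rfl fun x _ => ?_
    rw [cf, dif_pos (by rw [Finset.card_erase_of_mem x.2, hy]; rfl), smul_eq_mul]
  · simp

theorem cf_ext {z : Finset (Option W)} {p : ℕ} {f f' : Γ.CW k z p}
    (h : ∀ y g, y.card = p → Γ.InG y z g → Γ.cf k f y g = Γ.cf k f' y g) : f = f' := by
  funext y
  apply co_ext
  intro g hg
  have := h y.1 g y.2 hg
  rw [cf, cf, dif_pos y.2, dif_pos y.2] at this
  exact this

theorem cf_out {z : Finset (Option W)} {p : ℕ} (f : Γ.CW k z p) {y g} (h : ¬ Γ.InG y z g) : Γ.cf k f y g = 0 := by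
  rw [cf]; split_ifs with h1
  · exact co_out _ h
  · rfl

theorem dif_dif (z : Finset (Option W)) (p : ℕ) (f : Γ.CW k z p) : Γ.dif k z (p+1) (Γ.dif k z p f) = 0 := by
  classical
  apply cf_ext
  intro y g hy hg
  rw [cf_dif _ _ _ _ _ _ hy, if_pos hg]
  have e0 : Γ.cf k (0 : Γ.CW k z (p+1+1)) y g = 0 := by
    rw [cf]; split_ifs <;> simp
  rw [e0]
  have e1 : ∀ x ∈ y, eps k x (y.erase x) * Γ.cf k (Γ.dif k z p f) (y.erase x) g =
      ∑ x' ∈ y.erase x, eps k x (y.erase x) * (eps k x' ((y.erase x).erase x') * Γ.cf k f ((y.erase x).erase x') g) := by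
    intro x hx
    rw [cf_dif _ _ _ _ _ _ (by rw [Finset.card_erase_of_mem hx, hy]; rfl)]
    rw [← Finset.mul_sum]
    split_ifs with h
    · rfl
    · congr 1
      symm
      apply Finset.sum_eq_zero
      intro x' hx'
      rw [Finset.mem_erase] at hx'
      have : ¬ Γ.InG ((y.erase x).erase x') z g := by
        intro h'
        apply h
        have := Γ.mid (x := x') (x' := x) (y := (y.erase x).erase x') (z := z) (g := g) hx'.1 (by simp) (by simp) h' (by
          have : insert x' (insert x ((y.erase x).erase x')) = y := by
            ext v; simp only [Finset.mem_insert, Finset.mem_erase]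
            by_cases h1 : v = x'
            · simp [h1, hx'.2]
            · by_cases h2 : v = x
              · simp [h2, hx]
              · simp [h1, h2]
          rw [this]; exact hg)
        rwa [Finset.insert_erase (by simp [hx'])] at this
      rw [Γ.cf_out k f this, mul_zero]
  rw [Finset.sum_congr rfl e1, Finset.sum_sigma']
  refine Finset.sum_involution (fun a _ => ⟨a.2, a.1⟩) ?_ ?_ ?_ ?_
  · rintro ⟨x, x'⟩ h
    simp only [Finset.mem_sigma, Finset.mem_erase] at h
    obtain ⟨hx, hxx, hx'⟩ := h
    have e2 : (y.erase x').erase x = (y.erase x).erase x' := Finset.erase_right_comm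
    simp only [e2]
    have e3 := eps_swap k (x := x) (x' := x') (y := (y.erase x).erase x') (Ne.symm hxx) (by simp) (by simp)
    rw [Finset.insert_erase (by simp [hxx, hx']), ← e2, Finset.insert_erase (by simp [Ne.symm hxx, hx]), e2] at e3
    linear_combination (Γ.cf k f ((y.erase x).erase x') g) * e3
  · rintro ⟨x, x'⟩ h _ h2
    simp only [Finset.mem_sigma, Finset.mem_erase] at h
    simp only [Sigma.mk.injEq] at h2
    exact h.2.1 (by simpa using h2.1)
  · rintro ⟨x, x'⟩ h
    simp only [Finset.mem_sigma, Finset.mem_erase] at h ⊢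
    exact ⟨h.2.2, Ne.symm h.2.1, h.1⟩
  · rintro ⟨x, x'⟩ h; rfl

/-- support in degree p closed: exactness in positive degree -/
theorem dif_exact (z : Finset (Option W)) (hz : Γ.Low z) (hne : z.Nonempty) (p : ℕ) (f : Γ.CW k z (p+1))
    (hf : Γ.dif k z (p+1) f = 0) : ∃ f', Γ.dif k z p f' = f := by
  classical
  choose t ht hmin using fun g => Γ.exists_toggle hne g
  -- homotopy
  have hex : ∃ f' : Γ.CW k z p, ∀ y g, y.card = p →
      Γ.cf k f' y g = if t g ∈ y then 0 else eps k (t g) y * Γ.cf k f (insert (t g) y) g := by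
    refine ⟨fun y => tr (Γ.G y.1 z) (∑ x : {x // x ∉ y.1},
      eps k x.1 y.1 • ((co (f ⟨insert x.1 y.1, by rw [Finset.card_insert_of_notMem x.2, y.2]⟩)).filter
        (fun g => t g = x.1))), ?_⟩
    intro y g hy
    rw [cf, dif_pos hy, co_tr, Finsupp.finsetSum_apply]
    simp only [Finsupp.smul_apply, Finsupp.filter_apply, smul_eq_mul, mul_ite, mul_zero]
    by_cases h1 : t g ∈ y
    · rw [if_pos h1]
      split_ifs
      · apply Finset.sum_eq_zero
        intro x _
        rw [if_neg]
        rintro h; exact x.2 (h ▸ h1)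
      · rfl
    · rw [if_neg h1]
      have hsum : (∑ x : {x // x ∉ y}, if t g = x.1 then eps k x.1 y * co (f ⟨insert x.1 y,
          by rw [Finset.card_insert_of_notMem x.2, hy]⟩) g else 0)
          = eps k (t g) y * Γ.cf k f (insert (t g) y) g := by
        rw [Finset.sum_eq_single ⟨t g, h1⟩]
        · rw [if_pos rfl, cf, dif_pos]
        · intro b _ hb
          rw [if_neg]
          rintro h; exact hb (Subtype.ext h.symm)
        · simp
      rw [hsum]
      split_ifs with h2
      · rfl
      · rw [Γ.cf_out k f, mul_zero]
        intro h3
        exact h2 (Γ.toggle_down hz (ht g) (hmin g) h1 h3)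
  obtain ⟨f', hf'⟩ := hex
  refine ⟨f', ?_⟩
  apply cf_ext
  intro y g hy hg
  rw [cf_dif _ _ _ _ _ _ hy, if_pos hg]
  have e1 : ∀ x ∈ y, eps k x (y.erase x) * Γ.cf k f' (y.erase x) g = if t g ∈ y.erase x then 0 else
      eps k x (y.erase x) * (eps k (t g) (y.erase x) * Γ.cf k f (insert (t g) (y.erase x)) g) := by
    intro x hx
    rw [hf' _ _ (by rw [Finset.card_erase_of_mem hx, hy]; rfl)]
    split_ifs <;> simp
  rw [Finset.sum_congr rfl e1]
  by_cases h1 : t g ∈ y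
  · rw [Finset.sum_eq_single (t g)]
    · rw [if_neg (by simp), Finset.insert_erase h1, ← mul_assoc, eps_sq, one_mul]
    · intro x hx hxt
      rw [if_pos (by simp [Ne.symm hxt, h1])]
    · exact fun h => absurd h1 h
  · have h2 := Γ.cf_dif k z (p+1) f (insert (t g) y) (by rw [Finset.card_insert_of_notMem h1, hy]) g
    have e0 : Γ.cf k (0 : Γ.CW k z (p+1+1)) (insert (t g) y) g = 0 := by
      rw [cf]; split_ifs <;> simp
    rw [hf, e0, if_pos (Γ.toggle_up hz (ht g) (hmin g) h1 hg), Finset.sum_insert h1, Finset.erase_insert h1] at h2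
    have h3 : Γ.cf k f y g = - eps k (t g) y * ∑ x ∈ y, eps k x ((insert (t g) y).erase x) *
        Γ.cf k f ((insert (t g) y).erase x) g := by
      have := eps_sq k (t g) y
      linear_combination (-eps k (t g) y) * h2 - Γ.cf k f y g * this
    rw [h3, Finset.mul_sum]
    refine Finset.sum_congr rfl fun x hx => ?_
    have hxt : x ≠ t g := by rintro rfl; exact h1 hx
    rw [if_neg (by simp [h1])]
    have e2 : (insert (t g) y).erase x = insert (t g) (y.erase x) := by
      rw [Finset.erase_insert_of_ne (Ne.symm hxt)]
    rw [e2]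
    have e3 := eps_swap k (x := x) (x' := t g) (y := y.erase x) hxt (by simp) (by simp [h1])
    rw [Finset.insert_erase hx] at e3
    have e4 := eps_sq k (t g) y
    have e5 := eps_sq k (t g) (y.erase x)
    linear_combination (Γ.cf k f (insert (t g) (y.erase x)) g) * (-eps k x (y.erase x) * eps k (t g) (y.erase x) * e4 - eps k x (insert (t g) (y.erase x)) * eps k (t g) y * e5 + eps k (t g) y * eps k (t g) (y.erase x) * e3)

theorem dif_inj (z : Finset (Option W)) (hz : Γ.Low z) (hne : z.Nonempty) :
    Function.Injective (Γ.dif k z 0) := by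
  classical
  rw [injective_iff_map_eq_zero]
  intro f hf
  apply cf_ext
  intro y g hy hg
  have e0 : ∀ p y, Γ.cf k (0 : Γ.CW k z p) y g = 0 := by
    intro p y; rw [cf]; split_ifs <;> simp
  rw [e0]
  obtain rfl := Finset.card_eq_zero.1 hy
  obtain ⟨t, ht, hmin⟩ := Γ.exists_toggle hne g
  have h2 := Γ.cf_dif k z 0 f {t} (by simp) g
  have h3 : Γ.InG {t} z g := Γ.toggle_up hz ht hmin (by simp) hg
  rw [hf, e0, if_pos h3] at h2
  simpa [eps] using h2.symm

/-- indicator of the complement of a set of nodes -/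
def xz (z : Finset (Option W)) : W → ℤ := fun w => if some w ∈ z then 0 else 1

theorem gv_xz {z : Finset (Option W)} (h : none ∈ z) (v : Option W) :
    gv v (xz z) = if v ∈ z then 0 else 1 := by
  cases v with
  | none => simp [gv, h]
  | some w => simp [gv, xz]

theorem ev_xz {z : Finset (Option W)} (h : none ∈ z) (hz : Γ.Low z) (e : E) :
    Γ.ev e (xz z) = if Γ.tgt e ∈ z then 0 else if Γ.src e ∈ z then 1 else 0 := by
  rw [ev_apply, gv_xz h, gv_xz h]
  by_cases h1 : Γ.tgt e ∈ z
  · simp [h1, hz e h1]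
  · by_cases h2 : Γ.src e ∈ z <;> simp [h1, h2]

theorem xz_mem {z : Finset (Option W)} (h : none ∈ z) (hz : Γ.Low z) : xz z ∈ Γ.sig := by
  intro e; rw [ev_xz Γ h hz]; split_ifs <;> simp

theorem AC_G_loc {C : Type} [AddCommGroup C] [Module (AddMonoidAlgebra k Γ.sig) C]
    [IsNoetherianRing (AddMonoidAlgebra k Γ.sig)] [Finite E] (d : SD (AddMonoidAlgebra k Γ.sig) C)
    {y z : Finset (Option W)} (hy : Γ.Low y) (hz : Γ.Low z) (hyz : y ⊆ z) (hne : z.Nonempty)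
    (h : AC d (RM k (Γ.G y y))) : AC d (RM k (Γ.G y z)) := by
  have hn := Γ.low_none hz hne
  have hsub : (Γ.G y y).carrier ⊆ (Γ.G y z).carrier := by
    intro g hg
    rw [mem_G] at *
    exact ⟨hy, hyz, hg.neg, fun e _ _ h3 h4 => hg.off e h3 h4,
      fun e h3 h4 => hg.off e (fun h => h3 (hyz h)) (fun h => h4 (hyz h))⟩
  have hl : ∀ g s, g ∈ (Γ.G y y).carrier → s ∈ Γ.sig → g + s ∈ (Γ.G y z).carrier →
      g + s ∈ (Γ.G y y).carrier := by
    intro g s hg hs h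
    rw [mem_G] at *
    exact ⟨hy, subset_rfl, h.neg, fun e h1 _ h3 _ => absurd h1 h3,
      fun e h3 h4 => by rw [map_add]; exact add_nonneg (hg.off e h3 h4) (hs e)⟩
  haveI := reg_loc (k := k) hsub hl ⟨xz z, Γ.xz_mem hn hz⟩ (by
    have key : ∀ g g' : W → ℤ, (∀ e, ¬ (Γ.tgt e ∉ z ∧ Γ.src e ∈ z) → Γ.ev e g = Γ.ev e g') →
        Γ.InG y z g → Γ.InG y z g' := by
      intro g g' hgg h
      refine ⟨h.low, h.sub, fun e h1 h2 => ?_, fun e h1 h2 h3 h4 => ?_, fun e h1 h2 => ?_⟩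
      · rw [← hgg e (fun h => h.1 (hyz h2))]; exact h.neg e h1 h2
      · rw [← hgg e (fun h => h.1 h2)]; exact h.pos e h1 h2 h3 h4
      · rw [← hgg e (fun h => h1 h.2)]; exact h.off e h1 h2
    intro g
    rw [mem_G, mem_G]
    have h1 : ∀ e, ¬ (Γ.tgt e ∉ z ∧ Γ.src e ∈ z) → Γ.ev e g = Γ.ev e (g + xz z) := by
      intro e he
      rw [map_add, ev_xz Γ hn hz]
      by_cases h1 : Γ.tgt e ∈ z
      · simp [h1]
      · have : Γ.src e ∉ z := fun h => he ⟨h1, h⟩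
        simp [h1, this]
    exact ⟨key _ _ h1, key _ _ fun e he => (h1 e he).symm⟩) (by
    intro g hg
    rw [mem_G] at hg
    haveI := Fintype.ofFinite E
    let N : ℕ := ∑ e, (Γ.ev e g).natAbs
    have hN : ∀ e, - Γ.ev e g ≤ N := by
      intro e
      have : (Γ.ev e g).natAbs ≤ N := Finset.single_le_sum (f := fun e => (Γ.ev e g).natAbs)
        (fun _ _ => Nat.zero_le _) (Finset.mem_univ e)
      omega
    refine ⟨N, ?_⟩
    rw [mem_G]
    have hev : ∀ e, Γ.ev e (g + N • xz z) = Γ.ev e g + N * (if Γ.tgt e ∈ z then 0 else if Γ.src e ∈ z then 1 else 0) := by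
      intro e; rw [map_add, map_nsmul, ev_xz Γ hn hz]; simp
    refine ⟨hy, subset_rfl, fun e h1 h2 => ?_, fun e h1 _ h3 _ => absurd h1 h3, fun e h1 h2 => ?_⟩
    · have := hg.neg e h1 h2
      simp only [hev, if_pos (hyz h2)]; linarith
    · simp only [hev]
      split_ifs with h3 h4
      · have := hg.pos e (hz e h3) h3 h1 h2; linarith
      · have := hN e; linarith
      · have := hg.off e h4 h3; linarith)
  exact AC.loc h (Submonoid.powers (mon k (⟨xz z, Γ.xz_mem hn hz⟩ : Γ.sig))) (res (k := k) _ _ (reg_loc_linear hsub hl))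

/-- the region of the monoid itself -/
def S0 : Reg Γ.sig := ⟨{g | g ∈ Γ.sig}, fun g s s' hg hs hs' _ => add_mem hg hs⟩

theorem AC_G {C : Type} [AddCommGroup C] [Module (AddMonoidAlgebra k Γ.sig) C]
    [IsNoetherianRing (AddMonoidAlgebra k Γ.sig)] [Finite E] (d : SD (AddMonoidAlgebra k Γ.sig) C)
    (h0 : AC d (RM k (Γ.G ∅ ∅))) (z : Finset (Option W)) (hz : Γ.Low z) :
    AC d (RM k (Γ.G z z)) := by
  classical
  induction z using Finset.strongInduction with
  | H z ih =>
    rcases z.eq_empty_or_nonempty with rfl | hne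
    · exact h0
    obtain ⟨r, hr⟩ : ∃ r, z.card = r + 1 := ⟨z.card - 1, by have := hne.card_pos; omega⟩
    have hemp : ∀ y, (∀ g, ¬ Γ.InG y z g) → Subsingleton (RM k (Γ.G y z)) := by
      intro y h
      exact ⟨fun f f' => co_ext fun g hg => absurd hg (h g)⟩
    have hsub : ∀ q ≤ r, AC d (Γ.CW k z q) := by
      intro q hq
      apply AC.pi
      rintro ⟨y, hy⟩
      by_cases h : Γ.Low y ∧ y ⊆ z
      · have hss : y ⊂ z := by
          refine Finset.ssubset_iff_subset_ne.2 ⟨h.2, ?_⟩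
          rintro rfl; omega
        exact Γ.AC_G_loc k d h.1 hz h.2 hne (ih y hss h.1)
      · haveI := hemp y fun g hg => h ⟨hg.low, hg.sub⟩
        exact AC_subsingleton d _
    have hlong := AC.long (d := d) (Γ.CW k z) (Γ.dif k z) (Γ.dif_inj k z hz hne) (fun p f => ⟨fun h =>
      Γ.dif_exact k z hz hne p f h, by rintro ⟨f', rfl⟩; exact Γ.dif_dif k z p f'⟩) r hsub
    -- the last module
    let π : Γ.CW k z (r+1) →ₗ[AddMonoidAlgebra k Γ.sig] RM k (Γ.G z z) :=
      LinearMap.proj (φ := fun y : {y : Finset (Option W) // y.card = r+1} => RM k (Γ.G y.1 z)) ⟨z, hr⟩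
    have hπi : Function.Injective π := by
      intro f f' h
      funext y
      by_cases hy : y.1 = z
      · obtain rfl : y = ⟨z, hr⟩ := Subtype.ext hy
        exact h
      · haveI := hemp y.1 fun g hg => hy (Finset.eq_of_subset_of_card_le hg.sub (by rw [hr, y.2]))
        exact Subsingleton.elim _ _
    have hπs : Function.Surjective π := by
      intro x
      refine ⟨fun y => if hy : y.1 = z then tr _ (co x) else 0, ?_⟩
      simp only [π, LinearMap.proj_apply, dif_pos]
      exact tr_co x
    have htop : ∀ f : Γ.CW k z (r+1), f ∈ LinearMap.range (Γ.dif k z r) := by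
      intro f
      apply Γ.dif_exact k z hz hne r f
      funext y
      haveI := hemp y.1 fun g hg => by have := Finset.card_le_card hg.sub; rw [y.2] at this; omega
      exact Subsingleton.elim _ _
    refine hlong.congr (LinearEquiv.ofBijective (π.comp (Submodule.subtype _)) ⟨hπi.comp (Submodule.subtype_injective _), ?_⟩)
    intro x
    obtain ⟨f, rfl⟩ := hπs x
    exact ⟨⟨f, htop f⟩, rfl⟩

/-- the monoid ring as a region module -/
theorem AC_S0 {C : Type} [AddCommGroup C] [Module (AddMonoidAlgebra k Γ.sig) C]
    [IsNoetherianRing (AddMonoidAlgebra k Γ.sig)] (d : SD (AddMonoidAlgebra k Γ.sig) C) :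
    AC d (RM k (Γ.G ∅ ∅)) := by
  classical
  have hmem : ∀ g, g ∈ (Γ.G ∅ ∅).carrier ↔ g ∈ Γ.sig := by
    intro g
    rw [mem_G]
    exact ⟨fun h e => h.off e (by simp) (by simp), fun h => ⟨by intro e; simp, by simp, by simp, by simp, fun e _ _ => h e⟩⟩
  let φ : AddMonoidAlgebra k Γ.sig →ₗ[AddMonoidAlgebra k Γ.sig] RM k (Γ.G ∅ ∅) :=
    LinearMap.toSpanSingleton _ _ (bas (Γ.G ∅ ∅) 0)
  have h0 : (0 : W → ℤ) ∈ (Γ.G ∅ ∅).carrier := (hmem 0).2 (zero_mem _)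
  have hφ : ∀ (r : AddMonoidAlgebra k Γ.sig) (s : Γ.sig), co (φ r) s = r.coeff s := by
    intro r s
    induction r using AddMonoidAlgebra.induction_linear with
    | zero => simp
    | add f g hf hg => simp only [map_add, Finsupp.add_apply, hf, hg, AddMonoidAlgebra.coeff_add]
    | single t a =>
      simp only [φ, LinearMap.toSpanSingleton_apply]
      rw [co_single_smul, if_pos ((hmem _).2 s.2), co_bas h0, AddMonoidAlgebra.coeff_single,
        Finsupp.single_apply, Finsupp.single_apply]
      have : ((0 : W → ℤ) = s - t) ↔ t = s := by
        rw [eq_comm, sub_eq_zero, eq_comm]; exact Subtype.coe_inj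
      simp only [this]; simp
  refine (AC_self d).congr (LinearEquiv.ofBijective φ ⟨?_, ?_⟩)
  · intro r r' h
    ext s
    rw [← hφ, ← hφ, h]
  · intro f
    rw [sum_bas f]
    refine ⟨∑ g ∈ (co f).support, if h : g ∈ Γ.sig then AddMonoidAlgebra.single ⟨g, h⟩ (co f g) else 0, ?_⟩
    rw [map_sum]
    refine Finset.sum_congr rfl fun g hg => ?_
    have hg' := (hmem g).1 (co_mem (Finsupp.mem_support_iff.1 hg))
    rw [dif_pos hg']
    simp only [φ, LinearMap.toSpanSingleton_apply]
    have : (AddMonoidAlgebra.single ⟨g, hg'⟩ (co f g) : AddMonoidAlgebra k Γ.sig) = co f g • mon k ⟨g, hg'⟩ := by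
      rw [AddMonoidAlgebra.smul_single]; simp
    rw [this, smul_assoc, mon_bas _ h0]
    simp

/-- the negative region -/
def Hreg : Reg Γ.sig := Γ.G Finset.univ Finset.univ

theorem mem_Hreg {g : W → ℤ} : g ∈ Γ.Hreg.carrier ↔ ∀ e, Γ.ev e g < 0 := by
  rw [Hreg, mem_G]
  exact ⟨fun h e => h.neg e (by simp) (by simp), fun h => ⟨by intro e; simp, by simp, fun e _ _ => h e, by simp, by simp⟩⟩

theorem AC_H {C : Type} [AddCommGroup C] [Module (AddMonoidAlgebra k Γ.sig) C]
    [IsNoetherianRing (AddMonoidAlgebra k Γ.sig)] [Finite E] (d : SD (AddMonoidAlgebra k Γ.sig) C) :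
    AC d (RM k Γ.Hreg) :=
  Γ.AC_G k d (Γ.AC_S0 k d) _ (by intro e; simp)

end Cousin

end Gr
end SDP

set_option linter.unusedVariables false
set_option linter.unusedSectionVars false
set_option maxHeartbeats 1000000
set_option synthInstance.maxHeartbeats 1000000

namespace SDP
open scoped TensorProduct

/-- gcd extraction in a UFD -/
theorem ufd_gcd {P ι : Type} [CommRing P] [IsDomain P] [UniqueFactorizationMonoid P] [Fintype ι] (f : ι → P)
    (i0 : ι) : ∃ (δ : P) (ρ : ι → P), (∀ i, f i = δ * ρ i) ∧ ∀ x y, (∀ i, x ∣ ρ i * y) → x ∣ y := by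
  classical
  letI : NormalizedGCDMonoid P := Classical.choice (inferInstance : Nonempty (NormalizedGCDMonoid P))
  obtain ⟨g, he, hg⟩ := Finset.extract_gcd f (s := Finset.univ) ⟨i0, Finset.mem_univ _⟩
  refine ⟨Finset.univ.gcd f, g, fun i => he i (Finset.mem_univ i), fun x y h => ?_⟩
  have h1 : x ∣ Finset.univ.gcd (fun i => g i * y) := Finset.dvd_gcd fun i _ => h i
  have h2 := Finset.gcd_mul_right' (s := Finset.univ) (f := g) y
  rw [hg, one_mul] at h2
  exact h1.trans h2.dvd

namespace Gr
variable {W E : Type} (Γ : Gr W E) [Fintype W] [DecidableEq W] [Fintype E] (k : Type) [Field k]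

instance usM : UniqueSums (W → ℤ) :=
  UniqueSums.of_injective_addHom (Finsupp.linearEquivFunOnFinite ℤ ℤ W).symm.toAddEquiv.toAddHom
    (Finsupp.linearEquivFunOnFinite ℤ ℤ W).symm.injective inferInstance

instance usS : UniqueSums Γ.sig :=
  UniqueSums.of_injective_addHom Γ.sig.subtype.toAddHom Subtype.val_injective (usM (W := W))

instance domR : IsDomain (AddMonoidAlgebra k Γ.sig) := inferInstance

theorem gv_nonneg {g : W → ℤ} (hg : g ∈ Γ.sig) (v : Option W) : 0 ≤ gv v g := by
  induction hn : Γ.ht v using Nat.strong_induction_on generalizing v with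
  | _ n ih =>
    cases v with
    | none => exact le_rfl
    | some w =>
      obtain ⟨e, he⟩ := Γ.hin w
      have h1 := Γ.hht e
      rw [he] at h1
      have h2 := ih _ (hn ▸ h1) (Γ.src e) rfl
      have h3 := hg e
      rw [ev_apply, he] at h3
      linarith

theorem exists_unit (e : E) : ∃ x ∈ Γ.sig, Γ.ev e x = 1 := by
  let z : Finset (Option W) := Finset.univ.filter fun v => Γ.ht v < Γ.ht (Γ.tgt e)
  have hz : Γ.Low z := by
    intro e' he'
    simp only [z, Finset.mem_filter, Finset.mem_univ, true_and] at *
    exact (Γ.hht e').trans he'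
  have hs : Γ.src e ∈ z := by simp [z, Γ.hht e]
  have ht : Γ.tgt e ∉ z := by simp [z]
  have hn := Γ.low_none hz ⟨_, hs⟩
  refine ⟨xz z, Γ.xz_mem hn hz, ?_⟩
  rw [ev_xz Γ hn hz, if_neg ht, if_pos hs]

theorem exists_interior : ∃ q ∈ Γ.sig, ∀ e, 1 ≤ Γ.ev e q := by
  choose x hx hx1 using Γ.exists_unit
  refine ⟨∑ e, x e, sum_mem fun e _ => hx e, fun e => ?_⟩
  rw [map_sum, ← hx1 e]
  exact Finset.single_le_sum (f := fun e' => Γ.ev e (x e')) (fun e' _ => hx e' e) (Finset.mem_univ e)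

/-- exponent as finitely supported function -/
noncomputable def toFs : Γ.sig →+ (W →₀ ℕ) where
  toFun s := Finsupp.equivFunOnFinite.symm fun w => (s.1 w).toNat
  map_zero' := by ext w; simp
  map_add' s t := by
    ext w
    have h1 := Γ.gv_nonneg s.2 (some w)
    have h2 := Γ.gv_nonneg t.2 (some w)
    have e : ∀ g : W → ℤ, gv (some w) g = g w := fun g => rfl
    rw [e] at h1 h2
    simp [Int.toNat_add h1 h2]

theorem toFs_apply (s : Γ.sig) (w : W) : ((Γ.toFs s w : ℕ) : ℤ) = s.1 w := by
  have h1 := Γ.gv_nonneg s.2 (some w)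
  have e : gv (some w) s.1 = s.1 w := rfl
  rw [e] at h1
  simp [toFs, h1]

theorem toFs_inj : Function.Injective Γ.toFs := by
  intro s t h
  ext w
  rw [← toFs_apply, ← toFs_apply, h]

/-- embedding in a polynomial ring -/
noncomputable def kap : AddMonoidAlgebra k Γ.sig →ₐ[k] MvPolynomial W k :=
  AddMonoidAlgebra.lift k (MvPolynomial W k) Γ.sig
    { toFun := fun s => MvPolynomial.monomial (Γ.toFs s.toAdd) 1
      map_one' := by rw [toAdd_one, map_zero]; rfl
      map_mul' := fun s t => by rw [toAdd_mul, map_add, MvPolynomial.monomial_mul, one_mul] }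

theorem kap_single (s : Γ.sig) (a : k) :
    Γ.kap k (AddMonoidAlgebra.single s a) = MvPolynomial.monomial (Γ.toFs s) a := by
  rw [kap, AddMonoidAlgebra.lift_single]
  simp [MvPolynomial.smul_monomial]

theorem coeff_kap (r : AddMonoidAlgebra k Γ.sig) (s : Γ.sig) :
    MvPolynomial.coeff (Γ.toFs s) (Γ.kap k r) = r.coeff s := by
  classical
  induction r using AddMonoidAlgebra.induction_linear with
  | zero => simp
  | add f g hf hg => simp [map_add, hf, hg]
  | single t a =>
    rw [kap_single, MvPolynomial.coeff_monomial, AddMonoidAlgebra.coeff_single, Finsupp.single_apply]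
    simp only [Γ.toFs_inj.eq_iff]

theorem kap_inj : Function.Injective (Γ.kap k) := by
  intro r r' h
  ext s
  rw [← coeff_kap, ← coeff_kap, h]

theorem exists_add_mem (q : Γ.sig) (hq : ∀ e, 1 ≤ Γ.ev e q) (g : W → ℤ) : ∃ N : ℕ, ∀ n, N ≤ n → g + n • (q : W → ℤ) ∈ Γ.sig := by
  refine ⟨∑ e, (Γ.ev e g).natAbs, fun n hn e => ?_⟩
  have : (Γ.ev e g).natAbs ≤ n := (Finset.single_le_sum (f := fun e => (Γ.ev e g).natAbs)
        (fun _ _ => Nat.zero_le _) (Finset.mem_univ e)).trans hn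
  rw [map_add, map_nsmul, nsmul_eq_mul]
  have h1 := hq e
  have h2 : (n : ℤ) ≤ n * Γ.ev e q := le_mul_of_one_le_right (by positivity) h1
  omega

theorem exists_kap (q : Γ.sig) (hq : ∀ e, 1 ≤ Γ.ev e q) (y : MvPolynomial W k) :
    ∃ N : ℕ, ∀ n, N ≤ n → ∃ r, Γ.kap k r = Γ.kap k (mon k (n • q)) * y := by
  induction y using MvPolynomial.induction_on' with
  | monomial g a =>
    obtain ⟨N, hN⟩ := Γ.exists_add_mem q hq (fun w => (g w : ℤ))
    refine ⟨N, fun n hn => ⟨AddMonoidAlgebra.single ⟨_, hN n hn⟩ a, ?_⟩⟩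
    rw [kap_single, kap_single, MvPolynomial.monomial_mul, one_mul]
    have hx : Γ.toFs ⟨_, hN n hn⟩ = Γ.toFs (n • q) + g := by
      ext w
      have : ((Γ.toFs ⟨_, hN n hn⟩ w : ℕ) : ℤ) = ((Γ.toFs (n • q) w + g w : ℕ) : ℤ) := by
        rw [toFs_apply]; push_cast; rw [toFs_apply]; simp; ring
      exact_mod_cast this
    rw [hx]
  | add y y' h h' =>
    obtain ⟨N, hN⟩ := h
    obtain ⟨N', hN'⟩ := h'
    refine ⟨max N N', fun n hn => ?_⟩
    obtain ⟨r, hr⟩ := hN n (le_trans (le_max_left _ _) hn)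
    obtain ⟨r', hr'⟩ := hN' n (le_trans (le_max_right _ _) hn)
    exact ⟨r + r', by rw [map_add, hr, hr']; ring⟩

variable {k}
variable {C : Type} [AddCommGroup C] [Module (AddMonoidAlgebra k Γ.sig) C]

theorem mon_ne (s : Γ.sig) : mon k s ≠ 0 := by
  intro h
  have := congrArg (fun r => r.coeff s) h
  simp [AddMonoidAlgebra.coeff_single] at this

/-- semidualizing modules are isomorphic to ideals containing a monomial -/
theorem exists_ideal [IsNoetherianRing (AddMonoidAlgebra k Γ.sig)] (d : SD (AddMonoidAlgebra k Γ.sig) C) :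
    (∀ (r : AddMonoidAlgebra k Γ.sig) (c : C), r ≠ 0 → r • c = 0 → c = 0) ∧
    ∃ (ψ : C →ₗ[AddMonoidAlgebra k Γ.sig] AddMonoidAlgebra k Γ.sig) (c0 : C) (s0 : Γ.sig),
      Function.Injective ψ ∧ ψ c0 = mon k s0 := by
  classical
  set R := AddMonoidAlgebra k Γ.sig with hR
  have htf : ∀ (r : R) (c : C), r ≠ 0 → r • c = 0 → c = 0 := by
    intro r c hr hrc
    have := (AC_self d).torsion {r} (fun x hx => by
      have := hx r rfl
      rw [smul_eq_mul] at this
      exact (mul_eq_zero.1 this).resolve_left hr) ((1 : R) ⊗ₜ[R] c) (fun j hj => by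
      rw [Set.mem_singleton_iff.1 hj, ← TensorProduct.tmul_smul, hrc, TensorProduct.tmul_zero])
    have h2 := congrArg (TensorProduct.lid R C) this
    simpa using h2
  refine ⟨htf, ?_⟩
  haveI := d.fin
  obtain ⟨φ, hφ⟩ := exists_map_domain (A := R) (W := C) (by
    intro a ha
    by_contra h
    push Not at h
    exact ha (d.smul_eq_zero a h))
  obtain ⟨c1, hc1⟩ : ∃ c, φ c ≠ 0 := by
    by_contra h
    push Not at h
    exact hφ (LinearMap.ext h)
  have hend : ∃ r : R, ∀ x, φ x • c1 = r • x := by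
    obtain ⟨r, hr⟩ := d.h0 (fun a => φ (d.c a) • c1) (by
      have := d.map_rel ((LinearMap.toSpanSingleton R C c1).comp φ)
      exact this)
    refine ⟨r, fun x => ?_⟩
    have : (LinearMap.toSpanSingleton R C c1).comp φ = LinearMap.lsmul R C r := d.map_ext fun a => hr a
    exact LinearMap.congr_fun this x
  obtain ⟨r, hr⟩ := hend
  have hr1 : r = φ c1 := by
    have := congrArg φ (hr c1)
    rw [map_smul, map_smul, smul_eq_mul, smul_eq_mul] at this
    exact (mul_right_cancel₀ hc1 this).symm
  have hφi : ∀ x, φ x = 0 → x = 0 := by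
    intro x hx
    have := hr x
    rw [hx, zero_smul] at this
    exact htf r x (hr1 ▸ hc1) this.symm
  -- gcd
  have hn0 : ∃ a, φ (d.c a) ≠ 0 := by
    by_contra h
    push Not at h
    exact hφ (d.map_ext (ψ := 0) fun a => by simpa using h a)
  obtain ⟨a1, ha1⟩ := hn0
  obtain ⟨δ, ρ, hδ, hgcd⟩ := ufd_gcd (fun a => Γ.kap k (φ (d.c a))) a1
  obtain ⟨q0, hq0, hq1⟩ := Γ.exists_interior
  let q : Γ.sig := ⟨q0, hq0⟩
  choose N hN using fun a => Γ.exists_kap k q hq1 (ρ a)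
  let n := Finset.univ.sup N
  choose ρ' hρ' using fun a => hN a n (Finset.le_sup (Finset.mem_univ a))
  have hk1 : Γ.kap k (φ (d.c a1)) ≠ 0 := by
    intro h; exact ha1 (Γ.kap_inj k (by rw [h, map_zero]))
  have hδ0 : δ ≠ 0 := by
    intro h; apply hk1; rw [hδ, h, zero_mul]
  have hρ0 : ρ a1 ≠ 0 := by
    intro h; apply hk1; rw [hδ, h, mul_zero]
  have hmk : ∀ s, Γ.kap k (mon k s) ≠ 0 := by
    intro s h; exact Γ.mon_ne s (Γ.kap_inj k (by rw [h, map_zero]))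
  have hρ0' : ρ' a1 ≠ 0 := by
    intro h
    have := hρ' a1
    rw [h, map_zero] at this
    exact mul_ne_zero (hmk _) hρ0 this.symm
  have hrel : ∀ a, ρ' a • d.c a1 = ρ' a1 • d.c a := by
    intro a
    rw [← sub_eq_zero]
    apply hφi
    apply Γ.kap_inj k
    simp only [map_sub, map_smul, smul_eq_mul, map_mul, hρ', map_zero]
    have h1 := hδ a1
    have h2 := hδ a
    rw [h1, h2]; ring
  let S : Submonoid R :=
    { carrier := {x | ∃ s, x = mon k s}
      one_mem' := ⟨0, rfl⟩
      mul_mem' := by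
        rintro _ _ ⟨s, rfl⟩ ⟨t, rfl⟩
        exact ⟨s + t, by rw [mon, mon, AddMonoidAlgebra.single_mul_single, one_mul]⟩ }
  obtain ⟨_, ⟨s, rfl⟩, c', hc'⟩ := locTor d S (ρ' a1) (fun r h => (mul_eq_zero.1 h).resolve_left hρ0')
    (Set.range ρ') (d.c a1) (by rintro _ ⟨a, rfl⟩; exact ⟨_, hrel a⟩) (by
      intro r h
      have h1 : ∀ a, ∃ s ∈ S, ρ' a1 ∣ s * ρ' a * r := fun a => h _ ⟨a, rfl⟩
      choose s hs hd using h1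
      have hsS : ∏ a, s a ∈ S := prod_mem fun a _ => hs a
      have h2 : ρ a1 ∣ Γ.kap k ((∏ a, s a) * r) := by
        apply hgcd
        intro a
        have h3 : ρ' a1 ∣ (∏ a, s a) * ρ' a * r := by
          rw [← Finset.prod_erase_mul _ _ (Finset.mem_univ a)]
          have := (hd a).mul_left (∏ x ∈ Finset.univ.erase a, s x)
          rwa [show (∏ x ∈ Finset.univ.erase a, s x) * (s a * ρ' a * r) = (∏ x ∈ Finset.univ.erase a, s x) * s a * ρ' a * r by ring] at this
        have h4 := map_dvd (Γ.kap k) h3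
        rw [map_mul, map_mul, hρ', hρ'] at h4
        rw [show Γ.kap k (∏ a, s a) * (Γ.kap k (mon k (n • q)) * ρ a) * Γ.kap k r =
          Γ.kap k (mon k (n • q)) * (ρ a * Γ.kap k ((∏ a, s a) * r)) by rw [map_mul]; ring] at h4
        exact (mul_dvd_mul_iff_left (hmk _)).1 h4
      obtain ⟨y, hy⟩ := h2
      obtain ⟨N', hN'⟩ := Γ.exists_kap k q hq1 y
      obtain ⟨r', hr'⟩ := hN' N' le_rfl
      refine ⟨mon k (n • q) * mon k (N' • q) * ∏ a, s a, S.mul_mem (S.mul_mem ⟨_, rfl⟩ ⟨_, rfl⟩) hsS, r', ?_⟩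
      apply Γ.kap_inj k
      rw [map_mul] at hy
      simp only [map_mul, hr', hρ']
      linear_combination (Γ.kap k (mon k (n • q)) * Γ.kap k (mon k (N' • q))) * hy)
  have hall : ∀ a, mon k s • d.c a = ρ' a • c' := by
    intro a
    rw [← sub_eq_zero]
    apply htf (ρ' a1) _ hρ0'
    rw [smul_sub, smul_comm, ← hrel, smul_comm, hc', smul_comm, sub_self]
  have hc0 : c' ≠ 0 := by
    rintro rfl
    rw [smul_zero] at hc'
    have := htf _ _ (Γ.mon_ne s) hc'
    exact ha1 (by rw [this, map_zero])
  have hcan : ∀ r : R, r • c' = 0 → r = 0 := by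
    intro r hr
    by_contra h
    exact hc0 (htf r c' h hr)
  obtain ⟨ψ, hψ⟩ := d.exists_map (X := R) ρ' (by
    funext b
    apply hcan
    rw [Mx_apply, Finset.sum_smul]
    simp only [smul_eq_mul, mul_smul, ← hall]
    have h1 := congrFun d.dc b
    rw [Mx_apply] at h1
    have h2 : ∀ x, d.D 0 b x • mon k s • d.c x = mon k s • d.D 0 b x • d.c x := fun x => smul_comm _ _ _
    simp only [h2, ← Finset.smul_sum]
    rw [h1]; simp)
  have hψ' : ∀ x, mon k s • x = ψ x • c' := by
    intro x
    have : LinearMap.lsmul R C (mon k s) = (LinearMap.toSpanSingleton R C c').comp ψ :=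
      d.map_ext fun a => by simp [hψ, hall]
    exact LinearMap.congr_fun this x
  refine ⟨ψ, c', s, ?_, ?_⟩
  · rw [injective_iff_map_eq_zero]
    intro x hx
    apply htf _ x (Γ.mon_ne s)
    rw [hψ', hx, zero_smul]
  · have := hψ' c'
    rw [← sub_eq_zero, ← sub_smul] at this
    exact (sub_eq_zero.1 (hcan _ this)).symm

end Gr
end SDP

set_option linter.unusedVariables false
set_option linter.unusedSectionVars false
set_option maxHeartbeats 1000000
set_option synthInstance.maxHeartbeats 1000000

namespace SDP
open scoped TensorProduct

namespace Gr
variable {W E : Type} (Γ : Gr W E) [Fintype W] [DecidableEq W] [Fintype E] {k : Type} [Field k]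

theorem mon_mul (s t : Γ.sig) : mon k s * mon k t = mon k (s + t) := by
  rw [mon, mon, AddMonoidAlgebra.single_mul_single, one_mul]

theorem ev_nsmul (e : E) (n : ℕ) (g : W → ℤ) : Γ.ev e (n • g) = n * Γ.ev e g := by
  rw [map_nsmul, nsmul_eq_mul]

theorem mon_pow (s : Γ.sig) (n : ℕ) : mon k s ^ n = mon k (n • s) := by
  rw [mon, AddMonoidAlgebra.single_pow, one_pow]

/-- the ring as a region module -/
noncomputable def emL : AddMonoidAlgebra k Γ.sig →ₗ[AddMonoidAlgebra k Γ.sig] RM k Γ.S0 :=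
  LinearMap.toSpanSingleton _ _ (bas Γ.S0 0)

theorem emL_single (s : Γ.sig) (a : k) :
    Γ.emL (AddMonoidAlgebra.single s a) = a • bas Γ.S0 (s : W → ℤ) := by
  classical
  have h0 : (0 : W → ℤ) ∈ Γ.S0.carrier := Γ.sig.zero_mem
  apply co_ext
  intro g hg
  rw [emL, LinearMap.toSpanSingleton_apply, co_single_smul, if_pos hg, co_bas h0, map_smul,
    co_bas (show (s : W → ℤ) ∈ Γ.S0.carrier from s.2)]
  simp [Finsupp.single_apply, sub_eq_zero, eq_comm]

theorem co_emL (r : AddMonoidAlgebra k Γ.sig) (s : Γ.sig) : co (Γ.emL r) (s : W → ℤ) = r.coeff s := by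
  classical
  induction r using AddMonoidAlgebra.induction_linear with
  | zero => simp
  | add f g hf hg => simp [map_add, hf, hg]
  | single t a =>
    rw [emL_single, map_smul, co_bas (show (t : W → ℤ) ∈ Γ.S0.carrier from t.2), AddMonoidAlgebra.coeff_single]
    simp [Finsupp.single_apply]

theorem co_emL_mul (s : Γ.sig) (r : AddMonoidAlgebra k Γ.sig) (t : Γ.sig) :
    (mon k s * r).coeff t = co (Γ.emL r) (t - s : W → ℤ) := by
  classical
  rw [← co_emL, ← smul_eq_mul, map_smul, co_mon_smul, if_pos]
  exact t.2

theorem dvd_iff (s : Γ.sig) (f : AddMonoidAlgebra k Γ.sig) :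
    mon k s ∣ f ↔ ∀ g : Γ.sig, f.coeff g ≠ 0 → ∀ e, Γ.ev e s ≤ Γ.ev e g := by
  classical
  constructor
  · rintro ⟨y, rfl⟩ g hg e
    rw [co_emL_mul] at hg
    have h1 : (g : W → ℤ) - s ∈ Γ.sig := co_mem hg
    have := h1 e
    rw [map_sub] at this
    linarith
  · intro h
    have hf : f = ∑ g ∈ f.coeff.support, AddMonoidAlgebra.single g (f.coeff g) := by
      ext t
      rw [AddMonoidAlgebra.coeff_sum, Finsupp.finsetSum_apply]
      simp only [AddMonoidAlgebra.coeff_single, Finsupp.single_apply]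
      rw [Finset.sum_ite_eq']
      split_ifs with h
      · rfl
      · simpa using h
    rw [hf]
    apply Finset.dvd_sum
    intro g hg
    have h1 : (g : W → ℤ) - s ∈ Γ.sig := fun e => by
      have := h g (Finsupp.mem_support_iff.1 hg) e
      rw [map_sub]; linarith
    refine ⟨AddMonoidAlgebra.single ⟨_, h1⟩ (f.coeff g), ?_⟩
    rw [mon, AddMonoidAlgebra.single_mul_single, one_mul]
    congr 1
    ext w; simp

theorem exists_min {f : AddMonoidAlgebra k Γ.sig} (hf : f ≠ 0) (e : E) :
    ∃ g : Γ.sig, f.coeff g ≠ 0 ∧ ∀ g' : Γ.sig, f.coeff g' ≠ 0 → Γ.ev e g ≤ Γ.ev e g' := by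
  have hne : f.coeff.support.Nonempty := by
    rw [Finsupp.support_nonempty_iff]
    intro h
    apply hf
    ext s
    rw [h]; simp
  obtain ⟨g, hg, h⟩ := Finset.exists_min_image f.coeff.support (fun g => Γ.ev e g) hne
  exact ⟨g, Finsupp.mem_support_iff.1 hg, fun g' hg' => h g' (Finsupp.mem_support_iff.2 hg')⟩

/-- multiplicativity of the order along an edge -/
theorem exists_mul_min {f f' : AddMonoidAlgebra k Γ.sig} (e : E) {g g' : Γ.sig} (hg : f.coeff g ≠ 0)
    (hmin : ∀ x : Γ.sig, f.coeff x ≠ 0 → Γ.ev e g ≤ Γ.ev e x) (hg' : f'.coeff g' ≠ 0)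
    (hmin' : ∀ x : Γ.sig, f'.coeff x ≠ 0 → Γ.ev e g' ≤ Γ.ev e x) :
    ∃ x : Γ.sig, (f * f').coeff x ≠ 0 ∧ Γ.ev e x = Γ.ev e g + Γ.ev e g' := by
  classical
  let A : Finset Γ.sig := f.coeff.support.filter fun x => Γ.ev e x = Γ.ev e g
  let B : Finset Γ.sig := f'.coeff.support.filter fun x => Γ.ev e x = Γ.ev e g'
  obtain ⟨a, ha, b, hb, hu⟩ := UniqueSums.uniqueAdd_of_nonempty (A := A) (B := B)
    ⟨g, by simp [A, hg]⟩ ⟨g', by simp [B, hg']⟩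
  simp only [A, B, Finset.mem_filter, Finsupp.mem_support_iff] at ha hb
  refine ⟨a + b, ?_, ?_⟩
  · rw [AddMonoidAlgebra.coeff_mul_add_of_uniqueAdd]
    · exact mul_ne_zero ha.1 hb.1
    · intro x y hx hy hxy
      rw [Finsupp.mem_support_iff] at hx hy
      have h1 := hmin x hx
      have h2 := hmin' y hy
      have h3 := congrArg (fun z : Γ.sig => Γ.ev e z) hxy
      simp only [AddSubmonoid.coe_add, map_add] at h3
      refine hu ?_ ?_ hxy
      · simp only [A, Finset.mem_filter, Finsupp.mem_support_iff]; exact ⟨hx, by linarith⟩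
      · simp only [B, Finset.mem_filter, Finsupp.mem_support_iff]; exact ⟨hy, by linarith⟩
  · rw [AddSubmonoid.coe_add, map_add, ha.2, hb.2]

/-- upper regions -/
def Breg (u : E → ℤ) : Reg Γ.sig :=
  ⟨{g | ∀ e, u e ≤ Γ.ev e g}, fun g s s' hg hs hs' _ e => by
    have := hg e; have := hs e; rw [map_add]; linarith⟩

theorem mem_Breg {u : E → ℤ} {g : W → ℤ} : g ∈ (Γ.Breg u).carrier ↔ ∀ e, u e ≤ Γ.ev e g := Iff.rfl

variable {C : Type} [AddCommGroup C] [Module (AddMonoidAlgebra k Γ.sig) C]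

theorem class_step [IsNoetherianRing (AddMonoidAlgebra k Γ.sig)]
    (hfac : ∀ e, ∃ r, Γ.ev e r = 0 ∧ ∀ e', e' ≠ e → 0 < Γ.ev e' r) (d : SD (AddMonoidAlgebra k Γ.sig) C) :
    ∃ u : E → ℤ, Nonempty (C ≃ₗ[AddMonoidAlgebra k Γ.sig] RM k (Γ.Breg u)) := by
  classical
  obtain ⟨htf, ψ, c0, s0, hψ, hc0⟩ := Γ.exists_ideal d
  choose r0 hr0 hr1 using hfac
  have hrs : ∀ e, r0 e ∈ Γ.sig := fun e e' => by
    by_cases h : e' = e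
    · subst h; exact (hr0 e').ge
    · exact (hr1 e e' h).le
  let rr : E → Γ.sig := fun e => ⟨r0 e, hrs e⟩
  choose x0 hx0 hx1 using Γ.exists_unit
  let xx : E → Γ.sig := fun e => ⟨x0 e, hx0 e⟩
  have hmin : ∀ e, ∃ v : ℕ, (∃ c, ∃ g : Γ.sig, (ψ c).coeff g ≠ 0 ∧ Γ.ev e g = v) ∧
      ∀ c (g : Γ.sig), (ψ c).coeff g ≠ 0 → (v : ℤ) ≤ Γ.ev e g := by
    intro e
    have hex : ∃ v : ℕ, ∃ c, ∃ g : Γ.sig, (ψ c).coeff g ≠ 0 ∧ Γ.ev e g = v :=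
      ⟨(Γ.ev e s0).toNat, c0, s0, by rw [hc0]; simp [AddMonoidAlgebra.coeff_single],
        by rw [Int.toNat_of_nonneg (s0.2 e)]⟩
    refine ⟨Nat.find hex, Nat.find_spec hex, fun c g hg => ?_⟩
    have := Nat.find_min' hex ⟨c, g, hg, (Int.toNat_of_nonneg (g.2 e)).symm⟩
    have h2 := g.2 e
    omega
  choose u hu hul using hmin
  have hmon : ∀ s : Γ.sig, ∀ r, mon k s * r = 0 → r = 0 := fun s r h =>
    (mul_eq_zero.1 h).resolve_left (Γ.mon_ne s)
  -- step 1
  have step1 : ∀ h : Γ.sig, (∀ e, (u e : ℤ) ≤ Γ.ev e h) → ∀ e, ∃ s : Γ.sig, Γ.ev e s = 0 ∧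
      ∃ c', mon k s • mon k h • c0 = mon k s0 • c' := by
    intro h hh e
    obtain ⟨cf, gf, hgf, hgfu⟩ := hu e
    -- N large
    obtain ⟨N, hN⟩ : ∃ N : ℕ, ∀ e', e' ≠ e → u e * Γ.ev e' (x0 e) ≤ N * Γ.ev e' (r0 e) := by
      refine ⟨∑ e', (u e * Γ.ev e' (x0 e)).natAbs, fun e' he' => ?_⟩
      have h1 : (u e * Γ.ev e' (x0 e)).natAbs ≤ ∑ e', (u e * Γ.ev e' (x0 e)).natAbs :=
        Finset.single_le_sum (f := fun e' => (u e * Γ.ev e' (x0 e)).natAbs)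
          (fun _ _ => Nat.zero_le _) (Finset.mem_univ e')
      have h2 := hr1 e e' he'
      generalize (∑ e', (u e * Γ.ev e' (x0 e)).natAbs) = T at *
      have h3 : (T : ℤ) ≤ T * Γ.ev e' (r0 e) := le_mul_of_one_le_right (by positivity) h2
      omega
    have hd : mon k (u e • xx e) ∣ mon k (N • rr e) * ψ cf := by
      rw [dvd_iff]
      intro g hg e'
      rw [co_emL_mul] at hg
      have h1 : (g : W → ℤ) - (N • rr e : Γ.sig) ∈ Γ.sig := co_mem hg
      have hg2 : (ψ cf).coeff ⟨_, h1⟩ ≠ 0 := by rwa [← co_emL]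
      have h2 := hul e cf _ hg2
      have h3 := h1 e'
      simp only [AddSubmonoidClass.coe_nsmul, ev_nsmul, map_sub, xx, rr] at h1 h2 h3 ⊢
      by_cases he : e' = e
      · subst he; rw [hx1, mul_one]; rw [hr0] at h2; linarith
      · have := hN e' he; linarith
    obtain ⟨f1, hf1⟩ := hd
    -- order of f1
    have hf10 : f1 ≠ 0 := by
      rintro rfl
      rw [mul_zero] at hf1
      have := hmon _ _ hf1
      rw [this] at hgf; simp at hgf
    have hord : ∃ g : Γ.sig, f1.coeff g ≠ 0 ∧ Γ.ev e g = 0 := by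
      have h1 : (mon k (N • rr e) * ψ cf).coeff (N • rr e + gf) ≠ 0 := by
        rw [co_emL_mul]
        simp only [AddSubmonoid.coe_add, add_sub_cancel_left]
        rwa [co_emL]
      rw [hf1, co_emL_mul] at h1
      have h2 := co_mem h1
      refine ⟨⟨_, h2⟩, by rwa [← co_emL], ?_⟩
      simp only [AddSubmonoidClass.coe_nsmul, AddSubmonoid.coe_add, ev_nsmul, map_sub, map_add, xx, rr]
      rw [hr0, hgfu, hx1]; ring
    obtain ⟨gm, hgm, hgm0⟩ := hord
    let S : Submonoid (AddMonoidAlgebra k Γ.sig) :=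
      { carrier := {x | ∃ s : Γ.sig, Γ.ev e s = 0 ∧ x = mon k s}
        one_mem' := ⟨0, by simp, rfl⟩
        mul_mem' := by
          rintro _ _ ⟨s, hs, rfl⟩ ⟨t, ht, rfl⟩
          exact ⟨s + t, by simp [hs, ht], Γ.mon_mul s t⟩ }
    have hb : (h : W → ℤ) + N • r0 e - u e • x0 e ∈ Γ.sig := fun e' => by
      have h1 := hh e'
      have h2 := h.2 e'
      simp only [ev_nsmul, map_sub, map_add]
      by_cases he : e' = e
      · subst he; rw [hx1, hr0]; linarith
      · have := hN e' he; linarith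
    obtain ⟨_, ⟨s, hs, rfl⟩, c', hc'⟩ := locTor d S (mon k s0) (hmon s0) {f1} (mon k h • c0) (by
        intro j hj
        rw [Set.mem_singleton_iff.1 hj]
        refine ⟨mon k ⟨_, hb⟩ • cf, ?_⟩
        apply hψ
        simp only [map_smul, smul_eq_mul, hc0]
        apply mul_left_cancel₀ (Γ.mon_ne (k := k) (u e • xx e))
        have h3 : mon k (u e • xx e) * mon k (⟨_, hb⟩ : Γ.sig) = mon k h * mon k (N • rr e) := by
          rw [mon_mul, mon_mul]
          congr 1
          ext w; simp [xx, rr]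
        calc _ = (mon k (u e • xx e) * f1) * (mon k h * mon k s0) := by ring
          _ = (mon k h * mon k (N • rr e)) * (mon k s0 * ψ cf) := by rw [← hf1]; ring
          _ = _ := by rw [← h3]; ring) (by
        intro r hr
        obtain ⟨_, ⟨s, hs, rfl⟩, hd⟩ := hr f1 rfl
        have hval : ∀ g : Γ.sig, r.coeff g ≠ 0 → Γ.ev e s0 ≤ Γ.ev e g := by
          intro g hg
          have hr0 : r ≠ 0 := by rintro rfl; simp at hg
          obtain ⟨g', hg', hm'⟩ := Γ.exists_min hr0 e
          obtain ⟨x, hx, hxe⟩ := Γ.exists_mul_min e hgm (fun y _ => by rw [hgm0]; exact y.2 e) hg' hm'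
          rw [mul_assoc, dvd_iff] at hd
          have h4 := hd (s + x) (by
            rw [co_emL_mul]
            simp only [AddSubmonoid.coe_add, add_sub_cancel_left]
            rwa [co_emL]) e
          rw [AddSubmonoid.coe_add, map_add, hs, hxe, hgm0] at h4
          have := hm' g hg
          linarith
        obtain ⟨N', hN'⟩ : ∃ N : ℕ, ∀ e', e' ≠ e → Γ.ev e' s0 ≤ N * Γ.ev e' (r0 e) := by
          refine ⟨∑ e', (Γ.ev e' s0).natAbs, fun e' he' => ?_⟩
          have h1 : (Γ.ev e' s0).natAbs ≤ ∑ e', (Γ.ev e' s0).natAbs :=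
            Finset.single_le_sum (f := fun e' => (Γ.ev e' s0).natAbs)
              (fun _ _ => Nat.zero_le _) (Finset.mem_univ e')
          have h2 := hr1 e e' he'
          generalize (∑ e', (Γ.ev e' s0).natAbs) = T at *
          have h3 : (T : ℤ) ≤ T * Γ.ev e' (r0 e) := le_mul_of_one_le_right (by positivity) h2
          omega
        refine ⟨mon k (N' • rr e), ⟨_, by simp only [AddSubmonoidClass.coe_nsmul, rr, ev_nsmul, hr0, mul_zero], rfl⟩, ?_⟩
        rw [dvd_iff]
        intro g hg e'
        rw [co_emL_mul] at hg
        have h1 : (g : W → ℤ) - (N' • rr e : Γ.sig) ∈ Γ.sig := co_mem hg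
        have hg2 : r.coeff ⟨_, h1⟩ ≠ 0 := by rwa [← co_emL]
        have h2 := hval _ hg2
        have h3 := h1 e'
        simp only [AddSubmonoidClass.coe_nsmul, ev_nsmul, map_sub, rr] at h2 h3 ⊢
        by_cases he : e' = e
        · subst he; rw [hr0] at h2; linarith
        · have := hN' e' he; linarith)
    exact ⟨s, hs, c', hc'⟩
  have step2 : ∀ h : Γ.sig, (∀ e, (u e : ℤ) ≤ Γ.ev e h) → ∃ c, ψ c = mon k h := by
    intro h hh
    choose s hs c' hc' using step1 h hh
    obtain ⟨o, ho, c'', hc''⟩ := locTor d ⊥ (mon k s0) (hmon s0) (Set.range fun e => mon k (s e)) (mon k h • c0) (by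
      rintro _ ⟨e, rfl⟩
      exact ⟨_, hc' e⟩) (by
      intro r hr
      refine ⟨1, one_mem _, ?_⟩
      rw [one_mul, dvd_iff]
      intro g hg e
      obtain ⟨o, ho, hd⟩ := hr _ ⟨e, rfl⟩
      rw [Submonoid.mem_bot.1 ho, one_mul, dvd_iff] at hd
      have h4 := hd (s e + g) (by
            rw [co_emL_mul]
            simp only [AddSubmonoid.coe_add, add_sub_cancel_left]
            rwa [co_emL]) e
      rw [AddSubmonoid.coe_add, map_add, hs] at h4
      linarith)
    rw [Submonoid.mem_bot.1 ho, one_smul] at hc''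
    refine ⟨c'', ?_⟩
    have := congrArg ψ hc''
    simp only [map_smul, smul_eq_mul, hc0] at this
    rw [mul_comm] at this
    exact (mul_left_cancel₀ (Γ.mon_ne s0) this).symm
  -- conclusion
  let U : E → ℤ := fun e => u e
  have hsub : ∀ g, g ∈ (Γ.Breg U).carrier → g ∈ Γ.sig := fun g hg e => le_trans (by positivity) (hg e)
  have hsupp : ∀ c g, co (Γ.emL (ψ c)) g ≠ 0 → g ∈ (Γ.Breg U).carrier := by
    intro c g hg e
    have h1 : g ∈ Γ.sig := co_mem hg
    refine hul e c ⟨g, h1⟩ ?_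
    rwa [← co_emL]
  let θ0 : C →+ RM k (Γ.Breg U) :=
    { toFun := fun c => tr _ (co (Γ.emL (ψ c)))
      map_zero' := by simp
      map_add' := fun c c' => by simp }
  have hθ0 : ∀ c g, co (θ0 c) g = co (Γ.emL (ψ c)) g := by
    intro c g
    change co (tr _ (co (Γ.emL (ψ c)))) g = _
    rw [co_tr]
    split_ifs with h
    · rfl
    · by_contra hne
      exact h (hsupp c g (Ne.symm hne))
  let θ : C →ₗ[AddMonoidAlgebra k Γ.sig] RM k (Γ.Breg U) :=
    { θ0 with
      map_smul' := fun r c => by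
        refine alg_lin θ0 ?_ r c
        intro s a x
        apply co_ext
        intro g hg
        rw [hθ0, map_smul, map_smul, co_single_smul, co_single_smul, if_pos hg, if_pos (show g ∈ Γ.S0.carrier from hsub g hg), hθ0] }
  have hθ : ∀ c g, co (θ c) g = co (Γ.emL (ψ c)) g := hθ0
  refine ⟨U, ⟨LinearEquiv.ofBijective θ ⟨?_, ?_⟩⟩⟩
  · intro c c' hcc
    apply hψ
    ext s
    rw [← co_emL, ← co_emL, ← hθ, ← hθ, hcc]
  · intro f
    have hb : ∀ g ∈ (Γ.Breg U).carrier, ∃ c, θ c = bas (Γ.Breg U) g := by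
      intro g hg
      obtain ⟨c, hc⟩ := step2 ⟨g, hsub g hg⟩ hg
      refine ⟨c, ?_⟩
      apply co_ext
      intro g' hg'
      rw [hθ, hc, emL_single, one_smul, co_bas hg, co_bas (B := Γ.S0) (hsub g hg)]
    rw [sum_bas f]
    rw [← LinearMap.mem_range]
    apply Submodule.sum_mem
    intro g hg
    obtain ⟨c, hc⟩ := hb g (co_mem (Finsupp.mem_support_iff.1 hg))
    rw [← hc, ← one_smul (AddMonoidAlgebra k Γ.sig) (θ c), ← smul_assoc]
    exact Submodule.smul_mem _ _ ⟨c, rfl⟩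

end Gr
end SDP

set_option linter.unusedVariables false
set_option linter.unusedSectionVars false
set_option maxHeartbeats 1000000
set_option synthInstance.maxHeartbeats 1000000

namespace SDP
open scoped TensorProduct

/-- derivations into a module without first extensions are inner -/
theorem SD.ext_one {R C X : Type} [CommRing R] [AddCommGroup C] [Module R C] [AddCommGroup X] [Module R X]
    (d : SD R C) (hX : Ex (d.D 0) (d.D 1) X) (f : R →+ C →+ X)
    (hf : ∀ r r' c, f (r * r') c = r • f r' c + f r (r' • c)) :
    ∃ ψ : C → X, (∀ c c', ψ (c + c') = ψ c + ψ c') ∧ ∀ r c, ψ (r • c) = f r c + r • ψ c := by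
  have hdc : ∀ b, ∑ a, d.D 0 b a • d.c a = 0 := fun b => by
    have := congrFun d.dc b
    rwa [Mx_apply] at this
  obtain ⟨y, hy⟩ := hX (fun b => ∑ a, f (d.D 0 b a) (d.c a)) (by
    funext c
    rw [Mx_apply]
    have h1 : ∀ b a, d.D 1 c b • f (d.D 0 b a) (d.c a) =
        f (d.D 1 c b * d.D 0 b a) (d.c a) - f (d.D 1 c b) (d.D 0 b a • d.c a) := by
      intro b a; rw [hf]; abel
    simp only [Finset.smul_sum, h1, Finset.sum_sub_distrib]
    have h2 : ∀ b, ∑ a, f (d.D 1 c b) (d.D 0 b a • d.c a) = 0 := by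
      intro b; rw [← map_sum, hdc, map_zero]
    simp only [h2, Finset.sum_const_zero, sub_zero]
    rw [Finset.sum_comm]
    apply Finset.sum_eq_zero
    intro a _
    have h3 : ∑ b, d.D 1 c b * d.D 0 b a = 0 := by
      have := congrFun (congrFun (d.dd 0) c) a
      rwa [Matrix.mul_apply] at this
    rw [← AddMonoidHom.finsetSum_apply, ← map_sum, h3, map_zero]; rfl)
  choose v hv using d.gen
  let Φ : (Fin (d.n 0) → R) → X := fun v => ∑ a, (f (v a) (d.c a) - v a • y a)
  have hadd : ∀ v w, Φ (v + w) = Φ v + Φ w := by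
    intro v w
    simp only [Φ, ← Finset.sum_add_distrib]
    refine Finset.sum_congr rfl fun a _ => ?_
    rw [Pi.add_apply, map_add, AddMonoidHom.add_apply, add_smul]; abel
  have hwd0 : ∀ v, ∑ a, v a • d.c a = 0 → Φ v = 0 := by
    intro v h
    obtain ⟨w, rfl⟩ := d.ex0 v h
    simp only [Φ, Finset.sum_sub_distrib, Mx_apply, Matrix.transpose_apply, smul_eq_mul]
    rw [sub_eq_zero]
    have h1 : ∀ a, f (∑ b, d.D 0 b a * w b) (d.c a) = ∑ b, (w b • f (d.D 0 b a) (d.c a) + f (w b) (d.D 0 b a • d.c a)) := by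
      intro a
      rw [map_sum, AddMonoidHom.finsetSum_apply]
      refine Finset.sum_congr rfl fun b _ => ?_
      rw [mul_comm, hf]
    simp only [h1]
    rw [Finset.sum_comm]
    simp only [Finset.sum_add_distrib]
    have h2 : ∀ b, ∑ a, f (w b) (d.D 0 b a • d.c a) = 0 := by
      intro b; rw [← map_sum, hdc, map_zero]
    simp only [h2, Finset.sum_const_zero, add_zero, Finset.sum_smul]
    rw [Finset.sum_comm (γ := Fin (d.n 0))]
    refine Finset.sum_congr rfl fun b _ => ?_
    have h3 := congrFun hy b
    rw [Mx_apply] at h3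
    rw [← Finset.smul_sum, ← h3, Finset.smul_sum]
    refine Finset.sum_congr rfl fun a _ => ?_
    rw [smul_smul, mul_comm]
  have hwd : ∀ v w, ∑ a, v a • d.c a = ∑ a, w a • d.c a → Φ v = Φ w := by
    intro v w h
    have h1 := hwd0 (v - w) (by simp [sub_smul, h])
    have h2 := hadd (v - w) w
    rw [sub_add_cancel, h1, zero_add] at h2
    exact h2
  refine ⟨fun c => Φ (v c), fun c c' => ?_, fun r c => ?_⟩
  · rw [← hadd]
    apply hwd
    simp only [Pi.add_apply, add_smul, Finset.sum_add_distrib, ← hv]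
  · change Φ (v (r • c)) = _
    rw [hwd (v (r • c)) (r • v c) (by rw [← hv]; simp only [Pi.smul_apply, smul_assoc, ← Finset.smul_sum, ← hv])]
    have h3 : f r c = ∑ a, f r (v c a • d.c a) := by rw [← map_sum, ← hv]
    rw [h3]
    simp only [Φ, Finset.smul_sum, ← Finset.sum_add_distrib]
    refine Finset.sum_congr rfl fun a _ => ?_
    rw [Pi.smul_apply, smul_eq_mul, hf, smul_sub, smul_smul]; abel

namespace Gr
variable {W E : Type} (Γ : Gr W E) [Fintype W] [DecidableEq W] [Fintype E] {k : Type} [Field k]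

/-- lower regions -/
def Dreg (u : E → ℤ) : Reg Γ.sig :=
  ⟨{g | ∀ e, Γ.ev e g ≤ u e - 1}, fun g s s' hg hs hs' h e => by
    have h1 := h e; have := hs' e; rw [map_add] at h1; linarith⟩

theorem mem_Dreg {u : E → ℤ} {g : W → ℤ} : g ∈ (Γ.Dreg u).carrier ↔ ∀ e, Γ.ev e g ≤ u e - 1 := Iff.rfl

/-- scalars as monoid algebra elements -/
theorem k_smul {B : Reg Γ.sig} (a : k) (x : RM k B) :
    a • x = (AddMonoidAlgebra.single 0 a : AddMonoidAlgebra k Γ.sig) • x := by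
  classical
  apply co_ext
  intro g hg
  rw [co_single_smul, if_pos hg, map_smul]; simp

section maps
variable {u : E → ℤ}

/-- maps with prescribed monomial values -/
noncomputable def mp (B B' : Reg Γ.sig) (v : (W → ℤ) → RM k B')
    (hv : ∀ a ∈ B.carrier, ∀ s : Γ.sig, (a + s ∈ B.carrier → mon k s • v a = v (a + s)) ∧ (a + s ∉ B.carrier → mon k s • v a = 0)) :
    RM k B →ₗ[AddMonoidAlgebra k Γ.sig] RM k B' where
  toFun x := Finsupp.linearCombination k v (co x)
  map_add' x y := by rw [map_add, map_add]
  map_smul' r x := by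
    refine alg_lin ((Finsupp.linearCombination k v).comp (co (k := k) (B := B))).toAddMonoidHom ?_ r x
    intro s a x
    change Finsupp.linearCombination k v (co _) = _ • Finsupp.linearCombination k v (co x)
    have hs : (AddMonoidAlgebra.single s a : AddMonoidAlgebra k Γ.sig) = AddMonoidAlgebra.single 0 a * mon k s := by
      rw [mon, AddMonoidAlgebra.single_mul_single, zero_add, mul_one]
    rw [hs, mul_smul, mul_smul, ← k_smul, ← k_smul, map_smul, map_smul]
    congr 1
    conv_lhs => rw [sum_bas x]
    conv_rhs => rw [sum_bas x]
    simp only [Finset.smul_sum, map_sum]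
    refine Finset.sum_congr rfl fun g hg => ?_
    have hg := co_mem (Finsupp.mem_support_iff.1 hg)
    rw [smul_comm (mon k s) (co x g) (bas B g), mon_bas s hg, map_smul co, map_smul co, map_smul, map_smul,
      smul_comm (mon k s), co_bas hg, Finsupp.linearCombination_single, one_smul]
    congr 1
    by_cases h : g + s ∈ B.carrier
    · rw [co_bas h, Finsupp.linearCombination_single, one_smul, (hv g hg s).1 h]
    · rw [bas_out h, (hv g hg s).2 h]; simp

theorem mp_bas {B B' : Reg Γ.sig} (v : (W → ℤ) → RM k B') (hv) {a} (ha : a ∈ B.carrier) :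
    Γ.mp B B' v hv (bas B a) = v a := by
  change Finsupp.linearCombination k v (co _) = _
  rw [co_bas ha, Finsupp.linearCombination_single, one_smul]

theorem lin_ext {B B' : Reg Γ.sig} {φ φ' : RM k B →ₗ[AddMonoidAlgebra k Γ.sig] RM k B'}
    (h : ∀ a ∈ B.carrier, φ (bas B a) = φ' (bas B a)) : φ = φ' := by
  ext x
  rw [sum_bas x]
  simp only [map_sum]
  refine Finset.sum_congr rfl fun g hg => ?_
  have hg := co_mem (Finsupp.mem_support_iff.1 hg)
  rw [k_smul, map_smul, map_smul, h g hg]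

/-- translation by an exponent -/
noncomputable def shf (u : E → ℤ) (h : W → ℤ) :
    RM k (Γ.Breg u) →ₗ[AddMonoidAlgebra k Γ.sig] RM k (Γ.Dreg u) :=
  Γ.mp _ _ (fun c => bas _ (c + h)) (by
    intro a ha s
    have hs : a + s ∈ (Γ.Breg u).carrier := fun e => by
      have := ha e; have := s.2 e; rw [map_add]; linarith
    refine ⟨fun _ => ?_, fun h => absurd hs h⟩
    by_cases h1 : a + h ∈ (Γ.Dreg u).carrier
    · rw [mon_bas s h1, add_right_comm]
    · rw [bas_out h1, smul_zero, bas_out]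
      intro h2
      apply h1
      intro e
      have := h2 e; have := s.2 e
      simp only [map_add] at *; linarith)

theorem shf_bas (h : W → ℤ) {c} (hc : c ∈ (Γ.Breg u).carrier) :
    Γ.shf (k := k) u h (bas _ c) = bas _ (c + h) := Γ.mp_bas _ _ hc

theorem shf_out {h : W → ℤ} (hh : h ∉ Γ.Hreg.carrier) : Γ.shf (k := k) u h = 0 := by
  apply lin_ext
  intro c hc
  rw [shf_bas _ _ hc, bas_out]
  · rfl
  · intro h1
    apply hh
    rw [mem_Hreg]
    intro e
    have := h1 e; have := hc e
    rw [map_add] at *; linarith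

/-- multiplication pairing -/
noncomputable def bet (u : E → ℤ) : RM k Γ.Hreg →ₗ[AddMonoidAlgebra k Γ.sig]
    (RM k (Γ.Breg u) →ₗ[AddMonoidAlgebra k Γ.sig] RM k (Γ.Dreg u)) where
  toFun x := Finsupp.linearCombination k (Γ.shf (k := k) u) (co x)
  map_add' x y := by rw [map_add, map_add]
  map_smul' r x := by
    refine alg_lin ((Finsupp.linearCombination k (Γ.shf (k := k) u)).comp (co (k := k) (B := Γ.Hreg))).toAddMonoidHom ?_ r x
    intro s a x
    change Finsupp.linearCombination k _ (co _) = _ • Finsupp.linearCombination k _ (co x)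
    have hs : (AddMonoidAlgebra.single s a : AddMonoidAlgebra k Γ.sig) = AddMonoidAlgebra.single 0 a * mon k s := by
      rw [mon, AddMonoidAlgebra.single_mul_single, zero_add, mul_one]
    have hk : ∀ φ : RM k (Γ.Breg u) →ₗ[AddMonoidAlgebra k Γ.sig] RM k (Γ.Dreg u),
        (AddMonoidAlgebra.single 0 a : AddMonoidAlgebra k Γ.sig) • φ = a • φ := by
      intro φ; ext c; simp only [LinearMap.smul_apply, k_smul]
    rw [hs, mul_smul, mul_smul, ← k_smul, hk, map_smul, map_smul]
    congr 1
    conv_lhs => rw [sum_bas x]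
    conv_rhs => rw [sum_bas x]
    simp only [Finset.smul_sum, map_sum]
    refine Finset.sum_congr rfl fun g hg => ?_
    have hg := co_mem (Finsupp.mem_support_iff.1 hg)
    rw [smul_comm (mon k s) (co x g) (bas _ g), mon_bas s hg, map_smul co, map_smul co, map_smul, map_smul,
      smul_comm (mon k s), co_bas hg, Finsupp.linearCombination_single, one_smul]
    congr 1
    have h2 : mon k s • Γ.shf (k := k) u g = Γ.shf (k := k) u (g + s) := by
      apply lin_ext
      intro c hc
      have hs : c + s ∈ (Γ.Breg u).carrier := fun e => by
        have := hc e; have := s.2 e; rw [map_add]; linarith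
      rw [LinearMap.smul_apply, ← map_smul, mon_bas s hc, shf_bas _ _ hs, shf_bas _ _ hc]
      congr 1; abel
    rw [h2]
    by_cases h : g + s ∈ Γ.Hreg.carrier
    · rw [co_bas h, Finsupp.linearCombination_single, one_smul]
    · rw [bas_out h, shf_out _ h]; simp

theorem bet_bas {h : W → ℤ} (hh : h ∈ Γ.Hreg.carrier) : Γ.bet (k := k) u (bas _ h) = Γ.shf u h := by
  change Finsupp.linearCombination k _ (co _) = _
  rw [co_bas hh, Finsupp.linearCombination_single, one_smul]

end maps
end Gr
end SDP

set_option linter.unusedVariables false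
set_option linter.unusedSectionVars false
set_option maxHeartbeats 1000000
set_option synthInstance.maxHeartbeats 1000000

namespace SDP
open scoped TensorProduct

namespace Gr
variable {W E : Type} (Γ : Gr W E) [Fintype W] [DecidableEq W] [Fintype E] {k : Type} [Field k] {u : E → ℤ}

/-- basic tensors only depend on the sum of exponents -/
theorem tens_eq {h h' c c' : W → ℤ} (hh : h ∈ Γ.Hreg.carrier) (hh' : h' ∈ Γ.Hreg.carrier)
    (hc : c ∈ (Γ.Breg u).carrier) (hc' : c' ∈ (Γ.Breg u).carrier) (he : h + c = h' + c') :
    (bas Γ.Hreg h : RM k Γ.Hreg) ⊗ₜ[AddMonoidAlgebra k Γ.sig] (bas (Γ.Breg u) c : RM k (Γ.Breg u)) =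
      bas Γ.Hreg h' ⊗ₜ[AddMonoidAlgebra k Γ.sig] bas (Γ.Breg u) c' := by
  obtain ⟨q, hq, hq1⟩ := Γ.exists_interior
  obtain ⟨N, hN⟩ := Γ.exists_add_mem ⟨q, hq⟩ hq1 (c' - c)
  have h1 := hN N le_rfl
  have h2 : N • q ∈ Γ.sig := nsmul_mem hq N
  have key : ∀ (h c s : W → ℤ) (hs : s ∈ Γ.sig), h ∈ Γ.Hreg.carrier → c ∈ (Γ.Breg u).carrier →
     (bas Γ.Hreg h : RM k Γ.Hreg) ⊗ₜ[AddMonoidAlgebra k Γ.sig] (bas (Γ.Breg u) c : RM k (Γ.Breg u)) =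
      bas Γ.Hreg (h - s) ⊗ₜ[AddMonoidAlgebra k Γ.sig] bas (Γ.Breg u) (c + s) := by
    intro h c s hs hh hc
    have h3 : h - s ∈ Γ.Hreg.carrier := by
      rw [mem_Hreg] at *
      intro e
      have := hh e; have := hs e
      rw [map_sub]; linarith
    rw [← mon_bas ⟨s, hs⟩ hc, ← TensorProduct.smul_tmul, mon_bas _ h3]
    simp
  rw [key h c _ h1 hh hc, key h' c' _ h2 hh' hc']
  congr 2
  · simp only [] at *; rw [eq_sub_iff_add_eq.2 he]; abel
  · simp only []; abel

theorem exists_common (g : W → ℤ) (u : E → ℤ) : ∃ c, c ∈ (Γ.Breg u).carrier ∧ g - c ∈ Γ.Hreg.carrier := by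
  obtain ⟨q, hq, hq1⟩ := Γ.exists_interior
  refine ⟨(∑ e, ((u e).natAbs + (Γ.ev e g).natAbs + 1)) • q, ?_⟩
  have hl : ∀ e, (u e).natAbs + (Γ.ev e g).natAbs + 1 ≤ ∑ e, ((u e).natAbs + (Γ.ev e g).natAbs + 1) := fun e =>
    Finset.single_le_sum (f := fun e => (u e).natAbs + (Γ.ev e g).natAbs + 1) (fun _ _ => Nat.zero_le _) (Finset.mem_univ e)
  generalize (∑ e, ((u e).natAbs + (Γ.ev e g).natAbs + 1)) = N at hl
  have hN : ∀ e, (N : ℤ) ≤ N * Γ.ev e q := fun e => le_mul_of_one_le_right (by positivity) (hq1 e)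
  rw [mem_Hreg, mem_Breg]
  constructor
  · intro e
    have := hl e; have := hN e
    rw [ev_nsmul]; omega
  · intro e
    have := hl e; have := hN e
    rw [map_sub, ev_nsmul]; omega

theorem tens_zero (hfac : ∀ e, ∃ r, Γ.ev e r = 0 ∧ ∀ e', e' ≠ e → 0 < Γ.ev e' r)
    {h c : W → ℤ} (hh : h ∈ Γ.Hreg.carrier)
    (hc : c ∈ (Γ.Breg u).carrier) (he : h + c ∉ (Γ.Dreg u).carrier) :
    (bas Γ.Hreg h : RM k Γ.Hreg) ⊗ₜ[AddMonoidAlgebra k Γ.sig] (bas (Γ.Breg u) c : RM k (Γ.Breg u)) = 0 := by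
  rw [mem_Dreg] at he
  push Not at he
  obtain ⟨e, he⟩ := he
  obtain ⟨r, hr0, hr1⟩ := hfac e
  obtain ⟨x, hx, hx1⟩ := Γ.exists_unit e
  rw [map_add] at he
  have hrs : r ∈ Γ.sig := fun e' => by
    by_cases h : e' = e
    · subst h; exact hr0.ge
    · exact (hr1 e' h).le
  have hh0 := (Γ.mem_Hreg.1 hh)
  obtain ⟨a, ha⟩ : ∃ a : ℕ, Γ.ev e h = -a := ⟨(-Γ.ev e h).toNat, by have := hh0 e; omega⟩
  obtain ⟨N, hN⟩ : ∃ N : ℕ, ∀ e', e' ≠ e → a * Γ.ev e' x ≤ N * Γ.ev e' r := by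
    refine ⟨∑ e', (a * Γ.ev e' x).natAbs, fun e' he' => ?_⟩
    have h1 : (a * Γ.ev e' x).natAbs ≤ ∑ e', (a * Γ.ev e' x).natAbs :=
      Finset.single_le_sum (f := fun e' => (a * Γ.ev e' x).natAbs)
        (fun _ _ => Nat.zero_le _) (Finset.mem_univ e')
    have h2 := hr1 e' he'
    generalize (∑ e', (a * Γ.ev e' x).natAbs) = T at *
    have h3 : (T : ℤ) ≤ T * Γ.ev e' r := le_mul_of_one_le_right (by positivity) h2
    omega
  have hs : N • r ∈ Γ.sig := nsmul_mem hrs N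
  have hax : a • x ∈ Γ.sig := nsmul_mem hx a
  have h3 : h - N • r ∈ Γ.Hreg.carrier := by
    rw [mem_Hreg] at *
    intro e
    have := hh e; have := hs e
    rw [map_sub]; linarith
  have h4 : c + N • r - a • x ∈ (Γ.Breg u).carrier := by
    intro e'
    rw [map_sub, map_add, ev_nsmul, ev_nsmul]
    by_cases hee : e' = e
    · subst hee; rw [hr0, hx1]; linarith
    · have := hN e' hee; have := hc e'; linarith
  have h5 : h - N • r + a • x ∉ Γ.Hreg.carrier := by
    rw [mem_Hreg]
    intro h6
    have := h6 e
    rw [map_add, map_sub, ev_nsmul, ev_nsmul, hr0, hx1, ha] at this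
    linarith
  have h7 : h = (h - N • r) + ((⟨_, hs⟩ : Γ.sig) : W → ℤ) := by simp
  have h8 : (bas Γ.Hreg h : RM k Γ.Hreg) = mon k (⟨_, hs⟩ : Γ.sig) • bas Γ.Hreg (h - N • r) := by
    rw [mon_bas _ h3, ← h7]
  rw [h8, TensorProduct.smul_tmul, mon_bas _ hc]
  have h9 : c + ((⟨_, hs⟩ : Γ.sig) : W → ℤ) = (c + N • r - a • x) + ((⟨_, hax⟩ : Γ.sig) : W → ℤ) := by simp
  rw [h9, ← mon_bas _ h4, ← TensorProduct.smul_tmul, mon_bas _ h3, bas_out h5, TensorProduct.zero_tmul]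

theorem tens_equiv (hfac : ∀ e, ∃ r, Γ.ev e r = 0 ∧ ∀ e', e' ≠ e → 0 < Γ.ev e' r) :
    ∃ Φ : (RM k Γ.Hreg ⊗[AddMonoidAlgebra k Γ.sig] RM k (Γ.Breg u)) ≃ₗ[AddMonoidAlgebra k Γ.sig] RM k (Γ.Dreg u),
      ∀ h c, Φ (h ⊗ₜ c) = Γ.bet u h c := by
  choose cc hcc hcc' using fun g => Γ.exists_common g u
  let μ := TensorProduct.lift (Γ.bet (k := k) u)
  have hμ : ∀ {h c}, h ∈ Γ.Hreg.carrier → c ∈ (Γ.Breg u).carrier → μ (bas _ h ⊗ₜ bas _ c) = bas _ (h + c) := by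
    intro h c hh hc
    simp only [μ, TensorProduct.lift.tmul]
    rw [bet_bas _ hh, shf_bas _ _ hc, add_comm]
  let v : (W → ℤ) → (RM k Γ.Hreg ⊗[AddMonoidAlgebra k Γ.sig] RM k (Γ.Breg u)) :=
    fun g => bas _ (g - cc g) ⊗ₜ bas _ (cc g)
  let ν : RM k (Γ.Dreg u) →ₗ[k] (RM k Γ.Hreg ⊗[AddMonoidAlgebra k Γ.sig] RM k (Γ.Breg u)) :=
    (Finsupp.linearCombination k v).comp co
  have hν : ∀ {g}, g ∈ (Γ.Dreg u).carrier → ν (bas _ g) = v g := by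
    intro g hg
    simp only [ν, LinearMap.comp_apply]
    rw [co_bas hg, Finsupp.linearCombination_single, one_smul]
  have hkμ : ∀ (a : k) x, μ (a • x) = a • μ x := by
    intro a x
    rw [← one_smul (AddMonoidAlgebra k Γ.sig) x, ← smul_assoc, map_smul, one_smul, k_smul]
    congr 1
    rw [AddMonoidAlgebra.one_def, AddMonoidAlgebra.smul_single, smul_eq_mul, mul_one]
  have hνμ : ∀ x, ν (μ x) = x := by
    intro x
    induction x using TensorProduct.induction_on with
    | zero => simp
    | add x y hx hy => rw [map_add, map_add, hx, hy]
    | tmul h c =>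
      rw [sum_bas h, sum_bas c, TensorProduct.sum_tmul]
      simp only [TensorProduct.tmul_sum, map_sum]
      refine Finset.sum_congr rfl fun g hg => Finset.sum_congr rfl fun g' hg' => ?_
      have hg := co_mem (Finsupp.mem_support_iff.1 hg)
      have hg' := co_mem (Finsupp.mem_support_iff.1 hg')
      rw [← TensorProduct.smul_tmul', TensorProduct.tmul_smul, hkμ, hkμ, map_smul, map_smul, hμ hg hg']
      congr 2
      by_cases hd : g + g' ∈ (Γ.Dreg u).carrier
      · rw [hν hd]
        exact Γ.tens_eq (hcc' _) hg (hcc _) hg' (by abel)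
      · rw [bas_out hd, Γ.tens_zero hfac hg hg' hd, map_zero]
  refine ⟨LinearEquiv.ofBijective μ ⟨?_, ?_⟩, fun h c => TensorProduct.lift.tmul _ _⟩
  · exact Function.LeftInverse.injective hνμ
  · intro x
    rw [sum_bas x, ← LinearMap.mem_range]
    apply Submodule.sum_mem
    intro g hg
    have hg := co_mem (Finsupp.mem_support_iff.1 hg)
    rw [k_smul]
    apply Submodule.smul_mem
    exact ⟨v g, by simp only [v]; rw [hμ (hcc' _) (hcc _), sub_add_cancel]⟩

/-- box of exponents -/
def Qs (u : E → ℤ) (w : W → ℤ) : Set (W → ℤ) := {a | ∀ e, u e ≤ Γ.ev e a ∧ Γ.ev e a ≤ u e + Γ.ev e w - 1}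

/-- edgewise order -/
def Le (a b : W → ℤ) : Prop := ∀ e, Γ.ev e a ≤ Γ.ev e b

/-- the three vanishing properties of a box -/
structure Good (k : Type) [Field k] {M : Type} (le : M → M → Prop) (Q : Set M) : Prop where
  ne : Q.Nonempty
  conn : ∀ χ : M → k, (∀ a ∈ Q, ∀ b ∈ Q, le a b → χ a = χ b) → ∀ a ∈ Q, ∀ b ∈ Q, χ a = χ b
  cocy : ∀ φ : M → M → k, (∀ a ∈ Q, ∀ b ∈ Q, ∀ c ∈ Q, le a b → le b c → φ a c = φ a b + φ b c) →
    ∃ p : M → k, ∀ a ∈ Q, ∀ b ∈ Q, le a b → φ a b = p b - p a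

theorem good_box [IsNoetherianRing (AddMonoidAlgebra k Γ.sig)]
    (hfac : ∀ e, ∃ r, Γ.ev e r = 0 ∧ ∀ e', e' ≠ e → 0 < Γ.ev e' r)
    (d : SD (AddMonoidAlgebra k Γ.sig) (RM k (Γ.Breg u))) (w : W → ℤ) (hw : ∀ e, 1 ≤ Γ.ev e w) :
    Good k Γ.Le (Γ.Qs u w) := by
  classical
  have hA := Γ.AC_H k d
  obtain ⟨Φ, hΦ⟩ := Γ.tens_equiv (k := k) (u := u) hfac
  have hwH : -w ∈ Γ.Hreg.carrier := by
    rw [mem_Hreg]; intro e; have := hw e; rw [map_neg]; linarith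
  have hQB : ∀ a ∈ Γ.Qs u w, a ∈ (Γ.Breg u).carrier := fun a ha e => (ha e).1
  have hQD : ∀ a, a ∈ Γ.Qs u w → a - w ∈ (Γ.Dreg u).carrier := fun a ha e => by
    have := (ha e).2; rw [map_sub]; linarith
  have hDQ : ∀ a, a ∈ (Γ.Breg u).carrier → a - w ∈ (Γ.Dreg u).carrier → a ∈ Γ.Qs u w := fun a ha hd e => by
    have := ha e
    have := hd e; rw [map_sub] at this; constructor <;> linarith
  have hBs : ∀ a ∈ (Γ.Breg u).carrier, ∀ s : Γ.sig, a + s ∈ (Γ.Breg u).carrier := fun a ha s e => by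
    have := ha e; have := s.2 e; rw [map_add]; linarith
  have hDs : ∀ a, ∀ s : Γ.sig, a + s - w ∈ (Γ.Dreg u).carrier → a - w ∈ (Γ.Dreg u).carrier := fun a s h e => by
    have := h e; have := s.2 e; simp only [map_sub, map_add] at *; linarith
  have hmb : ∀ (s : Γ.sig) a, mon k s • bas (k := k) (Γ.Dreg u) (a - w) = bas (k := k) (Γ.Dreg u) (a + s - w) := by
    intro s a
    by_cases h : a - w ∈ (Γ.Dreg u).carrier
    · rw [mon_bas s h]; congr 1; abel
    · rw [bas_out h, bas_out (fun h' => h (hDs a s h')), smul_zero]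
  refine ⟨?_, ?_, ?_⟩
  · by_contra hne
    rw [Set.not_nonempty_iff_eq_empty] at hne
    have h0 : Γ.shf (k := k) u (-w) = 0 := by
      apply lin_ext
      intro c hc
      rw [shf_bas _ _ hc, bas_out]
      · rfl
      · intro h
        rw [← sub_eq_add_neg] at h
        have := hDQ c hc h
        rw [hne] at this
        exact this
    have h1 := hA.inj' (bas _ (-w)) (fun c => by
      apply Φ.injective
      rw [hΦ, bet_bas _ hwH, h0, map_zero]; rfl)
    have h2 := congrArg (fun x => co x (-w)) h1
    simp only [co_bas hwH] at h2
    simp at h2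
  · intro χ hχ
    let φ := Γ.mp (k := k) (Γ.Breg u) (Γ.Dreg u) (fun a => χ a • bas _ (a - w)) (by
      intro a ha s
      refine ⟨fun hs => ?_, fun hs => absurd (hBs a ha s) hs⟩
      rw [smul_comm, hmb]
      by_cases h : a + s - w ∈ (Γ.Dreg u).carrier
      · congr 1
        exact hχ a (hDQ a ha (hDs a s h)) _ (hDQ _ hs h) (fun e => by
          have := s.2 e; rw [map_add]; linarith)
      · rw [bas_out h]; simp)
    have hφ : ∀ a ∈ (Γ.Breg u).carrier, φ (bas _ a) = χ a • bas _ (a - w) := fun a ha => Γ.mp_bas _ _ ha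
    obtain ⟨x, hx⟩ := hA.hom (Φ.symm.toLinearMap.comp φ)
    have hx' : ∀ c, φ c = Γ.bet u x c := by
      intro c
      rw [← hΦ, ← hx]; simp
    have key : ∀ a ∈ Γ.Qs u w, χ a = co x (-w) := by
      intro a ha
      have h1 := hx' (bas _ a)
      rw [hφ a (hQB a ha), sum_bas x] at h1
      simp only [map_sum] at h1
      have h2 := congrArg (fun y => co y (a - w)) h1
      simp only [map_smul, co_bas (hQD a ha), LinearMap.sum_apply, map_sum, Finsupp.finsetSum_apply] at h2
      rw [Finsupp.smul_apply, Finsupp.single_eq_same, smul_eq_mul, mul_one] at h2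
      rw [h2]
      have h3 : ∀ g ∈ (co x).support, co (Γ.bet u (co x g • bas _ g) (bas (Γ.Breg u) a)) (a - w)
          = if g = -w then co x g else 0 := by
        intro g hg
        have hg := co_mem (Finsupp.mem_support_iff.1 hg)
        rw [k_smul, map_smul, LinearMap.smul_apply, ← k_smul, bet_bas _ hg, shf_bas _ _ (hQB a ha), map_smul,
          Finsupp.smul_apply, bas, co_tr, if_pos (hQD a ha), Finsupp.single_apply]
        have : a + g = a - w ↔ g = -w := by rw [sub_eq_add_neg]; exact add_right_inj a
        simp only [this]
        split_ifs <;> simp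
      rw [Finset.sum_congr rfl h3, Finset.sum_ite_eq']
      split_ifs with h
      · rfl
      · simpa [eq_comm] using h
    intro a ha b hb
    rw [key a ha, key b hb]
  · intro φ hφ
    let f0 : Γ.sig → RM k (Γ.Breg u) →ₗ[k] RM k (Γ.Dreg u) := fun s =>
      (Finsupp.linearCombination k (fun a => φ a (a + s) • bas (k := k) (Γ.Dreg u) (a + s - w))).comp co
    have hf0 : ∀ s a, a ∈ (Γ.Breg u).carrier → f0 s (bas _ a) = φ a (a + s) • bas (k := k) (Γ.Dreg u) (a + s - w) := by
      intro s a ha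
      simp only [f0, LinearMap.comp_apply]
      rw [co_bas ha, Finsupp.linearCombination_single, one_smul]
    let f : AddMonoidAlgebra k Γ.sig →+ RM k (Γ.Breg u) →+ RM k (Γ.Dreg u) :=
      { toFun := fun r => (Finsupp.linearCombination k f0 r.coeff).toAddMonoidHom
        map_zero' := by ext; simp
        map_add' := fun r r' => by ext; simp }
    have hf : ∀ s x c, f (AddMonoidAlgebra.single s x) c = x • f0 s c := by
      intro s x c
      change (Finsupp.linearCombination k f0 (AddMonoidAlgebra.single s x).coeff) c = _
      rw [AddMonoidAlgebra.coeff_single, Finsupp.linearCombination_single]; rfl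
    have hsm : ∀ (s : Γ.sig) (x : k) (B : Reg Γ.sig) (y : RM k B),
        (AddMonoidAlgebra.single s x : AddMonoidAlgebra k Γ.sig) • y = x • mon k s • y := by
      intro s x B y
      rw [k_smul, ← mul_smul, mon, AddMonoidAlgebra.single_mul_single, zero_add, mul_one]
    have key2 : ∀ (s t : Γ.sig) c, f0 (s + t) c = mon k s • f0 t c + f0 s (mon k t • c) := by
      intro s t c
      rw [sum_bas c]
      simp only [map_sum, Finset.smul_sum, ← Finset.sum_add_distrib]
      refine Finset.sum_congr rfl fun a ha => ?_
      have ha := co_mem (Finsupp.mem_support_iff.1 ha)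
      rw [map_smul, map_smul, smul_comm (mon k s), smul_comm (mon k t), map_smul, ← smul_add]
      congr 1
      have hat := hBs a ha t
      rw [mon_bas t ha, hf0 _ _ ha, hf0 _ _ ha, hf0 _ _ hat, smul_comm (mon k s), hmb, add_right_comm a (t : W → ℤ) s,
        add_assoc a (s : W → ℤ) t, ← add_smul]
      have e1 : ((s + t : Γ.sig) : W → ℤ) = (s : W → ℤ) + t := rfl
      rw [e1]
      by_cases hd : a + ((s : W → ℤ) + t) - w ∈ (Γ.Dreg u).carrier
      · congr 1
        have h1 : a + (t : W → ℤ) - w ∈ (Γ.Dreg u).carrier := by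
          apply hDs _ s
          rwa [add_right_comm, add_assoc]
        have h2 := hDs _ t h1
        have h3 : a + ((s : W → ℤ) + t) ∈ (Γ.Breg u).carrier := hBs a ha (s + t)
        exact hφ a (hDQ _ ha h2) _ (hDQ _ hat h1) _ (hDQ _ h3 hd)
          (fun e => by have := t.2 e; rw [map_add]; linarith)
          (fun e => by have := s.2 e; simp only [map_add]; linarith)
      · rw [bas_out hd, smul_zero, smul_zero]
    have hder : ∀ r r' c, f (r * r') c = r • f r' c + f r (r' • c) := by
      intro r r' c
      induction r using AddMonoidAlgebra.induction_linear with
      | zero => simp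
      | add r1 r2 h1 h2 =>
        rw [add_mul, map_add, AddMonoidHom.add_apply, h1, h2, add_smul, map_add, AddMonoidHom.add_apply]; abel
      | single s x =>
        induction r' using AddMonoidAlgebra.induction_linear with
        | zero => simp
        | add r1 r2 h1 h2 =>
          rw [mul_add, map_add, map_add, AddMonoidHom.add_apply, h1, h2, add_smul, map_add, AddMonoidHom.add_apply, smul_add]; abel
        | single t y =>
          rw [AddMonoidAlgebra.single_mul_single, hf, hf, hf, hsm s x, hsm t y, map_smul (f0 s), smul_comm (mon k s) y, key2, mul_smul,
            smul_add, smul_add]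
    obtain ⟨ψ, hψa, hψ⟩ := d.ext_one (Ex_equiv Φ (hA.h 0)) f hder
    refine ⟨fun a => co (ψ (bas _ a)) (a - w), fun a ha b hb hab => ?_⟩
    have hs : b - a ∈ Γ.sig := fun e => by have := hab e; rw [map_sub]; linarith
    have h1 := hψ (mon k (⟨_, hs⟩ : Γ.sig)) (bas _ a)
    rw [mon_bas _ (hQB a ha), hf, one_smul, hf0 _ _ (hQB a ha)] at h1
    have h2 : a + ((⟨_, hs⟩ : Γ.sig) : W → ℤ) = b := by simp
    rw [h2] at h1
    beta_reduce
    rw [h1]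
    simp only [map_add, map_smul, Finsupp.add_apply, Finsupp.smul_apply]
    rw [co_bas (hQD b hb), co_mon_smul, if_pos (hQD b hb)]
    have h3 : b - w - ((⟨_, hs⟩ : Γ.sig) : W → ℤ) = a - w := by simp only []; abel
    rw [h3]; simp

end Gr
end SDP

set_option linter.unusedVariables false
set_option linter.unusedSectionVars false
set_option maxHeartbeats 1000000
set_option synthInstance.maxHeartbeats 1000000

namespace SDP

section Test
variable (k : Type) [Field k] {M I M' I' : Type}

/-- boxes of an affine system -/
def Bx (F : I → Prop) (vg vk : I → M → ℤ) (ε : M) : Set M := {x | ∀ i, F i → 0 ≤ vg i x ∧ vg i x ≤ vk i ε}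

/-- the order on a system -/
def LeF (F : I → Prop) (vg : I → M → ℤ) (x y : M) : Prop := ∀ i, F i → vg i x ≤ vg i y

structure Tst (F : I → Prop) (vg vk : I → M → ℤ) (ε : M) : Prop where
  ne : (Bx F vg vk ε).Nonempty
  conn : ∀ χ : M → k, (∀ a ∈ Bx F vg vk ε, ∀ b ∈ Bx F vg vk ε, LeF F vg a b → χ a = χ b) →
    ∀ a ∈ Bx F vg vk ε, ∀ b ∈ Bx F vg vk ε, χ a = χ b
  cyc : ∀ φ : M → M → k, (∀ a ∈ Bx F vg vk ε, ∀ b ∈ Bx F vg vk ε, ∀ c ∈ Bx F vg vk ε,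
      LeF F vg a b → LeF F vg b c → φ a c = φ a b + φ b c) →
    ∀ a ∈ Bx F vg vk ε, ∀ b ∈ Bx F vg vk ε, ∀ c ∈ Bx F vg vk ε, ∀ d ∈ Bx F vg vk ε,
      LeF F vg a c → LeF F vg a d → LeF F vg b c → LeF F vg b d → φ a c + φ b d = φ a d + φ b c

/-- a system all of whose boxes pass the tests -/
def TG (F : I → Prop) (vg vk : I → M → ℤ) : Prop := ∀ ε, (∀ i, F i → 0 ≤ vk i ε) → Tst k F vg vk ε

variable {k}

theorem LeF.trans {F : I → Prop} {vg : I → M → ℤ} {x y z : M} (h : LeF F vg x y) (h' : LeF F vg y z) : LeF F vg x z :=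
  fun i hi => (h i hi).trans (h' i hi)

theorem LeF.refl {F : I → Prop} {vg : I → M → ℤ} (x : M) : LeF F vg x x := fun i hi => le_rfl

/-- cocycles are unchanged under equivalences, in the alternating sum over a four cycle -/
theorem cyc_equiv {F : I → Prop} {vg : I → M → ℤ} {Q : Set M} {φ : M → M → k}
    (hφ : ∀ a ∈ Q, ∀ b ∈ Q, ∀ c ∈ Q, LeF F vg a b → LeF F vg b c → φ a c = φ a b + φ b c)
    {a b c d a' b' c' d' : M} (ha : a ∈ Q) (hb : b ∈ Q) (hc : c ∈ Q) (hd : d ∈ Q)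
    (ha' : a' ∈ Q) (hb' : b' ∈ Q) (hc' : c' ∈ Q) (hd' : d' ∈ Q)
    (ea : LeF F vg a' a ∧ LeF F vg a a') (eb : LeF F vg b' b ∧ LeF F vg b b')
    (ec : LeF F vg c' c ∧ LeF F vg c c') (ed : LeF F vg d' d ∧ LeF F vg d d')
    (hac : LeF F vg a c) (had : LeF F vg a d) (hbc : LeF F vg b c) (hbd : LeF F vg b d)
    (h : φ a' c' + φ b' d' = φ a' d' + φ b' c') : φ a c + φ b d = φ a d + φ b c := by
  have key : ∀ x ∈ Q, ∀ x' ∈ Q, ∀ y ∈ Q, ∀ y' ∈ Q, LeF F vg x' x → LeF F vg x x' → LeF F vg y' y → LeF F vg y y' → LeF F vg x y →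
      φ x y = φ x x' + φ x' y' + φ y' y := by
    intro x hx x' hx' y hy y' hy' h1 h2 h3 h4 h5
    rw [hφ x hx x' hx' y hy h2 (h1.trans h5), hφ x' hx' y' hy' y hy ((h1.trans h5).trans h4) h3]; ring
  rw [key a ha a' ha' c hc c' hc' ea.1 ea.2 ec.1 ec.2 hac, key b hb b' hb' d hd d' hd' eb.1 eb.2 ed.1 ed.2 hbd,
    key a ha a' ha' d hd d' hd' ea.1 ea.2 ed.1 ed.2 had, key b hb b' hb' c hc c' hc' eb.1 eb.2 ec.1 ec.2 hbc]
  linear_combination h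

theorem TG.trans {F : I → Prop} {vg vk : I → M → ℤ} {F' : I' → Prop} {vg' vk' : I' → M' → ℤ} (h : TG k F vg vk)
    (H : ∀ ε', (∀ i, F' i → 0 ≤ vk' i ε') → ∃ ε, (∀ i, F i → 0 ≤ vk i ε) ∧ ∃ f : M' → M, ∃ g : M → M',
      (∀ x ∈ Bx F' vg' vk' ε', f x ∈ Bx F vg vk ε) ∧ (∀ x ∈ Bx F vg vk ε, g x ∈ Bx F' vg' vk' ε') ∧
      (∀ x ∈ Bx F' vg' vk' ε', ∀ y ∈ Bx F' vg' vk' ε', LeF F' vg' x y → LeF F vg (f x) (f y)) ∧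
      (∀ x ∈ Bx F vg vk ε, ∀ y ∈ Bx F vg vk ε, LeF F vg x y → LeF F' vg' (g x) (g y)) ∧
      (∀ x ∈ Bx F' vg' vk' ε', LeF F' vg' (g (f x)) x ∧ LeF F' vg' x (g (f x)))) : TG k F' vg' vk' := by
  intro ε' hε'
  obtain ⟨ε, hε, f, g, hf, hg, fm, gm, hgf⟩ := H ε' hε'
  obtain ⟨⟨x, hx⟩, conn, cyc⟩ := h ε hε
  refine ⟨⟨g x, hg x hx⟩, ?_, ?_⟩
  · intro χ hχ a ha b hb
    have h1 := conn (fun x => χ (g x)) (fun a ha b hb hab => hχ _ (hg _ ha) _ (hg _ hb) (gm _ ha _ hb hab))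
      (f a) (hf a ha) (f b) (hf b hb)
    rw [hχ _ (hg _ (hf _ ha)) _ ha (hgf a ha).1, hχ _ (hg _ (hf _ hb)) _ hb (hgf b hb).1] at h1
    exact h1
  · intro φ hφ a ha b hb c hc d hd hac had hbc hbd
    have h1 := cyc (fun x y => φ (g x) (g y)) (fun a ha b hb c hc hab hbc =>
      hφ _ (hg _ ha) _ (hg _ hb) _ (hg _ hc) (gm _ ha _ hb hab) (gm _ hb _ hc hbc))
      (f a) (hf a ha) (f b) (hf b hb) (f c) (hf c hc) (f d) (hf d hd)
      (fm _ ha _ hc hac) (fm _ ha _ hd had) (fm _ hb _ hc hbc) (fm _ hb _ hd hbd)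
    exact cyc_equiv hφ ha hb hc hd (hg _ (hf _ ha)) (hg _ (hf _ hb)) (hg _ (hf _ hc)) (hg _ (hf _ hd))
      (hgf a ha) (hgf b hb) (hgf c hc) (hgf d hd) hac had hbc hbd h1

/-- reflection -/
theorem TG.reflect [AddCommGroup M] {F : I → Prop} {vg vk vg' : I → M → ℤ} (h : TG k F vg vk)
    (H : ∀ i ε x, vg' i (ε - x) = vk i ε - vg i x) : TG k F vg' vk := by
  intro ε hε
  obtain ⟨⟨x, hx⟩, conn, cyc⟩ := h ε hε
  have H' : ∀ i x, vg i (ε - x) = vk i ε - vg' i x := by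
    intro i x
    have := H i ε (ε - x)
    rw [sub_sub_cancel] at this; linarith
  have h1 : ∀ x ∈ Bx F vg vk ε, ε - x ∈ Bx F vg' vk ε := fun x hx i hi => by
    have := hx i hi; rw [H]; constructor <;> linarith
  have h2 : ∀ x ∈ Bx F vg' vk ε, ε - x ∈ Bx F vg vk ε := fun x hx i hi => by
    have := hx i hi; rw [H']; constructor <;> linarith
  have h3 : ∀ x y, LeF F vg x y → LeF F vg' (ε - y) (ε - x) := fun x y h i hi => by
    have := h i hi; rw [H, H]; linarith
  have h4 : ∀ x y, LeF F vg' x y → LeF F vg (ε - y) (ε - x) := fun x y h i hi => by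
    have := h i hi; rw [H', H']; linarith
  refine ⟨⟨ε - x, h1 x hx⟩, ?_, ?_⟩
  · intro χ hχ a ha b hb
    have := conn (fun x => χ (ε - x)) (fun a ha b hb hab => (hχ _ (h1 _ hb) _ (h1 _ ha) (h3 _ _ hab)).symm)
      _ (h2 _ ha) _ (h2 _ hb)
    simpa using this
  · intro φ hφ a ha b hb c hc d hd hac had hbc hbd
    have := cyc (fun x y => φ (ε - y) (ε - x)) (fun a ha b hb c hc hab hbc => by
      rw [hφ _ (h1 _ hc) _ (h1 _ hb) _ (h1 _ ha) (h3 _ _ hbc) (h3 _ _ hab)]; ring)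
      _ (h2 _ hc) _ (h2 _ hd) _ (h2 _ ha) _ (h2 _ hb) (h4 _ _ hac) (h4 _ _ hbc) (h4 _ _ had) (h4 _ _ hbd)
    simp only [sub_sub_cancel] at this
    rw [this]; ring

/-- localization along a ray -/
theorem TG.loc [AddCommGroup M] {F : I → Prop} {vg vk : I → M → ℤ} (h : TG k F vg vk)
    (hfin : {i | F i}.Finite) (ρ : I → ℤ) (r : M) (hg : ∀ i x, vg i (x + r) = vg i x + ρ i)
    (hk : ∀ i x, vk i (x + r) = vk i x + ρ i) (F' : I → Prop) (hF : ∀ i, F i → F' i → ρ i = 0)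
    (hF' : ∀ i, F i → ¬ F' i → 0 < ρ i) : TG k (fun i => F i ∧ F' i) vg vk := by
  have hg' : ∀ i x (n : ℕ), vg i (x + n • r) = vg i x + n * ρ i := by
    intro i x n
    induction n with
    | zero => simp
    | succ n ih => rw [succ_nsmul, ← add_assoc, hg, ih]; push_cast; ring
  have hk' : ∀ i x (n : ℕ), vk i (x + n • r) = vk i x + n * ρ i := by
    intro i x n
    induction n with
    | zero => simp
    | succ n ih => rw [succ_nsmul, ← add_assoc, hk, ih]; push_cast; ring
  have hbig : ∀ z : I → ℤ, ∃ N : ℕ, ∀ n : ℕ, N ≤ n → ∀ i, F i → ¬ F' i → z i ≤ n * ρ i := by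
    intro z
    refine ⟨∑ i ∈ hfin.toFinset, (z i).natAbs, fun n hn i hi hi' => ?_⟩
    have h1 : (z i).natAbs ≤ ∑ i ∈ hfin.toFinset, (z i).natAbs :=
      Finset.single_le_sum (f := fun i => (z i).natAbs) (fun _ _ => Nat.zero_le _) (hfin.mem_toFinset.2 hi)
    have h2 := hF' i hi hi'
    have h3 : (n : ℤ) ≤ n * ρ i := le_mul_of_one_le_right (by positivity) h2
    omega
  have leq : ∀ x (n m : ℕ), LeF (fun i => F i ∧ F' i) vg (x + n • r) (x + m • r) := fun x n m i hi => by
    rw [hg', hg', hF i hi.1 hi.2]; simp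
  have leq0 : ∀ x (n : ℕ), LeF (fun i => F i ∧ F' i) vg (x + n • r) x ∧ LeF (fun i => F i ∧ F' i) vg x (x + n • r) := by
    intro x n
    have h1 := leq x n 0; have h2 := leq x 0 n
    rw [zero_smul, add_zero] at h1 h2
    exact ⟨h1, h2⟩
  intro ε hε
  have hBB : ∀ n : ℕ, ∀ x, x ∈ Bx F vg vk (ε + n • r) → x ∈ Bx (fun i => F i ∧ F' i) vg vk ε := by
    intro n x hx i hi
    have := hx i hi.1
    rw [hk', hF i hi.1 hi.2] at this
    simpa using this
  have hLL : ∀ x y, LeF F vg x y → LeF (fun i => F i ∧ F' i) vg x y := fun x y h i hi => h i hi.1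
  obtain ⟨N0, hN0⟩ := hbig (fun i => - vk i ε)
  have hpos : ∀ n, N0 ≤ n → ∀ i, F i → 0 ≤ vk i (ε + n • r) := by
    intro n hn i hi
    rw [hk']
    by_cases hi' : F' i
    · rw [hF i hi hi']; have := hε i ⟨hi, hi'⟩; linarith
    · have := hN0 n hn i hi hi'; linarith
  have hmem : ∀ x ∈ Bx (fun i => F i ∧ F' i) vg vk ε, ∃ N : ℕ, ∀ n : ℕ, N ≤ n → ∃ N' : ℕ, ∀ n' : ℕ, N' ≤ n' →
      x + n • r ∈ Bx F vg vk (ε + n' • r) := by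
    intro x hx
    obtain ⟨N, hN⟩ := hbig (fun i => - vg i x)
    refine ⟨N, fun n hn => ?_⟩
    obtain ⟨N', hN'⟩ := hbig (fun i => vg i x + n * ρ i - vk i ε)
    refine ⟨N', fun n' hn' i hi => ?_⟩
    rw [hg', hk']
    by_cases hi' : F' i
    · rw [hF i hi hi']; have := hx i ⟨hi, hi'⟩; simpa using this
    · have := hN n hn i hi hi'; have := hN' n' hn' i hi hi'; constructor <;> linarith
  refine ⟨?_, ?_, ?_⟩
  · obtain ⟨x, hx⟩ := (h _ (hpos N0 le_rfl)).ne
    exact ⟨x, hBB _ _ hx⟩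
  · intro χ hχ a ha b hb
    obtain ⟨n1, h1⟩ := hmem a ha
    obtain ⟨n2, h2⟩ := hmem b hb
    obtain ⟨m1, h1⟩ := h1 n1 le_rfl
    obtain ⟨m2, h2⟩ := h2 n2 le_rfl
    have := (h _ (hpos (N0 + m1 + m2) (by omega))).conn χ (fun a ha b hb hab =>
      hχ a (hBB _ _ ha) b (hBB _ _ hb) (hLL _ _ hab)) _ (h1 _ (by omega)) _ (h2 _ (by omega))
    rwa [hχ _ (hBB _ _ (h1 m1 le_rfl)) _ ha (leq0 _ _).1, hχ _ (hBB _ _ (h2 m2 le_rfl)) _ hb (leq0 _ _).1] at this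
  · intro φ hφ a ha b hb c hc d hd hac had hbc hbd
    obtain ⟨n1, h1⟩ := hmem a ha
    obtain ⟨n2, h2⟩ := hmem b hb
    obtain ⟨n3, h3⟩ := hmem c hc
    obtain ⟨n4, h4⟩ := hmem d hd
    obtain ⟨p1, hp1⟩ := hbig (fun i => vg i a + n1 * ρ i - vg i c)
    obtain ⟨p2, hp2⟩ := hbig (fun i => vg i a + n1 * ρ i - vg i d)
    obtain ⟨p3, hp3⟩ := hbig (fun i => vg i b + n2 * ρ i - vg i c)
    obtain ⟨p4, hp4⟩ := hbig (fun i => vg i b + n2 * ρ i - vg i d)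
    obtain ⟨m1, h1⟩ := h1 n1 le_rfl
    obtain ⟨m2, h2⟩ := h2 n2 le_rfl
    obtain ⟨m3, h3⟩ := h3 (n3 + p1 + p3) (by omega)
    obtain ⟨m4, h4⟩ := h4 (n4 + p2 + p4) (by omega)
    have hle : ∀ (x y : M) (n n' p : ℕ), LeF (fun i => F i ∧ F' i) vg x y →
        (∀ q : ℕ, p ≤ q → ∀ i, F i → ¬ F' i → vg i x + n * ρ i - vg i y ≤ q * ρ i) → p ≤ n' →
        LeF F vg (x + n • r) (y + n' • r) := by
      intro x y n n' p hxy hp hpn i hi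
      rw [hg', hg']
      by_cases hi' : F' i
      · rw [hF i hi hi']; have := hxy i ⟨hi, hi'⟩; simpa using this
      · have := hp n' hpn i hi hi'; linarith
    have := (h _ (hpos (N0 + m1 + m2 + m3 + m4) (by omega))).cyc φ (fun a ha b hb c hc hab hbc =>
      hφ a (hBB _ _ ha) b (hBB _ _ hb) c (hBB _ _ hc) (hLL _ _ hab) (hLL _ _ hbc))
      _ (h1 _ (by omega)) _ (h2 _ (by omega)) _ (h3 _ (by omega)) _ (h4 _ (by omega))
      (hle _ _ _ _ p1 hac hp1 (by omega)) (hle _ _ _ _ p2 had hp2 (by omega))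
      (hle _ _ _ _ p3 hbc hp3 (by omega)) (hle _ _ _ _ p4 hbd hp4 (by omega))
    exact cyc_equiv hφ ha hb hc hd (hBB _ _ (h1 _ le_rfl)) (hBB _ _ (h2 _ le_rfl)) (hBB _ _ (h3 _ le_rfl))
      (hBB _ _ (h4 _ le_rfl)) (leq0 _ _) (leq0 _ _) (leq0 _ _) (leq0 _ _) hac had hbc hbd this

/-- systems with the same boxes -/
theorem TG.same {F F' : I → Prop} {vg vk : I → M → ℤ} (h : TG k F vg vk)
    (h0 : ∀ ε, (∀ i, F' i → 0 ≤ vk i ε) → ∀ i, F i → 0 ≤ vk i ε)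
    (h1 : ∀ ε, (∀ i, F' i → 0 ≤ vk i ε) → ∀ x, x ∈ Bx F vg vk ε ↔ x ∈ Bx F' vg vk ε)
    (h2 : ∀ ε, (∀ i, F' i → 0 ≤ vk i ε) → ∀ x y, x ∈ Bx F vg vk ε → y ∈ Bx F vg vk ε → (LeF F vg x y ↔ LeF F' vg x y)) :
    TG k F' vg vk := by
  refine h.trans fun ε hε => ⟨ε, h0 ε hε, id, id, fun x hx => (h1 ε hε x).2 hx, fun x hx => (h1 ε hε x).1 hx,
    fun x hx y hy hxy => (h2 ε hε x y ((h1 ε hε x).2 hx) ((h1 ε hε y).2 hy)).2 hxy, fun x hx y hy hxy => (h2 ε hε x y hx hy).1 hxy,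
    fun x hx => ⟨LeF.refl _, LeF.refl _⟩⟩

end Test
end SDP

set_option linter.unusedVariables false
set_option linter.unusedSectionVars false
set_option maxHeartbeats 1000000
set_option synthInstance.maxHeartbeats 1000000

namespace SDP

/-- shapes of thick ladders: corners `(a,b)` below and `(c,d)` above, with sentinels -/
structure Sh where
  m : ℕ
  n : ℕ
  L : ℕ
  K : ℕ
  a : ℕ → ℕ
  b : ℕ → ℕ
  c : ℕ → ℕ
  d : ℕ → ℕ

structure Sh.Ok (S : Sh) : Prop where
  hL : 2 ≤ S.L
  hK : 2 ≤ S.K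
  am : ∀ s t, s < t → t ≤ S.L → S.a s < S.a t
  bm : ∀ s t, s < t → t ≤ S.L → S.b t < S.b s
  cm : ∀ s t, s < t → t ≤ S.K → S.c s < S.c t
  dm : ∀ s t, s < t → t ≤ S.K → S.d t < S.d s
  a0 : S.a 0 = 0
  b0 : S.b 0 + 1 = S.n
  aL : S.a S.L + 1 = S.m
  bL : S.b S.L = 0
  c0 : S.c 0 = 1
  d0 : S.d 0 = S.n
  cK : S.c S.K = S.m
  dK : S.d S.K = 1
  tha : ∀ t s, 0 < t → t < S.L → 0 < s → s < S.K → S.a t < S.c s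
  thb : ∀ t s, 0 < t → t < S.L → 0 < s → s < S.K → S.b t < S.d s
  thc : ∀ t s, 0 < t → t < S.L → 0 < s → s < S.K → ¬ (S.c s = S.a t + 1 ∧ S.d s = S.b t + 1)

/-- divisor classes -/
structure Cl where
  l : ℕ → ℤ
  u : ℕ → ℤ
  s : ℤ

structure Cl.Ok (γ : Cl) (S : Sh) : Prop where
  l0 : γ.l 0 = 0
  u0 : γ.u 0 = 0
  lL : γ.l S.L = γ.s
  uK : γ.u S.K = γ.s

inductive Ed where
  | row (i : ℕ)
  | col (j : ℕ)
  | lo (t : ℕ)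
  | up (s : ℕ)
  | z1
  | z1n
  | z2
  | z2n

/-- pairs of potentials -/
abbrev Pt : Type := (ℕ → ℤ) × (ℕ → ℤ)

namespace Sh
variable (S : Sh)

/-- edge values of a pair of potentials in a given class -/
def val (γ : Cl) : Ed → Pt → ℤ
  | .row i, p => p.1 (i + 1) - p.1 i
  | .col j, p => p.2 j - p.2 (j + 1)
  | .lo t, p => γ.l t - p.1 (S.a t) + p.2 (S.b t)
  | .up s, p => p.1 (S.c s) - p.2 (S.d s) - γ.u s
  | .z1, p => p.1 0 - p.2 S.n
  | .z1n, p => p.2 S.n - p.1 0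
  | .z2, p => p.1 S.m - p.2 0 - γ.s
  | .z2n, p => γ.s + p.2 0 - p.1 S.m

/-- the linear part of `val` -/
def lin : Ed → Pt → ℤ := S.val ⟨fun _ => 0, fun _ => 0, 0⟩

/-- the canonical class -/
def kap : Cl := ⟨fun t => S.n - 1 - S.a t - S.b t, fun s => S.n + 1 - S.c s - S.d s, S.n - S.m⟩

/-- the honest edges -/
def ok : Ed → Prop
  | .row i => i < S.m
  | .col j => j < S.n
  | .lo t => 0 < t ∧ t < S.L
  | .up s => 0 < s ∧ s < S.K
  | _ => True

/-- the edges with lower sentinels -/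
def okL : Ed → Prop
  | .row i => i + 1 < S.m
  | .col j => j + 1 < S.n
  | .lo t => t ≤ S.L
  | .up s => 0 < s ∧ s < S.K
  | _ => True

variable {S}

theorem val_add (γ : Cl) (e : Ed) (x r : Pt) : S.val γ e (x + r) = S.val γ e x + S.lin e r := by
  cases e <;> simp only [val, lin, Prod.fst_add, Prod.snd_add, Pi.add_apply] <;> ring

theorem Ok.kap_ok (h : S.Ok) : S.kap.Ok S := by
  have := h.a0; have := h.b0; have := h.aL; have := h.bL; have := h.c0; have := h.d0; have := h.cK; have := h.dK
  constructor <;> simp only [kap] <;> omega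

theorem Ok.kap_lt (h : S.Ok) {t s : ℕ} (h1 : 0 < t) (h2 : t < S.L) (h3 : 0 < s) (h4 : s < S.K) : S.kap.u s < S.kap.l t := by
  have := h.tha t s h1 h2 h3 h4; have := h.thb t s h1 h2 h3 h4; have := h.thc t s h1 h2 h3 h4
  simp only [kap]; omega

theorem okL_fin : {e | S.okL e}.Finite := by
  apply Set.Finite.subset (((((Set.finite_lt_nat S.m).image Ed.row).union ((Set.finite_lt_nat S.n).image Ed.col)).union
    (((Set.finite_le_nat S.L).image Ed.lo).union ((Set.finite_lt_nat S.K).image Ed.up))).union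
      (Set.toFinite {Ed.z1, Ed.z1n, Ed.z2, Ed.z2n}))
  intro e he
  cases e <;> simp [okL] at he ⊢ <;> omega

end Sh

variable (k : Type) [Field k]

/-- the test property of a class -/
def Sh.TS (S : Sh) (γ : Cl) : Prop := TG k S.ok (S.val γ) (S.val S.kap)

variable {k} {S : Sh} {γ : Cl}

theorem TS_low (hS : S.Ok) (hγ : γ.Ok S) (h : S.TS k γ) : TG k S.okL (S.val γ) (S.val S.kap) := by
  have h0 := hS.a0; have h1 := hS.b0; have h2 := hS.aL; have h3 := hS.bL; have h4 := hS.hL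
  have hm : 0 < S.m := by omega
  have hn : 0 < S.n := by omega
  have e0 : ∀ {γ : Cl} {p : Pt}, γ.Ok S → S.val γ .z1 p = 0 → S.val γ (.lo 0) p = S.val γ (.col (S.n - 1)) p := by
    intro γ p hγ hp
    simp only [Sh.val] at *
    rw [h0, hγ.l0, show S.n - 1 + 1 = S.n by omega, show S.b 0 = S.n - 1 by omega]; linarith
  have eL : ∀ {γ : Cl} {p : Pt}, γ.Ok S → S.val γ .z2 p = 0 → S.val γ (.lo S.L) p = S.val γ (.row (S.m - 1)) p := by
    intro γ p hγ hp
    simp only [Sh.val] at *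
    rw [h3, hγ.lL, show S.m - 1 + 1 = S.m by omega, show S.a S.L = S.m - 1 by omega]; linarith
  have z1 : ∀ {γ : Cl} {p : Pt}, S.val γ .z1n p = - S.val γ .z1 p := by intro γ p; simp only [Sh.val]; ring
  have z2 : ∀ {γ : Cl} {p : Pt}, S.val γ .z2n p = - S.val γ .z2 p := by intro γ p; simp only [Sh.val]; ring
  have tr1 : ∀ {P : Ed → Prop}, (P (.lo 0) → P (.col (S.n - 1))) → (P (.lo S.L) → P (.row (S.m - 1))) →
      (∀ i, S.okL i → P i) → ∀ i, S.ok i → P i := by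
    intro P hc hr hP i hi
    cases i with
    | row i =>
      by_cases h : i + 1 < S.m
      · exact hP _ h
      · have : i = S.m - 1 := by have : i < S.m := hi; omega
        subst this; exact hr (hP (.lo S.L) (le_refl S.L))
    | col j =>
      by_cases h : j + 1 < S.n
      · exact hP _ h
      · have : j = S.n - 1 := by have : j < S.n := hi; omega
        subst this; exact hc (hP (.lo 0) (Nat.zero_le _))
    | lo t => exact hP _ hi.2.le
    | up s => exact hP _ hi
    | z1 => exact hP _ trivial
    | z1n => exact hP _ trivial
    | z2 => exact hP _ trivial
    | z2n => exact hP _ trivial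
  have tr2 : ∀ {P : Ed → Prop}, (P (.col (S.n - 1)) → P (.lo 0)) → (P (.row (S.m - 1)) → P (.lo S.L)) →
      (∀ i, S.ok i → P i) → ∀ i, S.okL i → P i := by
    intro P hc hr hP i hi
    cases i with
    | row i => exact hP _ (lt_trans (Nat.lt_succ_self _) hi)
    | col i => exact hP _ (lt_trans (Nat.lt_succ_self _) hi)
    | lo t =>
      have ht : t ≤ S.L := hi
      by_cases h0 : t = 0
      · subst h0; exact hc (hP (.col _) (show S.n - 1 < S.n by omega))
      · by_cases hl : t = S.L
        · subst hl; exact hr (hP (.row _) (show S.m - 1 < S.m by omega))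
        · exact hP (.lo t) ⟨by omega, by omega⟩
    | up s => exact hP _ hi
    | z1 => exact hP _ trivial
    | z1n => exact hP _ trivial
    | z2 => exact hP _ trivial
    | z2n => exact hP _ trivial
  have zz : ∀ {ε : Pt}, (∀ i, S.okL i → 0 ≤ S.val S.kap i ε) → S.val S.kap .z1 ε = 0 ∧ S.val S.kap .z2 ε = 0 := by
    intro ε hε
    have a1 := hε .z1 trivial; have a2 := hε .z1n trivial; have a3 := hε .z2 trivial; have a4 := hε .z2n trivial
    rw [z1] at a2; rw [z2] at a4
    exact ⟨by linarith, by linarith⟩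
  have zx : ∀ {ε x : Pt}, (∀ i, S.okL i → 0 ≤ S.val S.kap i ε) → (x ∈ Bx S.ok (S.val γ) (S.val S.kap) ε ∨ x ∈ Bx S.okL (S.val γ) (S.val S.kap) ε)
      → S.val γ .z1 x = 0 ∧ S.val γ .z2 x = 0 := by
    intro ε x hε hx
    obtain ⟨q1, q2⟩ := zz hε
    have a1 : 0 ≤ S.val γ .z1 x ∧ S.val γ .z1 x ≤ S.val S.kap .z1 ε := by rcases hx with hx | hx <;> exact hx _ trivial
    have a2 : 0 ≤ S.val γ .z2 x ∧ S.val γ .z2 x ≤ S.val S.kap .z2 ε := by rcases hx with hx | hx <;> exact hx _ trivial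
    exact ⟨by linarith, by linarith⟩
  refine h.same ?_ ?_ ?_
  · intro ε hε
    obtain ⟨q1, q2⟩ := zz hε
    exact tr1 (by rw [e0 hS.kap_ok q1]; exact id) (by rw [eL hS.kap_ok q2]; exact id) hε
  · intro ε hε x
    obtain ⟨q1, q2⟩ := zz hε
    constructor
    · intro hx
      obtain ⟨p1, p2⟩ := zx hε (Or.inl hx)
      exact tr2 (P := fun i => 0 ≤ S.val γ i x ∧ S.val γ i x ≤ S.val S.kap i ε) (by rw [e0 hS.kap_ok q1, e0 hγ p1]; exact id)
        (by rw [eL hS.kap_ok q2, eL hγ p2]; exact id) hx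
    · intro hx
      obtain ⟨p1, p2⟩ := zx hε (Or.inr hx)
      exact tr1 (P := fun i => 0 ≤ S.val γ i x ∧ S.val γ i x ≤ S.val S.kap i ε) (by rw [e0 hS.kap_ok q1, e0 hγ p1]; exact id)
        (by rw [eL hS.kap_ok q2, eL hγ p2]; exact id) hx
  · intro ε hε x y hx hy
    obtain ⟨p1, p2⟩ := zx hε (Or.inl hx)
    obtain ⟨q1, q2⟩ := zx hε (Or.inl hy)
    constructor
    · exact fun h => tr2 (P := fun i => S.val γ i x ≤ S.val γ i y) (by rw [e0 hγ q1, e0 hγ p1]; exact id)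
        (by rw [eL hγ q2, eL hγ p2]; exact id) h
    · exact fun h => tr1 (P := fun i => S.val γ i x ≤ S.val γ i y) (by rw [e0 hγ q1, e0 hγ p1]; exact id)
        (by rw [eL hγ q2, eL hγ p2]; exact id) h

/-- reflected class -/
def Sh.rfl (S : Sh) (γ : Cl) : Cl := ⟨fun t => S.kap.l t - γ.l t, fun t => S.kap.u t - γ.u t, S.kap.s - γ.s⟩

theorem TS_rfl (h : S.TS k γ) : S.TS k (S.rfl γ) := by
  refine TG.reflect h fun i ε x => ?_
  cases i <;> simp only [Sh.val, Sh.rfl, Prod.fst_sub, Prod.snd_sub, Pi.sub_apply] <;> ring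

theorem rfl_ok (hS : S.Ok) (hγ : γ.Ok S) : (S.rfl γ).Ok S := by
  obtain ⟨h1, h2, h3, h4⟩ := hγ
  obtain ⟨g1, g2, g3, g4⟩ := hS.kap_ok
  constructor <;> simp only [Sh.rfl] <;> linarith

/-- swapped shape -/
def Sh.sw (S : Sh) : Sh where
  m := S.n
  n := S.m
  L := S.K
  K := S.L
  a t := S.n - S.d t
  b t := S.m - S.c t
  c t := S.n - S.b t
  d t := S.m - S.a t

def Cl.sw (γ : Cl) : Cl := ⟨fun t => - γ.u t, fun t => - γ.l t, - γ.s⟩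

theorem Sh.Ok.a_le (hS : S.Ok) {t : ℕ} (ht : t ≤ S.L) : S.a t < S.m := by
  have := hS.aL
  rcases ht.lt_or_eq with h | h
  · have := hS.am t S.L h le_rfl; omega
  · subst h; omega

theorem Sh.Ok.b_le (hS : S.Ok) {t : ℕ} (ht : t ≤ S.L) : S.b t < S.n := by
  have := hS.b0
  rcases Nat.eq_zero_or_pos t with h | h
  · subst h; omega
  · have := hS.bm 0 t h ht; omega

theorem Sh.Ok.c_le (hS : S.Ok) {t : ℕ} (ht : t ≤ S.K) : 1 ≤ S.c t ∧ S.c t ≤ S.m := by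
  have := hS.c0; have := hS.cK
  constructor
  · rcases Nat.eq_zero_or_pos t with h | h
    · subst h; omega
    · have := hS.cm 0 t h ht; omega
  · rcases ht.lt_or_eq with h | h
    · have := hS.cm t S.K h le_rfl; omega
    · subst h; omega

theorem Sh.Ok.d_le (hS : S.Ok) {t : ℕ} (ht : t ≤ S.K) : 1 ≤ S.d t ∧ S.d t ≤ S.n := by
  have := hS.d0; have := hS.dK
  constructor
  · rcases ht.lt_or_eq with h | h
    · have := hS.dm t S.K h le_rfl; omega
    · subst h; omega
  · rcases Nat.eq_zero_or_pos t with h | h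
    · subst h; omega
    · have := hS.dm 0 t h ht; omega

theorem sw_ok (hS : S.Ok) : S.sw.Ok := by
  have h1 := hS.a0; have h2 := hS.b0; have h3 := hS.aL; have h4 := hS.bL
  have h5 := hS.c0; have h6 := hS.d0; have h7 := hS.cK; have h8 := hS.dK
  constructor
  · exact hS.hK
  · exact hS.hL
  · intro s t hst ht
    have := hS.dm s t hst ht; have := hS.d_le (hst.le.trans ht); simp only [Sh.sw] at *; omega
  · intro s t hst ht
    have := hS.cm s t hst ht; have := hS.c_le ht; simp only [Sh.sw] at *; omega
  · intro s t hst ht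
    have := hS.bm s t hst ht; have := hS.b_le (hst.le.trans ht); simp only [Sh.sw] at *; omega
  · intro s t hst ht
    have := hS.am s t hst ht; have := hS.a_le ht; simp only [Sh.sw] at *; omega
  · simp only [Sh.sw]; omega
  · simp only [Sh.sw]; omega
  · simp only [Sh.sw]; omega
  · simp only [Sh.sw]; omega
  · simp only [Sh.sw]; omega
  · simp only [Sh.sw]; omega
  · simp only [Sh.sw]; omega
  · simp only [Sh.sw]; omega
  all_goals
    intro t s h1 h2 h3 h4
    have e1 := hS.tha s t h3 h4 h1 h2
    have e2 := hS.thb s t h3 h4 h1 h2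
    have e3 := hS.thc s t h3 h4 h1 h2
    have e4 := hS.a_le (t := s) h4.le
    have e5 := hS.b_le (t := s) h4.le
    have e6 := hS.c_le (t := t) (le_of_lt h2)
    have e7 := hS.d_le (t := t) (le_of_lt h2)
    simp only [Sh.sw]; omega

theorem sw_cl (hγ : γ.Ok S) : γ.sw.Ok S.sw := by
  obtain ⟨h1, h2, h3, h4⟩ := hγ
  constructor <;> simp only [Sh.sw, Cl.sw] <;> linarith

theorem TS_sw (hS : S.Ok) (h : S.TS k γ) : S.sw.TS k γ.sw := by
  let f : Pt → Pt := fun p => (fun i => p.2 (S.m - i), fun j => p.1 (S.n - j))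
  let g : Pt → Pt := fun p => (fun i => p.2 (S.n - i), fun j => p.1 (S.m - j))
  have hf : ∀ i, S.ok i → ∃ i', S.sw.ok i' ∧ (∀ x, S.val γ i (f x) = S.sw.val γ.sw i' x) ∧
      ∀ x, S.val S.kap i (f x) = S.sw.val S.sw.kap i' x := by
    intro i hi
    cases i with
    | row i =>
      have hi : i < S.m := hi
      refine ⟨.col (S.m - 1 - i), by simp only [Sh.ok, Sh.sw]; omega, fun x => ?_, fun x => ?_⟩ <;>
      · simp only [Sh.val, f]
        rw [show S.m - (i + 1) = S.m - 1 - i by omega, show S.m - i = S.m - 1 - i + 1 by omega]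
    | col i =>
      have hi : i < S.n := hi
      refine ⟨.row (S.n - 1 - i), by simp only [Sh.ok, Sh.sw]; omega, fun x => ?_, fun x => ?_⟩ <;>
      · simp only [Sh.val, f]
        rw [show S.n - (i + 1) = S.n - 1 - i by omega, show S.n - i = S.n - 1 - i + 1 by omega]
    | lo t =>
      refine ⟨.up t, hi, fun x => ?_, fun x => ?_⟩
      · simp only [Sh.val, f, Sh.sw, Cl.sw]; ring
      · have := hS.a_le hi.2.le; have := hS.b_le hi.2.le
        simp only [Sh.val, f, Sh.sw, Sh.kap]; push_cast [Nat.cast_sub this.le, Nat.cast_sub (hS.a_le hi.2.le).le]; ring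
    | up t =>
      refine ⟨.lo t, hi, fun x => ?_, fun x => ?_⟩
      · simp only [Sh.val, f, Sh.sw, Cl.sw]; ring
      · have := hS.c_le hi.2.le; have := hS.d_le hi.2.le
        simp only [Sh.val, f, Sh.sw, Sh.kap]; push_cast [Nat.cast_sub this.2, Nat.cast_sub (hS.c_le hi.2.le).2]; ring
    | z1 =>
      refine ⟨.z1n, trivial, fun x => ?_, fun x => ?_⟩ <;> simp [Sh.val, f, Sh.sw]
    | z1n =>
      refine ⟨.z1, trivial, fun x => ?_, fun x => ?_⟩ <;> simp [Sh.val, f, Sh.sw]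
    | z2 =>
      refine ⟨.z2n, trivial, fun x => ?_, fun x => ?_⟩ <;> simp [Sh.val, f, Sh.sw, Cl.sw, Sh.kap] <;> ring
    | z2n =>
      refine ⟨.z2, trivial, fun x => ?_, fun x => ?_⟩ <;> simp [Sh.val, f, Sh.sw, Cl.sw, Sh.kap] <;> ring
  have hg : ∀ i, S.sw.ok i → ∃ i', S.ok i' ∧ (∀ x, S.sw.val γ.sw i (g x) = S.val γ i' x) ∧
      ∀ x, S.sw.val S.sw.kap i (g x) = S.val S.kap i' x := by
    intro i hi
    cases i with
    | row i =>
      have hi : i < S.n := hi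
      refine ⟨.col (S.n - 1 - i), by simp only [Sh.ok]; omega, fun x => ?_, fun x => ?_⟩ <;>
      · simp only [Sh.val, g]
        rw [show S.n - (i + 1) = S.n - 1 - i by omega, show S.n - i = S.n - 1 - i + 1 by omega]
    | col i =>
      have hi : i < S.m := hi
      refine ⟨.row (S.m - 1 - i), by simp only [Sh.ok]; omega, fun x => ?_, fun x => ?_⟩ <;>
      · simp only [Sh.val, g]
        rw [show S.m - (i + 1) = S.m - 1 - i by omega, show S.m - i = S.m - 1 - i + 1 by omega]
    | lo t =>
      have hi' : 0 < t ∧ t < S.K := hi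
      have h1 := hS.c_le hi'.2.le; have h2 := hS.d_le hi'.2.le
      refine ⟨.up t, hi, fun x => ?_, fun x => ?_⟩
      · simp only [Sh.val, g, Sh.sw, Cl.sw, Nat.sub_sub_self h1.2, Nat.sub_sub_self h2.2]; ring
      · simp only [Sh.val, g, Sh.sw, Sh.kap, Nat.sub_sub_self h1.2, Nat.sub_sub_self h2.2]; push_cast [Nat.cast_sub h1.2, Nat.cast_sub h2.2]; ring
    | up t =>
      have hi' : 0 < t ∧ t < S.L := hi
      have h1 := (hS.a_le hi'.2.le).le; have h2 := (hS.b_le hi'.2.le).le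
      refine ⟨.lo t, hi, fun x => ?_, fun x => ?_⟩
      · simp only [Sh.val, g, Sh.sw, Cl.sw, Nat.sub_sub_self h1, Nat.sub_sub_self h2]; ring
      · simp only [Sh.val, g, Sh.sw, Sh.kap, Nat.sub_sub_self h1, Nat.sub_sub_self h2]; push_cast [Nat.cast_sub h1, Nat.cast_sub h2]; ring
    | z1 =>
      refine ⟨.z1n, trivial, fun x => ?_, fun x => ?_⟩ <;> simp [Sh.val, g, Sh.sw]
    | z1n =>
      refine ⟨.z1, trivial, fun x => ?_, fun x => ?_⟩ <;> simp [Sh.val, g, Sh.sw]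
    | z2 =>
      refine ⟨.z2n, trivial, fun x => ?_, fun x => ?_⟩ <;> simp [Sh.val, g, Sh.sw, Cl.sw, Sh.kap] <;> ring
    | z2n =>
      refine ⟨.z2, trivial, fun x => ?_, fun x => ?_⟩ <;> simp [Sh.val, g, Sh.sw, Cl.sw, Sh.kap] <;> ring
  have hgf : ∀ x, (∀ i ≤ S.n, (g (f x)).1 i = x.1 i) ∧ (∀ j ≤ S.m, (g (f x)).2 j = x.2 j) := fun x =>
    ⟨fun i hi => by simp [f, g, Nat.sub_sub_self hi], fun i hi => by simp [f, g, Nat.sub_sub_self hi]⟩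
  have hv : ∀ x i, S.sw.ok i → S.sw.val γ.sw i (g (f x)) = S.sw.val γ.sw i x := by
    intro x i hi
    obtain ⟨h1, h2⟩ := hgf x
    have : S.sw.m = S.n := rfl
    have : S.sw.n = S.m := rfl
    have hsw := sw_ok hS
    cases i with
    | row i =>
      have hi : i < S.n := hi
      simp only [Sh.val]
      rw [h1 _ hi, h1 _ hi.le]
    | col i =>
      have hi : i < S.m := hi
      simp only [Sh.val]
      rw [h2 _ hi, h2 _ hi.le]
    | lo t =>
      simp only [Sh.val]
      rw [h1 _ (hsw.a_le hi.2.le).le, h2 _ (hsw.b_le hi.2.le).le]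
    | up t =>
      simp only [Sh.val]
      rw [h1 _ (hsw.c_le hi.2.le).2, h2 _ (hsw.d_le hi.2.le).2]
    | _ => simp only [Sh.val]; rw [h1 _ (by omega), h2 _ (by omega)]
  refine TG.trans h fun ε hε => ⟨f ε, ?_, f, g, ?_, ?_, ?_, ?_, ?_⟩
  · intro i hi
    obtain ⟨i', hi', h1, h2⟩ := hf i hi
    rw [h2]; exact hε i' hi'
  · intro x hx i hi
    obtain ⟨i', hi', h1, h2⟩ := hf i hi
    rw [h2, h1]; exact hx i' hi'
  · intro x hx i hi
    obtain ⟨i', hi', h1, h2⟩ := hg i hi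
    obtain ⟨i'', hi'', h1', h2'⟩ := hf i' hi'
    have h3 := hx i' hi'
    rw [h1]
    refine ⟨h3.1, h3.2.trans ?_⟩
    rw [← h2]
    obtain ⟨q1, q2⟩ := hgf ε
    have hsw := sw_ok hS
    apply le_of_eq
    cases i with
    | row i =>
      have hi : i < S.n := hi
      simp only [Sh.val]
      rw [q1 _ hi, q1 _ hi.le]
    | col i =>
      have hi : i < S.m := hi
      simp only [Sh.val]
      rw [q2 _ hi, q2 _ hi.le]
    | lo t =>
      simp only [Sh.val]
      rw [q1 _ (hsw.a_le hi.2.le).le, q2 _ (hsw.b_le hi.2.le).le]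
    | up t =>
      simp only [Sh.val]
      rw [q1 _ (hsw.c_le hi.2.le).2, q2 _ (hsw.d_le hi.2.le).2]
    | _ =>
      have e1 : S.sw.m = S.n := rfl
      have e2 : S.sw.n = S.m := rfl
      simp only [Sh.val]; rw [q1 _ (by omega), q2 _ (by omega)]
  · intro x hx y hy hxy i hi
    obtain ⟨i', hi', h1, h2⟩ := hf i hi
    rw [h1, h1]; exact hxy i' hi'
  · intro x hx y hy hxy i hi
    obtain ⟨i', hi', h1, h2⟩ := hg i hi
    rw [h1, h1]; exact hxy i' hi'
  · intro x hx
    exact ⟨fun i hi => (hv x i hi).le, fun i hi => (hv x i hi).ge⟩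

end SDP

set_option linter.unusedVariables false
set_option linter.unusedSectionVars false
set_option maxHeartbeats 1000000
set_option synthInstance.maxHeartbeats 1000000

namespace SDP

section Red
variable {k : Type} [Field k] {M I M' I' : Type}

/-- reduction to fewer variables, the edges in `Z` being contracted -/
theorem TG.red {F : I → Prop} {vg vk : I → M → ℤ} {vg' vk' : I' → M' → ℤ} (h : TG k F vg vk) (Z : I → Prop)
    (f fk : M' → M) (g : M → M')
    (h1 : ∀ i, F i → Z i → ∀ x, vg i (f x) = 0 ∧ vk i (fk x) = 0)
    (h2 : ∀ i, F i → ¬ Z i → ∃ i', ∀ x, vg i (f x) = vg' i' x ∧ vk i (fk x) = vk' i' x)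
    (h3 : ∀ i', ∃ i, F i ∧ (∀ x, (∀ j, F j → Z j → vg j x = 0) → vg' i' (g x) = vg i x) ∧ ∀ x, vk i (fk x) = vk' i' x)
    (h4 : ∀ x, g (f x) = x) : TG k (fun _ => True) vg' vk' := by
  refine h.trans fun ε hε => ⟨fk ε, ?_, f, g, ?_, ?_, ?_, ?_, ?_⟩
  · intro i hi
    by_cases hz : Z i
    · rw [(h1 i hi hz ε).2]
    · obtain ⟨i', hi'⟩ := h2 i hi hz
      rw [(hi' ε).2]; exact hε i' trivial
  · intro x hx i hi
    by_cases hz : Z i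
    · rw [(h1 i hi hz ε).2, (h1 i hi hz x).1]; exact ⟨le_rfl, le_rfl⟩
    · obtain ⟨i', hi'⟩ := h2 i hi hz
      rw [(hi' ε).2, (hi' x).1]; exact hx i' trivial
  · intro x hx i' _
    obtain ⟨i, hi, e1, e2⟩ := h3 i'
    rw [e1, ← e2]
    · exact hx i hi
    · intro j hj hz
      have := hx j hj
      rw [(h1 j hj hz ε).2] at this
      omega
  · intro x hx y hy hxy i hi
    by_cases hz : Z i
    · rw [(h1 i hi hz x).1, (h1 i hi hz y).1]
    · obtain ⟨i', hi'⟩ := h2 i hi hz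
      rw [(hi' x).1, (hi' y).1]; exact hxy i' trivial
  · intro x hx y hy hxy i' _
    obtain ⟨i, hi, e1, e2⟩ := h3 i'
    have key : ∀ x ∈ Bx F vg vk (fk ε), ∀ j, F j → Z j → vg j x = 0 := by
      intro x hx j hj hz
      have := hx j hj
      rw [(h1 j hj hz ε).2] at this
      omega
    rw [e1 x (key x hx), e1 y (key y hy)]
    exact hxy i hi
  · intro x hx
    rw [h4]; exact ⟨LeF.refl _, LeF.refl _⟩

end Red

variable {k : Type} [Field k] {S : Sh} {γ : Cl}

/-- the edges of a block of faces -/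
def Sh.bl (S : Sh) (t1 t2 : ℕ) : Ed → Prop
  | .row i => S.a t1 ≤ i ∧ i < S.a t2
  | .col j => S.b t2 ≤ j ∧ j < S.b t1
  | .lo t => t1 ≤ t ∧ t ≤ t2
  | .up _ => False
  | _ => True

theorem bl_loc (hS : S.Ok) (hγ : γ.Ok S) (h : S.TS k γ) {t1 t2 : ℕ} (h12 : t1 < t2) (h2L : t2 ≤ S.L)
    (hne : ¬ (t1 = 0 ∧ t2 = S.L)) : TG k (fun e => S.okL e ∧ S.bl t1 t2 e) (S.val γ) (S.val S.kap) := by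
  have h0 := TS_low hS hγ h
  have am := hS.am t1 t2 h12 h2L
  have bm := hS.bm t1 t2 h12 h2L
  have ha2 := hS.a_le h2L
  have hb1 := hS.b_le (h12.le.trans h2L)
  obtain ⟨ρ, hρ⟩ : ∃ ρ : ℤ, ρ = if S.a t1 = 0 then 0 else S.m + S.n + 1 := ⟨_, rfl⟩
  obtain ⟨T, hT⟩ : ∃ T : ℤ, T = if S.b t2 = 0 then ρ else ρ + (S.m + S.n + 1) := ⟨_, rfl⟩
  let A : ℕ → ℤ := fun i => if i < S.a t1 then i else if i ≤ S.a t2 then ρ else if i < S.m then ρ + (i - S.a t2) else T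
  let B : ℕ → ℤ := fun j => if S.n ≤ j then 0 else if S.b t1 < j then ρ - (j - S.b t1) else if S.b t2 ≤ j then ρ else T - j
  have a00 := hS.a0; have bLL := hS.bL
  have at1 : t1 = 0 ↔ S.a t1 = 0 := by
    constructor
    · rintro rfl; exact hS.a0
    · intro h; by_contra hc
      have := hS.am 0 t1 (by omega) (by omega); omega
  have bt2 : t2 = S.L ↔ S.b t2 = 0 := by
    constructor
    · rintro rfl; exact hS.bL
    · intro h; by_contra hc
      have := hS.bm t2 S.L (by omega) (by omega); omega
  have key : ∀ e, S.okL e → (S.bl t1 t2 e → S.lin e (A, B) = 0) ∧ (¬ S.bl t1 t2 e → 0 < S.lin e (A, B)) := by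
    intro e he
    cases e with
    | row i =>
      have he : i + 1 < S.m := he
      simp only [Sh.bl, Sh.lin, Sh.val, A]
      constructor <;> intro hb <;> split_ifs at * <;> push_cast at * <;> omega
    | col j =>
      have he : j + 1 < S.n := he
      simp only [Sh.bl, Sh.lin, Sh.val, B]
      constructor <;> intro hb <;> split_ifs at * <;> push_cast at * <;> omega
    | lo t =>
      have he : t ≤ S.L := he
      have q1 := hS.a_le he
      have q2 := hS.b_le he
      have q3 : t < t1 → S.a t < S.a t1 ∧ S.b t1 < S.b t := fun hh => ⟨hS.am _ _ hh (by omega), hS.bm _ _ hh (by omega)⟩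
      have q4 : t2 < t → S.a t2 < S.a t ∧ S.b t < S.b t2 := fun hh => ⟨hS.am _ _ hh (by omega), hS.bm _ _ hh (by omega)⟩
      have q5 : t1 ≤ t → S.a t1 ≤ S.a t ∧ S.b t ≤ S.b t1 := fun hh => by
        rcases hh.eq_or_lt with rfl | hh
        · exact ⟨le_rfl, le_rfl⟩
        · exact ⟨(hS.am _ _ hh (by omega)).le, (hS.bm _ _ hh (by omega)).le⟩
      have q6 : t ≤ t2 → S.a t ≤ S.a t2 ∧ S.b t2 ≤ S.b t := fun hh => by
        rcases hh.eq_or_lt with rfl | hh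
        · exact ⟨le_rfl, le_rfl⟩
        · exact ⟨(hS.am _ _ hh (by omega)).le, (hS.bm _ _ hh (by omega)).le⟩
      simp only [Sh.bl, Sh.lin, Sh.val, A, B]
      constructor <;> intro hb <;> split_ifs at * <;> push_cast at * <;> omega
    | up s =>
      have he : 0 < s ∧ s < S.K := he
      have q1 := hS.c_le (t := s) (by omega)
      have q2 := hS.d_le (t := s) (by omega)
      have q3 := hS.cm s S.K he.2 le_rfl
      have q3' := hS.cK
      have q4 := hS.dm 0 s he.1 (by omega)
      have q4' := hS.d0
      have q5 : 0 < t1 → S.a t1 < S.c s ∧ S.b t1 < S.d s := fun hh => ⟨hS.tha _ _ hh (by omega) he.1 he.2, hS.thb _ _ hh (by omega) he.1 he.2⟩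
      have q6 : t2 < S.L → S.a t2 < S.c s ∧ S.b t2 < S.d s := fun hh => ⟨hS.tha _ _ (by omega) hh he.1 he.2, hS.thb _ _ (by omega) hh he.1 he.2⟩
      simp only [Sh.bl, Sh.lin, Sh.val, A, B]
      refine ⟨fun hb => hb.elim, fun _ => ?_⟩
      split_ifs at * <;> push_cast at * <;> omega
    | _ =>
      simp only [Sh.bl, Sh.lin, Sh.val, A, B]
      refine ⟨fun _ => ?_, fun hb => (hb trivial).elim⟩
      split_ifs at * <;> push_cast at * <;> omega
  exact h0.loc S.okL_fin (fun e => S.lin e (A, B)) (A, B) (fun e x => Sh.val_add _ _ _ _) (fun e x => Sh.val_add _ _ _ _) _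
    (fun e he hb => (key e he).1 hb) (fun e he hb => (key e he).2 hb)

theorem const_of_step {f : ℕ → ℤ} {p q : ℕ} (hpq : p ≤ q) (h : ∀ i, p ≤ i → i < q → f (i + 1) = f i) : f q = f p := by
  induction q, hpq using Nat.le_induction with
  | base => rfl
  | succ q hq ih => rw [h q hq (Nat.lt_succ_self _), ih fun i h1 h2 => h i h1 (by omega)]

end SDP

set_option linter.unusedVariables false
set_option linter.unusedSectionVars false
set_option maxHeartbeats 1000000
set_option synthInstance.maxHeartbeats 1000000

namespace SDP
variable {k : Type} [Field k] {S : Sh} {γ : Cl}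

/-- the reduced system of one face -/
def v1 (G : ℤ) (i : Fin 4) (x : ℤ × ℤ × ℤ) : ℤ := ![x.1, x.2.1, x.2.2, G - x.1 + x.2.1 + x.2.2] i

theorem v1_3 (G : ℤ) (x : ℤ × ℤ × ℤ) : v1 G 3 x = G - x.1 + x.2.1 + x.2.2 := rfl

theorem red1 (hS : S.Ok) (hγ : γ.Ok S) (h : S.TS k γ) {t : ℕ} (ht : t < S.L) :
    TG k (fun _ => True) (v1 (γ.l (t + 1) - γ.l t)) (v1 (S.kap.l (t + 1) - S.kap.l t)) := by
  have hL := hS.hL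
  have h0 := bl_loc hS hγ h (show t < t + 1 by omega) ht (by omega)
  have am := hS.am t (t + 1) (by omega) ht
  have bm := hS.bm t (t + 1) (by omega) ht
  have ha2 := hS.a_le (t := t + 1) ht
  have hb1 := hS.b_le (t := t) (by omega)
  let f : Cl → ℤ × ℤ × ℤ → Pt := fun γ x =>
    (fun i => if i = S.m then x.2.2 - γ.l t + (if S.b t = 0 then 0 else x.2.1) + γ.s else if i ≤ S.a t then 0 else x.1,
     fun j => if j = S.n then 0 else if S.b t ≤ j then x.2.2 - γ.l t else x.2.2 - γ.l t + x.2.1)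
  let Z : Ed → Prop := fun e => match e with
    | .row i => i ≠ S.a t
    | .col j => j + 1 ≠ S.b t
    | .lo _ => False
    | .up _ => False
    | _ => True
  have hZ : ∀ γ : Cl, ∀ e, S.okL e ∧ S.bl t (t + 1) e → Z e → ∀ x, S.val γ e (f γ x) = 0 := by
    intro γ e he hz x
    cases e with
    | row i =>
      have e1 : i + 1 < S.m := he.1
      obtain ⟨e2, e3⟩ : S.a t ≤ i ∧ i < S.a (t + 1) := he.2
      have e4 : i ≠ S.a t := hz
      simp only [Sh.val, f]; split_ifs <;> omega
    | col j =>
      have e1 : j + 1 < S.n := he.1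
      obtain ⟨e2, e3⟩ : S.b (t + 1) ≤ j ∧ j < S.b t := he.2
      have e4 : j + 1 ≠ S.b t := hz
      simp only [Sh.val, f]; split_ifs <;> omega
    | lo t => exact hz.elim
    | up s => exact hz.elim
    | _ => simp only [Sh.val, f]; split_ifs <;> omega
  have c0 : ∀ γ : Cl, ∀ x, S.val γ (.row (S.a t)) (f γ x) = x.1 := by
    intro γ x; simp only [Sh.val, f]; split_ifs <;> omega
  have c1 : ∀ γ : Cl, ∀ x, S.val γ (.col (S.b t - 1)) (f γ x) = x.2.1 := by
    intro γ x; simp only [Sh.val, f]; split_ifs <;> omega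
  have c2 : ∀ γ : Cl, ∀ x, S.val γ (.lo t) (f γ x) = x.2.2 := by
    intro γ x; simp only [Sh.val, f]; split_ifs <;> omega
  have c3 : ∀ γ : Cl, ∀ x, S.val γ (.lo (t + 1)) (f γ x) = γ.l (t + 1) - γ.l t - x.1 + x.2.1 + x.2.2 := by
    intro γ x; simp only [Sh.val, f]; split_ifs <;> omega
  refine h0.red Z (f γ) (f S.kap) (fun p => (S.val γ (.row (S.a t)) p, S.val γ (.col (S.b t - 1)) p, S.val γ (.lo t) p))
    (fun e he hz x => ⟨hZ _ e he hz x, hZ _ e he hz x⟩) ?_ ?_ ?_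
  · intro e he hz
    cases e with
    | row i =>
      have : i = S.a t := not_not.1 hz
      subst this; exact ⟨0, fun x => ⟨c0 _ x, c0 _ x⟩⟩
    | col j =>
      have : j = S.b t - 1 := by have : j + 1 = S.b t := not_not.1 hz
                                 omega
      subst this; exact ⟨1, fun x => ⟨c1 _ x, c1 _ x⟩⟩
    | lo t' =>
      obtain ⟨e1, e2⟩ : t ≤ t' ∧ t' ≤ t + 1 := he.2
      rcases (show t' = t ∨ t' = t + 1 by omega) with rfl | rfl
      · exact ⟨2, fun x => ⟨c2 _ x, c2 _ x⟩⟩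
      · exact ⟨3, fun x => ⟨c3 _ x, c3 _ x⟩⟩
    | up s => exact he.2.elim
    | _ => exact (hz trivial).elim
  · intro i
    fin_cases i
    · exact ⟨.row (S.a t), ⟨show S.a t + 1 < S.m by omega, le_refl (S.a t), am⟩, fun x _ => rfl, fun x => c0 _ x⟩
    · exact ⟨.col (S.b t - 1), ⟨show S.b t - 1 + 1 < S.n by omega, show _ ∧ _ by omega⟩, fun x _ => rfl, fun x => c1 _ x⟩
    · exact ⟨.lo t, ⟨ht.le, le_refl t, Nat.le_succ t⟩, fun x _ => rfl, fun x => c2 _ x⟩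
    · refine ⟨.lo (t + 1), ⟨ht, Nat.le_succ t, le_refl (t + 1)⟩, fun x hx => ?_, fun x => c3 _ x⟩
      have e1 : x.1 (S.a (t + 1)) = x.1 (S.a t + 1) := const_of_step (f := x.1) (by omega) fun i h1 h2 => by
        have := hx (.row i) ⟨show i + 1 < S.m by omega, show _ ∧ _ by omega⟩ (show i ≠ _ by omega)
        simp only [Sh.val] at this; linarith
      have e2 : x.2 (S.b t - 1) = x.2 (S.b (t + 1)) := const_of_step (f := x.2) (by omega) fun i h1 h2 => by
        have := hx (.col i) ⟨show i + 1 < S.n by omega, show _ ∧ _ by omega⟩ (show i + 1 ≠ _ by omega)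
        simp only [Sh.val] at this; linarith
      show v1 _ 3 _ = _
      rw [v1_3]
      simp only [Sh.val]
      rw [e1, ← e2, show S.b t - 1 + 1 = S.b t by omega]; ring
  · intro x
    show (_, _, _) = x
    rw [c0, c1, c2]

theorem Tst.two {M I : Type} {F : I → Prop} {vg vk : I → M → ℤ} {ε : M} (h : Tst k F vg vk ε) (P : M → Prop)
    (hP : ∀ a ∈ Bx F vg vk ε, ∀ b ∈ Bx F vg vk ε, LeF F vg a b → (P a ↔ P b)) (x y : M) (hx : x ∈ Bx F vg vk ε)
    (hy : y ∈ Bx F vg vk ε) (hPx : P x) : P y := by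
  classical
  have := h.conn (fun m => if P m then 1 else 0) (fun a ha b hb hab => by
    have := hP a ha b hb hab
    simp only [this]) x hx y hy
  by_contra hc
  simp [hPx, hc] at this

theorem face1 (hS : S.Ok) (hγ : γ.Ok S) (h : S.TS k γ) {t : ℕ} (ht : t < S.L) :
    γ.l (t + 1) - γ.l t = 0 ∨ γ.l (t + 1) - γ.l t = S.kap.l (t + 1) - S.kap.l t := by
  have h0 := red1 hS hγ h ht
  generalize γ.l (t + 1) - γ.l t = G at *
  generalize S.kap.l (t + 1) - S.kap.l t = κ at *
  rcases le_or_gt 0 κ with hk | hk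
  · obtain ⟨⟨x, hx⟩, -, -⟩ := h0 (κ, 0, 0) (by simp [Fin.forall_fin_succ, v1]; omega)
    simp [Bx, Fin.forall_fin_succ, v1] at hx
    by_contra hc
    have h1 := h0 (κ - 1, 0, 0) (by simp [Fin.forall_fin_succ, v1]; omega)
    have := h1.two (fun x => x.1 = G) (by
      simp only [Bx, LeF, Fin.forall_fin_succ, v1]; simp; omega)
      (G, 0, 0) (G - 1, 0, 0) (by simp [Bx, Fin.forall_fin_succ, v1]; omega) (by simp [Bx, Fin.forall_fin_succ, v1]; omega) rfl
    simp at this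
  · obtain ⟨⟨x, hx⟩, -, -⟩ := h0 (0, -κ, 0) (by simp [Fin.forall_fin_succ, v1]; omega)
    simp [Bx, Fin.forall_fin_succ, v1] at hx
    by_contra hc
    have h1 := h0 (0, -κ - 1, 1) (by simp [Fin.forall_fin_succ, v1]; omega)
    have := h1.two (fun x => x.2.1 = -G) (by
      simp only [Bx, LeF, Fin.forall_fin_succ, v1]; simp; omega)
      (0, -G, 0) (0, -G - 1, 1) (by simp [Bx, Fin.forall_fin_succ, v1]; omega) (by simp [Bx, Fin.forall_fin_succ, v1]; omega) rfl
    simp at this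

/-- the reduced system of two faces -/
def v2 (G1 G2 : ℤ) (i : Fin 7) (x : ℤ × ℤ × ℤ × ℤ × ℤ) : ℤ :=
  ![x.1, x.2.1, x.2.2.1, x.2.2.2.1, x.2.2.2.2, G1 - x.1 + x.2.1 + x.2.2.1,
    G1 - x.1 + x.2.1 + x.2.2.1 + G2 - x.2.2.2.1 + x.2.2.2.2] i

theorem v2_5 (G1 G2 : ℤ) (x : ℤ × ℤ × ℤ × ℤ × ℤ) : v2 G1 G2 5 x = G1 - x.1 + x.2.1 + x.2.2.1 := rfl
theorem v2_6 (G1 G2 : ℤ) (x : ℤ × ℤ × ℤ × ℤ × ℤ) : v2 G1 G2 6 x = G1 - x.1 + x.2.1 + x.2.2.1 + G2 - x.2.2.2.1 + x.2.2.2.2 := rfl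

theorem red2 (hS : S.Ok) (hγ : γ.Ok S) (h : S.TS k γ) {p q : ℕ} (hpq : p < q) (hq : q < S.L) (hne : ¬ (p = 0 ∧ q + 1 = S.L))
    (hc : ∀ t, p < t → t ≤ q → γ.l t = γ.l q ∧ S.kap.l t = S.kap.l q) :
    TG k (fun _ => True) (v2 (γ.l q - γ.l p) (γ.l (q + 1) - γ.l q)) (v2 (S.kap.l q - S.kap.l p) (S.kap.l (q + 1) - S.kap.l q)) := by
  have h0 := bl_loc hS hγ h (show p < q + 1 by omega) hq hne
  have am := hS.am p q hpq hq.le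
  have bm := hS.bm p q hpq hq.le
  have am' := hS.am q (q + 1) (by omega) hq
  have bm' := hS.bm q (q + 1) (by omega) hq
  have ha2 := hS.a_le (t := q + 1) hq
  have hb1 := hS.b_le (t := p) (by omega)
  have mid : ∀ t, p < t → t ≤ q → S.a p < S.a t ∧ S.a t ≤ S.a q ∧ S.b q ≤ S.b t ∧ S.b t < S.b p := by
    intro t h1 h2
    have e1 := hS.am p t h1 (by omega); have e2 := hS.bm p t h1 (by omega)
    rcases h2.eq_or_lt with rfl | h2
    · omega
    · have e1 := hS.am t q h2 (by omega); have e2 := hS.bm t q h2 (by omega)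
      omega
  let f : Cl → ℤ × ℤ × ℤ × ℤ × ℤ → Pt := fun γ x =>
    (fun i => if i = S.m then x.2.2.1 - γ.l p + x.2.1 + (if S.b q = 0 then 0 else x.2.2.2.2) + γ.s
        else if i ≤ S.a p then 0 else if i ≤ S.a q then x.1 else x.1 + x.2.2.2.1,
     fun j => if j = S.n then 0 else if S.b p ≤ j then x.2.2.1 - γ.l p else if S.b q ≤ j then x.2.2.1 - γ.l p + x.2.1
        else x.2.2.1 - γ.l p + x.2.1 + x.2.2.2.2)
  let Z : Ed → Prop := fun e => match e with
    | .row i => i ≠ S.a p ∧ i ≠ S.a q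
    | .col j => j + 1 ≠ S.b p ∧ j + 1 ≠ S.b q
    | .lo _ => False
    | .up _ => False
    | _ => True
  have hZ : ∀ γ : Cl, ∀ e, S.okL e ∧ S.bl p (q + 1) e → Z e → ∀ x, S.val γ e (f γ x) = 0 := by
    intro γ e he hz x
    cases e with
    | row i =>
      have e1 : i + 1 < S.m := he.1
      obtain ⟨e2, e3⟩ : S.a p ≤ i ∧ i < S.a (q + 1) := he.2
      obtain ⟨e4, e5⟩ : i ≠ S.a p ∧ i ≠ S.a q := hz
      simp only [Sh.val, f]; split_ifs <;> omega
    | col j =>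
      have e1 : j + 1 < S.n := he.1
      obtain ⟨e2, e3⟩ : S.b (q + 1) ≤ j ∧ j < S.b p := he.2
      obtain ⟨e4, e5⟩ : j + 1 ≠ S.b p ∧ j + 1 ≠ S.b q := hz
      simp only [Sh.val, f]; split_ifs <;> omega
    | lo t => exact hz.elim
    | up s => exact hz.elim
    | _ => simp only [Sh.val, f]; split_ifs <;> omega
  have c0 : ∀ γ : Cl, ∀ x, S.val γ (.row (S.a p)) (f γ x) = x.1 := by
    intro γ x; simp only [Sh.val, f]; split_ifs <;> omega
  have c1 : ∀ γ : Cl, ∀ x, S.val γ (.col (S.b p - 1)) (f γ x) = x.2.1 := by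
    intro γ x; simp only [Sh.val, f]; split_ifs <;> omega
  have c2 : ∀ γ : Cl, ∀ x, S.val γ (.lo p) (f γ x) = x.2.2.1 := by
    intro γ x; simp only [Sh.val, f]; split_ifs <;> omega
  have c3 : ∀ γ : Cl, ∀ x, S.val γ (.row (S.a q)) (f γ x) = x.2.2.2.1 := by
    intro γ x; simp only [Sh.val, f]; split_ifs <;> omega
  have c4 : ∀ γ : Cl, ∀ x, S.val γ (.col (S.b q - 1)) (f γ x) = x.2.2.2.2 := by
    intro γ x; simp only [Sh.val, f]; split_ifs <;> omega
  have c5 : ∀ γ : Cl, ∀ t, p < t → t ≤ q → γ.l t = γ.l q → ∀ x, S.val γ (.lo t) (f γ x) = γ.l q - γ.l p - x.1 + x.2.1 + x.2.2.1 := by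
    intro γ t h1 h2 h3 x
    have := mid t h1 h2
    simp only [Sh.val, f]; split_ifs <;> omega
  have c6 : ∀ γ : Cl, ∀ x, S.val γ (.lo (q + 1)) (f γ x) = γ.l q - γ.l p - x.1 + x.2.1 + x.2.2.1 + (γ.l (q + 1) - γ.l q)
      - x.2.2.2.1 + x.2.2.2.2 := by
    intro γ x; simp only [Sh.val, f]; split_ifs <;> omega
  have ev : ∀ x : Pt, (∀ j, S.okL j ∧ S.bl p (q + 1) j → Z j → S.val γ j x = 0) →
      x.1 (S.a q) = x.1 (S.a p + 1) ∧ x.2 (S.b p - 1) = x.2 (S.b q) ∧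
      x.1 (S.a (q + 1)) = x.1 (S.a q + 1) ∧ x.2 (S.b q - 1) = x.2 (S.b (q + 1)) := by
    intro x hx
    have er : ∀ i, S.a p < i → i < S.a (q + 1) → i ≠ S.a q → x.1 (i + 1) = x.1 i := fun i h1 h2 h3 => by
      have := hx (.row i) ⟨show i + 1 < S.m by omega, show _ ∧ _ by omega⟩ (show _ ∧ _ by omega)
      simp only [Sh.val] at this; linarith
    have ec : ∀ i, S.b (q + 1) ≤ i → i + 1 < S.b p → i + 1 ≠ S.b q → x.2 (i + 1) = x.2 i := fun i h1 h2 h3 => by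
      have := hx (.col i) ⟨show i + 1 < S.n by omega, show _ ∧ _ by omega⟩ (show _ ∧ _ by omega)
      simp only [Sh.val] at this; linarith
    refine ⟨const_of_step (f := x.1) (by omega) fun i h1 h2 => er i (by omega) (by omega) (by omega),
      const_of_step (f := x.2) (by omega) fun i h1 h2 => ec i (by omega) (by omega) (by omega),
      const_of_step (f := x.1) (by omega) fun i h1 h2 => er i (by omega) (by omega) (by omega),
      const_of_step (f := x.2) (by omega) fun i h1 h2 => ec i (by omega) (by omega) (by omega)⟩
  refine h0.red Z (f γ) (f S.kap) (fun x => (S.val γ (.row (S.a p)) x, S.val γ (.col (S.b p - 1)) x, S.val γ (.lo p) x,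
    S.val γ (.row (S.a q)) x, S.val γ (.col (S.b q - 1)) x))
    (fun e he hz x => ⟨hZ _ e he hz x, hZ _ e he hz x⟩) ?_ ?_ ?_
  · intro e he hz
    cases e with
    | row i =>
      have : i = S.a p ∨ i = S.a q := by have : ¬ (_ ∧ _) := hz
                                         omega
      rcases this with rfl | rfl
      · exact ⟨0, fun x => ⟨c0 _ x, c0 _ x⟩⟩
      · exact ⟨3, fun x => ⟨c3 _ x, c3 _ x⟩⟩
    | col j =>
      have : j = S.b p - 1 ∨ j = S.b q - 1 := by have : ¬ (_ ∧ _) := hz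
                                                 omega
      rcases this with rfl | rfl
      · exact ⟨1, fun x => ⟨c1 _ x, c1 _ x⟩⟩
      · exact ⟨4, fun x => ⟨c4 _ x, c4 _ x⟩⟩
    | lo t' =>
      obtain ⟨e1, e2⟩ : p ≤ t' ∧ t' ≤ q + 1 := he.2
      rcases (show t' = p ∨ t' = q + 1 ∨ (p < t' ∧ t' ≤ q) by omega) with rfl | rfl | ⟨e3, e4⟩
      · exact ⟨2, fun x => ⟨c2 _ x, c2 _ x⟩⟩
      · exact ⟨6, fun x => ⟨c6 _ x, c6 _ x⟩⟩
      · exact ⟨5, fun x => ⟨c5 _ t' e3 e4 (hc _ e3 e4).1 x, c5 _ t' e3 e4 (hc _ e3 e4).2 x⟩⟩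
    | up s => exact he.2.elim
    | _ => exact (hz trivial).elim
  · intro i
    fin_cases i
    · exact ⟨.row (S.a p), ⟨show S.a p + 1 < S.m by omega, show _ ∧ _ by omega⟩, fun x _ => rfl, fun x => c0 _ x⟩
    · exact ⟨.col (S.b p - 1), ⟨show S.b p - 1 + 1 < S.n by omega, show _ ∧ _ by omega⟩, fun x _ => rfl, fun x => c1 _ x⟩
    · exact ⟨.lo p, ⟨show p ≤ S.L by omega, show _ ∧ _ by omega⟩, fun x _ => rfl, fun x => c2 _ x⟩
    · exact ⟨.row (S.a q), ⟨show S.a q + 1 < S.m by omega, show _ ∧ _ by omega⟩, fun x _ => rfl, fun x => c3 _ x⟩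
    · exact ⟨.col (S.b q - 1), ⟨show S.b q - 1 + 1 < S.n by omega, show _ ∧ _ by omega⟩, fun x _ => rfl, fun x => c4 _ x⟩
    · refine ⟨.lo q, ⟨show q ≤ S.L by omega, show _ ∧ _ by omega⟩, fun x hx => ?_, fun x => c5 _ q hpq le_rfl rfl x⟩
      obtain ⟨e1, e2, -, -⟩ := ev x hx
      show v2 _ _ 5 _ = _
      rw [v2_5]
      simp only [Sh.val]
      rw [e1, ← e2, show S.b p - 1 + 1 = S.b p by omega]; ring
    · refine ⟨.lo (q + 1), ⟨show q + 1 ≤ S.L by omega, show _ ∧ _ by omega⟩, fun x hx => ?_, fun x => c6 _ x⟩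
      obtain ⟨e1, e2, e3, e4⟩ := ev x hx
      show v2 _ _ 6 _ = _
      rw [v2_6]
      simp only [Sh.val]
      rw [e1, e2, e3, ← e4, show S.b p - 1 + 1 = S.b p by omega, show S.b q - 1 + 1 = S.b q by omega]; ring
  · intro x
    show (_, _, _, _, _) = x
    rw [c0, c1, c2, c3, c4]

/-- neighbouring faces cannot be coloured (canonical, zero) -/
theorem test2a {κ1 κ2 : ℤ} (n1 : κ1 ≠ 0) (n2 : κ2 ≠ 0) (h : TG k (fun _ => True) (v2 κ1 0) (v2 κ1 κ2)) : κ1 < 0 ∧ κ2 < 0 := by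
  rcases lt_or_gt_of_ne n1 with s1 | s1 <;> rcases lt_or_gt_of_ne n2 with s2 | s2
  · exact ⟨s1, s2⟩
  · exfalso
    have h1 := h (0, -κ1, 1, κ2, 0) (by simp [Fin.forall_fin_succ, v2]; omega)
    have := h1.cyc (fun a b => if (a.2.1 = -κ1 ∧ a.2.2.1 = 0) ∧ (b.2.1 = -κ1 ∧ b.2.2.1 = 1 ∧ b.2.2.2.1 = 1) then 1 else 0) (by
      rintro ⟨a1, a2, a3, a4, a5⟩ ha ⟨b1, b2, b3, b4, b5⟩ hb ⟨c1, c2, c3, c4, c5⟩ hc hab hbc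
      simp [Bx, LeF, Fin.forall_fin_succ, v2] at *
      split_ifs <;> first | (exfalso; omega) | simp)
      (0, -κ1, 0, 0, 0) (by simp [Bx, Fin.forall_fin_succ, v2]; omega)
      (0, -κ1 - 1, 1, 0, 0) (by simp [Bx, Fin.forall_fin_succ, v2]; omega)
      (0, -κ1, 1, 1, 0) (by simp [Bx, Fin.forall_fin_succ, v2]; omega)
      (0, -κ1, 1, 0, 0) (by simp [Bx, Fin.forall_fin_succ, v2]; omega)
      (by simp [LeF, Fin.forall_fin_succ, v2]) (by simp [LeF, Fin.forall_fin_succ, v2])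
      (by simp [LeF, Fin.forall_fin_succ, v2]; omega) (by simp [LeF, Fin.forall_fin_succ, v2]; omega)
    simp at this
  · exfalso
    obtain ⟨⟨x, hx⟩, -, -⟩ := h (κ1 - 1, 0, 0, 0, -κ2 - 1) (by simp [Fin.forall_fin_succ, v2]; omega)
    simp [Bx, Fin.forall_fin_succ, v2] at hx
    omega
  · exfalso
    have h1 := h (κ1 - 1, 0, 0, κ2, 0) (by simp [Fin.forall_fin_succ, v2]; omega)
    have := h1.two (fun x => x.2.2.2.1 = 0) (by
      simp only [Bx, LeF, Fin.forall_fin_succ, v2]; simp; omega)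
      (κ1 - 1, 0, 0, 0, 0) (κ1 - 1, 0, 0, 1, 0) (by simp [Bx, Fin.forall_fin_succ, v2]; omega)
      (by simp [Bx, Fin.forall_fin_succ, v2]; omega) rfl
    simp at this

/-- neighbouring faces cannot be coloured (zero, canonical), negative case -/
theorem test2b {κ1 κ2 : ℤ} (s1 : κ1 < 0) (s2 : κ2 < 0) (h : TG k (fun _ => True) (v2 0 κ2) (v2 κ1 κ2)) : False := by
  have h1 := h (0, -κ1, 1, 0, -κ2 - 1) (by simp [Fin.forall_fin_succ, v2]; omega)
  have := h1.two (fun x => x.2.1 = 0) (by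
    simp only [Bx, LeF, Fin.forall_fin_succ, v2]; simp; omega)
    (0, 0, 1, 0, -κ2 - 1) (0, 1, 0, 0, -κ2 - 1) (by simp [Bx, Fin.forall_fin_succ, v2]; omega)
    (by simp [Bx, Fin.forall_fin_succ, v2]; omega) rfl
  simp at this

theorem face2 (hS : S.Ok) (hγ : γ.Ok S) (h : S.TS k γ) {p q : ℕ} (hpq : p < q) (hq : q < S.L) (hne : ¬ (p = 0 ∧ q + 1 = S.L))
    (hc : ∀ t, p < t → t ≤ q → γ.l t = γ.l q ∧ S.kap.l t = S.kap.l q) (n1 : S.kap.l q - S.kap.l p ≠ 0)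
    (n2 : S.kap.l (q + 1) - S.kap.l q ≠ 0) : γ.l q - γ.l p = 0 ↔ γ.l (q + 1) - γ.l q = 0 := by
  have f1 := face1 hS hγ h (show p < S.L by omega)
  have f2 := face1 hS hγ h hq
  rw [(hc (p + 1) (by omega) hpq).1, (hc (p + 1) (by omega) hpq).2] at f1
  have r1 := red2 hS hγ h hpq hq hne hc
  have r2 := red2 hS (rfl_ok hS hγ) (TS_rfl h) hpq hq hne (fun t h1 h2 => by
    obtain ⟨e1, e2⟩ := hc t h1 h2
    simp only [Sh.rfl, e1, e2, and_self])
  simp only [Sh.rfl] at r2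
  have e1 : S.kap.l q - γ.l q - (S.kap.l p - γ.l p) = S.kap.l q - S.kap.l p - (γ.l q - γ.l p) := by ring
  have e2 : S.kap.l (q + 1) - γ.l (q + 1) - (S.kap.l q - γ.l q) = S.kap.l (q + 1) - S.kap.l q - (γ.l (q + 1) - γ.l q) := by ring
  rw [e1, e2] at r2
  generalize γ.l (q + 1) - γ.l q = G2 at *
  generalize γ.l q - γ.l p = G1 at *
  generalize S.kap.l (q + 1) - S.kap.l q = κ2 at *
  generalize S.kap.l q - S.kap.l p = κ1 at *
  rcases f1 with rfl | rfl <;> rcases f2 with rfl | rfl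
  · simp
  · simp only [sub_zero, sub_self] at r2
    obtain ⟨s1, s2⟩ := test2a n1 n2 r2
    exact (test2b s1 s2 r1).elim
  · simp only [sub_zero, sub_self] at r2
    obtain ⟨s1, s2⟩ := test2a n1 n2 r1
    exact (test2b s1 s2 r2).elim
  · simp [n1, n2]

/-- the edges between a lower corner and the last upper corner -/
def Sh.bx (S : Sh) (t : ℕ) : Ed → Prop
  | .row i => S.a t ≤ i
  | .col j => j < S.d (S.K - 1)
  | .lo t' => t ≤ t'
  | .up s => s = S.K - 1
  | _ => True

theorem ok_fin : {e | S.ok e}.Finite := by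
  apply Set.Finite.subset (((((Set.finite_lt_nat S.m).image Ed.row).union ((Set.finite_lt_nat S.n).image Ed.col)).union
    (((Set.finite_le_nat S.L).image Ed.lo).union ((Set.finite_lt_nat S.K).image Ed.up))).union
      (Set.toFinite {Ed.z1, Ed.z1n, Ed.z2, Ed.z2n}))
  intro e he
  cases e <;> simp [Sh.ok] at he ⊢ <;> omega

theorem bx_loc (hS : S.Ok) (h : S.TS k γ) {t : ℕ} (h1 : 0 < t) (h2 : t < S.L) :
    TG k (fun e => S.ok e ∧ S.bx t e) (S.val γ) (S.val S.kap) := by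
  have hK := hS.hK
  have h3 := hS.tha t (S.K - 1) h1 h2 (by omega) (by omega)
  have h4 := hS.thb t (S.K - 1) h1 h2 (by omega) (by omega)
  have ha := hS.am 0 t h1 h2.le
  have ha0 := hS.a0
  have hc := hS.cm (S.K - 1) S.K (by omega) le_rfl
  have hcK := hS.cK
  have hd := hS.dm 0 (S.K - 1) (by omega) (by omega)
  have hd0 := hS.d0
  let A : ℕ → ℤ := fun i => if i < S.a t then i else S.m + S.n + 1
  let B : ℕ → ℤ := fun j => if j ≤ S.d (S.K - 1) then S.m + S.n + 1 else S.n - j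
  have key : ∀ e, S.ok e → (S.bx t e → S.lin e (A, B) = 0) ∧ (¬ S.bx t e → 0 < S.lin e (A, B)) := by
    intro e he
    cases e with
    | row i =>
      have he : i < S.m := he
      simp only [Sh.bx, Sh.lin, Sh.val, A]
      constructor <;> intro hb <;> split_ifs at * <;> push_cast at * <;> omega
    | col j =>
      have he : j < S.n := he
      simp only [Sh.bx, Sh.lin, Sh.val, B]
      constructor <;> intro hb <;> split_ifs at * <;> push_cast at * <;> omega
    | lo t' =>
      obtain ⟨e1, e2⟩ : 0 < t' ∧ t' < S.L := he
      have q0 := hS.thb t' (S.K - 1) e1 e2 (by omega) (by omega)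
      have q1 : t' < t → S.a t' < S.a t := fun hh => hS.am _ _ hh (by omega)
      have q2 : t ≤ t' → S.a t ≤ S.a t' := fun hh => by
        rcases hh.eq_or_lt with rfl | hh
        · exact le_rfl
        · exact (hS.am _ _ hh (by omega)).le
      simp only [Sh.bx, Sh.lin, Sh.val, A, B]
      constructor <;> intro hb <;> split_ifs at * <;> push_cast at * <;> omega
    | up s =>
      obtain ⟨e1, e2⟩ : 0 < s ∧ s < S.K := he
      have q0 := hS.tha t s h1 h2 e1 e2
      have q1 : s < S.K - 1 → S.d (S.K - 1) < S.d s := fun hh => hS.dm _ _ hh (by omega)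
      simp only [Sh.bx, Sh.lin, Sh.val, A, B]
      constructor
      · rintro rfl; split_ifs at * <;> push_cast at * <;> omega
      · intro hb; split_ifs at * <;> push_cast at * <;> omega
    | _ =>
      simp only [Sh.bx, Sh.lin, Sh.val, A, B]
      refine ⟨fun _ => ?_, fun hb => (hb trivial).elim⟩
      split_ifs at * <;> push_cast at * <;> omega
  exact TG.loc h ok_fin (fun e => S.lin e (A, B)) (A, B) (fun e x => Sh.val_add _ _ _ _) (fun e x => Sh.val_add _ _ _ _) _
    (fun e he hb => (key e he).1 hb) (fun e he hb => (key e he).2 hb)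

/-- the reduced system of a lower corner and the last upper corner -/
def v3 (δ η G1 G2 : ℤ) (i : Fin 6) (x : ℤ × ℤ × ℤ × ℤ) : ℤ :=
  ![x.1, x.2.1, x.2.2.1, x.2.2.2, x.1 + x.2.1 - δ * x.2.2.1 - G1, x.2.2.1 + x.2.2.2 - η * x.2.1 + G2] i

theorem v3_4 (δ η G1 G2 : ℤ) (x : ℤ × ℤ × ℤ × ℤ) : v3 δ η G1 G2 4 x = x.1 + x.2.1 - δ * x.2.2.1 - G1 := rfl
theorem v3_5 (δ η G1 G2 : ℤ) (x : ℤ × ℤ × ℤ × ℤ) : v3 δ η G1 G2 5 x = x.2.2.1 + x.2.2.2 - η * x.2.1 + G2 := rfl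

theorem red3 (hS : S.Ok) (h : S.TS k γ) {t s s' : ℕ} (h1 : 0 < t) (h2 : t < S.L)
    (hc : ∀ t', t < t' → t' < S.L → γ.l t' = γ.s ∧ S.kap.l t' = S.kap.s)
    (s1 : S.a t < s) (s2 : s < S.m) (s3 : S.c (S.K - 1) ≤ s + 1) (s4 : S.b t ≤ s' + 1) (s5 : s' + 1 < S.d (S.K - 1)) :
    TG k (fun _ => True) (v3 (if s' < S.b t then 1 else 0) (if S.c (S.K - 1) ≤ s then 1 else 0) (γ.s - γ.l t) (γ.s - γ.u (S.K - 1)))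
      (v3 (if s' < S.b t then 1 else 0) (if S.c (S.K - 1) ≤ s then 1 else 0) (S.kap.s - S.kap.l t) (S.kap.s - S.kap.u (S.K - 1))) := by
  have h0 := bx_loc hS h h1 h2
  have hK := hS.hK
  have h3 := hS.tha t (S.K - 1) h1 h2 (by omega) (by omega)
  have h4 := hS.thb t (S.K - 1) h1 h2 (by omega) (by omega)
  have ha := hS.am 0 t h1 h2.le
  have ha0 := hS.a0
  have hcc := hS.cm (S.K - 1) S.K (by omega) le_rfl
  have hcK := hS.cK
  have hd := hS.dm 0 (S.K - 1) (by omega) (by omega)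
  have hd0 := hS.d0
  have mid : ∀ t', t < t' → t' < S.L → S.a t < S.a t' ∧ S.a t' < S.c (S.K - 1) ∧ S.b t' < S.b t := by
    intro t' e1 e2
    exact ⟨hS.am _ _ e1 e2.le, hS.tha t' _ (by omega) e2 (by omega) (by omega), hS.bm _ _ e1 e2.le⟩
  generalize hc1 : S.c (S.K - 1) = c1 at *
  generalize hd1 : S.d (S.K - 1) = d1 at *
  let A : Cl → ℤ × ℤ × ℤ × ℤ → ℕ → ℤ := fun γ x i => γ.s - (if i ≤ S.a t then x.1 else 0) - (if i ≤ s then x.2.1 else 0)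
  let f : Cl → ℤ × ℤ × ℤ × ℤ → Pt := fun γ x => (A γ x,
    fun j => if j = S.n then A γ x 0 else - (if s' < j then x.2.2.1 else 0) - (if d1 ≤ j then x.2.2.2 else 0))
  let Z : Ed → Prop := fun e => match e with
    | .row i => i ≠ S.a t ∧ i ≠ s
    | .col j => j ≠ s' ∧ j + 1 ≠ d1
    | .lo _ => False
    | .up _ => False
    | _ => True
  have hZ : ∀ γ : Cl, ∀ e, S.ok e ∧ S.bx t e → Z e → ∀ x, S.val γ e (f γ x) = 0 := by
    intro γ e he hz x
    cases e with
    | row i =>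
      have e1 : i < S.m := he.1
      have e2 : S.a t ≤ i := he.2
      obtain ⟨e4, e5⟩ : i ≠ S.a t ∧ i ≠ s := hz
      simp only [Sh.val, f, A]; split_ifs <;> omega
    | col j =>
      have e1 : j < S.n := he.1
      have e2 : j < d1 := hd1 ▸ he.2
      obtain ⟨e4, e5⟩ : j ≠ s' ∧ j + 1 ≠ d1 := hz
      simp only [Sh.val, f, A]; split_ifs <;> omega
    | lo t => exact hz.elim
    | up s => exact hz.elim
    | _ => simp only [Sh.val, f, A]; split_ifs <;> omega
  have c0 : ∀ γ : Cl, ∀ x, S.val γ (.row (S.a t)) (f γ x) = x.1 := by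
    intro γ x; simp only [Sh.val, f, A]; split_ifs <;> omega
  have c1' : ∀ γ : Cl, ∀ x, S.val γ (.row s) (f γ x) = x.2.1 := by
    intro γ x; simp only [Sh.val, f, A]; split_ifs <;> omega
  have c2 : ∀ γ : Cl, ∀ x, S.val γ (.col s') (f γ x) = x.2.2.1 := by
    intro γ x; simp only [Sh.val, f, A]; split_ifs <;> omega
  have c3 : ∀ γ : Cl, ∀ x, S.val γ (.col (d1 - 1)) (f γ x) = x.2.2.2 := by
    intro γ x; simp only [Sh.val, f, A]; split_ifs <;> omega
  have c4 : ∀ γ : Cl, ∀ x, S.val γ (.lo t) (f γ x) = x.1 + x.2.1 - (if s' < S.b t then 1 else 0) * x.2.2.1 - (γ.s - γ.l t) := by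
    intro γ x; simp only [Sh.val, f, A]; split_ifs <;> omega
  have c5 : ∀ γ : Cl, ∀ x, S.val γ (.up (S.K - 1)) (f γ x) = x.2.2.1 + x.2.2.2 - (if c1 ≤ s then 1 else 0) * x.2.1 +
      (γ.s - γ.u (S.K - 1)) := by
    intro γ x; simp only [Sh.val, f, A, hc1, hd1]; split_ifs <;> omega
  have c6 : ∀ γ : Cl, ∀ t', t < t' → t' < S.L → γ.l t' = γ.s → ∀ x, S.val γ (.lo t') (f γ x) = x.2.1 := by
    intro γ t' e1 e2 e3 x
    have := mid t' e1 e2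
    simp only [Sh.val, f, A]; split_ifs <;> omega
  have ev : ∀ x : Pt, (∀ j, S.ok j ∧ S.bx t j → Z j → S.val γ j x = 0) →
      (∀ i, S.a t < i → i ≤ s → x.1 i = x.1 s) ∧ x.1 (S.a t + 1) = x.1 s ∧ x.1 (s + 1) = x.1 S.m ∧
      (∀ j, j ≤ s' → x.2 j = x.2 0) ∧ x.2 s' = x.2 0 ∧ x.2 (s' + 1) = x.2 (d1 - 1) ∧ x.1 S.m = x.2 0 + γ.s := by
    intro x hx
    have er : ∀ i, S.a t < i → i < S.m → i ≠ s → x.1 (i + 1) = x.1 i := fun i e1 e2 e3 => by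
      have := hx (.row i) ⟨e2, e1.le⟩ (show _ ∧ _ by omega)
      simp only [Sh.val] at this; linarith
    have ec : ∀ i, i + 1 < d1 → i ≠ s' → x.2 (i + 1) = x.2 i := fun i e1 e2 => by
      have := hx (.col i) ⟨show i < S.n by omega, show i < S.d (S.K - 1) by omega⟩ (show _ ∧ _ by omega)
      simp only [Sh.val] at this; linarith
    have f1 : ∀ i, S.a t < i → i ≤ s → x.1 i = x.1 s := fun i h1 h2 =>
      (const_of_step (f := x.1) h2 fun i _ _ => er i (by omega) (by omega) (by omega)).symm
    have f2 : ∀ j, j ≤ s' → x.2 j = x.2 0 := fun i h1 =>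
      (const_of_step (f := x.2) (Nat.zero_le i) fun i _ _ => ec i (by omega) (by omega))
    refine ⟨f1, f1 _ (by omega) (by omega), (const_of_step (f := x.1) (by omega) fun i _ _ => er i (by omega) (by omega) (by omega)).symm,
      f2, f2 _ le_rfl, (const_of_step (f := x.2) (by omega) fun i _ _ => ec i (by omega) (by omega)).symm, ?_⟩
    have := hx .z2 ⟨trivial, trivial⟩ trivial
    simp only [Sh.val] at this; linarith
  refine h0.red Z (f γ) (f S.kap) (fun x => (S.val γ (.row (S.a t)) x, S.val γ (.row s) x, S.val γ (.col s') x,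
    S.val γ (.col (d1 - 1)) x))
    (fun e he hz x => ⟨hZ _ e he hz x, hZ _ e he hz x⟩) ?_ ?_ ?_
  · intro e he hz
    cases e with
    | row i =>
      have : i = S.a t ∨ i = s := by have : ¬ (_ ∧ _) := hz
                                     omega
      rcases this with rfl | rfl
      · exact ⟨0, fun x => ⟨c0 _ x, c0 _ x⟩⟩
      · exact ⟨1, fun x => ⟨c1' _ x, c1' _ x⟩⟩
    | col j =>
      have : j = s' ∨ j = d1 - 1 := by have : ¬ (_ ∧ _) := hz
                                       omega
      rcases this with rfl | rfl
      · exact ⟨2, fun x => ⟨c2 _ x, c2 _ x⟩⟩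
      · exact ⟨3, fun x => ⟨c3 _ x, c3 _ x⟩⟩
    | lo t' =>
      have e1 : t ≤ t' := he.2
      have e2 : t' < S.L := he.1.2
      rcases e1.eq_or_lt with rfl | e3
      · exact ⟨4, fun x => ⟨c4 _ x, c4 _ x⟩⟩
      · exact ⟨1, fun x => ⟨c6 _ t' e3 e2 (hc _ e3 e2).1 x, c6 _ t' e3 e2 (hc _ e3 e2).2 x⟩⟩
    | up s =>
      have : s = S.K - 1 := he.2
      subst this
      exact ⟨5, fun x => ⟨c5 _ x, c5 _ x⟩⟩
    | _ => exact (hz trivial).elim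
  · intro i
    fin_cases i
    · exact ⟨.row (S.a t), ⟨show S.a t < S.m by omega, le_refl (S.a t)⟩, fun x _ => rfl, fun x => c0 _ x⟩
    · exact ⟨.row s, ⟨s2, s1.le⟩, fun x _ => rfl, fun x => c1' _ x⟩
    · exact ⟨.col s', ⟨show s' < S.n by omega, show s' < S.d (S.K - 1) by omega⟩, fun x _ => rfl, fun x => c2 _ x⟩
    · exact ⟨.col (d1 - 1), ⟨show d1 - 1 < S.n by omega, show d1 - 1 < S.d (S.K - 1) by omega⟩, fun x _ => rfl, fun x => c3 _ x⟩
    · refine ⟨.lo t, ⟨⟨h1, h2⟩, le_refl t⟩, fun x hx => ?_, fun x => c4 _ x⟩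
      obtain ⟨e1, e1', e2, e3, e3', e4, e5⟩ := ev x hx
      show v3 _ _ _ _ 4 _ = _
      rw [v3_4]
      simp only [Sh.val]
      split_ifs with hs
      · have : S.b t = s' + 1 := by omega
        rw [this]; linarith
      · have := e3 (S.b t) (by omega)
        linarith
    · refine ⟨.up (S.K - 1), ⟨⟨show 0 < S.K - 1 by omega, show S.K - 1 < S.K by omega⟩, rfl⟩, fun x hx => ?_, fun x => c5 _ x⟩
      obtain ⟨e1, e1', e2, e3, e3', e4, e5⟩ := ev x hx
      show v3 _ _ _ _ 5 _ = _
      rw [v3_5]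
      simp only [Sh.val, hc1, hd1]
      rw [show d1 - 1 + 1 = d1 by omega]
      split_ifs with hs
      · have := e1 c1 (by omega) hs
        linarith
      · have : c1 = s + 1 := by omega
        rw [this]; linarith
  · intro x
    show (_, _, _, _) = x
    rw [c0, c1', c2, c3]

end SDP

set_option linter.unusedVariables false
set_option linter.unusedSectionVars false
set_option maxHeartbeats 1000000
set_option synthInstance.maxHeartbeats 1000000

namespace SDP
variable {k : Type} [Field k] {S : Sh} {γ : Cl}

theorem test3a {κ1 κ2 : ℤ} (n1 : κ1 ≠ 0) (n2 : κ2 ≠ 0) (h : TG k (fun _ => True) (v3 1 1 κ1 0) (v3 1 1 κ1 κ2))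
    (h' : TG k (fun _ => True) (v3 1 0 κ1 0) (v3 1 0 κ1 κ2) ∨ TG k (fun _ => True) (v3 0 1 κ1 0) (v3 0 1 κ1 κ2)) :
    κ1 < 0 ∧ κ2 < 0 := by
  rcases lt_or_gt_of_ne n1 with s1 | s1 <;> rcases lt_or_gt_of_ne n2 with s2 | s2
  · exact ⟨s1, s2⟩
  · exfalso
    have h1 := h (0, 1, 1, 0) (by simp [Fin.forall_fin_succ, v3]; omega)
    have := h1.two (fun x => x.2.1 = 0 ∧ x.2.2.1 = 1) (by
      simp only [Bx, LeF, Fin.forall_fin_succ, v3]; simp; omega)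
      (0, 0, 1, 0) (0, 0, 0, 0) (by simp [Bx, Fin.forall_fin_succ, v3]; omega) (by simp [Bx, Fin.forall_fin_succ, v3]; omega) (by simp)
    simp at this
  · exfalso
    rcases h' with h | h
    · have h1 := h (κ1, 1, 1, -κ2 - 1) (by simp [Fin.forall_fin_succ, v3]; omega)
      have := h1.two (fun x => x.2.1 = 1) (by
        simp only [Bx, LeF, Fin.forall_fin_succ, v3]; simp; omega)
        (κ1 - 1, 1, 0, 0) (κ1, 0, 0, 0) (by simp [Bx, Fin.forall_fin_succ, v3]; omega) (by simp [Bx, Fin.forall_fin_succ, v3]; omega) (by simp)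
      simp at this
    · have h1 := h (κ1 - 1, 1, -κ2, 1) (by simp [Fin.forall_fin_succ, v3]; omega)
      have := h1.two (fun x => x.2.2.1 = 1) (by
        simp only [Bx, LeF, Fin.forall_fin_succ, v3]; simp; omega)
        (κ1 - 1, 1, 1, 0) (κ1 - 1, 1, 0, 1) (by simp [Bx, Fin.forall_fin_succ, v3]; omega) (by simp [Bx, Fin.forall_fin_succ, v3]; omega) (by simp)
      simp at this
  · exfalso
    obtain ⟨⟨x, hx⟩, -, -⟩ := h (κ1 - 1, 1, 0, 0) (by simp [Fin.forall_fin_succ, v3]; omega)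
    simp [Bx, Fin.forall_fin_succ, v3] at hx
    omega

theorem test3b {κ1 κ2 : ℤ} (s1 : κ1 < 0) (s2 : κ2 < 0) (h : TG k (fun _ => True) (v3 1 1 0 κ2) (v3 1 1 κ1 κ2)) : False := by
  obtain ⟨⟨x, hx⟩, -, -⟩ := h (0, 0, 1, -κ2 - 1) (by simp [Fin.forall_fin_succ, v3]; omega)
  simp [Bx, Fin.forall_fin_succ, v3] at hx
  omega

theorem face_up (hS : S.Ok) (hγ : γ.Ok S) (h : S.TS k γ) {t : ℕ} (ht : t < S.K) :
    γ.u (t + 1) - γ.u t = 0 ∨ γ.u (t + 1) - γ.u t = S.kap.u (t + 1) - S.kap.u t := by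
  have h0 := face1 (sw_ok hS) (sw_cl hγ) (TS_sw hS h) (t := t) ht
  have := hS.c_le (t := t) (by omega); have := hS.d_le (t := t) (by omega)
  have := hS.c_le (t := t + 1) (by omega); have := hS.d_le (t := t + 1) (by omega)
  simp only [Sh.kap, Sh.sw, Cl.sw] at *
  omega

/-- the link between a lower face and the last upper face -/
theorem face3 (hS : S.Ok) (hγ : γ.Ok S) (h : S.TS k γ) {t : ℕ} (h1 : 0 < t) (h2 : t < S.L)
    (hc : ∀ t', t < t' → t' ≤ S.L → γ.l t' = γ.s ∧ S.kap.l t' = S.kap.s) (n1 : S.kap.s - S.kap.l t ≠ 0)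
    (n2 : S.kap.s - S.kap.u (S.K - 1) ≠ 0) : γ.s - γ.l t = 0 ↔ γ.s - γ.u (S.K - 1) = 0 := by
  have hK := hS.hK
  have f1 := face1 hS hγ h h2
  rw [(hc (t + 1) (by omega) h2).1, (hc (t + 1) (by omega) h2).2] at f1
  have f2 := face_up hS hγ h (show S.K - 1 < S.K by omega)
  rw [show S.K - 1 + 1 = S.K by omega, hγ.uK, hS.kap_ok.uK] at f2
  have h3 := hS.tha t (S.K - 1) h1 h2 (by omega) (by omega)
  have h4 := hS.thb t (S.K - 1) h1 h2 (by omega) (by omega)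
  have h5 := hS.thc t (S.K - 1) h1 h2 (by omega) (by omega)
  have hcc := hS.cm (S.K - 1) S.K (by omega) le_rfl
  have hcK := hS.cK
  have hb := hS.bm t S.L h2 le_rfl
  have main : ∀ γ : Cl, S.TS k γ → (∀ t', t < t' → t' < S.L → γ.l t' = γ.s ∧ S.kap.l t' = S.kap.s) →
      TG k (fun _ => True) (v3 1 1 (γ.s - γ.l t) (γ.s - γ.u (S.K - 1))) (v3 1 1 (S.kap.s - S.kap.l t) (S.kap.s - S.kap.u (S.K - 1))) ∧
      (TG k (fun _ => True) (v3 1 0 (γ.s - γ.l t) (γ.s - γ.u (S.K - 1))) (v3 1 0 (S.kap.s - S.kap.l t) (S.kap.s - S.kap.u (S.K - 1))) ∨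
      TG k (fun _ => True) (v3 0 1 (γ.s - γ.l t) (γ.s - γ.u (S.K - 1))) (v3 0 1 (S.kap.s - S.kap.l t) (S.kap.s - S.kap.u (S.K - 1)))) := by
    intro γ h hc
    refine ⟨?_, ?_⟩
    · have := red3 hS h h1 h2 hc (s := S.m - 1) (s' := S.b t - 1) (by omega) (by omega) (by omega) (by omega) (by omega)
      rwa [if_pos (by omega), if_pos (by omega)] at this
    · by_cases hcase : S.a t + 2 ≤ S.c (S.K - 1)
      · left
        have := red3 hS h h1 h2 hc (s := S.c (S.K - 1) - 1) (s' := S.b t - 1) (by omega) (by omega) (by omega) (by omega) (by omega)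
        rwa [if_pos (by omega), if_neg (by omega)] at this
      · right
        have := red3 hS h h1 h2 hc (s := S.m - 1) (s' := S.b t) (by omega) (by omega) (by omega) (by omega) (by omega)
        rwa [if_neg (by omega), if_pos (by omega)] at this
  have r1 := main γ h fun t' e1 e2 => hc t' e1 e2.le
  have r2 := main (S.rfl γ) (TS_rfl h) (fun t' e1 e2 => by
    obtain ⟨q1, q2⟩ := hc t' e1 e2.le
    simp only [Sh.rfl, q1, q2, and_self])
  simp only [Sh.rfl] at r2
  have e1 : S.kap.s - γ.s - (S.kap.l t - γ.l t) = S.kap.s - S.kap.l t - (γ.s - γ.l t) := by ring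
  have e2 : S.kap.s - γ.s - (S.kap.u (S.K - 1) - γ.u (S.K - 1)) = S.kap.s - S.kap.u (S.K - 1) - (γ.s - γ.u (S.K - 1)) := by ring
  rw [e1, e2] at r2
  generalize γ.s - γ.l t = G1 at *
  generalize γ.s - γ.u (S.K - 1) = G2 at *
  generalize S.kap.s - S.kap.l t = κ1 at *
  generalize S.kap.s - S.kap.u (S.K - 1) = κ2 at *
  rcases f1 with rfl | rfl <;> rcases f2 with rfl | rfl
  · simp
  · simp only [sub_zero, sub_self] at r2
    obtain ⟨s1, s2⟩ := test3a n1 n2 r2.1 r2.2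
    exact (test3b s1 s2 r1.1).elim
  · simp only [sub_zero, sub_self] at r2
    obtain ⟨s1, s2⟩ := test3a n1 n2 r1.1 r1.2
    exact (test3b s1 s2 r2.1).elim
  · simp [n1, n2]

end SDP

set_option linter.unusedVariables false
set_option linter.unusedSectionVars false
set_option maxHeartbeats 1000000
set_option synthInstance.maxHeartbeats 1000000

namespace SDP

/-- the exceptional colouring of a chain of faces -/
def Mixed (g κ : ℕ → ℤ) (L : ℕ) (v : ℤ) : Prop :=
  (∀ t, 0 < t → t < L → κ t = v) ∧ v ≠ 0 ∧ v ≠ κ L ∧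
    (((∀ t, 0 < t → t < L → g t = v) ∧ g L = v) ∨ ((∀ t, 0 < t → t < L → g t = 0) ∧ g L = κ L - v))

theorem last_jump (κ : ℕ → ℤ) (h0 : κ 0 = 0) (q : ℕ) :
    (∀ t ≤ q, κ t = 0) ∨ ∃ p < q, κ q - κ p ≠ 0 ∧ ∀ t, p < t → t ≤ q → κ t = κ q := by
  induction q with
  | zero => left; intro t ht; rw [Nat.le_zero.1 ht, h0]
  | succ q ih =>
    by_cases h : κ (q + 1) = κ q
    · rcases ih with ih | ⟨p, hp, h1, h2⟩
      · left; intro t ht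
        rcases Nat.le_succ_iff.1 ht with ht | rfl
        · exact ih t ht
        · rw [h, ih q le_rfl]
      · right
        refine ⟨p, by omega, by rw [h]; exact h1, fun t e1 e2 => ?_⟩
        rcases Nat.le_succ_iff.1 e2 with ht | rfl
        · rw [h]; exact h2 t e1 ht
        · rfl
    · right
      refine ⟨q, by omega, sub_ne_zero.2 h, fun t e1 e2 => ?_⟩
      rw [show t = q + 1 by omega]

theorem one_side (g κ : ℕ → ℤ) (L : ℕ) (hL : 2 ≤ L) (g0 : g 0 = 0) (k0 : κ 0 = 0)
    (f1 : ∀ t < L, g (t + 1) - g t = 0 ∨ g (t + 1) - g t = κ (t + 1) - κ t)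
    (f2 : ∀ p q, p < q → q < L → ¬ (p = 0 ∧ q + 1 = L) → (∀ t, p < t → t ≤ q → g t = g q ∧ κ t = κ q) →
      κ q - κ p ≠ 0 → κ (q + 1) - κ q ≠ 0 → (g q - g p = 0 ↔ g (q + 1) - g q = 0)) :
    (∀ t ≤ L, g t = 0) ∨ (∀ t ≤ L, g t = κ t) ∨ ∃ v, Mixed g κ L v := by
  have step : ∀ q < L, ((∀ t ≤ q, g t = 0) ∨ (∀ t ≤ q, g t = κ t)) →
      ((∀ t ≤ q + 1, g t = 0) ∨ (∀ t ≤ q + 1, g t = κ t)) ∨ (q + 1 = L ∧ ∃ v, Mixed g κ L v) := by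
    intro q hq hU
    have ext0 : (∀ t ≤ q, g t = 0) → g (q + 1) = 0 → (∀ t ≤ q + 1, g t = 0) := by
      intro h1 h2 t ht
      rcases Nat.le_succ_iff.1 ht with ht | rfl
      · exact h1 t ht
      · exact h2
    have extk : (∀ t ≤ q, g t = κ t) → g (q + 1) = κ (q + 1) → (∀ t ≤ q + 1, g t = κ t) := by
      intro h1 h2 t ht
      rcases Nat.le_succ_iff.1 ht with ht | rfl
      · exact h1 t ht
      · exact h2
    have fq := f1 q hq
    rcases last_jump κ k0 q with hz | ⟨p, hp, h1, h2⟩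
    · left
      have gz : ∀ t ≤ q, g t = 0 := by
        rcases hU with h | h
        · exact h
        · intro t ht; rw [h t ht, hz t ht]
      have gk : ∀ t ≤ q, g t = κ t := fun t ht => by rw [gz t ht, hz t ht]
      have e1 := gz q le_rfl; have e2 := hz q le_rfl
      rcases fq with h | h
      · exact Or.inl (ext0 gz (by linarith))
      · exact Or.inr (extk gk (by linarith))
    · by_cases hj : κ (q + 1) - κ q = 0
      · left
        have hg : g (q + 1) = g q := by rcases fq with h | h <;> linarith
        rcases hU with h | h
        · exact Or.inl (ext0 h (by rw [hg, h q le_rfl]))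
        · exact Or.inr (extk h (by rw [hg, h q le_rfl]; linarith))
      · by_cases hne : p = 0 ∧ q + 1 = L
        · obtain ⟨rfl, hqL⟩ := hne
          have hv : κ q ≠ 0 := by rwa [k0, sub_zero] at h1
          rcases hU with h | h
          · rcases fq with h' | h'
            · left; exact Or.inl (ext0 h (by linarith [h q le_rfl]))
            · right
              refine ⟨hqL, κ q, fun t e1 e2 => h2 t e1 (by omega), hv, ?_, Or.inr ⟨fun t e1 e2 => h t (by omega), ?_⟩⟩
              · rw [← hqL]; intro hc; exact hj (by linarith)
              · rw [← hqL]; linarith [h q le_rfl]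
          · rcases fq with h' | h'
            · right
              refine ⟨hqL, κ q, fun t e1 e2 => h2 t e1 (by omega), hv, ?_, Or.inl ⟨fun t e1 e2 => ?_, ?_⟩⟩
              · rw [← hqL]; intro hc; exact hj (by linarith)
              · rw [h t (by omega), h2 t e1 (by omega)]
              · rw [← hqL]; linarith [h q le_rfl]
            · left; exact Or.inr (extk h (by linarith [h q le_rfl]))
        · left
          have hc : ∀ t, p < t → t ≤ q → g t = g q ∧ κ t = κ q := fun t e1 e2 => by
            refine ⟨?_, h2 t e1 e2⟩
            rcases hU with h | h
            · rw [h t e2, h q le_rfl]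
            · rw [h t e2, h q le_rfl, h2 t e1 e2]
          have hf := f2 p q hp hq hne hc h1 hj
          rcases hU with h | h
          · left
            rw [h q le_rfl, h p hp.le] at hf
            have := hf.1 (by simp)
            exact ext0 h (by linarith)
          · right
            rw [h q le_rfl, h p hp.le] at hf
            rcases fq with h' | h'
            · rw [h q le_rfl] at h'
              exact (h1 (hf.2 h')).elim
            · exact extk h (by linarith [h q le_rfl])
  have pre : ∀ q < L, ((∀ t ≤ q, g t = 0) ∨ (∀ t ≤ q, g t = κ t)) := by
    intro q
    induction q with
    | zero => intro _; left; intro t ht; rw [Nat.le_zero.1 ht, g0]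
    | succ q ih =>
      intro hq
      rcases step q (by omega) (ih (by omega)) with h | ⟨h, -⟩
      · exact h
      · omega
  rcases step (L - 1) (by omega) (pre _ (by omega)) with h | ⟨-, h⟩
  · rw [show L - 1 + 1 = L by omega] at h
    rcases h with h | h
    · exact Or.inl h
    · exact Or.inr (Or.inl h)
  · exact Or.inr (Or.inr h)

theorem last_nz (κ : ℕ → ℤ) (L : ℕ) : (∀ t ≤ L, κ t = 0) ∨ ∃ p ≤ L, κ p ≠ 0 ∧ ∀ t, p < t → t ≤ L → κ t = 0 := by
  induction L with
  | zero =>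
    by_cases h : κ 0 = 0
    · left; intro t ht; rw [Nat.le_zero.1 ht, h]
    · right; exact ⟨0, le_rfl, h, fun t e1 e2 => by omega⟩
  | succ q ih =>
    by_cases h : κ (q + 1) = 0
    · rcases ih with ih | ⟨p, hp, h1, h2⟩
      · left; intro t ht
        rcases Nat.le_succ_iff.1 ht with ht | rfl
        · exact ih t ht
        · exact h
      · right
        refine ⟨p, by omega, h1, fun t e1 e2 => ?_⟩
        rcases Nat.le_succ_iff.1 e2 with ht | rfl
        · exact h2 t e1 ht
        · exact h
    · right; exact ⟨q + 1, le_rfl, h, fun t e1 e2 => by omega⟩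

/-- uniform sides with opposite colours agree -/
theorem opposite (gl κl gu κu : ℕ → ℤ) (L K : ℕ) (hL : 2 ≤ L) (hK : 2 ≤ K) (kl0 : κl 0 = 0) (ku0 : κu 0 = 0)
    (gs : gl L = gu K) (ks : κl L = κu K) (hlt : ∀ t s, 0 < t → t < L → 0 < s → s < K → κu s ≠ κl t)
    (l1 : ∀ t, 0 < t → t < L → (∀ t', t < t' → t' ≤ L → gl t' = gl L ∧ κl t' = κl L) → κl L - κl t ≠ 0 →
      κl L - κu (K - 1) ≠ 0 → (gl L - gl t = 0 ↔ gl L - gu (K - 1) = 0))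
    (l2 : ∀ t, 0 < t → t < K → (∀ t', t < t' → t' ≤ K → gu t' = gl L ∧ κu t' = κl L) → κl L - κu t ≠ 0 →
      κl L - κl (L - 1) ≠ 0 → (gl L - gu t = 0 ↔ gl L - gl (L - 1) = 0))
    (h1 : ∀ t ≤ L, gl t = 0) (h2 : ∀ t ≤ K, gu t = κu t) :
    (∀ t ≤ L, gl t = κl t) ∨ (∀ t ≤ K, gu t = 0) := by
  have e0 : gl L = 0 := h1 L le_rfl
  have e1 : κu K = 0 := by rw [← h2 K le_rfl, ← gs, e0]
  have e2 : κl L = 0 := by rw [ks, e1]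
  rcases last_nz κl L with hz | ⟨p, hp, p1, p2⟩
  · left; intro t ht; rw [h1 t ht, hz t ht]
  rcases last_nz κu K with hz | ⟨q, hq, q1, q2⟩
  · right; intro t ht; rw [h2 t ht, hz t ht]
  exfalso
  have hp0 : p ≠ 0 := by rintro rfl; exact p1 kl0
  have hpL : p ≠ L := by rintro rfl; exact p1 e2
  have hq0 : q ≠ 0 := by rintro rfl; exact q1 ku0
  have hqK : q ≠ K := by rintro rfl; exact q1 e1
  have hne := hlt (L - 1) (K - 1) (by omega) (by omega) (by omega) (by omega)
  by_cases hc : κu (K - 1) = 0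
  · have := l2 q (by omega) (by omega) (fun t' a1 a2 => ⟨by rw [h2 t' a2, q2 t' a1 a2, e0], by rw [q2 t' a1 a2, e2]⟩)
      (by rw [e2, zero_sub]; exact neg_ne_zero.2 q1) (by rw [e2, zero_sub]; exact neg_ne_zero.2 (fun h => hne (by rw [hc, h])))
    rw [e0, h2 q hq, h1 (L - 1) (by omega)] at this
    have := this.2 (by simp)
    exact q1 (by linarith)
  · have := l1 p (by omega) (by omega) (fun t' a1 a2 => ⟨by rw [h1 t' a2, e0], by rw [p2 t' a1 a2, e2]⟩)
      (by rw [e2, zero_sub]; exact neg_ne_zero.2 p1) (by rw [e2, zero_sub]; exact neg_ne_zero.2 hc)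
    rw [e0, h1 p hp, h2 (K - 1) (by omega)] at this
    have := this.1 (by simp)
    exact hc (by linarith)

theorem mixed_unif {g κ : ℕ → ℤ} {L : ℕ} {v : ℤ} (h : Mixed g κ L v) : g L ≠ 0 ∧ g L ≠ κ L := by
  obtain ⟨h1, h2, h3, h4 | h4⟩ := h
  · rw [h4.2]; exact ⟨h2, h3⟩
  · rw [h4.2]
    exact ⟨fun h => h3 (by linarith), fun h => h2 (by linarith)⟩

theorem two_sides (gl κl gu κu : ℕ → ℤ) (L K : ℕ) (hL : 2 ≤ L) (hK : 2 ≤ K) (kl0 : κl 0 = 0) (ku0 : κu 0 = 0)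
    (gs : gl L = gu K) (ks : κl L = κu K) (hlt : ∀ t s, 0 < t → t < L → 0 < s → s < K → κu s ≠ κl t)
    (l1 : ∀ t, 0 < t → t < L → (∀ t', t < t' → t' ≤ L → gl t' = gl L ∧ κl t' = κl L) → κl L - κl t ≠ 0 →
      κl L - κu (K - 1) ≠ 0 → (gl L - gl t = 0 ↔ gl L - gu (K - 1) = 0))
    (l2 : ∀ t, 0 < t → t < K → (∀ t', t < t' → t' ≤ K → gu t' = gl L ∧ κu t' = κl L) → κl L - κu t ≠ 0 →
      κl L - κl (L - 1) ≠ 0 → (gl L - gu t = 0 ↔ gl L - gl (L - 1) = 0))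
    (h1 : (∀ t ≤ L, gl t = 0) ∨ (∀ t ≤ L, gl t = κl t) ∨ ∃ v, Mixed gl κl L v)
    (h2 : (∀ t ≤ K, gu t = 0) ∨ (∀ t ≤ K, gu t = κu t) ∨ ∃ v, Mixed gu κu K v) :
    ((∀ t ≤ L, gl t = 0) ∧ (∀ t ≤ K, gu t = 0)) ∨ ((∀ t ≤ L, gl t = κl t) ∧ (∀ t ≤ K, gu t = κu t)) := by
  rcases h1 with h1 | h1 | ⟨v, h1⟩
  · rcases h2 with h2 | h2 | ⟨v, h2⟩
    · exact Or.inl ⟨h1, h2⟩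
    · rcases opposite gl κl gu κu L K hL hK kl0 ku0 gs ks hlt l1 l2 h1 h2 with h | h
      · exact Or.inr ⟨h, h2⟩
      · exact Or.inl ⟨h1, h⟩
    · exact ((mixed_unif h2).1 (by rw [← gs, h1 L le_rfl])).elim
  · rcases h2 with h2 | h2 | ⟨v, h2⟩
    · have := opposite gu κu gl κl K L hK hL ku0 kl0 gs.symm ks.symm (fun t s a b c d => (hlt s t c d a b).symm)
        (by rw [← gs, ← ks]; exact l2) (by rw [← gs, ← ks]; exact l1) h2 h1
      rcases this with h | h
      · exact Or.inr ⟨h1, h⟩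
      · exact Or.inl ⟨h, h2⟩
    · exact Or.inr ⟨h1, h2⟩
    · exact ((mixed_unif h2).2 (by rw [← gs, ← ks, h1 L le_rfl])).elim
  · rcases h2 with h2 | h2 | ⟨w, h2⟩
    · exact ((mixed_unif h1).1 (by rw [gs, h2 K le_rfl])).elim
    · exact ((mixed_unif h1).2 (by rw [gs, ks, h2 K le_rfl])).elim
    · exfalso
      obtain ⟨a1, a2, a3, a4⟩ := h1
      obtain ⟨b1, b2, b3, b4⟩ := h2
      have hne := hlt (L - 1) (K - 1) (by omega) (by omega) (by omega) (by omega)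
      have eL := a1 (L - 1) (by omega) (by omega)
      have eK := b1 (K - 1) (by omega) (by omega)
      have := l1 (L - 1) (by omega) (by omega) (fun t' a1 a2 => by rw [show t' = L by omega]; exact ⟨rfl, rfl⟩)
        (by rw [eL]; exact fun h => a3 (by linarith)) (by rw [eK, ks]; exact fun h => b3 (by linarith))
      rw [eL, eK] at hne
      rcases a4 with ⟨a4, a5⟩ | ⟨a4, a5⟩ <;> rcases b4 with ⟨b4, b5⟩ | ⟨b4, b5⟩ <;>
        rw [a4 (L - 1) (by omega) (by omega), b4 (K - 1) (by omega) (by omega)] at this <;> omega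

variable {k : Type} [Field k] {S : Sh} {γ : Cl}

theorem kap_sw_l (hS : S.Ok) {t : ℕ} (ht : t ≤ S.K) : S.sw.kap.l t = - S.kap.u t := by
  have := hS.c_le ht; have := hS.d_le ht
  simp only [Sh.kap, Sh.sw]; omega

theorem kap_sw_u (hS : S.Ok) {t : ℕ} (ht : t ≤ S.L) : S.sw.kap.u t = - S.kap.l t := by
  have := hS.a_le ht; have := hS.b_le ht
  simp only [Sh.kap, Sh.sw]; omega

theorem kap_sw_s : S.sw.kap.s = - S.kap.s := by
  simp only [Sh.kap, Sh.sw]; omega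

/-- only two classes survive the tests -/
theorem two_classes (hS : S.Ok) (hγ : γ.Ok S) (h : S.TS k γ) :
    ((∀ t ≤ S.L, γ.l t = 0) ∧ (∀ t ≤ S.K, γ.u t = 0)) ∨ ((∀ t ≤ S.L, γ.l t = S.kap.l t) ∧ (∀ t ≤ S.K, γ.u t = S.kap.u t)) := by
  have hk := hS.kap_ok
  have hsw := sw_ok hS
  have hγs := sw_cl hγ
  have hs := TS_sw hS h
  apply two_sides γ.l S.kap.l γ.u S.kap.u S.L S.K hS.hL hS.hK hk.l0 hk.u0 (by rw [hγ.lL, hγ.uK]) (by rw [hk.lL, hk.uK])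
    (fun t s a b c d => (hS.kap_lt a b c d).ne)
  · rw [hγ.lL, hk.lL]
    exact fun t a b c n1 n2 => face3 hS hγ h a b c n1 n2
  · rw [hγ.lL, hk.lL]
    intro t a b c n1 n2
    have := face3 hsw hγs hs (t := t) a b (fun t' a1 a2 => by
      obtain ⟨q1, q2⟩ := c t' a1 a2
      rw [kap_sw_l hS a2, kap_sw_s, q2]
      exact ⟨congrArg (- ·) q1, rfl⟩) (by rw [kap_sw_l hS b.le, kap_sw_s]; intro hc; exact n1 (by linarith))
      (by
        have : S.L - 1 ≤ S.L := by omega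
        rw [show S.sw.K = S.L from rfl, kap_sw_u hS this, kap_sw_s]; intro hc; exact n2 (by linarith))
    simp only [Cl.sw, show S.sw.K = S.L from rfl] at this
    omega
  · exact one_side _ _ _ hS.hL hγ.l0 hk.l0 (fun t ht => face1 hS hγ h ht)
      (fun p q a b c d e f => face2 hS hγ h a b c d e f)
  · refine one_side _ _ _ hS.hK hγ.u0 hk.u0 (fun t ht => face_up hS hγ h ht) (fun p q a b c d e f => ?_)
    have := face2 hsw hγs hs (p := p) (q := q) a b c (fun t e1 e2 => by
      obtain ⟨q1, q2⟩ := d t e1 e2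
      rw [kap_sw_l hS (by omega), kap_sw_l hS (by omega), q2]
      exact ⟨congrArg (- ·) q1, rfl⟩) (by rw [kap_sw_l hS (by omega), kap_sw_l hS (by omega)]; intro hc; exact e (by linarith))
      (by rw [kap_sw_l hS (by omega), kap_sw_l hS (by omega)]; intro hc; exact f (by linarith))
    simp only [Cl.sw] at this
    omega

end SDP

set_option linter.unusedVariables false
set_option linter.unusedSectionVars false
set_option maxHeartbeats 1000000
set_option synthInstance.maxHeartbeats 1000000

namespace SDP
namespace Sh
variable {S : Sh}

/-- the edges of the graph of a shape -/
def okE (S : Sh) : Ed → Prop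
  | .row i => i < S.m
  | .col j => j < S.n
  | .lo t => 0 < t ∧ t < S.L
  | .up s => 0 < s ∧ s < S.K
  | _ => False

/-- edge type -/
abbrev Et (S : Sh) : Type := {e : Ed // S.okE e}

/-- vertex type -/
abbrev Wt (S : Sh) : Type := Fin (S.m + S.n - 1)

theorem okE_ok {e : Ed} (h : S.okE e) : S.ok e := by cases e <;> simp_all [okE, ok]

theorem okE_fin : {e | S.okE e}.Finite := by
  apply Set.Finite.subset ((((Set.finite_lt_nat S.m).image Ed.row).union ((Set.finite_lt_nat S.n).image Ed.col)).union
    (((Set.finite_le_nat S.L).image Ed.lo).union ((Set.finite_lt_nat S.K).image Ed.up)))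
  intro e he
  cases e <;> simp [okE] at he ⊢ <;> omega

noncomputable instance : Fintype S.Et := okE_fin.fintype

/-- the vertex with a given number -/
def nd (S : Sh) (v : ℕ) : Option S.Wt := if h : 0 < v ∧ v < S.m + S.n then some ⟨v - 1, by omega⟩ else none

def nA (S : Sh) (i : ℕ) : Option S.Wt := S.nd i
def nB (S : Sh) (j : ℕ) : Option S.Wt := S.nd (if j = 0 then S.m else if j < S.n then S.m + j else 0)

/-- potentials of a vector -/
def pt (g : S.Wt → ℤ) : Pt := (fun i => Gr.gv (S.nA i) g, fun j => Gr.gv (S.nB j) g)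

/-- the vector of a pair of potentials -/
def vec (S : Sh) (p : Pt) : S.Wt → ℤ := fun w => if w.1 + 1 ≤ S.m then p.1 (w.1 + 1) else p.2 (w.1 + 1 - S.m)

structure Pt0 (S : Sh) (p : Pt) : Prop where
  z : p.1 0 = 0
  zn : p.2 S.n = 0
  e : p.1 S.m = p.2 0

theorem Ok.mn (hS : S.Ok) : 2 ≤ S.m ∧ 2 ≤ S.n := by
  have := hS.a0; have := hS.b0; have := hS.aL; have := hS.bL
  have := hS.hL
  have := hS.am 0 S.L (by omega) le_rfl
  have := hS.bm 0 S.L (by omega) le_rfl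
  omega

theorem pt_pt0 (hS : S.Ok) (g : S.Wt → ℤ) : Pt0 S (pt g) := by
  have := hS.mn
  have h1 : ¬ (S.n = 0) := by omega
  constructor <;> simp [pt, nA, nB, nd, Gr.gv, h1]

theorem vec_A (hS : S.Ok) {p : Pt} (hp : Pt0 S p) {i : ℕ} (hi : i ≤ S.m) : (pt (S.vec p)).1 i = p.1 i := by
  have := hS.mn
  simp only [pt, nA, nd]
  split_ifs with h
  · simp only [Gr.gv, vec, AddMonoidHom.coe_mk, ZeroHom.coe_mk, Option.elim]
    rw [show i - 1 + 1 = i by omega, if_pos hi]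
  · have : i = 0 := by omega
    subst this
    simp [Gr.gv, hp.z]

theorem vec_B (hS : S.Ok) {p : Pt} (hp : Pt0 S p) {j : ℕ} (hj : j ≤ S.n) : (pt (S.vec p)).2 j = p.2 j := by
  have := hS.mn
  rcases Nat.eq_zero_or_pos j with h0 | h0
  · subst h0
    rw [← hp.e, ← vec_A hS hp le_rfl]; simp [pt, nB, nA]
  rcases Nat.lt_or_ge j S.n with h1 | h1
  · simp only [pt, nB, if_neg h0.ne', if_pos h1, nd]
    rw [dif_pos (by omega)]
    simp only [Gr.gv, vec, AddMonoidHom.coe_mk, ZeroHom.coe_mk, Option.elim]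
    rw [if_neg (by omega)]
    rw [show S.m + j - 1 + 1 - S.m = j by omega]
  · have : j = S.n := by omega
    subst this
    rw [hp.zn]; exact (pt_pt0 hS _).zn

theorem lin_congr (hS : S.Ok) {p q : Pt} (h1 : ∀ i ≤ S.m, p.1 i = q.1 i) (h2 : ∀ j ≤ S.n, p.2 j = q.2 j) {e : Ed} (he : S.okE e) :
    S.lin e p = S.lin e q := by
  have e1 := hS.aL; have e2 := hS.b0
  cases e with
  | row i => simp only [okE] at he; simp only [lin, val]; rw [h1 _ (by omega), h1 _ (by omega)]
  | col j => simp only [okE] at he; simp only [lin, val]; rw [h2 _ (by omega), h2 _ (by omega)]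
  | lo t =>
    simp only [okE] at he
    have := hS.am t S.L he.2 le_rfl
    have := hS.bm 0 t he.1 he.2.le
    simp only [lin, val]; rw [h1 _ (by omega), h2 _ (by omega)]
  | up s =>
    simp only [okE] at he
    have := hS.cm s S.K he.2 le_rfl
    have := hS.dm 0 s he.1 he.2.le
    have := hS.d0; have := hS.cK
    simp only [lin, val]; rw [h1 _ (by omega), h2 _ (by omega)]
  | _ => exact he.elim

theorem lin_vec (hS : S.Ok) {p : Pt} (hp : Pt0 S p) {e : Ed} (he : S.okE e) : S.lin e (pt (S.vec p)) = S.lin e p :=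
  lin_congr hS (fun i hi => vec_A hS hp hi) (fun j hj => vec_B hS hp hj) he

def esrc (S : Sh) : Ed → Option S.Wt
  | .row i => S.nA i
  | .col j => S.nB (j + 1)
  | .lo t => S.nA (S.a t)
  | .up s => S.nB (S.d s)
  | _ => none

def etgt (S : Sh) : Ed → Option S.Wt
  | .row i => S.nA (i + 1)
  | .col j => S.nB j
  | .lo t => S.nB (S.b t)
  | .up s => S.nA (S.c s)
  | _ => none

theorem lin_pt (g : S.Wt → ℤ) (e : Ed) (he : S.okE e) : S.lin e (pt g) = Gr.gv (S.etgt e) g - Gr.gv (S.esrc e) g := by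
  cases e <;> simp only [lin, val, etgt, esrc, pt] <;> first | exact he.elim | ring

structure Bd (S : Sh) (i j : ℕ) : Prop where
  i1 : 2 ≤ i
  i2 : i + 1 ≤ S.m
  j1 : 2 ≤ j
  j2 : j + 1 ≤ S.n
  lo : ∀ t, 0 < t → t < S.L → 0 < S.a t ∧ 0 < S.b t ∧ S.a t < i ∧ S.b t < j
  up : ∀ s, 0 < s → s < S.K → i ≤ S.c s ∧ j ≤ S.d s ∧ S.c s < S.m ∧ S.d s < S.n

theorem Ok.bd (hS : S.Ok) : ∃ i j, Bd S i j := by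
  have := hS.a0; have := hS.b0; have := hS.aL; have := hS.bL; have := hS.c0; have := hS.d0; have := hS.cK; have := hS.dK
  have hL := hS.hL; have hK := hS.hK
  have h1 := hS.am 0 (S.L - 1) (by omega) (by omega)
  have h2 := hS.am (S.L - 1) S.L (by omega) (by omega)
  have h3 := hS.bm 0 1 (by omega) (by omega)
  have h4 := hS.bm 1 S.L (by omega) (by omega)
  refine ⟨S.a (S.L - 1) + 1, S.b 1 + 1, by omega, by omega, by omega, by omega, ?_, ?_⟩
  · intro t ht ht'
    have := hS.am 0 t ht ht'.le
    have := hS.bm t S.L ht' le_rfl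
    have h5 : t = S.L - 1 ∨ S.a t < S.a (S.L - 1) := by
      rcases Nat.lt_or_ge t (S.L - 1) with h | h
      · exact Or.inr (hS.am t _ h (by omega))
      · left; omega
    have h6 : t = 1 ∨ S.b t < S.b 1 := by
      rcases Nat.lt_or_ge 1 t with h | h
      · exact Or.inr (hS.bm 1 t h (by omega))
      · left; omega
    refine ⟨by omega, by omega, ?_, ?_⟩
    · rcases h5 with h | h
      · rw [h]; omega
      · omega
    · rcases h6 with h | h
      · rw [h]; omega
      · omega
  · intro s hs hs'
    have := hS.tha (S.L - 1) s (by omega) (by omega) hs hs'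
    have := hS.thb 1 s (by omega) (by omega) hs hs'
    have := hS.cm s S.K hs' le_rfl
    have := hS.dm 0 s hs hs'.le
    omega

/-- strictly positive potential -/
theorem exists_pos (hS : S.Ok) : ∃ p : Pt, Pt0 S p ∧ (∀ i, 0 ≤ p.1 i) ∧ (∀ j ≤ S.n, 0 ≤ p.2 j) ∧ ∀ e, S.okE e → 0 < S.lin e p := by
  obtain ⟨x, y, h⟩ := hS.bd
  have := h.i1; have := h.i2; have := h.j1; have := h.j2
  refine ⟨(fun i => if i < x then i else 2 * (S.m + S.n) + i,
    fun j => if j = 0 then 2 * (S.m + S.n) + S.m else if j < y then S.m + S.n - j else S.n - j), ⟨?_, ?_, ?_⟩, ?_, ?_, ?_⟩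
  · dsimp; split_ifs <;> omega
  · dsimp; split_ifs <;> omega
  · dsimp; split_ifs <;> omega
  · intro i; dsimp; split_ifs <;> omega
  · intro i hi; dsimp; split_ifs <;> omega
  · intro e he
    cases e with
    | row i => simp only [okE] at he; simp only [lin, val]; push_cast; split_ifs <;> omega
    | col j => simp only [okE] at he; simp only [lin, val]; push_cast; split_ifs <;> omega
    | lo t =>
      simp only [okE] at he; have := h.lo t he.1 he.2
      simp only [lin, val]; split_ifs <;> omega
    | up t =>
      simp only [okE] at he; have := h.up t he.1 he.2
      simp only [lin, val]; split_ifs <;> omega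
    | _ => exact he.elim

theorem exists_Gr (hS : S.Ok) : ∃ Γ : Gr S.Wt S.Et, ∀ e : S.Et, Γ.tgt e = S.etgt e.1 ∧ Γ.src e = S.esrc e.1 := by
  have := hS.mn
  obtain ⟨p, hp, h1, h2, h3⟩ := exists_pos hS
  have hvn : ∀ w, 0 ≤ S.vec p w := by
    intro w
    simp only [vec]
    split_ifs with h
    · exact h1 _
    · exact h2 _ (by have := w.2; omega)
  refine ⟨⟨fun e => S.esrc e.1, fun e => S.etgt e.1, fun v => (Gr.gv v (S.vec p)).toNat, ?_, ?_⟩, fun e => ⟨Eq.refl _, Eq.refl _⟩⟩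
  · intro e
    have h4 := h3 e.1 e.2
    rw [← lin_vec hS hp e.2, lin_pt _ _ e.2] at h4
    have h5 : 0 ≤ Gr.gv (S.esrc e.1) (S.vec p) := by
      cases S.esrc e.1 with
      | none => exact le_rfl
      | some w => exact hvn w
    omega
  · intro w
    have hw := w.2
    by_cases h : w.1 < S.m
    · refine ⟨⟨.row w.1, h⟩, ?_⟩
      simp only [etgt, nA, nd]
      rw [dif_pos (by omega)]
      congr 1
    · refine ⟨⟨.col (w.1 + 1 - S.m), by simp only [okE]; omega⟩, ?_⟩
      simp only [etgt, nB, nd]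
      rw [dif_pos (by split_ifs <;> omega)]
      congr 1
      apply Fin.ext
      dsimp
      split_ifs <;> omega

/-- the graph of a shape -/
noncomputable def gr (hS : S.Ok) : Gr S.Wt S.Et := (exists_Gr hS).choose

theorem gr_ev (hS : S.Ok) (e : S.Et) (g : S.Wt → ℤ) : (gr hS).ev e g = S.lin e.1 (pt g) := by
  rw [Gr.ev_apply, lin_pt _ _ e.2]
  have := (exists_Gr hS).choose_spec e
  simp only [gr]
  rw [this.1, this.2]

end Sh
end SDP

set_option linter.unusedVariables false
set_option linter.unusedSectionVars false
set_option maxHeartbeats 1000000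
set_option synthInstance.maxHeartbeats 1000000

namespace SDP
namespace Sh
variable {S : Sh}

/-- facet potentials -/
theorem exists_fac (hS : S.Ok) (e : Ed) (he : S.okE e) :
    ∃ p : Pt, Pt0 S p ∧ S.lin e p = 0 ∧ ∀ e', S.okE e' → e' ≠ e → 0 < S.lin e' p := by
  obtain ⟨x, y, h⟩ := hS.bd
  have := h.i1; have := h.i2; have := h.j1; have := h.j2
  obtain ⟨m, hm⟩ : ∃ m : ℤ, m = S.m := ⟨_, Eq.refl _⟩
  obtain ⟨n, hn⟩ : ∃ n : ℤ, n = S.n := ⟨_, Eq.refl _⟩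
  have fin : ∀ p : Pt, p.1 0 = 0 → p.2 S.n = 0 → p.1 S.m = p.2 0 → S.lin e p = 0 →
      (∀ i, i < S.m → .row i ≠ e → 0 < p.1 (i + 1) - p.1 i) → (∀ j, j < S.n → .col j ≠ e → 0 < p.2 j - p.2 (j + 1)) →
      (∀ t, 0 < t → t < S.L → .lo t ≠ e → 0 < 0 - p.1 (S.a t) + p.2 (S.b t)) →
      (∀ t, 0 < t → t < S.K → .up t ≠ e → 0 < p.1 (S.c t) - p.2 (S.d t) - 0) →
      ∃ p : Pt, Pt0 S p ∧ S.lin e p = 0 ∧ ∀ e', S.okE e' → e' ≠ e → 0 < S.lin e' p := by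
    intro p h1 h2 h3 h4 h5 h6 h7 h8
    refine ⟨p, ⟨h1, h2, h3⟩, h4, fun e' he' hne => ?_⟩
    cases e' with
    | row i => exact h5 i he' hne
    | col j => exact h6 j he' hne
    | lo t => exact h7 t he'.1 he'.2 hne
    | up t => exact h8 t he'.1 he'.2 hne
    | _ => exact he'.elim
  cases e with
  | row i0 =>
    simp only [okE] at he
    by_cases h0 : i0 = 0 ∨ i0 + 1 = S.m
    · apply fin (fun i => (i : ℤ) - (if i0 < i then 1 else 0) + (if x ≤ i then 2 * (m + n) else 0),
        fun j => if j = 0 then m - 1 + 2 * (m + n) else if j < y then m + n - j else n - j)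
      · dsimp; split_ifs <;> omega
      · dsimp; split_ifs <;> omega
      · dsimp; split_ifs <;> omega
      · simp only [lin, val]; push_cast; split_ifs <;> omega
      · intro i hi hne
        have : i ≠ i0 := fun h => hne (h ▸ Eq.refl _)
        dsimp; split_ifs <;> push_cast <;> omega
      · intro j hj hne; dsimp; split_ifs <;> push_cast <;> omega
      · intro t ht ht' hne; have := h.lo t ht ht'; dsimp; split_ifs <;> omega
      · intro t ht ht' hne; have := h.up t ht ht'; dsimp; split_ifs <;> omega
    · apply fin (fun i => if i = 0 then 0 else if i = S.m then 6 * (m + n) + n else 2 * (m + n) + i - (if i0 < i then 1 else 0),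
        fun j => if j < y then 6 * (m + n) + n - j else n - j)
      · simp
      · dsimp; split_ifs <;> omega
      · dsimp; split_ifs <;> omega
      · simp only [lin, val]; push_cast; split_ifs <;> omega
      · intro i hi hne
        have : i ≠ i0 := fun h => hne (h ▸ Eq.refl _)
        dsimp; split_ifs <;> push_cast <;> omega
      · intro j hj hne; dsimp; split_ifs <;> push_cast <;> omega
      · intro t ht ht' hne; have := h.lo t ht ht'; dsimp; split_ifs <;> omega
      · intro t ht ht' hne; have := h.up t ht ht'; dsimp; split_ifs <;> omega
  | col j0 =>
    simp only [okE] at he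
    by_cases h0 : j0 = 0 ∨ j0 + 1 = S.n
    · apply fin (fun i => if i = S.m then 10 * (m + n) + n - (if j0 = 0 then 1 else 0) else if x ≤ i then 20 * (m + n) * 0 + 4 * (m + n) + i else i,
        fun j => if j < y then 10 * (m + n) + n - j - (if j ≤ j0 ∧ j0 = 0 then 1 else 0) else n - j - (if j ≤ j0 ∧ j0 ≠ 0 then 1 else 0))
      · dsimp; split_ifs <;> omega
      · dsimp; split_ifs <;> omega
      · dsimp; split_ifs <;> omega
      · simp only [lin, val]; push_cast; split_ifs <;> omega
      · intro i hi hne; dsimp; split_ifs <;> push_cast <;> omega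
      · intro j hj hne
        have : j ≠ j0 := fun h => hne (h ▸ Eq.refl _)
        dsimp; split_ifs <;> push_cast <;> omega
      · intro t ht ht' hne; have := h.lo t ht ht'; dsimp; split_ifs <;> omega
      · intro t ht ht' hne; have := h.up t ht ht'; dsimp; split_ifs <;> omega
    · apply fin (fun i => if i < x then i else 6 * (m + n) + i,
        fun j => if j = 0 then 6 * (m + n) + m else if j = S.n then 0 else 2 * (m + n) + (n - j) - (if j ≤ j0 then 1 else 0))
      · dsimp; split_ifs <;> omega
      · dsimp; split_ifs <;> omega
      · dsimp; split_ifs <;> omega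
      · simp only [lin, val]; push_cast; split_ifs <;> omega
      · intro i hi hne; dsimp; split_ifs <;> push_cast <;> omega
      · intro j hj hne
        have : j ≠ j0 := fun h => hne (h ▸ Eq.refl _)
        dsimp; split_ifs <;> push_cast <;> omega
      · intro t ht ht' hne; have := h.lo t ht ht'; dsimp; split_ifs <;> omega
      · intro t ht ht' hne; have := h.up t ht ht'; dsimp; split_ifs <;> omega
  | lo t0 =>
    simp only [okE] at he
    have h0 := h.lo t0 he.1 he.2
    apply fin (fun i => if i = S.m then 4 * (m + n) + n else if S.a t0 ≤ i then 2 * (m + n) + i - S.a t0 else i,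
        fun j => if j < S.b t0 then 4 * (m + n) + n - j else if j = S.b t0 then 2 * (m + n) else if j < S.n then m + n - j else 0)
    · dsimp; split_ifs <;> omega
    · dsimp; split_ifs <;> omega
    · dsimp; split_ifs <;> omega
    · simp only [lin, val]; split_ifs <;> omega
    · intro i hi hne; dsimp; split_ifs <;> push_cast <;> omega
    · intro j hj hne; dsimp; split_ifs <;> push_cast <;> omega
    · intro t ht ht' hne
      have h2 : t ≠ t0 := fun h => hne (h ▸ Eq.refl _)
      have h3 : (S.a t < S.a t0 ∧ S.b t0 < S.b t) ∨ (S.a t0 < S.a t ∧ S.b t < S.b t0) := by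
        rcases Nat.lt_or_gt_of_ne h2 with h2 | h2
        · exact Or.inl ⟨hS.am _ _ h2 (by omega), hS.bm _ _ h2 (by omega)⟩
        · exact Or.inr ⟨hS.am _ _ h2 (by omega), hS.bm _ _ h2 (by omega)⟩
      have := h.lo t ht ht'; dsimp; split_ifs <;> omega
    · intro t ht ht' hne; have := h.up t ht ht'; dsimp; split_ifs <;> omega
  | up s0 =>
    simp only [okE] at he
    have h0 := h.up s0 he.1 he.2
    apply fin (fun i => if i = 0 then 0 else if i < S.c s0 then n + i else if i = S.c s0 then 3 * (m + n) else 6 * (m + n) + i,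
        fun j => if j = 0 then 6 * (m + n) + m else if j ≤ S.d s0 then 3 * (m + n) + S.d s0 - j else n - j)
    · simp
    · dsimp; split_ifs <;> omega
    · dsimp; split_ifs <;> omega
    · simp only [lin, val]; split_ifs <;> omega
    · intro i hi hne; dsimp; split_ifs <;> push_cast <;> omega
    · intro j hj hne; dsimp; split_ifs <;> push_cast <;> omega
    · intro t ht ht' hne; have := h.lo t ht ht'; dsimp; split_ifs <;> omega
    · intro t ht ht' hne
      have h2 : t ≠ s0 := fun h => hne (h ▸ Eq.refl _)
      have h3 : (S.c t < S.c s0 ∧ S.d s0 < S.d t) ∨ (S.c s0 < S.c t ∧ S.d t < S.d s0) := by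
        rcases Nat.lt_or_gt_of_ne h2 with h2 | h2
        · exact Or.inl ⟨hS.cm _ _ h2 (by omega), hS.dm _ _ h2 (by omega)⟩
        · exact Or.inr ⟨hS.cm _ _ h2 (by omega), hS.dm _ _ h2 (by omega)⟩
      have := h.up t ht ht'; dsimp; split_ifs <;> omega
  | _ => exact he.elim

theorem hfac (hS : S.Ok) (e : S.Et) : ∃ r, (gr hS).ev e r = 0 ∧ ∀ e', e' ≠ e → 0 < (gr hS).ev e' r := by
  obtain ⟨p, hp, h1, h2⟩ := exists_fac hS e.1 e.2
  refine ⟨S.vec p, ?_, fun e' he' => ?_⟩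
  · rw [gr_ev, lin_vec hS hp e.2, h1]
  · rw [gr_ev, lin_vec hS hp e'.2]; exact h2 _ e'.2 (fun h => he' (Subtype.ext h))

/-- extension of an edge function -/
noncomputable def ue (u : S.Et → ℤ) (e : Ed) : ℤ := by
  classical exact if h : S.okE e then u ⟨e, h⟩ else 0

theorem ue_eq (u : S.Et → ℤ) (e : S.Et) : ue u e.1 = u e := by
  simp only [ue]; rw [dif_pos e.2]

/-- accumulated potentials -/
noncomputable def ac (u : S.Et → ℤ) : Pt :=
  (fun i => ∑ i' ∈ Finset.range i, ue u (.row i'), fun j => ∑ j' ∈ Finset.Ico j S.n, ue u (.col j'))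

/-- the class of an edge function -/
noncomputable def cls (u : S.Et → ℤ) : Cl where
  l t := if t = 0 then 0 else if t = S.L then (ac u).2 0 - (ac u).1 S.m else (ac u).2 (S.b t) - (ac u).1 (S.a t) - ue u (.lo t)
  u t := if t = 0 then 0 else if t = S.K then (ac u).2 0 - (ac u).1 S.m else (ac u).2 (S.d t) - (ac u).1 (S.c t) + ue u (.up t)
  s := (ac u).2 0 - (ac u).1 S.m

theorem cls_ok (hS : S.Ok) (u : S.Et → ℤ) : (cls u).Ok S := by
  have := hS.hL; have := hS.hK
  constructor <;> simp only [cls] <;> split_ifs <;> simp_all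

theorem ac_row (u : S.Et → ℤ) (i : ℕ) : (ac u).1 (i + 1) = (ac u).1 i + ue u (.row i) := Finset.sum_range_succ _ _

theorem ac_col (u : S.Et → ℤ) {j : ℕ} (hj : j < S.n) : (ac u).2 j = ue u (.col j) + (ac u).2 (j + 1) := by
  simp only [ac]; rw [Finset.sum_eq_sum_Ico_succ_bot hj]

theorem ac_0 (u : S.Et → ℤ) : (ac u).1 0 = 0 := by simp [ac]
theorem ac_n (u : S.Et → ℤ) : (ac u).2 S.n = 0 := by simp [ac]

theorem val_cls (u : S.Et → ℤ) {e : Ed} (he : S.okE e) (p : Pt) : S.val (cls u) e p = S.lin e (p + ac u) - ue u e := by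
  cases e with
  | row i => simp only [val, lin, Prod.fst_add, Pi.add_apply, ac_row]; ring
  | col j => simp only [val, lin, Prod.snd_add, Pi.add_apply]; rw [ac_col u he]; ring
  | lo t =>
    simp only [okE] at he
    simp only [val, lin, Prod.snd_add, Prod.fst_add, Pi.add_apply, cls]
    rw [if_neg (by omega), if_neg (by omega)]; ring
  | up t =>
    simp only [okE] at he
    simp only [val, lin, Prod.snd_add, Prod.fst_add, Pi.add_apply, cls]
    rw [if_neg (by omega), if_neg (by omega)]; ring
  | _ => exact he.elim

theorem val_kap (hS : S.Ok) {e : Ed} (he : S.ok e) (p : Pt) : S.val S.kap e p = S.val (cls (S := S) (fun _ => 1)) e p := by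
  have h1 : ∀ {e}, S.okE e → ue (S := S) (fun _ => 1) e = 1 := fun {e} h => by simp only [ue]; rw [dif_pos h]
  have hA : ∀ i ≤ S.m, (ac (S := S) (fun _ => 1)).1 i = i := by
    intro i hi
    simp only [ac]
    rw [Finset.sum_congr (Eq.refl _) (fun x hx => h1 (by simp only [okE]; have := Finset.mem_range.1 hx; omega))]; simp
  have hB : ∀ j ≤ S.n, (ac (S := S) (fun _ => 1)).2 j = S.n - j := by
    intro i hi
    simp only [ac]
    rw [Finset.sum_congr (Eq.refl _) (fun x hx => h1 (by simp only [okE]; have := Finset.mem_Ico.1 hx; omega))]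
    simp; omega
  have e1 := hS.aL; have e2 := hS.b0; have := hS.d0; have := hS.cK
  cases e with
  | lo t =>
    simp only [ok] at he
    have := hS.am t S.L he.2 le_rfl
    have := hS.bm 0 t he.1 he.2.le
    simp only [val, cls, kap]
    rw [if_neg (by omega), if_neg (by omega), hA _ (by omega), hB _ (by omega), h1 (by simp only [okE]; omega)]; ring
  | up t =>
    simp only [ok] at he
    have := hS.cm t S.K he.2 le_rfl
    have := hS.dm 0 t he.1 he.2.le
    simp only [val, cls, kap]
    rw [if_neg (by omega), if_neg (by omega), hA _ (by omega), hB _ (by omega), h1 (by simp only [okE]; omega)]; ring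
  | z2 => simp only [val, cls, kap]; rw [hA _ le_rfl, hB _ (by omega)]; simp
  | z2n => simp only [val, cls, kap]; rw [hA _ le_rfl, hB _ (by omega)]; simp
  | _ => simp only [val]

/-- vector of a point in a class -/
noncomputable def ff (u : S.Et → ℤ) (x : Pt) : S.Wt → ℤ := S.vec (x + ac u - ((fun _ => x.1 0), (fun _ => x.1 0)))

/-- point of a vector -/
noncomputable def gg (u : S.Et → ℤ) (g : S.Wt → ℤ) : Pt := pt g - ac u

theorem ff_val (hS : S.Ok) (u : S.Et → ℤ) {x : Pt} (h1 : S.val (cls u) .z1 x = 0) (h2 : S.val (cls u) .z2 x = 0) (e : S.Et) :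
    (gr hS).ev e (ff u x) = S.val (cls u) e.1 x + u e := by
  rw [gr_ev, ff, lin_vec hS _ e.2, val_cls u e.2, ue_eq]
  · obtain ⟨e, he⟩ := e
    cases e <;> first | exact he.elim | (simp only [lin, val, Prod.fst_sub, Prod.snd_sub, Pi.sub_apply]; ring)
  · have h3 := ac_0 u; have h4 := ac_n u
    simp only [val, cls] at h1 h2
    constructor <;> simp only [Prod.fst_sub, Prod.snd_sub, Pi.sub_apply, Prod.fst_add, Prod.snd_add, Pi.add_apply] <;> linarith

theorem gg_val (hS : S.Ok) (u : S.Et → ℤ) (g : S.Wt → ℤ) (e : S.Et) :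
    S.val (cls u) e.1 (gg u g) = (gr hS).ev e g - u e := by
  rw [gr_ev, val_cls u e.2, ue_eq, gg, sub_add_cancel]

theorem gg_z (hS : S.Ok) (u : S.Et → ℤ) (g : S.Wt → ℤ) :
    S.val (cls u) .z1 (gg u g) = 0 ∧ S.val (cls u) .z2 (gg u g) = 0 := by
  have h3 := ac_0 u; have h4 := ac_n u
  have h := pt_pt0 hS g
  have := h.z; have := h.zn; have := h.e
  constructor <;> simp only [val, cls, gg, Prod.fst_sub, Prod.snd_sub, Pi.sub_apply] <;> linarith

theorem z_neg (γ : Cl) (x : Pt) : S.val γ .z1n x = - S.val γ .z1 x ∧ S.val γ .z2n x = - S.val γ .z2 x := by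
  constructor <;> simp only [val] <;> ring

theorem ok_cases {P : Ed → Prop} (h : ∀ e : S.Et, P e.1) (h1 : P .z1) (h2 : P .z1n) (h3 : P .z2) (h4 : P .z2n) {e : Ed}
    (he : S.ok e) : P e := by
  cases e with
  | row i => exact h ⟨.row i, he⟩
  | col i => exact h ⟨.col i, he⟩
  | lo i => exact h ⟨.lo i, he⟩
  | up i => exact h ⟨.up i, he⟩
  | _ => assumption

variable {k : Type} [Field k]

theorem TS_of_good (hS : S.Ok) (u : S.Et → ℤ)
    (h : ∀ w, (∀ e, 1 ≤ (gr hS).ev e w) → Gr.Good k (gr hS).Le ((gr hS).Qs u w)) : S.TS k (cls u) := by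
  have T : TG k (fun _ : S.Et => True) (fun e a => (gr hS).ev e a - u e) (fun e w => (gr hS).ev e w - 1) := by
    intro w hw
    obtain ⟨ne, conn, cocy⟩ := h w (fun e => by have := hw e trivial; linarith)
    have hQ : ∀ a, a ∈ Bx (fun _ : S.Et => True) (fun e a => (gr hS).ev e a - u e) (fun e w => (gr hS).ev e w - 1) w ↔
        a ∈ (gr hS).Qs u w := by
      intro a
      constructor
      · intro h e; have := h e trivial; dsimp only at this; constructor <;> linarith
      · intro h e _; have := h e; dsimp only; constructor <;> linarith
    have hL : ∀ a b, LeF (fun _ : S.Et => True) (fun e a => (gr hS).ev e a - u e) a b ↔ (gr hS).Le a b := by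
      intro a b
      constructor
      · intro h e; have := h e trivial; dsimp only at this; linarith
      · intro h e _; have := h e; dsimp only; linarith
    refine ⟨?_, ?_, ?_⟩
    · obtain ⟨a, ha⟩ := ne; exact ⟨a, (hQ a).2 ha⟩
    · intro χ hχ a ha b hb
      exact conn χ (fun a ha b hb hab => hχ a ((hQ _).2 ha) b ((hQ _).2 hb) ((hL _ _).2 hab)) a ((hQ _).1 ha) b ((hQ _).1 hb)
    · intro φ hφ a ha b hb c hc d hd hac had hbc hbd
      obtain ⟨p, hp⟩ := cocy φ (fun a ha b hb c hc hab hbc => hφ a ((hQ _).2 ha) b ((hQ _).2 hb) c ((hQ _).2 hc)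
        ((hL _ _).2 hab) ((hL _ _).2 hbc))
      simp only [hQ, hL] at *
      rw [hp a ha c hc hac, hp b hb d hd hbd, hp a ha d hd had, hp b hb c hc hbc]; ring
  unfold Sh.TS
  refine T.trans ?_
  intro ε hε
  have z1 := hε .z1 trivial
  have z1n := hε .z1n trivial
  have z2 := hε .z2 trivial
  have z2n := hε .z2n trivial
  have hk1 : S.val S.kap .z1 ε = 0 := by have := (z_neg (S := S) S.kap ε).1; omega
  have hk2 : S.val S.kap .z2 ε = 0 := by have := (z_neg (S := S) S.kap ε).2; omega
  have hbz : ∀ x ∈ Bx S.ok (S.val (cls u)) (S.val S.kap) ε, S.val (cls u) .z1 x = 0 ∧ S.val (cls u) .z2 x = 0 := by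
    intro x hx
    have h1 := hx .z1 trivial
    have h2 := hx .z2 trivial
    omega
  have hw : ∀ e : S.Et, (gr hS).ev e (ff (fun _ => 1) ε) - 1 = S.val S.kap e.1 ε := by
    intro e
    rw [ff_val hS _ ((val_kap hS (e := .z1) trivial ε).symm.trans hk1) ((val_kap hS (e := .z2) trivial ε).symm.trans hk2), val_kap hS (okE_ok e.2)]; ring
  refine ⟨ff (fun _ => 1) ε, fun e _ => ?_, ff u, gg u, ?_, ?_, ?_, ?_, ?_⟩
  · rw [hw]; exact hε _ (okE_ok e.2)
  · intro x hx e _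
    have := hbz x hx
    dsimp only
    rw [ff_val hS u this.1 this.2, hw, add_sub_cancel_right]
    exact hx _ (okE_ok e.2)
  · intro a ha e he
    refine ok_cases (P := fun e => 0 ≤ S.val (cls u) e (gg u a) ∧ S.val (cls u) e (gg u a) ≤ S.val S.kap e ε) ?_ ?_ ?_ ?_ ?_ he
    · intro e
      have := ha e trivial
      dsimp only at this
      rw [gg_val, ← hw]; exact this
    · rw [(gg_z hS u a).1]; exact ⟨le_rfl, z1⟩
    · rw [(z_neg _ _).1, (gg_z hS u a).1, neg_zero]; exact ⟨le_rfl, z1n⟩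
    · rw [(gg_z hS u a).2]; exact ⟨le_rfl, z2⟩
    · rw [(z_neg _ _).2, (gg_z hS u a).2, neg_zero]; exact ⟨le_rfl, z2n⟩
  · intro x hx y hy hxy e _
    have h1 := hbz x hx; have h2 := hbz y hy
    dsimp only
    rw [ff_val hS u h1.1 h1.2, ff_val hS u h2.1 h2.2]
    have := hxy e.1 (okE_ok e.2); linarith
  · intro a ha b hb hab e he
    refine ok_cases (P := fun e => S.val (cls u) e (gg u a) ≤ S.val (cls u) e (gg u b)) ?_ ?_ ?_ ?_ ?_ he
    · intro e; rw [gg_val, gg_val]; exact hab e trivial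
    · rw [(gg_z hS u a).1, (gg_z hS u b).1]
    · rw [(z_neg _ _).1, (z_neg _ _).1, (gg_z hS u a).1, (gg_z hS u b).1]
    · rw [(gg_z hS u a).2, (gg_z hS u b).2]
    · rw [(z_neg _ _).2, (z_neg _ _).2, (gg_z hS u a).2, (gg_z hS u b).2]
  · intro x hx
    have h1 := hbz x hx
    have key : ∀ e, S.ok e → S.val (cls u) e (gg u (ff u x)) = S.val (cls u) e x := by
      intro e he
      refine ok_cases (P := fun e => S.val (cls u) e (gg u (ff u x)) = S.val (cls u) e x) ?_ ?_ ?_ ?_ ?_ he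
      · intro e; rw [gg_val hS, ff_val hS u h1.1 h1.2]; ring
      · rw [(gg_z hS u _).1, h1.1]
      · rw [(z_neg _ _).1, (z_neg _ _).1, (gg_z hS u _).1, h1.1]
      · rw [(gg_z hS u _).2, h1.2]
      · rw [(z_neg _ _).2, (z_neg _ _).2, (gg_z hS u _).2, h1.2]
    exact ⟨fun e he => (key e he).le, fun e he => (key e he).ge⟩

theorem cls_eq (hS : S.Ok) {u u' : S.Et → ℤ} (h1 : ∀ t ≤ S.L, (cls u).l t = (cls u').l t) (h2 : ∀ t ≤ S.K, (cls u).u t = (cls u').u t) :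
    ∃ a0, ∀ e, u e = (gr hS).ev e a0 + u' e := by
  have hL := hS.hL
  refine ⟨S.vec (ac u - ac u'), fun e => ?_⟩
  rw [gr_ev, lin_vec hS _ e.2]
  · obtain ⟨e, he⟩ := e
    have e1 := ue_eq u ⟨e, he⟩
    have e2 := ue_eq u' ⟨e, he⟩
    dsimp only at e1 e2 ⊢
    rw [← e1, ← e2]
    cases e with
    | row i => simp only [lin, val, Prod.fst_sub, Pi.sub_apply, ac_row]; ring
    | col j => simp only [lin, val, Prod.snd_sub, Pi.sub_apply]; rw [ac_col u he, ac_col u' he]; ring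
    | lo t =>
      have := h1 t he.2.le
      simp only [okE] at he
      simp only [cls] at this
      rw [if_neg (by omega), if_neg (by omega), if_neg (by omega), if_neg (by omega)] at this
      simp only [lin, val, Prod.fst_sub, Prod.snd_sub, Pi.sub_apply]; linarith
    | up t =>
      have := h2 t he.2.le
      simp only [okE] at he
      simp only [cls] at this
      rw [if_neg (by omega), if_neg (by omega), if_neg (by omega), if_neg (by omega)] at this
      simp only [lin, val, Prod.fst_sub, Prod.snd_sub, Pi.sub_apply]; linarith
    | _ => exact he.elim
  · have h3 := ac_0 u; have h4 := ac_n u; have h5 := ac_0 u'; have h6 := ac_n u'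
    have := h1 S.L le_rfl
    simp only [cls, if_true] at this
    rw [if_neg (by omega), if_neg (by omega)] at this
    constructor <;> simp only [Prod.fst_sub, Prod.snd_sub, Pi.sub_apply] <;> linarith

/-- the two possible classes -/
theorem two_cls (hS : S.Ok) [IsNoetherianRing (AddMonoidAlgebra k (gr hS).sig)] {u : S.Et → ℤ}
    (d : SD (AddMonoidAlgebra k (gr hS).sig) (RM k ((gr hS).Breg u))) :
    ((∀ t ≤ S.L, (cls u).l t = 0) ∧ (∀ t ≤ S.K, (cls u).u t = 0)) ∨
    ((∀ t ≤ S.L, (cls u).l t = S.kap.l t) ∧ (∀ t ≤ S.K, (cls u).u t = S.kap.u t)) :=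
  two_classes hS (cls_ok hS u) (TS_of_good hS u (fun w hw => (gr hS).good_box (hfac hS) d w hw))

end Sh
end SDP

set_option linter.unusedVariables false
set_option linter.unusedSectionVars false
set_option maxHeartbeats 1000000
set_option synthInstance.maxHeartbeats 1000000

namespace SDP

/-- the cells of a shape -/
def Sh.cells (S : Sh) : Set (ℕ × ℕ) := {p | 1 ≤ p.1 ∧ p.1 ≤ S.m ∧ 1 ≤ p.2 ∧ p.2 ≤ S.n ∧
  (∀ t, 0 < t → t < S.L → ¬ (p.1 ≤ S.a t ∧ p.2 ≤ S.b t)) ∧ ∀ s, 0 < s → s < S.K → ¬ (S.c s < p.1 ∧ S.d s < p.2)}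

section Ladder
open LadderDet
variable {m n : ℕ} {Y : Set (ℕ × ℕ)}

/-- rows weakly left and columns weakly above are empty -/
def NW (m n : ℕ) (Y : Set (ℕ × ℕ)) (i j : ℕ) : Prop :=
  1 ≤ i ∧ i ≤ m ∧ 1 ≤ j ∧ j ≤ n ∧ (∀ j', (i, j') ∈ Y → j < j') ∧ (∀ i', (i', j) ∈ Y → i < i')

def SE (m n : ℕ) (Y : Set (ℕ × ℕ)) (i j : ℕ) : Prop :=
  1 ≤ i ∧ i ≤ m ∧ 1 ≤ j ∧ j ≤ n ∧ (∀ j', (i, j') ∈ Y → j' < j) ∧ (∀ i', (i', j) ∈ Y → i' < i)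

theorem lad_grid (hY : StdLadder m n Y) {i j : ℕ} (h : (i, j) ∈ Y) : 1 ≤ i ∧ i ≤ m ∧ 1 ≤ j ∧ j ≤ n := hY.1.1 _ h

theorem lad_sw (hY : StdLadder m n Y) {i j p q : ℕ} (h : (i, j) ∈ Y) (h' : (p, q) ∈ Y) (h1 : i ≤ p) (h2 : j ≤ q) :
    (i, q) ∈ Y ∧ (p, j) ∈ Y := hY.1.2 _ _ _ _ h h' h1 h2

theorem tri (hY : StdLadder m n Y) {i j : ℕ} (h : 1 ≤ i ∧ i ≤ m ∧ 1 ≤ j ∧ j ≤ n) : (i, j) ∈ Y ∨ NW m n Y i j ∨ SE m n Y i j := by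
  by_cases hij : (i, j) ∈ Y
  · exact Or.inl hij
  right
  obtain ⟨j1, hj1⟩ := hY.2.2.2.1 i h.1 h.2.1
  have hne : ∀ j', (i, j') ∈ Y → j' ≠ j := fun j' h' e => hij (e ▸ h')
  have hne' : ∀ i', (i', j) ∈ Y → i' ≠ i := fun j' h' e => hij (e ▸ h')
  obtain ⟨i1, hi1⟩ := hY.2.2.2.2 j h.2.2.1 h.2.2.2
  have A : ∀ j', (i, j') ∈ Y → ∀ i', (i', j) ∈ Y → ¬ (j < j' ∧ i' < i) := fun j' h1 i' h2 h3 =>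
    hij (lad_sw hY h2 h1 (by omega) (by omega)).2
  have B : ∀ j', (i, j') ∈ Y → ∀ i', (i', j) ∈ Y → ¬ (j' < j ∧ i < i') := fun j' h1 i' h2 h3 =>
    hij (lad_sw hY h1 h2 (by omega) (by omega)).1
  rcases Nat.lt_or_gt_of_ne (hne _ hj1) with h1 | h1
  · right
    have h2 : ∀ i', (i', j) ∈ Y → i' < i := fun i' hi' => by
      have := B _ hj1 _ hi'; have := hne' _ hi'; omega
    refine ⟨h.1, h.2.1, h.2.2.1, h.2.2.2, fun j' hj' => ?_, h2⟩
    have := A _ hj' _ hi1; have := hne _ hj'; have := h2 _ hi1; omega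
  · left
    have h2 : ∀ i', (i', j) ∈ Y → i < i' := fun i' hi' => by
      have := A _ hj1 _ hi'; have := hne' _ hi'; omega
    refine ⟨h.1, h.2.1, h.2.2.1, h.2.2.2, fun j' hj' => ?_, h2⟩
    have := B _ hj' _ hi1; have := hne _ hj'; have := h2 _ hi1; omega

theorem NW.down (hY : StdLadder m n Y) {i j p q : ℕ} (h : NW m n Y i j) (hp : p ≤ i) (hq : q ≤ j) : (p, q) ∉ Y := by
  obtain ⟨h1, h2, h3, h4, h5, h6⟩ := h
  intro hY'
  obtain ⟨j', hj'⟩ := hY.2.2.2.1 i h1 h2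
  have := h5 _ hj'
  have := h5 _ (lad_sw hY hY' hj' hp (by omega)).2
  omega

theorem SE.upw (hY : StdLadder m n Y) {i j p q : ℕ} (h : SE m n Y i j) (hp : i ≤ p) (hq : j ≤ q) : (p, q) ∉ Y := by
  obtain ⟨h1, h2, h3, h4, h5, h6⟩ := h
  intro hY'
  obtain ⟨j', hj'⟩ := hY.2.2.2.1 i h1 h2
  have := h5 _ hj'
  have := h5 _ (lad_sw hY hj' hY' hp (by omega)).1
  omega

theorem lc_NW (hY : StdLadder m n Y) {α β : ℕ} (h : IsLowerCorner Y (α, β)) : NW m n Y (α - 1) (β - 1) := by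
  obtain ⟨h1, h2, h3, h4⟩ := h
  dsimp only at h2 h3 h4
  have g1 := lad_grid hY h1; have g2 := lad_grid hY h2; have g3 := lad_grid hY h3
  rcases tri hY (i := α - 1) (j := β - 1) (by omega) with h | h | h
  · exact (h4 h).elim
  · exact h
  · have := h.2.2.2.2.1 _ h2; omega

theorem uc_SE (hY : StdLadder m n Y) {α β : ℕ} (h : IsUpperCorner Y (α, β)) : SE m n Y (α + 1) (β + 1) := by
  obtain ⟨h1, h2, h3, h4⟩ := h
  dsimp only at h2 h3 h4
  have g1 := lad_grid hY h1; have g2 := lad_grid hY h2; have g3 := lad_grid hY h3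
  rcases tri hY (i := α + 1) (j := β + 1) (by omega) with h | h | h
  · exact (h4 h).elim
  · have := h.2.2.2.2.1 _ h2; omega
  · exact h

/-- a crossing of the two missing regions disconnects -/
theorem no_cross (hY : StdLadder m n Y) (hc : TConnected m n 2 Y) {i j : ℕ} (h : NW m n Y i j) : ¬ SE m n Y (i + 1) (j + 1) := by
  intro h'
  apply hc
  obtain ⟨j1, hj1⟩ := hY.2.2.2.1 i h.1 h.2.1
  obtain ⟨j2, hj2⟩ := hY.2.2.2.1 (i + 1) h'.1 h'.2.1
  refine ⟨{p | p ∈ Y ∧ p.1 ≤ i}, {p | p ∈ Y ∧ i < p.1}, ⟨_, hj1, le_rfl⟩, ⟨_, hj2, Nat.lt_succ_self i⟩, ?_, ?_, ?_, ?_, ?_⟩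
  · refine ⟨fun p hp => hY.1.1 p hp.1, fun i j p q h1 h2 h3 h4 => ?_⟩
    have := lad_sw hY h1.1 h2.1 h3 h4
    exact ⟨⟨this.1, h1.2⟩, ⟨this.2, h2.2⟩⟩
  · refine ⟨fun p hp => hY.1.1 p hp.1, fun i j p q h1 h2 h3 h4 => ?_⟩
    have := lad_sw hY h1.1 h2.1 h3 h4
    exact ⟨⟨this.1, h1.2⟩, ⟨this.2, h2.2⟩⟩
  · ext p
    simp only [Set.mem_inter_iff, Set.mem_setOf_eq, Set.mem_empty_iff_false, iff_false]
    omega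
  · ext p
    simp only [Set.mem_union, Set.mem_setOf_eq]
    rcases Nat.lt_or_ge i p.1 with h | h
    · simp [h]
    · simp [h]
  · rintro M ⟨r, c, hr, hcs, hrc, rfl⟩
    have hr1 : r 0 < r 1 := hr (by decide)
    by_cases h1 : r 1 ≤ i
    · left
      rintro _ ⟨u, v, rfl⟩
      refine ⟨hrc u v, ?_⟩
      have : r u ≤ r 1 := hr.monotone (Fin.le_last u)
      dsimp only; omega
    by_cases h0 : i < r 0
    · right
      rintro _ ⟨u, v, rfl⟩
      refine ⟨hrc u v, ?_⟩
      have : r 0 ≤ r u := hr.monotone (Fin.zero_le u)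
      dsimp only; omega
    · exfalso
      rcases Nat.lt_or_ge j (c 0) with h2 | h2
      · exact h'.upw hY (by omega) h2 (hrc 1 0)
      · exact h.down hY (by omega) h2 (hrc 0 0)

theorem exists_lc (hY : StdLadder m n Y) (hc : TConnected m n 2 Y) {i j : ℕ} (h : NW m n Y i j) :
    ∃ α β, IsLowerCorner Y (α, β) ∧ i < α ∧ j < β := by
  classical
  induction hN : m + n - (i + j) using Nat.strong_induction_on generalizing i j with
  | _ N ih =>
    obtain ⟨i1, hi1⟩ := hY.2.2.2.2 j h.2.2.1 h.2.2.2.1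
    obtain ⟨j1, hj1⟩ := hY.2.2.2.1 i h.1 h.2.1
    have g1 := lad_grid hY hi1; have g2 := lad_grid hY hj1
    have l1 := h.2.2.2.2.2 _ hi1; have l2 := h.2.2.2.2.1 _ hj1
    have := h.1; have := h.2.2.1
    rcases tri hY (i := i + 1) (j := j) (by omega) with h1 | h1 | h1
    · rcases tri hY (i := i) (j := j + 1) (by omega) with h2 | h2 | h2
      · rcases tri hY (i := i + 1) (j := j + 1) (by omega) with h3 | h3 | h3
        · exact ⟨i + 1, j + 1, ⟨h3, h2, h1, h.down hY le_rfl le_rfl⟩, by omega, by omega⟩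
        · have := h3.2.2.2.2.1 _ h1; omega
        · exact (no_cross hY hc h h3).elim
      · obtain ⟨α, β, h3, h4, h5⟩ := ih _ (by omega) h2 (Eq.refl _)
        exact ⟨α, β, h3, by omega, by omega⟩
      · have := h2.2.2.2.2.1 _ hj1; omega
    · obtain ⟨α, β, h3, h4, h5⟩ := ih _ (by omega) h1 (Eq.refl _)
      exact ⟨α, β, h3, by omega, by omega⟩
    · have := h1.2.2.2.2.2 _ hi1; omega

theorem exists_uc (hY : StdLadder m n Y) (hc : TConnected m n 2 Y) {i j : ℕ} (h : SE m n Y i j) :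
    ∃ α β, IsUpperCorner Y (α, β) ∧ α < i ∧ β < j := by
  classical
  induction hN : i + j using Nat.strong_induction_on generalizing i j with
  | _ N ih =>
    obtain ⟨i1, hi1⟩ := hY.2.2.2.2 j h.2.2.1 h.2.2.2.1
    obtain ⟨j1, hj1⟩ := hY.2.2.2.1 i h.1 h.2.1
    have g1 := lad_grid hY hi1; have g2 := lad_grid hY hj1
    have l1 := h.2.2.2.2.2 _ hi1; have l2 := h.2.2.2.2.1 _ hj1
    have := h.2.1; have := h.2.2.2.1
    obtain ⟨i, rfl⟩ : ∃ x, i = x + 1 := ⟨i - 1, by omega⟩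
    obtain ⟨j, rfl⟩ : ∃ x, j = x + 1 := ⟨j - 1, by omega⟩
    rcases tri hY (i := i) (j := j + 1) (by omega) with h1 | h1 | h1
    · rcases tri hY (i := i + 1) (j := j) (by omega) with h2 | h2 | h2
      · rcases tri hY (i := i) (j := j) (by omega) with h3 | h3 | h3
        · exact ⟨i, j, ⟨h3, h2, h1, h.upw hY le_rfl le_rfl⟩, by omega, by omega⟩
        · exact (no_cross hY hc h3 h).elim
        · have := h3.2.2.2.2.1 _ h1; omega
      · have := h2.2.2.2.2.1 _ hj1; omega
      · obtain ⟨α, β, h3, h4, h5⟩ := ih _ (by omega) h2 (Eq.refl _)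
        exact ⟨α, β, h3, by omega, by omega⟩
    · have := h1.2.2.2.2.2 _ hi1; omega
    · obtain ⟨α, β, h3, h4, h5⟩ := ih _ (by omega) h1 (Eq.refl _)
      exact ⟨α, β, h3, by omega, by omega⟩

theorem lc_anti (hY : StdLadder m n Y) {α β α' β' : ℕ} (h : IsLowerCorner Y (α, β)) (h' : IsLowerCorner Y (α', β'))
    (hl : α ≤ α') : (α = α' ∧ β = β') ∨ (α < α' ∧ β' < β) := by
  have n1 := lc_NW hY h; have n2 := lc_NW hY h'
  obtain ⟨h1, h2, h3, -⟩ := h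
  obtain ⟨h1', h2', h3', -⟩ := h'
  dsimp only at *
  have g := lad_grid hY h1; have g2 := lad_grid hY h2; have g3 := lad_grid hY h3
  rcases Nat.lt_or_ge α α' with h | h
  · rcases Nat.lt_or_ge β' β with h4 | h4
    · exact Or.inr ⟨h, h4⟩
    · exact (n2.down hY (p := α) (q := β - 1) (by omega) (by omega) h3).elim
  · have : α = α' := by omega
    subst this
    rcases Nat.lt_trichotomy β β' with h4 | h4 | h4
    · exact (n2.down hY (p := α - 1) (q := β) (by omega) (by omega) h2).elim
    · exact Or.inl ⟨Eq.refl _, h4⟩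
    · exact (n1.down hY (p := α - 1) (q := β') (by omega) (by omega) h2').elim

theorem uc_anti (hY : StdLadder m n Y) {α β α' β' : ℕ} (h : IsUpperCorner Y (α, β)) (h' : IsUpperCorner Y (α', β'))
    (hl : α ≤ α') : (α = α' ∧ β = β') ∨ (α < α' ∧ β' < β) := by
  have n1 := uc_SE hY h; have n2 := uc_SE hY h'
  obtain ⟨h1, h2, h3, -⟩ := h
  obtain ⟨h1', h2', h3', -⟩ := h'
  dsimp only at *
  rcases Nat.lt_or_ge α α' with h | h
  · rcases Nat.lt_or_ge β' β with h4 | h4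
    · exact Or.inr ⟨h, h4⟩
    · exact (n1.upw hY (p := α') (q := β' + 1) (by omega) (by omega) h3').elim
  · have : α = α' := by omega
    subst this
    rcases Nat.lt_trichotomy β β' with h4 | h4 | h4
    · exact (n1.upw hY (p := α + 1) (q := β') (by omega) (by omega) h2').elim
    · exact Or.inl ⟨Eq.refl _, h4⟩
    · exact (n2.upw hY (p := α + 1) (q := β) (by omega) (by omega) h2).elim

/-- enumeration of corners -/
theorem exists_enum (P : ℕ → ℕ → Prop) (N : ℕ) (hb : ∀ α β, P α β → α ≤ N) (hne : ∃ α β, P α β)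
    (anti : ∀ α β α' β', P α β → P α' β' → α ≤ α' → (α = α' ∧ β = β') ∨ (α < α' ∧ β' < β)) :
    ∃ (L : ℕ) (f g : ℕ → ℕ), 2 ≤ L ∧ (∀ t, 0 < t → t < L → P (f t) (g t)) ∧
      (∀ α β, P α β → ∃ t, 0 < t ∧ t < L ∧ f t = α ∧ g t = β) ∧
      (∀ s t, 0 < s → s < t → t < L → f s < f t ∧ g t < g s) := by
  classical
  obtain ⟨p, hp⟩ : ∃ p : ℕ → Prop, p = fun α => ∃ β, P α β := ⟨_, Eq.refl _⟩
  have hfin : {α | p α}.Finite := by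
    rw [hp]; exact (Set.finite_le_nat N).subset (fun α ⟨β, h⟩ => hb α β h)
  have hch : ∀ α, ∃ β, (∃ β, P α β) → P α β := fun α => by
    by_cases h : ∃ β, P α β
    · obtain ⟨β, h⟩ := h; exact ⟨β, fun _ => h⟩
    · exact ⟨0, fun h' => (h h').elim⟩
  choose γ hγ using hch
  obtain ⟨N0, hN0⟩ : ∃ N, N = hfin.toFinset.card := ⟨_, Eq.refl _⟩
  have hmem : ∀ t, 0 < t → t < N0 + 1 → P (Nat.nth p (t - 1)) (γ (Nat.nth p (t - 1))) := fun t h1 h2 =>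
    hγ _ (by have := Nat.nth_mem_of_lt_card hfin (n := t - 1) (by omega); rw [hp] at this ⊢; exact this)
  refine ⟨N0 + 1, fun t => Nat.nth p (t - 1), fun t => γ (Nat.nth p (t - 1)), ?_, hmem, ?_, ?_⟩
  · obtain ⟨α, β, h⟩ := hne
    have : 0 < N0 := by rw [hN0]; exact Finset.card_pos.2 ⟨α, hfin.mem_toFinset.2 (by rw [hp]; exact ⟨β, h⟩)⟩
    omega
  · intro α β h
    obtain ⟨t, ht, e⟩ := Nat.exists_lt_card_finite_nth_eq hfin (show p α by rw [hp]; exact ⟨β, h⟩)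
    refine ⟨t + 1, by omega, by omega, ?_, ?_⟩
    · simpa using e
    · have := hmem (t + 1) (by omega) (by omega)
      simp only [Nat.add_sub_cancel] at this ⊢
      rw [e] at this ⊢
      rcases anti _ _ _ _ this h le_rfl with h | h
      · exact h.2
      · omega
  · intro s t h0 hst ht
    have h1 := Nat.nth_strictMonoOn hfin (show s - 1 ∈ Set.Iio hfin.toFinset.card from Set.mem_Iio.2 (by omega))
      (show t - 1 ∈ Set.Iio hfin.toFinset.card from Set.mem_Iio.2 (by omega)) (by omega)
    change Nat.nth p (s - 1) < Nat.nth p (t - 1) at h1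
    refine ⟨h1, ?_⟩
    rcases anti _ _ _ _ (hmem s h0 (by omega)) (hmem t (by omega) ht) h1.le with h | h
    · omega
    · exact h.2

theorem exists_shape (hY : StdLadder m n Y) (hc : TConnected m n 2 Y) (h2 : TwoSided Y)
    (hth : ∀ p q : ℕ × ℕ, IsLowerCorner Y p → IsUpperCorner Y q → p.1 ≤ q.1 ∧ p.2 ≤ q.2 ∧ p ≠ q) :
    ∃ S : Sh, S.Ok ∧ Y = S.cells := by
  obtain ⟨-, ⟨⟨α0, β0⟩, hl0⟩, ⟨⟨γ0, δ0⟩, hu0⟩⟩ := h2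
  have lg : ∀ α β, IsLowerCorner Y (α, β) → 2 ≤ α ∧ 2 ≤ β ∧ α + 1 ≤ m ∧ β + 1 ≤ n := by
    intro α β h
    have h1 := lc_NW hY h
    have h2 := hth _ _ h hu0
    have g2 := lad_grid hY hu0.2.1; have g3 := lad_grid hY hu0.2.2.1
    have := h1.1; have := h1.2.2.1
    dsimp only at *
    omega
  have ug : ∀ α β, IsUpperCorner Y (α, β) → 2 ≤ α ∧ 2 ≤ β ∧ α + 1 ≤ m ∧ β + 1 ≤ n := by
    intro α β h
    have h2 := hth _ _ hl0 h
    have g1 := lg _ _ hl0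
    have g2 := lad_grid hY h.2.1; have g3 := lad_grid hY h.2.2.1
    dsimp only at *
    omega
  obtain ⟨L, f, g, hL, hP, hs, hm⟩ := exists_enum (fun α β => IsLowerCorner Y (α, β)) m (fun α β h => by have := lg α β h; omega)
    ⟨α0, β0, hl0⟩ (fun α β α' β' h h' hl => lc_anti hY h h' hl)
  obtain ⟨K, f', g', hK, hP', hs', hm'⟩ := exists_enum (fun α β => IsUpperCorner Y (α, β)) m (fun α β h => by have := ug α β h; omega)
    ⟨γ0, δ0, hu0⟩ (fun α β α' β' h h' hl => uc_anti hY h h' hl)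
  have G := lg _ _ hl0
  let S : Sh := ⟨m, n, L, K, fun t => if t = 0 then 0 else if t = L then m - 1 else f t - 1,
    fun t => if t = 0 then n - 1 else if t = L then 0 else g t - 1, fun t => if t = 0 then 1 else if t = K then m else f' t,
    fun t => if t = 0 then n else if t = K then 1 else g' t⟩
  have Sa : ∀ t, 0 < t → t < L → S.a t = f t - 1 ∧ S.b t = g t - 1 := fun t h1 h2 => by
    simp only [S]; rw [if_neg (by omega), if_neg (by omega), if_neg (by omega), if_neg (by omega)]; simp
  have Sc : ∀ t, 0 < t → t < K → S.c t = f' t ∧ S.d t = g' t := fun t h1 h2 => by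
    simp only [S]; rw [if_neg (by omega), if_neg (by omega), if_neg (by omega), if_neg (by omega)]; simp
  have hPg : ∀ t, 0 < t → t < L → 2 ≤ f t ∧ 2 ≤ g t ∧ f t + 1 ≤ m ∧ g t + 1 ≤ n := fun t h1 h2 => lg _ _ (hP t h1 h2)
  have hPg' : ∀ t, 0 < t → t < K → 2 ≤ f' t ∧ 2 ≤ g' t ∧ f' t + 1 ≤ m ∧ g' t + 1 ≤ n := fun t h1 h2 => ug _ _ (hP' t h1 h2)
  have hthk : ∀ t s, 0 < t → t < L → 0 < s → s < K → f t ≤ f' s ∧ g t ≤ g' s ∧ ¬ (f t = f' s ∧ g t = g' s) := by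
    intro t s h1 h2 h3 h4
    have := hth _ _ (hP t h1 h2) (hP' s h3 h4)
    exact ⟨this.1, this.2.1, fun h => this.2.2 (Prod.ext h.1 h.2)⟩
  refine ⟨S, ⟨hL, hK, ?_, ?_, ?_, ?_, ?_, ?_, ?_, ?_, ?_, ?_, ?_, ?_, ?_, ?_, ?_⟩, ?_⟩
  · intro s t hst (ht : t ≤ L)
    simp only [S]
    by_cases h1 : s = 0 <;> by_cases h2 : t = L
    · rw [if_pos h1, if_neg (by omega), if_pos h2]; omega
    · have := hPg t (by omega) (by omega)
      rw [if_pos h1, if_neg (by omega), if_neg h2]; omega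
    · have := hPg s (by omega) (by omega)
      rw [if_neg h1, if_neg (by omega), if_neg (by omega), if_pos h2]; omega
    · have := hPg s (by omega) (by omega); have := hm s t (by omega) hst (by omega)
      rw [if_neg h1, if_neg (by omega), if_neg (by omega), if_neg (by omega)]; omega
  · intro s t hst (ht : t ≤ L)
    simp only [S]
    by_cases h1 : s = 0 <;> by_cases h2 : t = L
    · rw [if_neg (by omega), if_pos h2, if_pos h1]; omega
    · have := hPg t (by omega) (by omega)
      rw [if_neg (by omega), if_neg h2, if_pos h1]; omega
    · have := hPg s (by omega) (by omega)
      rw [if_neg (by omega), if_pos h2, if_neg h1, if_neg (by omega)]; omega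
    · have := hPg t (by omega) (by omega); have := hm s t (by omega) hst (by omega)
      rw [if_neg (by omega), if_neg h2, if_neg h1, if_neg (by omega)]; omega
  · intro s t hst (ht : t ≤ K)
    simp only [S]
    by_cases h1 : s = 0 <;> by_cases h2 : t = K
    · rw [if_pos h1, if_neg (by omega), if_pos h2]; omega
    · have := hPg' t (by omega) (by omega)
      rw [if_pos h1, if_neg (by omega), if_neg h2]; omega
    · have := hPg' s (by omega) (by omega)
      rw [if_neg h1, if_neg (by omega), if_neg (by omega), if_pos h2]; omega
    · have := hPg' s (by omega) (by omega); have := hm' s t (by omega) hst (by omega)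
      rw [if_neg h1, if_neg (by omega), if_neg (by omega), if_neg (by omega)]; omega
  · intro s t hst (ht : t ≤ K)
    simp only [S]
    by_cases h1 : s = 0 <;> by_cases h2 : t = K
    · rw [if_neg (by omega), if_pos h2, if_pos h1]; omega
    · have := hPg' t (by omega) (by omega)
      rw [if_neg (by omega), if_neg h2, if_pos h1]; omega
    · have := hPg' s (by omega) (by omega)
      rw [if_neg (by omega), if_pos h2, if_neg h1, if_neg (by omega)]; omega
    · have := hPg' t (by omega) (by omega); have := hm' s t (by omega) hst (by omega)
      rw [if_neg (by omega), if_neg h2, if_neg h1, if_neg (by omega)]; omega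
  · simp [S]
  · simp [S]; omega
  · simp only [S]; rw [if_neg (by omega)]; simp; omega
  · simp only [S]; rw [if_neg (by omega)]; simp
  · simp [S]
  · simp [S]
  · simp only [S]; rw [if_neg (by omega)]; simp
  · simp only [S]; rw [if_neg (by omega)]; simp
  · intro t s h1 h2 h3 h4
    rw [(Sa t h1 h2).1, (Sc s h3 h4).1]; have := hthk t s h1 h2 h3 h4; have := hPg t h1 h2; omega
  · intro t s h1 h2 h3 h4
    rw [(Sa t h1 h2).2, (Sc s h3 h4).2]; have := hthk t s h1 h2 h3 h4; have := hPg t h1 h2; omega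
  · intro t s h1 h2 h3 h4
    rw [(Sa t h1 h2).1, (Sa t h1 h2).2, (Sc s h3 h4).1, (Sc s h3 h4).2]
    have := hthk t s h1 h2 h3 h4; have := hPg t h1 h2; omega
  · ext ⟨i, j⟩
    constructor
    · intro h
      have gr := lad_grid hY h
      refine ⟨gr.1, gr.2.1, gr.2.2.1, gr.2.2.2, ?_, ?_⟩
      · intro t h1 (h2 : t < L)
        rw [(Sa t h1 h2).1, (Sa t h1 h2).2]
        intro h3
        exact (lc_NW hY (hP t h1 h2)).down hY h3.1 h3.2 h
      · intro t h1 (h2 : t < K)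
        rw [(Sc t h1 h2).1, (Sc t h1 h2).2]
        intro h3
        exact (uc_SE hY (hP' t h1 h2)).upw hY h3.1 h3.2 h
    · rintro ⟨h1, h2, h3, h4, h5, h6⟩
      rcases tri hY (i := i) (j := j) ⟨h1, h2, h3, h4⟩ with h | h | h
      · exact h
      · exfalso
        obtain ⟨α, β, h7, h8, h9⟩ := exists_lc hY hc h
        obtain ⟨t, t1, t2, t3, t4⟩ := hs α β h7
        apply h5 t t1 t2
        rw [(Sa t t1 t2).1, (Sa t t1 t2).2]; dsimp only; omega
      · exfalso
        obtain ⟨α, β, h7, h8, h9⟩ := exists_uc hY hc h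
        obtain ⟨t, t1, t2, t3, t4⟩ := hs' α β h7
        apply h6 t t1 t2
        rw [(Sc t t1 t2).1, (Sc t t1 t2).2]; dsimp only; omega

end Ladder
end SDP

set_option linter.unusedVariables false
set_option linter.unusedSectionVars false
set_option maxHeartbeats 1000000
set_option synthInstance.maxHeartbeats 1000000

namespace SDP
namespace Sh
variable {S : Sh}

/-- potentials of a cell -/
def cp (p : ℕ × ℕ) : Pt := (fun i => if p.1 ≤ i then 1 else 0, fun j => if j < p.2 then 1 else 0)

theorem cp_pt0 {p : ℕ × ℕ} (hp : p ∈ S.cells) : Pt0 S (cp p) := by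
  obtain ⟨h1, h2, h3, h4, -, -⟩ := hp
  constructor
  · simp only [cp]; rw [if_neg (by omega)]
  · simp only [cp]; rw [if_neg (by omega)]
  · simp only [cp]; rw [if_pos (by omega), if_pos (by omega)]

theorem mem_sig_iff (hS : S.Ok) {g : S.Wt → ℤ} : g ∈ (gr hS).sig ↔ ∀ e, S.okE e → 0 ≤ S.lin e (pt g) := by
  constructor
  · intro h e he
    rw [← gr_ev hS ⟨e, he⟩]; exact h _
  · intro h e
    rw [gr_ev hS]; exact h _ e.2

theorem pt_inj (hS : S.Ok) {g g' : S.Wt → ℤ} (h1 : ∀ i ≤ S.m, (pt g).1 i = (pt g').1 i)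
    (h2 : ∀ j ≤ S.n, (pt g).2 j = (pt g').2 j) : g = g' := by
  have hmn := hS.mn
  funext w
  have hw := w.2
  by_cases h : w.1 + 1 ≤ S.m
  · have := h1 _ h
    simpa [pt, nA, nd, Gr.gv, show w.1 + 1 < S.m + S.n by omega] using this
  · have := h2 (w.1 + 1 - S.m) (by omega)
    have e1 : ¬ (w.1 + 1 - S.m = 0) := by omega
    have e2 : w.1 + 1 - S.m < S.n := by omega
    have e3 : S.m + (w.1 + 1 - S.m) = w.1 + 1 := by omega
    simp only [pt, nB, if_neg e1, if_pos e2, e3, nd] at this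
    simpa [Gr.gv, show w.1 + 1 < S.m + S.n by omega] using this

/-- the vector of a cell -/
noncomputable def vc (hS : S.Ok) (p : S.cells) : (gr hS).sig := ⟨S.vec (cp p.1), by
  rw [mem_sig_iff]
  intro e he
  rw [lin_vec hS (cp_pt0 p.2) he]
  obtain ⟨p, h1, h2, h3, h4, h5, h6⟩ := p
  cases e with
  | row i => simp only [lin, val, cp]; split_ifs <;> omega
  | col i => simp only [lin, val, cp]; split_ifs <;> omega
  | lo t =>
    have := h5 t he.1 he.2
    simp only [lin, val, cp]; split_ifs <;> omega
  | up t =>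
    have := h6 t he.1 he.2
    simp only [lin, val, cp]; split_ifs <;> omega
  | _ => exact he.elim⟩

theorem vc_A (hS : S.Ok) (p : S.cells) {i : ℕ} (hi : i ≤ S.m) : (pt (vc hS p).1).1 i = if p.1.1 ≤ i then 1 else 0 :=
  vec_A hS (cp_pt0 p.2) hi

theorem vc_B (hS : S.Ok) (p : S.cells) {j : ℕ} (hj : j ≤ S.n) : (pt (vc hS p).1).2 j = if j < p.1.2 then 1 else 0 :=
  vec_B hS (cp_pt0 p.2) hj

theorem vc_swap (hS : S.Ok) {p q p' q' : S.cells} (h1 : p'.1 = (p.1.1, q.1.2)) (h2 : q'.1 = (q.1.1, p.1.2)) :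
    vc hS p + vc hS q = vc hS p' + vc hS q' := by
  apply Subtype.ext
  funext w
  simp only [vc, AddSubmonoid.coe_add, Pi.add_apply, vec, cp, h1, h2]
  split_ifs <;> simp

theorem swap_mem {i i' j j' : ℕ} (hp : (i, j') ∈ S.cells) (hq : (i', j) ∈ S.cells) (h1 : i ≤ i') (h2 : j' ≤ j) :
    (i, j) ∈ S.cells ∧ (i', j') ∈ S.cells := by
  obtain ⟨a1, a2, a3, a4, a5, a6⟩ := hp
  obtain ⟨b1, b2, b3, b4, b5, b6⟩ := hq
  simp only at *
  refine ⟨⟨a1, a2, b3, b4, fun t ht ht' h => a5 t ht ht' ?_, fun t ht ht' h => b6 t ht ht' ?_⟩,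
    ⟨b1, b2, a3, a4, fun t ht ht' h => a5 t ht ht' ?_, fun t ht ht' h => b6 t ht ht' ?_⟩⟩ <;> simp only at * <;> omega

theorem pt_add (g g' : S.Wt → ℤ) : pt (g + g') = pt g + pt g' := by
  refine Prod.ext (funext fun i => ?_) (funext fun j => ?_)
  · exact map_add _ _ _
  · exact map_add _ _ _

/-- exponents to vectors -/
noncomputable def V (hS : S.Ok) : (S.cells →₀ ℕ) →+ (gr hS).sig := Finsupp.liftAddHom fun p => multiplesHom _ (vc hS p)

theorem V_single (hS : S.Ok) (p : S.cells) : V hS (Finsupp.single p 1) = vc hS p := by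
  simp [V]

theorem V_sub (hS : S.Ok) {f : S.cells →₀ ℕ} {p} (h : f p ≠ 0) : ∃ h, f = Finsupp.single p 1 + h := by
  classical
  refine ⟨f - Finsupp.single p 1, ?_⟩
  rw [add_tsub_cancel_of_le]
  rw [Finsupp.single_le_iff]; omega

theorem A_nonneg (hS : S.Ok) {g : S.Wt → ℤ} (hg : g ∈ (gr hS).sig) {i i' : ℕ} (h : i ≤ i') (hi : i' ≤ S.m) :
    (pt g).1 i ≤ (pt g).1 i' := by
  induction i', h using Nat.le_induction with
  | base => exact le_refl _
  | succ i' h ih =>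
    have := (mem_sig_iff hS).1 hg (.row i') (by simp only [okE]; omega)
    simp only [lin, val] at this
    have := ih (by omega)
    linarith

theorem B_nonneg (hS : S.Ok) {g : S.Wt → ℤ} (hg : g ∈ (gr hS).sig) {i i' : ℕ} (h : i ≤ i') (hi : i' ≤ S.n) :
    (pt g).2 i' ≤ (pt g).2 i := by
  induction i', h using Nat.le_induction with
  | base => exact le_refl _
  | succ i' h ih =>
    have := (mem_sig_iff hS).1 hg (.col i') (by simp only [okE]; omega)
    simp only [lin, val] at this
    have := ih (by omega)
    linarith

theorem A_pos (hS : S.Ok) {g : S.Wt → ℤ} (hg : g ∈ (gr hS).sig) {i : ℕ} (hi : i ≤ S.m) : 0 ≤ (pt g).1 i := by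
  rw [← (pt_pt0 hS g).z]; exact A_nonneg hS hg (Nat.zero_le _) hi

theorem B_pos (hS : S.Ok) {g : S.Wt → ℤ} (hg : g ∈ (gr hS).sig) {i : ℕ} (hi : i ≤ S.n) : 0 ≤ (pt g).2 i := by
  rw [← (pt_pt0 hS g).zn]; exact B_nonneg hS hg hi le_rfl

theorem V_A (hS : S.Ok) (f : S.cells →₀ ℕ) {i : ℕ} (hi : i ≤ S.m) :
    0 < (pt (V hS f).1).1 i ↔ ∃ p, f p ≠ 0 ∧ p.1.1 ≤ i := by
  classical
  constructor
  · induction f using Finsupp.induction_linear with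
    | zero => intro h; rw [map_zero] at h; simp [pt] at h
    | add f g hf hg =>
      intro h
      rw [map_add, AddSubmonoid.coe_add, pt_add] at h
      simp only [Prod.fst_add, Pi.add_apply] at h
      have h1 := A_pos hS (V hS f).2 hi
      have h2 := A_pos hS (V hS g).2 hi
      rcases h1.lt_or_eq with h3 | h3
      · obtain ⟨p, h4, h5⟩ := hf h3
        exact ⟨p, by simp [h4], h5⟩
      · obtain ⟨p, h4, h5⟩ := hg (by linarith)
        exact ⟨p, by simp [h4], h5⟩
    | single p c =>
      intro h
      by_cases hc : c = 0
      · subst hc; rw [Finsupp.single_zero, map_zero] at h; simp [pt] at h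
      refine ⟨p, by simpa using hc, ?_⟩
      by_contra hp
      suffices H : ∀ c : ℕ, (pt (V hS (Finsupp.single p c)).1).1 i = 0 by rw [H] at h; exact lt_irrefl _ h
      intro c
      induction c with
      | zero => rw [Finsupp.single_zero, map_zero]; simp [pt]
      | succ c ih =>
        rw [Finsupp.single_add, map_add, AddSubmonoid.coe_add, pt_add]
        simp only [Prod.fst_add, Pi.add_apply]
        rw [ih, V_single, vc_A hS _ hi, if_neg hp]; simp
  · rintro ⟨p, hp, hpi⟩
    obtain ⟨h, rfl⟩ := V_sub hS hp
    rw [map_add, AddSubmonoid.coe_add, pt_add]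
    simp only [Prod.fst_add, Pi.add_apply]
    rw [V_single, vc_A hS _ hi, if_pos hpi]
    have := A_pos hS (V hS h).2 hi
    linarith

theorem V_B (hS : S.Ok) (f : S.cells →₀ ℕ) {i : ℕ} (hi : i ≤ S.n) :
    0 < (pt (V hS f).1).2 i ↔ ∃ p, f p ≠ 0 ∧ i < p.1.2 := by
  classical
  constructor
  · induction f using Finsupp.induction_linear with
    | zero => intro h; rw [map_zero] at h; simp [pt] at h
    | add f g hf hg =>
      intro h
      rw [map_add, AddSubmonoid.coe_add, pt_add] at h
      simp only [Prod.snd_add, Pi.add_apply] at h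
      have h1 := B_pos hS (V hS f).2 hi
      have h2 := B_pos hS (V hS g).2 hi
      rcases h1.lt_or_eq with h3 | h3
      · obtain ⟨p, h4, h5⟩ := hf h3
        exact ⟨p, by simp [h4], h5⟩
      · obtain ⟨p, h4, h5⟩ := hg (by linarith)
        exact ⟨p, by simp [h4], h5⟩
    | single p c =>
      intro h
      by_cases hc : c = 0
      · subst hc; rw [Finsupp.single_zero, map_zero] at h; simp [pt] at h
      refine ⟨p, by simpa using hc, ?_⟩
      by_contra hp
      suffices H : ∀ c : ℕ, (pt (V hS (Finsupp.single p c)).1).2 i = 0 by rw [H] at h; exact lt_irrefl _ h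
      intro c
      induction c with
      | zero => rw [Finsupp.single_zero, map_zero]; simp [pt]
      | succ c ih =>
        rw [Finsupp.single_add, map_add, AddSubmonoid.coe_add, pt_add]
        simp only [Prod.snd_add, Pi.add_apply]
        rw [ih, V_single, vc_B hS _ hi, if_neg hp]; simp
  · rintro ⟨p, hp, hpi⟩
    obtain ⟨h, rfl⟩ := V_sub hS hp
    rw [map_add, AddSubmonoid.coe_add, pt_add]
    simp only [Prod.snd_add, Pi.add_apply]
    rw [V_single, vc_B hS _ hi, if_pos hpi]
    have := B_pos hS (V hS h).2 hi
    linarith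

/-- the extremal cell of a vector -/
structure Ext0 (S : Sh) (g : S.Wt → ℤ) (i j : ℕ) : Prop where
  i1 : 1 ≤ i
  i2 : i ≤ S.m
  j1 : 1 ≤ j
  j2 : j ≤ S.n
  A0 : ∀ i' < i, (pt g).1 i' = 0
  A1 : ∀ i', i ≤ i' → i' ≤ S.m → 0 < (pt g).1 i'
  B0 : ∀ j', j ≤ j' → j' ≤ S.n → (pt g).2 j' = 0
  B1 : ∀ j' < j, 0 < (pt g).2 j'

theorem exists_Ext0 (hS : S.Ok) {g : S.Wt → ℤ} (hg : g ∈ (gr hS).sig) (h : 0 < (pt g).1 S.m) : ∃ i j, Ext0 S g i j := by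
  classical
  have hA : ∃ i, 0 < (pt g).1 i := ⟨_, h⟩
  have hB : ∃ j, (pt g).2 j = 0 := ⟨_, (pt_pt0 hS g).zn⟩
  have i2 := Nat.find_min' hA h
  have j2 := Nat.find_min' hB (pt_pt0 hS g).zn
  refine ⟨Nat.find hA, Nat.find hB, ?_, i2, ?_, j2, ?_, ?_, ?_, ?_⟩
  · rw [Nat.one_le_iff_ne_zero, Ne, Nat.find_eq_zero, (pt_pt0 hS g).z]; exact lt_irrefl _
  · rw [Nat.one_le_iff_ne_zero, Ne, Nat.find_eq_zero, ← (pt_pt0 hS g).e]; exact h.ne'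
  · intro i' hi'
    exact le_antisymm (not_lt.1 (Nat.find_min hA hi')) (A_pos hS hg (by omega))
  · intro i' h1 h2
    exact (Nat.find_spec hA).trans_le (A_nonneg hS hg h1 h2)
  · intro j' h1 h2
    exact le_antisymm ((B_nonneg hS hg h1 h2).trans (Nat.find_spec hB).le) (B_pos hS hg h2)
  · intro j' hj'
    exact lt_of_le_of_ne (B_pos hS hg (by omega)) (Ne.symm (Nat.find_min hB hj'))

theorem ext0_cell (hS : S.Ok) {g : S.Wt → ℤ} (hg : g ∈ (gr hS).sig) {i j : ℕ} (h : Ext0 S g i j) : (i, j) ∈ S.cells := by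
  have e1 := hS.aL; have e2 := hS.b0
  have := hS.d0; have := hS.cK
  refine ⟨h.i1, h.i2, h.j1, h.j2, ?_, ?_⟩
  · intro t h1 h2 h3
    have := hS.am t S.L h2 le_rfl
    have := hS.bm 0 t h1 h2.le
    have h5 := (mem_sig_iff hS).1 hg (.lo t) ⟨h1, h2⟩
    simp only [lin, val] at h5 h3
    have h6 := h.A1 (S.a t) h3.1 (by omega)
    have h7 := h.B0 (S.b t) h3.2 (by omega)
    linarith
  · intro t h1 h2 h3
    have h5 := (mem_sig_iff hS).1 hg (.up t) ⟨h1, h2⟩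
    simp only [lin, val] at h5 h3
    have h6 := h.A0 (S.c t) h3.1
    have h7 := h.B1 (S.d t) h3.2
    linarith

theorem peel (hS : S.Ok) {g : S.Wt → ℤ} (hg : g ∈ (gr hS).sig) {i j : ℕ} (h : Ext0 S g i j) (hc : (i, j) ∈ S.cells) :
    g - (vc hS ⟨(i, j), hc⟩).1 ∈ (gr hS).sig := by
  have e1 := hS.aL; have e2 := hS.b0
  have e3 := hS.d0; have e4 := hS.cK
  obtain ⟨q, hq⟩ : ∃ q, q = g - (vc hS ⟨(i, j), hc⟩).1 := ⟨_, Eq.refl _⟩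
  have hgq : g = q + (vc hS ⟨(i, j), hc⟩).1 := by rw [hq]; abel
  have hA : ∀ i' ≤ S.m, (pt q).1 i' = (pt g).1 i' - if i ≤ i' then 1 else 0 := fun i' hi' => by
    rw [hgq, pt_add]; simp only [Prod.fst_add, Pi.add_apply]; rw [vc_A hS _ hi']; simp
  have hB : ∀ i' ≤ S.n, (pt q).2 i' = (pt g).2 i' - if i' < j then 1 else 0 := fun i' hi' => by
    rw [hgq, pt_add]; simp only [Prod.snd_add, Pi.add_apply]; rw [vc_B hS _ hi']; simp
  rw [← hq, mem_sig_iff]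
  intro e he
  have h5 := (mem_sig_iff hS).1 hg e he
  cases e with
  | row i' =>
    simp only [okE] at he
    simp only [lin, val] at h5 ⊢
    rw [hA _ (by omega), hA _ (by omega)]
    have := h.A1 (i' + 1)
    have := h.A0 i'
    split_ifs <;> omega
  | col i' =>
    simp only [okE] at he
    simp only [lin, val] at h5 ⊢
    rw [hB _ (by omega), hB _ (by omega)]
    have := h.B1 i'
    have := h.B0 (i' + 1)
    split_ifs <;> omega
  | lo t =>
    have := hS.am t S.L he.2 le_rfl
    have := hS.bm 0 t he.1 he.2.le
    simp only [lin, val] at h5 ⊢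
    rw [hA _ (by omega), hB _ (by omega)]
    have := h.B1 (S.b t)
    have := h.A0 (S.a t)
    split_ifs <;> omega
  | up t =>
    have := hS.cm t S.K he.2 le_rfl
    have := hS.dm 0 t he.1 he.2.le
    simp only [lin, val] at h5 ⊢
    rw [hA _ (by omega), hB _ (by omega)]
    have := h.A1 (S.c t)
    have := h.B0 (S.d t)
    split_ifs <;> omega
  | _ => exact he.elim

theorem sig_zero (hS : S.Ok) {g : S.Wt → ℤ} (hg : g ∈ (gr hS).sig) (h : (pt g).1 S.m = 0) : g = 0 := by
  apply pt_inj hS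
  · intro i hi
    have h1 := A_pos hS hg hi
    have h2 := A_nonneg hS hg hi le_rfl
    rw [show (pt (0 : S.Wt → ℤ)).1 i = 0 by simp [pt]]; omega
  · intro j hj
    have h1 := B_pos hS hg hj
    have h2 := B_nonneg hS hg (Nat.zero_le j) hj
    have h3 := (pt_pt0 hS g).e
    rw [show (pt (0 : S.Wt → ℤ)).2 j = 0 by simp [pt]]; omega

theorem V_surj_aux (hS : S.Ok) : ∀ N : ℕ, ∀ g : (gr hS).sig, (pt g.1).1 S.m = N → ∃ f, V hS f = g := by
  intro N
  induction N with
  | zero =>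
    intro g hg
    refine ⟨0, ?_⟩
    rw [map_zero]
    exact Subtype.ext (sig_zero hS g.2 (by simpa using hg)).symm
  | succ N ih =>
    intro g hg
    obtain ⟨i, j, h⟩ := exists_Ext0 hS g.2 (by rw [hg]; positivity)
    have hc := ext0_cell hS g.2 h
    obtain ⟨q, hq⟩ : ∃ q : (gr hS).sig, g = q + vc hS ⟨(i, j), hc⟩ :=
      ⟨⟨_, peel hS g.2 h hc⟩, Subtype.ext (by simp)⟩
    obtain ⟨f, hf⟩ := ih q (by
      rw [hq, AddSubmonoid.coe_add, pt_add] at hg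
      simp only [Prod.fst_add, Pi.add_apply] at hg
      rw [vc_A hS _ le_rfl, if_pos h.i2] at hg
      push_cast at hg; linarith)
    exact ⟨f + Finsupp.single _ 1, by rw [map_add, hf, V_single, hq]⟩

theorem V_surj (hS : S.Ok) (g : (gr hS).sig) : ∃ f, V hS f = g :=
  V_surj_aux hS (((pt g.1).1 S.m).toNat) g (Int.toNat_of_nonneg (A_pos hS g.2 le_rfl)).symm

section ring
open LadderDet
variable (k : Type) [Field k]

/-- monomials in the ladder ring -/
noncomputable def M (S : Sh) (f : S.cells →₀ ℕ) : LadderRing k 2 S.cells := Ideal.Quotient.mk _ (MvPolynomial.monomial f 1)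

theorem M_add (f g : S.cells →₀ ℕ) : M k S (f + g) = M k S f * M k S g := by
  simp only [M]; rw [← map_mul, MvPolynomial.monomial_mul, one_mul]

theorem M_swap {p q p' q' : S.cells} (h1 : p'.1 = (p.1.1, q.1.2)) (h2 : q'.1 = (q.1.1, p.1.2)) (h3 : p.1.1 ≤ q.1.1) (h4 : p.1.2 ≤ q.1.2) :
    M k S (Finsupp.single p 1) * M k S (Finsupp.single q 1) = M k S (Finsupp.single p' 1) * M k S (Finsupp.single q' 1) := by
  obtain ⟨⟨i, j'⟩, hp⟩ := p
  obtain ⟨⟨i', j⟩, hq⟩ := q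
  obtain ⟨p', hp'⟩ := p'
  obtain ⟨q', hq'⟩ := q'
  simp only at h1 h2 h3 h4
  subst h1 h2
  rcases h3.eq_or_lt with rfl | h3
  · exact mul_comm _ _
  rcases h4.eq_or_lt with rfl | h4
  · exact Eq.refl _
  simp only [M]
  rw [← map_mul, ← map_mul, Ideal.Quotient.eq]
  apply Ideal.subset_span
  refine ⟨![i, i'], ![j', j], ?_, ?_, ?_, ?_⟩
  · intro a b hab
    fin_cases a <;> fin_cases b <;> simp at hab ⊢ <;> exact h3
  · intro a b hab
    fin_cases a <;> fin_cases b <;> simp at hab ⊢ <;> exact h4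
  · intro a b
    fin_cases a <;> fin_cases b <;> assumption
  · simp only [minorPoly, Matrix.det_fin_two, Matrix.of_apply, MvPolynomial.X]
    exact Eq.refl _

theorem M_step (hS : S.Ok) (f : S.cells →₀ ℕ) {i j : ℕ} (h : Ext0 S (V hS f).1 i j) (hc : (i, j) ∈ S.cells) :
    ∃ f1, M k S f = M k S f1 * M k S (Finsupp.single ⟨(i, j), hc⟩ 1) ∧ V hS f = V hS f1 + vc hS ⟨(i, j), hc⟩ := by
  classical
  have mi : ∀ q, f q ≠ 0 → i ≤ q.1.1 := fun q hq => by
    by_contra hlt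
    have h1 := h.A0 q.1.1 (by omega)
    have h2 := (V_A hS f (i := q.1.1) q.2.2.1).2 ⟨q, hq, le_rfl⟩
    omega
  have mj : ∀ q, f q ≠ 0 → q.1.2 ≤ j := fun q hq => by
    by_contra hlt
    have h1 := h.B0 j le_rfl h.j2
    have h2 := (V_B hS f (i := j) h.j2).2 ⟨q, hq, by omega⟩
    omega
  obtain ⟨p, hp, hpi⟩ := (V_A hS f h.i2).1 (h.A1 i le_rfl h.i2)
  have hj1 := h.j1
  have hj2 := h.j2
  obtain ⟨q, hq, hqj⟩ := (V_B hS f (i := j - 1) (by omega)).1 (h.B1 (j - 1) (by omega))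
  have p1 : p.1.1 = i := le_antisymm hpi (mi p hp)
  have q2 : q.1.2 = j := le_antisymm (mj q hq) (by omega)
  by_cases hpq : p = q
  · subst hpq
    obtain ⟨f1, rfl⟩ := V_sub hS hp
    have : p = ⟨(i, j), hc⟩ := Subtype.ext (Prod.ext p1 q2)
    subst this
    exact ⟨f1, by rw [M_add, mul_comm], by rw [map_add, V_single, add_comm]⟩
  · obtain ⟨f1, rfl⟩ := V_sub hS hp
    have hq1 : f1 q ≠ 0 := by simpa [Finsupp.single_apply, hpq] using hq
    obtain ⟨f2, rfl⟩ := V_sub hS hq1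
    have w1 := mi q hq
    have w2 := mj p hp
    have hq' : (q.1.1, p.1.2) ∈ S.cells := (swap_mem (i := p.1.1) (j := q.1.2) p.2 q.2 (p1.le.trans w1) (w2.trans q2.ge)).2
    have s1 := M_swap k (S := S) (p := p) (q := q) (p' := ⟨(i, j), hc⟩) (q' := ⟨(q.1.1, p.1.2), hq'⟩) (by simp [p1, q2]) (Eq.refl _)
      (by omega) (by omega)
    have s2 := vc_swap hS (p := p) (q := q) (p' := ⟨(i, j), hc⟩) (q' := ⟨(q.1.1, p.1.2), hq'⟩) (by simp [p1, q2]) (Eq.refl _)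
    refine ⟨Finsupp.single ⟨(q.1.1, p.1.2), hq'⟩ 1 + f2, ?_, ?_⟩
    · rw [M_add, M_add, M_add, ← mul_assoc, s1]; ring
    · rw [map_add, map_add, map_add, V_single, V_single, V_single, ← add_assoc, s2]; abel

theorem M_inj_aux (hS : S.Ok) : ∀ N : ℕ, ∀ f f' : S.cells →₀ ℕ, (pt (V hS f).1).1 S.m = N → V hS f = V hS f' → M k S f = M k S f' := by
  intro N
  induction N with
  | zero =>
    have H : ∀ f : S.cells →₀ ℕ, (pt (V hS f).1).1 S.m = 0 → f = 0 := by
      intro f hf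
      by_contra hne
      obtain ⟨p, hp⟩ := Finsupp.ne_iff.1 hne
      have := (V_A hS f le_rfl).2 ⟨p, hp, p.2.2.1⟩
      omega
    intro f f' h1 h2
    rw [H f (by simpa using h1), H f' (by rw [← h2]; simpa using h1)]
  | succ N ih =>
    intro f f' h1 h2
    obtain ⟨i, j, h⟩ := exists_Ext0 hS (V hS f).2 (by rw [h1]; positivity)
    have hc := ext0_cell hS (V hS f).2 h
    obtain ⟨f1, a1, a2⟩ := M_step k hS f h hc
    obtain ⟨f2, b1, b2⟩ := M_step k hS f' (h2 ▸ h) hc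
    rw [a1, b1, ih f1 f2 _ _]
    · rw [a2, AddSubmonoid.coe_add, pt_add] at h1
      simp only [Prod.fst_add, Pi.add_apply] at h1
      rw [vc_A hS _ le_rfl, if_pos h.i2] at h1
      push_cast at h1; linarith
    · rw [a2, b2] at h2
      exact Subtype.ext (add_right_cancel (congrArg Subtype.val h2))

theorem M_inj (hS : S.Ok) {f f' : S.cells →₀ ℕ} (h : V hS f = V hS f') : M k S f = M k S f' :=
  M_inj_aux k hS (((pt (V hS f).1).1 S.m).toNat) f f' (Int.toNat_of_nonneg (A_pos hS (V hS f).2 le_rfl)).symm h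

/-- the toric map -/
noncomputable def ph0 (hS : S.Ok) : MvPolynomial S.cells k →ₐ[k] AddMonoidAlgebra k (gr hS).sig :=
  MvPolynomial.aeval fun p => mon k (vc hS p)

theorem mon_add {hS : S.Ok} (s t : (gr hS).sig) : mon k (s + t) = mon k s * mon k t := by
  rw [mon, mon, mon, AddMonoidAlgebra.single_mul_single, one_mul]

theorem ph0_X (hS : S.Ok) (p) : ph0 k hS (MvPolynomial.X p) = mon k (vc hS p) := MvPolynomial.aeval_X _ _

theorem ph0_mon (hS : S.Ok) (f) : ph0 k hS (MvPolynomial.monomial f 1) = mon k (V hS f) := by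
  classical
  induction f using Finsupp.induction_linear with
  | zero => rw [map_zero]; exact map_one (ph0 k hS)
  | add f g hf hg => rw [map_add, mon_add, ← hf, ← hg, ← map_mul, MvPolynomial.monomial_mul, one_mul]
  | single p c =>
    induction c with
    | zero => rw [Finsupp.single_zero, map_zero]; exact map_one (ph0 k hS)
    | succ c ih =>
      rw [Finsupp.single_add, map_add, mon_add, ← ih, V_single, ← ph0_X, ← map_mul, MvPolynomial.X, MvPolynomial.monomial_mul, one_mul]

theorem ph0_ker (hS : S.Ok) : ∀ a ∈ minorIdeal k 2 S.cells, ph0 k hS a = 0 := by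
  intro a ha
  have : minorIdeal k 2 S.cells ≤ RingHom.ker (ph0 k hS) := by
    rw [minorIdeal, Ideal.span_le]
    rintro f ⟨r, c, hr, hc, h, rfl⟩
    change ph0 k hS _ = 0
    rw [minorPoly, Matrix.det_fin_two]
    simp only [Matrix.of_apply, map_sub, map_mul, ph0_X]
    rw [← mon_add, ← mon_add, vc_swap hS (p := ⟨(r 0, c 0), h 0 0⟩) (q := ⟨(r 1, c 1), h 1 1⟩)
      (p' := ⟨(r 0, c 1), h 0 1⟩) (q' := ⟨(r 1, c 0), h 1 0⟩) (Eq.refl _) (Eq.refl _), sub_self]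
  exact this ha

noncomputable def ph (hS : S.Ok) : LadderRing k 2 S.cells →ₐ[k] AddMonoidAlgebra k (gr hS).sig :=
  Ideal.Quotient.liftₐ _ (ph0 k hS) (ph0_ker k hS)

theorem ph_M (hS : S.Ok) (f) : ph k hS (M k S f) = mon k (V hS f) := ph0_mon k hS f

noncomputable def sec (hS : S.Ok) (g : (gr hS).sig) : S.cells →₀ ℕ := (V_surj hS g).choose
theorem V_sec (hS : S.Ok) (g : (gr hS).sig) : V hS (sec hS g) = g := (V_surj hS g).choose_spec

noncomputable def ps (hS : S.Ok) : AddMonoidAlgebra k (gr hS).sig →ₐ[k] LadderRing k 2 S.cells :=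
  AddMonoidAlgebra.lift k _ _ 
    { toFun := fun g => M k S (sec hS g.toAdd)
      map_one' := by
        rw [M_inj k hS (f' := 0) (by rw [V_sec]; exact (map_zero _).symm)]; exact map_one _
      map_mul' := fun g h => by
        rw [← M_add]; apply M_inj k hS; rw [V_sec, map_add, V_sec, V_sec]; exact Eq.refl _ }

theorem ps_mon (hS : S.Ok) (g) : ps k hS (mon k g) = M k S (sec hS g) := by
  rw [ps, mon, AddMonoidAlgebra.lift_single, one_smul]; exact Eq.refl _

/-- the ladder ring is a semigroup ring -/
noncomputable def iso (hS : S.Ok) : LadderRing k 2 S.cells ≃ₐ[k] AddMonoidAlgebra k (gr hS).sig :=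
  AlgEquiv.ofAlgHom (ph k hS) (ps k hS) (by
    apply AddMonoidAlgebra.algHom_ext
    · intro g
      change ph k hS (ps k hS (mon k g)) = mon k g
      rw [ps_mon, ph_M, V_sec]
    · exact Subsingleton.elim _ _) (by
    apply Ideal.Quotient.algHom_ext
    apply MvPolynomial.algHom_ext
    intro p
    change ps k hS (ph k hS (M k S (Finsupp.single p 1))) = M k S (Finsupp.single p 1)
    rw [ph_M, ps_mon]
    apply M_inj k hS; rw [V_sec])

theorem cells_fin : S.cells.Finite := by
  apply Set.Finite.subset ((Set.finite_le_nat S.m).prod (Set.finite_le_nat S.n))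
  intro p hp
  exact ⟨hp.2.1, hp.2.2.2.1⟩

theorem ladder_noeth : IsNoetherianRing (LadderRing k 2 S.cells) := by
  have := (cells_fin (S := S)).to_subtype
  infer_instance

theorem sig_noeth (hS : S.Ok) : IsNoetherianRing (AddMonoidAlgebra k (gr hS).sig) := by
  have := ladder_noeth k (S := S)
  exact isNoetherianRing_of_ringEquiv _ (iso k hS).toRingEquiv

end ring
end Sh
end SDP

set_option linter.unusedVariables false
set_option linter.unusedSectionVars false
set_option maxHeartbeats 1000000
set_option synthInstance.maxHeartbeats 1000000

namespace SDP

section transfer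
variable {R T : Type} [CommRing R] [CommRing T] (e : R ≃+* T) {C : Type} [AddCommGroup C] [Module R C] [Module T C]

theorem Mx_tr (h : ∀ (r : R) (c : C), e r • c = r • c) {p q : ℕ} (D : Matrix (Fin p) (Fin q) R) (v : Fin q → C) :
    Mx (D.map e) C v = Mx D C v := by
  funext b; simp [Mx_apply, h]

theorem Mx_tr' {p q : ℕ} (D : Matrix (Fin p) (Fin q) R) (v : Fin q → R) :
    Mx (D.map e) T (fun a => e (v a)) = fun b => e (Mx D R v b) := by
  funext b; simp [Mx_apply, map_sum]

/-- transfer along a ring isomorphism -/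
noncomputable def SD.tr (h : ∀ (r : R) (c : C), e r • c = r • c) (d : SD R C) : SD T C where
  n := d.n
  D i := (d.D i).map e
  c := d.c
  dd i := by
    have := congrArg (fun M => M.map e) (d.dd i)
    simpa [Matrix.map_mul] using this
  dc := by rw [Mx_tr e h]; exact d.dc
  ex i := by
    intro v hv
    obtain ⟨w, hw⟩ := d.ex i (fun a => e.symm (v a)) (by
      have := Mx_tr' e (d.D i).transpose (fun a => e.symm (v a))
      simp only [RingEquiv.apply_symm_apply] at this
      rw [← Matrix.transpose_map] at hv
      change Mx _ _ v = _ at this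
      rw [hv] at this
      funext b
      have := congrFun this b
      simpa using this.symm)
    refine ⟨fun a => e (w a), ?_⟩
    rw [← Matrix.transpose_map, Mx_tr', hw]
    funext b; simp
  ex0 v hv := by
    obtain ⟨w, hw⟩ := d.ex0 (fun a => e.symm (v a)) (by
      rw [← hv]; refine Finset.sum_congr rfl fun a _ => ?_
      rw [← h]; simp)
    refine ⟨fun a => e (w a), ?_⟩
    rw [← Matrix.transpose_map, Mx_tr', hw]
    funext b; simp
  gen x := by
    obtain ⟨v, hv⟩ := d.gen x
    exact ⟨fun a => e (v a), by rw [hv]; simp [h]⟩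
  hex i := by
    intro v hv
    rw [Mx_tr e h] at hv
    obtain ⟨w, hw⟩ := d.hex i v hv
    exact ⟨w, by rw [Mx_tr e h]; exact hw⟩
  hinj r hr := by
    have := d.hinj (e.symm r) fun a => by rw [← h, RingEquiv.apply_symm_apply]; exact hr a
    simpa using this
  h0 v hv := by
    rw [Mx_tr e h] at hv
    obtain ⟨r, hr⟩ := d.h0 v hv
    exact ⟨e r, fun a => by rw [h]; exact hr a⟩

end transfer

namespace Gr
variable {W E : Type} (Γ : Gr W E) [Fintype W] [DecidableEq W] [Fintype E] {k : Type} [Field k]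

/-- translation of divisorial modules -/
noncomputable def trl (u u' : E → ℤ) (a0 : W → ℤ) (h : ∀ e, u e = Γ.ev e a0 + u' e) :
    RM k (Γ.Breg u) →ₗ[AddMonoidAlgebra k Γ.sig] RM k (Γ.Breg u') :=
  Γ.mp _ _ (fun a => bas _ (a - a0)) (by
    have H : ∀ a, a ∈ (Γ.Breg u).carrier ↔ a - a0 ∈ (Γ.Breg u').carrier := fun a => by
      simp only [mem_Breg, map_sub, h]
      refine forall_congr' fun e => ?_
      constructor <;> intro <;> linarith
    intro a ha s
    rw [mon_bas _ ((H a).1 ha)]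
    rw [show a - a0 + (s : W → ℤ) = a + s - a0 by abel]
    exact ⟨fun _ => rfl, fun hn => bas_out (fun h' => hn ((H _).2 h'))⟩)

theorem trl_bas {u u' : E → ℤ} {a0 : W → ℤ} (h : ∀ e, u e = Γ.ev e a0 + u' e) {a} (ha : a ∈ (Γ.Breg u).carrier) :
    Γ.trl (k := k) u u' a0 h (bas _ a) = bas _ (a - a0) := Γ.mp_bas _ _ ha

theorem trl_equiv {u u' : E → ℤ} {a0 : W → ℤ} (h : ∀ e, u e = Γ.ev e a0 + u' e) :
    Nonempty (RM k (Γ.Breg u) ≃ₗ[AddMonoidAlgebra k Γ.sig] RM k (Γ.Breg u')) := by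
  have h' : ∀ e, u' e = Γ.ev e (-a0) + u e := fun e => by rw [map_neg, h]; ring
  have H : ∀ {u u' : E → ℤ} {a0 : W → ℤ} (h : ∀ e, u e = Γ.ev e a0 + u' e) {a}, a ∈ (Γ.Breg u).carrier → a - a0 ∈ (Γ.Breg u').carrier := by
    intro u u' a0 h a ha
    rw [mem_Breg] at ha ⊢
    intro e
    have := ha e
    rw [h] at this
    rw [map_sub]; linarith
  refine ⟨LinearEquiv.ofLinearMap (Γ.trl u u' a0 h) (Γ.trl u' u (-a0) h') ?_ ?_⟩
  · apply Γ.lin_ext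
    intro a ha
    rw [LinearMap.comp_apply, trl_bas _ h' ha, trl_bas _ h (H h' ha)]
    simp
  · apply Γ.lin_ext
    intro a ha
    rw [LinearMap.comp_apply, trl_bas _ h ha, trl_bas _ h' (H h ha)]
    simp

end Gr

section final
open LadderDet CategoryTheory

theorem final_shape {S : Sh} (hS : S.Ok) (k : Type) [Field k] (C : Fin 3 → ModuleCat.{0} (LadderRing k 2 S.cells))
    (hC : ∀ i, IsSemidualizing (C i)) : ∃ i j, i ≠ j ∧ Nonempty (C i ≅ C j) := by
  classical
  haveI := Sh.ladder_noeth k (S := S)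
  haveI := Sh.sig_noeth k hS
  let e : LadderRing k 2 S.cells ≃+* AddMonoidAlgebra k (Sh.gr hS).sig := (Sh.iso k hS).toRingEquiv
  letI inst : ∀ i, Module (AddMonoidAlgebra k (Sh.gr hS).sig) (C i) := fun i => Module.compHom (C i) e.symm.toRingHom
  have hsm : ∀ i (r : LadderRing k 2 S.cells) (c : C i), e r • c = r • c := fun i r c => by
    change e.symm (e r) • c = r • c
    rw [RingEquiv.symm_apply_apply]
  have key : ∀ i, ∃ u : S.Et → ℤ, Nonempty (C i ≃ₗ[AddMonoidAlgebra k (Sh.gr hS).sig] RM k ((Sh.gr hS).Breg u)) ∧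
      (((∀ t ≤ S.L, (Sh.cls u).l t = 0) ∧ (∀ t ≤ S.K, (Sh.cls u).u t = 0)) ∨
      ((∀ t ≤ S.L, (Sh.cls u).l t = S.kap.l t) ∧ (∀ t ≤ S.K, (Sh.cls u).u t = S.kap.u t))) := by
    intro i
    obtain ⟨d⟩ := exists_SD (C i) (hC i).1 (hC i).2.1 (hC i).2.2
    have d' := d.tr e (hsm i)
    obtain ⟨u, ⟨f⟩⟩ := (Sh.gr hS).class_step (Sh.hfac hS) d'
    exact ⟨u, ⟨f⟩, Sh.two_cls hS (d'.congr f)⟩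
  choose u f hu using key
  have pair : ∀ i j, (∀ t ≤ S.L, (Sh.cls (u i)).l t = (Sh.cls (u j)).l t) → (∀ t ≤ S.K, (Sh.cls (u i)).u t = (Sh.cls (u j)).u t) →
      Nonempty (C i ≅ C j) := by
    intro i j h1 h2
    obtain ⟨a0, h⟩ := Sh.cls_eq hS h1 h2
    obtain ⟨g⟩ := (Sh.gr hS).trl_equiv (k := k) h
    obtain ⟨fi⟩ := f i
    obtain ⟨fj⟩ := f j
    let F := fi.trans (g.trans fj.symm)
    refine ⟨LinearEquiv.toModuleIso (X₁ := C i) (X₂ := C j) { F with map_smul' := fun r x => ?_ }⟩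
    have := F.map_smul (e r) x
    rw [hsm, hsm] at this
    exact this
  by_contra hcon
  push Not at hcon
  have np : ∀ i j, i ≠ j → ¬ ((∀ t ≤ S.L, (Sh.cls (u i)).l t = (Sh.cls (u j)).l t) ∧ (∀ t ≤ S.K, (Sh.cls (u i)).u t = (Sh.cls (u j)).u t)) :=
    fun i j hij h => (not_nonempty_iff.2 (hcon i j hij)) (pair i j h.1 h.2)
  have n0 := np 0 1 (by decide)
  have n1 := np 0 2 (by decide)
  have n2 := np 1 2 (by decide)
  have comb : ∀ {i j : Fin 3} {l w : ℕ → ℤ}, ((∀ t ≤ S.L, (Sh.cls (u i)).l t = l t) ∧ (∀ t ≤ S.K, (Sh.cls (u i)).u t = w t)) →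
      ((∀ t ≤ S.L, (Sh.cls (u j)).l t = l t) ∧ (∀ t ≤ S.K, (Sh.cls (u j)).u t = w t)) →
      ((∀ t ≤ S.L, (Sh.cls (u i)).l t = (Sh.cls (u j)).l t) ∧ (∀ t ≤ S.K, (Sh.cls (u i)).u t = (Sh.cls (u j)).u t)) :=
    fun h h' => ⟨fun t ht => (h.1 t ht).trans (h'.1 t ht).symm, fun t ht => (h.2 t ht).trans (h'.2 t ht).symm⟩
  rcases hu 0 with a | a <;> rcases hu 1 with b | b <;> rcases hu 2 with c | c <;>
    first
    | exact n0 (comb (l := fun _ => 0) (w := fun _ => 0) a b)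
    | exact n1 (comb (l := fun _ => 0) (w := fun _ => 0) a c)
    | exact n2 (comb (l := fun _ => 0) (w := fun _ => 0) b c)
    | exact n0 (comb a b)
    | exact n1 (comb a c)
    | exact n2 (comb b c)

end final
end SDP


namespace LadderDet
open CategoryTheory

/-- **Thick Ladder Theorem.** Let `Y` be a two-sided `2`-connected ladder
such that every lower inside corner `(a,b)` and upper inside corner `(c,d)` satisfy
`a ≤ c`, `b ≤ d`, and `(a,b) ≠ (c,d)`. Then `R_2(Y)` has at most two semidualizing
modules up to isomorphism: among any three semidualizing modules, two are isomorphic. -/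
theorem thickLadder_semidualizing (m n : ℕ) (k : Type) [Field k]
    (Y : Set (ℕ × ℕ)) (hY : StdLadder m n Y) (hconn : TConnected m n 2 Y)
    (htwo : TwoSided Y)
    (hthick : ∀ p q : ℕ × ℕ, IsLowerCorner Y p → IsUpperCorner Y q →
      p.1 ≤ q.1 ∧ p.2 ≤ q.2 ∧ p ≠ q)
    (C : Fin 3 → ModuleCat.{0} (LadderRing k 2 Y))
    (hC : ∀ i, IsSemidualizing (C i)) :
    ∃ i j, i ≠ j ∧ Nonempty (C i ≅ C j) := by
  obtain ⟨S, hS, rfl⟩ := SDP.exists_shape hY hconn htwo hthick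
  exact SDP.final_shape hS k C hC

end LadderDet
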